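/- Let 𝔸 and 𝔹 be generalized algebraic theories. Given context morphisms f : X → X' and f' : X' → X'' in 𝔸 and g : Y → Y' and g' : Y' → Y'' in 𝔹, the morphism equality (f'⊗g') ∘ (f⊗g) ≡ (f'∘f) ⊗ (g'∘g) : X⊗Y → X''⊗Y'' is derivable in 𝔸⊗𝔹. -/

import Mathlib

set_option linter.unusedVariables false

/-! # Syntax of generalized algebraic theories (following Cartmell / the paper's appendix) -/

namespace GATPaper

/-- A sort-and-term alphabet: a countably infinite set of variables, a set of sort
symbols and a set of term symbols. -/
structure Alphabet : Type 1 where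
  Var : Type
  SortSym : Type
  TermSym : Type
  var_infinite : Infinite Var
  var_countable : Countable Var

attribute [instance] Alphabet.var_infinite Alphabet.var_countable

variable {A B : Alphabet}

/-- Term expressions over an alphabet. -/
inductive Expr (A : Alphabet) : Type where
  | var : A.Var → Expr A
  | app : A.TermSym → List (Expr A) → Expr A

/-- Sort expressions: a sort symbol applied to a list of term expressions. -/
structure SortE (A : Alphabet) : Type where
  head : A.SortSym
  args : List (Expr A)

/-- Occurrence of a variable in a term expression. -/
inductive Occurs (x : A.Var) : Expr A → Prop where
  | var : Occurs x (Expr.var x)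
  | app {t : A.TermSym} {es : List (Expr A)} {e : Expr A} :
      e ∈ es → Occurs x e → Occurs x (Expr.app t es)

/-- Occurrence of a variable in a sort expression. -/
def SOccurs (x : A.Var) (U : SortE A) : Prop := ∃ e ∈ U.args, Occurs x e

/-- Simultaneous substitution along a function on variables. -/
def Expr.subst (σ : A.Var → Expr A) : Expr A → Expr A
  | .var x => σ x
  | .app t es => .app t (es.attach.map fun e => Expr.subst σ e.1)
termination_by e => sizeOf e
decreasing_by
  have := List.sizeOf_lt_of_mem e.2
  simp only [Expr.app.sizeOf_spec]
  omega

def SortE.subst (σ : A.Var → Expr A) (U : SortE A) : SortE A :=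
  ⟨U.head, U.args.map (Expr.subst σ)⟩

open Classical in
/-- The function on variables determined by a finite list of substitution pairs
`(zᵢ, uᵢ)` (substituting `uᵢ` for `zᵢ`, first matching pair winning, all other
variables unchanged). -/
noncomputable def lookupV : List (A.Var × Expr A) → A.Var → Expr A
  | [], x => .var x
  | p :: ps, x => if p.1 = x then p.2 else lookupV ps x

/-- The simultaneous substitution `e[u₁ | z₁, …, u_k | z_k]` where
`ps = [(z₁,u₁),…,(z_k,u_k)]`. -/
noncomputable def Expr.substL (e : Expr A) (ps : List (A.Var × Expr A)) : Expr A :=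
  e.subst (lookupV ps)

noncomputable def SortE.substL (U : SortE A) (ps : List (A.Var × Expr A)) : SortE A :=
  U.subst (lookupV ps)

/-- A (pre)context is a finite list of (variable, sort expression) pairs. -/
abbrev PreCtx (A : Alphabet) := List (A.Var × SortE A)

/-- The list of variables of a precontext, as term expressions. -/
def ctxVars (X : PreCtx A) : List (Expr A) := X.map fun p => Expr.var p.1

/-- The scoping condition of a precontext: the `i`-th sort expression only contains
variables among the first `i` variables. -/
def IsPreCtx (X : PreCtx A) : Prop :=
  ∀ i (hi : i < X.length) (v : A.Var),
    SOccurs v (X[i]'hi).2 → v ∈ (X.take i).map Prod.fst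

/-- Substitution pairs sending the variables of `X` to the entries of `f`. -/
def mkSub (X : PreCtx A) (f : List (Expr A)) : List (A.Var × Expr A) :=
  (X.map Prod.fst).zip f

/-- `Xᵢ[f₁ | x₁, …, f_{i-1} | x_{i-1}]` (0-based: the `i`-th sort of `X`
substituted along the first `i` entries of `f`). -/
noncomputable def subPre (X : PreCtx A) (f : List (Expr A)) (i : ℕ) (hi : i < X.length) :
    SortE A :=
  ((X[i]'hi).2).substL (mkSub (X.take i) (f.take i))

/-- Judgments: context judgments and the four kinds of standard judgments. -/
inductive Judg (A : Alphabet) : Type where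
  | ctx (X : PreCtx A)
  | sort (X : PreCtx A) (U : SortE A)
  | term (X : PreCtx A) (u : Expr A) (U : SortE A)
  | sortEq (X : PreCtx A) (U V : SortE A)
  | termEq (X : PreCtx A) (u v : Expr A) (U : SortE A)

/-- The context of a judgment. -/
def Judg.ctxOf : Judg A → PreCtx A
  | .ctx X => X
  | .sort X _ => X
  | .term X _ _ => X
  | .sortEq X _ _ => X
  | .termEq X _ _ _ => X

/-- The judgment introducing a sort symbol over the context `X`. -/
def introSort (X : PreCtx A) (S : A.SortSym) : Judg A := .sort X ⟨S, ctxVars X⟩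

/-- The judgment introducing a term symbol over the context `X`, with sort `U`. -/
def introTerm (X : PreCtx A) (t : A.TermSym) (U : SortE A) : Judg A :=
  .term X (.app t (ctxVars X)) U

/-- A set of axioms is a pretheory if: no axiom is a context judgment, every
axiom's context is a precontext, every sort symbol has a unique introducing sort
axiom and there are no other sort axioms, and likewise for term symbols. -/
structure IsPretheory (Ax : Set (Judg A)) : Prop where
  no_ctx : ∀ X : PreCtx A, Judg.ctx X ∉ Ax
  wf_ctx : ∀ J ∈ Ax, IsPreCtx J.ctxOf
  sort_intro : ∀ S : A.SortSym, ∃! X : PreCtx A, introSort X S ∈ Ax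
  sort_shape : ∀ (X : PreCtx A) (U : SortE A), Judg.sort X U ∈ Ax → U.args = ctxVars X
  term_intro : ∀ t : A.TermSym, ∃! p : PreCtx A × SortE A, introTerm p.1 t p.2 ∈ Ax
  term_shape : ∀ (X : PreCtx A) (u : Expr A) (U : SortE A), Judg.term X u U ∈ Ax →
      ∃ t : A.TermSym, u = Expr.app t (ctxVars X)

/-- One inference step of the paper's system: `Step Ax D J` holds when `J` is the
conclusion of an instance of one of the sixteen rules all of whose premises
satisfy `D`. -/
inductive Step (Ax : Set (Judg A)) (D : Judg A → Prop) : Judg A → Prop where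
  | ctx_nil : Step Ax D (.ctx [])
  | ctx_cons {X : PreCtx A} {U : SortE A} {x : A.Var}
      (hs : D (.sort X U)) (hfresh : ∀ p ∈ X, p.1 ≠ x)
      (hpre : IsPreCtx (X ++ [(x, U)])) :
      Step Ax D (.ctx (X ++ [(x, U)]))
  | s1 {X : PreCtx A} {U : SortE A} (h : D (.sort X U)) : Step Ax D (.sortEq X U U)
  | s2 {X : PreCtx A} {U V : SortE A} (h : D (.sortEq X U V)) : Step Ax D (.sortEq X V U)
  | s3 {X : PreCtx A} {U V W : SortE A}
      (h1 : D (.sortEq X U V)) (h2 : D (.sortEq X V W)) : Step Ax D (.sortEq X U W)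
  | t1 {X : PreCtx A} {u : Expr A} {U : SortE A}
      (h : D (.term X u U)) : Step Ax D (.termEq X u u U)
  | t2 {X : PreCtx A} {u v : Expr A} {U : SortE A}
      (h : D (.termEq X u v U)) : Step Ax D (.termEq X v u U)
  | t3 {X : PreCtx A} {u v w : Expr A} {U : SortE A}
      (h1 : D (.termEq X u v U)) (h2 : D (.termEq X v w U)) : Step Ax D (.termEq X u w U)
  | seqt {X : PreCtx A} {U U' : SortE A} {u : Expr A}
      (h1 : D (.sortEq X U U')) (h2 : D (.term X u U)) : Step Ax D (.term X u U')
  | seqteq {X : PreCtx A} {U U' : SortE A} {u u' : Expr A}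
      (h1 : D (.sortEq X U U')) (h2 : D (.termEq X u u' U))
      (h3 : D (.term X u U')) (h4 : D (.term X u' U')) : Step Ax D (.termEq X u u' U')
  | var {X : PreCtx A} {i : ℕ} (hi : i < X.length)
      (h : D (.sort X (X[i]'hi).2)) :
      Step Ax D (.term X (.var (X[i]'hi).1) (X[i]'hi).2)
  | sA {X : PreCtx A} {U : SortE A} (hax : Judg.sort X U ∈ Ax) (h : D (.ctx X))
      (hv : ∀ i (hi : i < X.length), D (.term X (.var (X[i]'hi).1) (X[i]'hi).2)) :
      Step Ax D (.sort X U)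
  | tA {X : PreCtx A} {u : Expr A} {U : SortE A} (hax : Judg.term X u U ∈ Ax)
      (h : D (.sort X U))
      (hv : ∀ i (hi : i < X.length), D (.term X (.var (X[i]'hi).1) (X[i]'hi).2)) :
      Step Ax D (.term X u U)
  | seqA {X : PreCtx A} {U U' : SortE A} (hax : Judg.sortEq X U U' ∈ Ax)
      (h1 : D (.sort X U)) (h2 : D (.sort X U')) : Step Ax D (.sortEq X U U')
  | teqA {X : PreCtx A} {u u' : Expr A} {U : SortE A} (hax : Judg.termEq X u u' U ∈ Ax)
      (h1 : D (.term X u U)) (h2 : D (.term X u' U)) : Step Ax D (.termEq X u u' U)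
  | sSub {X : PreCtx A} {S : A.SortSym} (hax : introSort X S ∈ Ax)
      {Y : PreCtx A} (hY : IsPreCtx Y) {f : List (Expr A)} (hlen : f.length = X.length)
      (hJ : D (introSort X S)) (hYc : D (.ctx Y))
      (hargs : ∀ i (hi : i < X.length) (hif : i < f.length),
        D (.term Y (f[i]'hif) (subPre X f i hi))) :
      Step Ax D (.sort Y ⟨S, f⟩)
  | tSub {X : PreCtx A} {t : A.TermSym} {U : SortE A} (hax : introTerm X t U ∈ Ax)
      {Y : PreCtx A} (hY : IsPreCtx Y) {f : List (Expr A)} (hlen : f.length = X.length)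
      (hJ : D (introTerm X t U))
      (hU : D (.sort Y (U.substL (mkSub X f))))
      (hargs : ∀ i (hi : i < X.length) (hif : i < f.length),
        D (.term Y (f[i]'hif) (subPre X f i hi))) :
      Step Ax D (.term Y (.app t f) (U.substL (mkSub X f)))
  | seqSub1 {X : PreCtx A} {U U' : SortE A} (hax : Judg.sortEq X U U' ∈ Ax)
      {Y : PreCtx A} (hY : IsPreCtx Y) {f : List (Expr A)} (hlen : f.length = X.length)
      (hJ : D (.sortEq X U U'))
      (h1 : D (.sort Y (U.substL (mkSub X f)))) (h2 : D (.sort Y (U'.substL (mkSub X f))))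
      (hargs : ∀ i (hi : i < X.length) (hif : i < f.length),
        D (.term Y (f[i]'hif) (subPre X f i hi))) :
      Step Ax D (.sortEq Y (U.substL (mkSub X f)) (U'.substL (mkSub X f)))
  | seqSub2 {X : PreCtx A} {S : A.SortSym} (hax : introSort X S ∈ Ax)
      {Y : PreCtx A} (hY : IsPreCtx Y) {f g : List (Expr A)}
      (hlf : f.length = X.length) (hlg : g.length = X.length)
      (hJ : D (introSort X S))
      (h1 : D (.sort Y ⟨S, f⟩)) (h2 : D (.sort Y ⟨S, g⟩))
      (hargs : ∀ i (hi : i < X.length) (hif : i < f.length) (hig : i < g.length),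
        D (.termEq Y (f[i]'hif) (g[i]'hig) (subPre X f i hi))) :
      Step Ax D (.sortEq Y ⟨S, f⟩ ⟨S, g⟩)
  | teqSub1 {X : PreCtx A} {u u' : Expr A} {U : SortE A}
      (hax : Judg.termEq X u u' U ∈ Ax)
      {Y : PreCtx A} (hY : IsPreCtx Y) {f : List (Expr A)} (hlen : f.length = X.length)
      (hJ : D (.termEq X u u' U))
      (h1 : D (.term Y (u.substL (mkSub X f)) (U.substL (mkSub X f))))
      (h2 : D (.term Y (u'.substL (mkSub X f)) (U.substL (mkSub X f))))
      (hargs : ∀ i (hi : i < X.length) (hif : i < f.length),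
        D (.term Y (f[i]'hif) (subPre X f i hi))) :
      Step Ax D (.termEq Y (u.substL (mkSub X f)) (u'.substL (mkSub X f))
        (U.substL (mkSub X f)))
  | teqSub2 {X : PreCtx A} {t : A.TermSym} {U : SortE A} (hax : introTerm X t U ∈ Ax)
      {Y : PreCtx A} (hY : IsPreCtx Y) {f g : List (Expr A)}
      (hlf : f.length = X.length) (hlg : g.length = X.length)
      (hJ : D (introTerm X t U))
      (h1 : D (.term Y (.app t f) (U.substL (mkSub X f))))
      (h2 : D (.term Y (.app t g) (U.substL (mkSub X f))))
      (hargs : ∀ i (hi : i < X.length) (hif : i < f.length) (hig : i < g.length),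
        D (.termEq Y (f[i]'hif) (g[i]'hig) (subPre X f i hi))) :
      Step Ax D (.termEq Y (.app t f) (.app t g) (U.substL (mkSub X f)))

/-- `DerAt Ax n J`: `J` is the conclusion of an inference step in the `n`-th stage
`𝒟ₙ` of the recursive construction of the derivable judgments. -/
def DerAt (Ax : Set (Judg A)) : ℕ → Judg A → Prop
  | 0, _ => False
  | n + 1, J => DerAt Ax n J ∨ Step Ax (DerAt Ax n) J

/-- A judgment is derivable if it is the conclusion of a step of some stage. -/
def Derivable (Ax : Set (Judg A)) (J : Judg A) : Prop := ∃ n, DerAt Ax n J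

/-- The height of a (derivable) judgment: the least stage at which it appears. -/
noncomputable def ht (Ax : Set (Judg A)) (J : Judg A) : ℕ := sInf {n | DerAt Ax n J}

/-- The height of a context: `0` for the empty context, and the height of
`∂X ⊢ Xₙ sort` otherwise. -/
noncomputable def htCtx (Ax : Set (Judg A)) (X : PreCtx A) : ℕ :=
  match X with
  | [] => 0
  | p :: X' =>
      ht Ax (.sort ((p :: X').dropLast) (((p :: X').getLast (List.cons_ne_nil p X')).2))

/-- A generalized algebraic theory: a pretheory all of whose axioms are derivable. -/
def IsGAT (Ax : Set (Judg A)) : Prop := IsPretheory Ax ∧ ∀ J ∈ Ax, Derivable Ax J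

/-- The partial term judgment `X ⊢ u term` is derivable. -/
def DerTerm (Ax : Set (Judg A)) (X : PreCtx A) (u : Expr A) : Prop :=
  ∃ U, Derivable Ax (.term X u U)

/-- The partial term equality judgment `X ⊢ u ≡ v term` is derivable. -/
def DerTermEq (Ax : Set (Judg A)) (X : PreCtx A) (u v : Expr A) : Prop :=
  ∃ U, Derivable Ax (.termEq X u v U)

/-- Height of a derivable partial term judgment: the minimum of the heights of
`X ⊢ u : U` over all `U`. -/
noncomputable def htTerm (Ax : Set (Judg A)) (X : PreCtx A) (u : Expr A) : ℕ :=
  sInf {n | ∃ U, DerAt Ax n (.term X u U)}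

/-- `f` is a context morphism from `X` to `Y`. -/
def IsMor (Ax : Set (Judg A)) (X Y : PreCtx A) (f : List (Expr A)) : Prop :=
  Derivable Ax (.ctx X) ∧ Derivable Ax (.ctx Y) ∧ f.length = Y.length ∧
  ∀ i (hi : i < Y.length) (hif : i < f.length),
    Derivable Ax (.term X (f[i]'hif) (subPre Y f i hi))

/-- The morphism equality `f ≡ g : X → Y` is derivable. -/
def MorEq (Ax : Set (Judg A)) (X Y : PreCtx A) (f g : List (Expr A)) : Prop :=
  IsMor Ax X Y f ∧ IsMor Ax X Y g ∧
  ∀ i (hi : i < Y.length) (hif : i < f.length) (hig : i < g.length),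
    Derivable Ax (.termEq X (f[i]'hif) (g[i]'hig) (subPre Y f i hi))

/-- The context equality `X ≡ Y ctx` is derivable. -/
def CtxEq (Ax : Set (Judg A)) (X Y : PreCtx A) : Prop :=
  X.length = Y.length ∧ Derivable Ax (.ctx X) ∧ Derivable Ax (.ctx Y) ∧
  ∀ i (hX : i < X.length) (hY : i < Y.length),
    Derivable Ax (.sortEq (X.take i) (X[i]'hX).2
      (((Y[i]'hY).2).substL (mkSub (Y.take i) (ctxVars (X.take i)))))

/-- Height of a context morphism. -/
noncomputable def htMor (Ax : Set (Judg A)) (X Y : PreCtx A) (f : List (Expr A)) : ℕ :=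
  max (htCtx Ax X) (max (htCtx Ax Y)
    ((Finset.range Y.length).sup fun i =>
      if h : i < Y.length ∧ i < f.length then
        ht Ax (.term X (f[i]'h.2) (subPre Y f i h.1))
      else 0))

/-- Height of a morphism equality. -/
noncomputable def htMorEq (Ax : Set (Judg A)) (X Y : PreCtx A) (f g : List (Expr A)) : ℕ :=
  max (htMor Ax X Y f) (max (htMor Ax X Y g)
    ((Finset.range Y.length).sup fun i =>
      if h : i < Y.length ∧ i < f.length ∧ i < g.length then
        ht Ax (.termEq X (f[i]'h.2.1) (g[i]'h.2.2) (subPre Y f i h.1))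
      else 0))

/-- The composite `g ∘ f` of tuples of term expressions, where `f : X → Y` and
`g : Y → Z`: the `i`-th entry is `gᵢ[f]`. -/
noncomputable def compMor (Y : PreCtx A) (f g : List (Expr A)) : List (Expr A) :=
  g.map fun e => e.substL (mkSub Y f)

/-- The canonical sort `𝒮(u)` of a term in a context (as a relation). -/
inductive CanonSort (Ax : Set (Judg A)) (X : PreCtx A) : Expr A → SortE A → Prop where
  | var {i : ℕ} (hi : i < X.length) : CanonSort Ax X (.var (X[i]'hi).1) (X[i]'hi).2
  | app {t : A.TermSym} {f : List (Expr A)} {Xa : PreCtx A} {V : SortE A}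
      (hax : introTerm Xa t V ∈ Ax) :
      CanonSort Ax X (.app t f) (V.substL (mkSub Xa f))


/-! ## The tensor product of generalized algebraic theories (§2 of the paper) -/

/-- The tensor product of two sort-and-term alphabets. -/
abbrev Alphabet.tensor (A B : Alphabet) : Alphabet :=
  { Var := A.Var × B.Var
    SortSym := A.SortSym × B.SortSym
    TermSym := (A.SortSym × B.TermSym) ⊕ (A.TermSym × B.SortSym)
    var_infinite := inferInstance
    var_countable := inferInstance }

/-- An input for the tensor term operations `⊗_t`, `●_t`: a derivable term judgment
`X ⊢ u : U` (notation `u^U`), or an augmented derivable sort judgment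
`(X ⊢ U sort, x)` (notation `x^U`), represented with `tm = var x`. -/
structure TArg (A : Alphabet) : Type where
  ctx : PreCtx A
  tm : Expr A
  srt : SortE A

/-- `L` is the lexicographically ordered `m × n` grid whose `(i,j)` entry is `M i j`. -/
def IsGrid {γ : Type} (m n : ℕ) (M : ℕ → ℕ → γ) (L : List γ) : Prop :=
  L.length = m * n ∧
  ∀ i j (hi : i < m) (hj : j < n) (h : i * n + j < L.length), L[i * n + j]'h = M i j

/-- Substitution pairs `[g 1 | x y₁, …, g n | x yₙ]` where the `yⱼ` are the
variables of `Y`. -/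
def pairsR (x : A.Var) (Y : PreCtx B) (g : ℕ → Expr (A.tensor B)) :
    List ((A.tensor B).Var × Expr (A.tensor B)) :=
  (List.finRange Y.length).map fun j => ((x, (Y.get j).1), g j.1)

/-- Substitution pairs `[g 1 | x₁ y, …, g m | x_m y]` where the `xᵢ` are the
variables of `X`. -/
def pairsL (X : PreCtx A) (y : B.Var) (g : ℕ → Expr (A.tensor B)) :
    List ((A.tensor B).Var × Expr (A.tensor B)) :=
  (List.finRange X.length).map fun i => (((X.get i).1, y), g i.1)

variable {A B : Alphabet}

/-- The graph of the tensor term operation on pairs of (augmented sort / term)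
judgments: `TTg TA TB false a b e` means `e = a ⊗_t b` and
`TTg TA TB true a b e` means `e = a ⊗*_t b` (the variant of §8 in which the two
defining substitution formulas for non-variable terms are interchanged). -/
inductive TTg (TA : Set (Judg A)) (TB : Set (Judg B)) :
    Bool → TArg A → TArg B → Expr (A.tensor B) → Prop where
  | varvar {b : Bool} {X : PreCtx A} {U : SortE A} {x : A.Var}
      {Y : PreCtx B} {V : SortE B} {y : B.Var} :
      TTg TA TB b ⟨X, .var x, U⟩ ⟨Y, .var y, V⟩ (.var (x, y))
  | varapp {b : Bool} {X : PreCtx A} {x : A.Var} {S : A.SortSym} {ss : List (Expr A)}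
      {Y : PreCtx B} {t : B.TermSym} {ts : List (Expr B)} {V : SortE B}
      (SS : ℕ → SortE A) (TSf : ℕ → SortE B)
      (hSS : ∀ i (hi : i < ss.length), CanonSort TA X (ss[i]'hi) (SS i))
      (hTS : ∀ j (hj : j < ts.length), CanonSort TB Y (ts[j]'hj) (TSf j))
      (M : ℕ → ℕ → Expr (A.tensor B)) (out : List (Expr (A.tensor B)))
      (hM : ∀ i (hi : i < ss.length), ∀ j (hj : j < ts.length),
          TTg TA TB b ⟨X, ss[i]'hi, SS i⟩ ⟨Y, ts[j]'hj, TSf j⟩ (M i j))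
      (hMx : ∀ j (hj : j < ts.length),
          TTg TA TB b ⟨X, .var x, ⟨S, ss⟩⟩ ⟨Y, ts[j]'hj, TSf j⟩ (M ss.length j))
      (hout : IsGrid (ss.length + 1) ts.length M out) :
      TTg TA TB b ⟨X, .var x, ⟨S, ss⟩⟩ ⟨Y, .app t ts, V⟩ (.app (Sum.inl (S, t)) out)
  | appvar {b : Bool} {X : PreCtx A} {s : A.TermSym} {ss : List (Expr A)} {U : SortE A}
      {Y : PreCtx B} {y : B.Var} {T : B.SortSym} {ts : List (Expr B)}
      (SS : ℕ → SortE A) (TSf : ℕ → SortE B)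
      (hSS : ∀ i (hi : i < ss.length), CanonSort TA X (ss[i]'hi) (SS i))
      (hTS : ∀ j (hj : j < ts.length), CanonSort TB Y (ts[j]'hj) (TSf j))
      (M : ℕ → ℕ → Expr (A.tensor B)) (out : List (Expr (A.tensor B)))
      (hM : ∀ i (hi : i < ss.length), ∀ j (hj : j < ts.length),
          TTg TA TB b ⟨X, ss[i]'hi, SS i⟩ ⟨Y, ts[j]'hj, TSf j⟩ (M i j))
      (hMy : ∀ i (hi : i < ss.length),
          TTg TA TB b ⟨X, ss[i]'hi, SS i⟩ ⟨Y, .var y, ⟨T, ts⟩⟩ (M i ts.length))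
      (hout : IsGrid ss.length (ts.length + 1) M out) :
      TTg TA TB b ⟨X, .app s ss, U⟩ ⟨Y, .var y, ⟨T, ts⟩⟩ (.app (Sum.inr (s, T)) out)
  | appapp_base {X : PreCtx A} {s : A.TermSym} {ss : List (Expr A)} {U : SortE A}
      {Y : PreCtx B} {t : B.TermSym} {ts : List (Expr B)} {V : SortE B} {x : A.Var}
      (hx : ∀ p ∈ X, p.1 ≠ x)
      (e0 : Expr (A.tensor B))
      (h0 : TTg TA TB false ⟨X, .var x, U⟩ ⟨Y, .app t ts, V⟩ e0)
      (g : ℕ → Expr (A.tensor B))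
      (hg : ∀ j (hj : j < Y.length),
          TTg TA TB false ⟨X, .app s ss, U⟩
            ⟨Y.take j, .var (Y[j]'hj).1, (Y[j]'hj).2⟩ (g j)) :
      TTg TA TB false ⟨X, .app s ss, U⟩ ⟨Y, .app t ts, V⟩ (e0.substL (pairsR x Y g))
  | appapp_star {X : PreCtx A} {s : A.TermSym} {ss : List (Expr A)} {U : SortE A}
      {Y : PreCtx B} {t : B.TermSym} {ts : List (Expr B)} {V : SortE B} {y : B.Var}
      (hy : ∀ p ∈ Y, p.1 ≠ y)
      (e0 : Expr (A.tensor B))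
      (h0 : TTg TA TB true ⟨X, .app s ss, U⟩ ⟨Y, .var y, V⟩ e0)
      (g : ℕ → Expr (A.tensor B))
      (hg : ∀ i (hi : i < X.length),
          TTg TA TB true ⟨X.take i, .var (X[i]'hi).1, (X[i]'hi).2⟩
            ⟨Y, .app t ts, V⟩ (g i)) :
      TTg TA TB true ⟨X, .app s ss, U⟩ ⟨Y, .app t ts, V⟩ (e0.substL (pairsL X y g))

/-- The graph of the operation `●_t` (flag `false`), resp. of `●*_t` (flag `true`). -/
inductive TTd (TA : Set (Judg A)) (TB : Set (Judg B)) :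
    Bool → TArg A → TArg B → Expr (A.tensor B) → Prop where
  | varL {b : Bool} {X : PreCtx A} {x : A.Var} {U : SortE A} {bArg : TArg B}
      {e : Expr (A.tensor B)}
      (h : TTg TA TB b ⟨X, .var x, U⟩ bArg e) : TTd TA TB b ⟨X, .var x, U⟩ bArg e
  | varR {b : Bool} {aArg : TArg A} {Y : PreCtx B} {y : B.Var} {V : SortE B}
      {e : Expr (A.tensor B)}
      (h : TTg TA TB b aArg ⟨Y, .var y, V⟩ e) : TTd TA TB b aArg ⟨Y, .var y, V⟩ e
  | appapp_base {X : PreCtx A} {s : A.TermSym} {ss : List (Expr A)} {U : SortE A}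
      {Y : PreCtx B} {t : B.TermSym} {ts : List (Expr B)} {V : SortE B} {y : B.Var}
      (hy : ∀ p ∈ Y, p.1 ≠ y)
      (e0 : Expr (A.tensor B))
      (h0 : TTg TA TB false ⟨X, .app s ss, U⟩ ⟨Y, .var y, V⟩ e0)
      (g : ℕ → Expr (A.tensor B))
      (hg : ∀ i (hi : i < X.length),
          TTg TA TB false ⟨X.take i, .var (X[i]'hi).1, (X[i]'hi).2⟩
            ⟨Y, .app t ts, V⟩ (g i)) :
      TTd TA TB false ⟨X, .app s ss, U⟩ ⟨Y, .app t ts, V⟩ (e0.substL (pairsL X y g))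
  | appapp_star {X : PreCtx A} {s : A.TermSym} {ss : List (Expr A)} {U : SortE A}
      {Y : PreCtx B} {t : B.TermSym} {ts : List (Expr B)} {V : SortE B} {x : A.Var}
      (hx : ∀ p ∈ X, p.1 ≠ x)
      (e0 : Expr (A.tensor B))
      (h0 : TTg TA TB true ⟨X, .var x, U⟩ ⟨Y, .app t ts, V⟩ e0)
      (g : ℕ → Expr (A.tensor B))
      (hg : ∀ j (hj : j < Y.length),
          TTg TA TB true ⟨X, .app s ss, U⟩
            ⟨Y.take j, .var (Y[j]'hj).1, (Y[j]'hj).2⟩ (g j)) :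
      TTd TA TB true ⟨X, .app s ss, U⟩ ⟨Y, .app t ts, V⟩ (e0.substL (pairsR x Y g))

/-- The graph of the tensor sort operation `⊗_s` (resp. `⊗*_s` for flag `true`):
`TSo TA TB b X x U Y y V W` means `W = U^x ⊗ V^y`. -/
inductive TSo (TA : Set (Judg A)) (TB : Set (Judg B)) :
    Bool → PreCtx A → A.Var → SortE A → PreCtx B → B.Var → SortE B →
    SortE (A.tensor B) → Prop where
  | mk {b : Bool} {X : PreCtx A} {x : A.Var} {S : A.SortSym} {ss : List (Expr A)}
      {Y : PreCtx B} {y : B.Var} {T : B.SortSym} {ts : List (Expr B)}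
      (hx : ∀ p ∈ X, p.1 ≠ x) (hy : ∀ p ∈ Y, p.1 ≠ y)
      (SS : ℕ → SortE A) (TSf : ℕ → SortE B)
      (hSS : ∀ i (hi : i < ss.length), CanonSort TA X (ss[i]'hi) (SS i))
      (hTS : ∀ j (hj : j < ts.length), CanonSort TB Y (ts[j]'hj) (TSf j))
      (M : ℕ → ℕ → Expr (A.tensor B)) (out : List (Expr (A.tensor B)))
      (hM : ∀ i (hi : i < ss.length), ∀ j (hj : j < ts.length),
          TTg TA TB b ⟨X, ss[i]'hi, SS i⟩ ⟨Y, ts[j]'hj, TSf j⟩ (M i j))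
      (hMx : ∀ j (hj : j < ts.length),
          TTg TA TB b ⟨X, .var x, ⟨S, ss⟩⟩ ⟨Y, ts[j]'hj, TSf j⟩ (M ss.length j))
      (hMy : ∀ i (hi : i < ss.length),
          TTg TA TB b ⟨X, ss[i]'hi, SS i⟩ ⟨Y, .var y, ⟨T, ts⟩⟩ (M i ts.length))
      (hout : IsGrid (ss.length + 1) (ts.length + 1) M out) :
      TSo TA TB b X x ⟨S, ss⟩ Y y ⟨T, ts⟩ ⟨(S, T), out.dropLast⟩

/-- The tensor precontext `Z = X ⊗ Y`, with entries `xᵢyⱼ : Xᵢ ⊗ Yⱼ` ordered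
lexicographically. -/
def TCtx (TA : Set (Judg A)) (TB : Set (Judg B)) (b : Bool)
    (X : PreCtx A) (Y : PreCtx B) (Z : PreCtx (A.tensor B)) : Prop :=
  Z.length = X.length * Y.length ∧
  ∀ i j (hi : i < X.length) (hj : j < Y.length) (h : i * Y.length + j < Z.length),
    (Z[i * Y.length + j]'h).1 = ((X[i]'hi).1, (Y[j]'hj).1) ∧
    TSo TA TB b (X.take i) (X[i]'hi).1 (X[i]'hi).2
      (Y.take j) (Y[j]'hj).1 (Y[j]'hj).2 (Z[i * Y.length + j]'h).2

/-- The graph of the tensor operation `⊙` on pairs of judgments of the admissible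
kinds of Table 1 (flag `false`), resp. of the interchanged operation `⊙*` of §8
(flag `true`).  `chA` and `chB` are the functions choosing, for each context, a
variable not occurring in it. -/
inductive TJudg (TA : Set (Judg A)) (TB : Set (Judg B))
    (chA : PreCtx A → A.Var) (chB : PreCtx B → B.Var) :
    Bool → Judg A → Judg B → Judg (A.tensor B) → Prop where
  /- sort ⊙ sort -/
  | ss {b : Bool} {X : PreCtx A} {U : SortE A} {Y : PreCtx B} {V : SortE B}
      {Z : PreCtx (A.tensor B)} {W : SortE (A.tensor B)}
      (hZ : TCtx TA TB b (X ++ [(chA X, U)]) (Y ++ [(chB Y, V)]) Z)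
      (hW : TSo TA TB b X (chA X) U Y (chB Y) V W) :
      TJudg TA TB chA chB b (.sort X U) (.sort Y V) (.sort Z.dropLast W)
  /- sort ⊙ term -/
  | st {b : Bool} {X : PreCtx A} {U : SortE A} {Y : PreCtx B} {v : Expr B} {V : SortE B}
      {Z : PreCtx (A.tensor B)} {e : Expr (A.tensor B)} {W : SortE (A.tensor B)}
      {g : ℕ → Expr (A.tensor B)}
      (hZ : TCtx TA TB b (X ++ [(chA X, U)]) Y Z)
      (he : TTg TA TB b ⟨X, .var (chA X), U⟩ ⟨Y, v, V⟩ e)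
      (hW : TSo TA TB b X (chA X) U Y (chB Y) V W)
      (hg : ∀ i (hi : i < X.length),
          TTg TA TB b ⟨X.take i, .var (X[i]'hi).1, (X[i]'hi).2⟩ ⟨Y, v, V⟩ (g i)) :
      TJudg TA TB chA chB b (.sort X U) (.term Y v V)
        (.term Z e (W.substL (pairsL X (chB Y) g)))
  /- term ⊙ sort -/
  | ts {b : Bool} {X : PreCtx A} {u : Expr A} {U : SortE A} {Y : PreCtx B} {V : SortE B}
      {Z : PreCtx (A.tensor B)} {e : Expr (A.tensor B)} {W : SortE (A.tensor B)}
      {g : ℕ → Expr (A.tensor B)}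
      (hZ : TCtx TA TB b X (Y ++ [(chB Y, V)]) Z)
      (he : TTg TA TB b ⟨X, u, U⟩ ⟨Y, .var (chB Y), V⟩ e)
      (hW : TSo TA TB b X (chA X) U Y (chB Y) V W)
      (hg : ∀ j (hj : j < Y.length),
          TTg TA TB b ⟨X, u, U⟩ ⟨Y.take j, .var (Y[j]'hj).1, (Y[j]'hj).2⟩ (g j)) :
      TJudg TA TB chA chB b (.term X u U) (.sort Y V)
        (.term Z e (W.substL (pairsR (chA X) Y g)))
  /- term ⊙ term -/
  | tt {b : Bool} {X : PreCtx A} {u : Expr A} {U : SortE A}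
      {Y : PreCtx B} {v : Expr B} {V : SortE B}
      {Z : PreCtx (A.tensor B)} {e1 e2 : Expr (A.tensor B)} {W : SortE (A.tensor B)}
      {gx gy : ℕ → Expr (A.tensor B)}
      (hZ : TCtx TA TB b X Y Z)
      (he1 : TTg TA TB b ⟨X, u, U⟩ ⟨Y, v, V⟩ e1)
      (he2 : TTd TA TB b ⟨X, u, U⟩ ⟨Y, v, V⟩ e2)
      (hW : TSo TA TB b X (chA X) U Y (chB Y) V W)
      (hgx : ∀ i (hi : i < X.length),
          TTg TA TB b ⟨X.take i, .var (X[i]'hi).1, (X[i]'hi).2⟩ ⟨Y, v, V⟩ (gx i))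
      (hgy : ∀ j (hj : j < Y.length),
          TTg TA TB b ⟨X, u, U⟩ ⟨Y.take j, .var (Y[j]'hj).1, (Y[j]'hj).2⟩ (gy j)) :
      TJudg TA TB chA chB b (.term X u U) (.term Y v V)
        (.termEq Z e1 e2 (W.substL (pairsL X (chB Y) gx ++ pairsR (chA X) Y gy)))
  /- sort ⊙ sort equality -/
  | sseq {b : Bool} {X : PreCtx A} {U : SortE A} {Y : PreCtx B} {V V' : SortE B}
      {Z : PreCtx (A.tensor B)} {W W' : SortE (A.tensor B)}
      (hZ : TCtx TA TB b (X ++ [(chA X, U)]) (Y ++ [(chB Y, V)]) Z)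
      (hW : TSo TA TB b X (chA X) U Y (chB Y) V W)
      (hW' : TSo TA TB b X (chA X) U Y (chB Y) V' W') :
      TJudg TA TB chA chB b (.sort X U) (.sortEq Y V V') (.sortEq Z.dropLast W W')
  /- sort equality ⊙ sort -/
  | seqs {b : Bool} {X : PreCtx A} {U U' : SortE A} {Y : PreCtx B} {V : SortE B}
      {Z : PreCtx (A.tensor B)} {W W' : SortE (A.tensor B)}
      (hZ : TCtx TA TB b (X ++ [(chA X, U)]) (Y ++ [(chB Y, V)]) Z)
      (hW : TSo TA TB b X (chA X) U Y (chB Y) V W)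
      (hW' : TSo TA TB b X (chA X) U' Y (chB Y) V W') :
      TJudg TA TB chA chB b (.sortEq X U U') (.sort Y V) (.sortEq Z.dropLast W W')
  /- sort ⊙ term equality -/
  | steq {b : Bool} {X : PreCtx A} {U : SortE A} {Y : PreCtx B} {v v' : Expr B}
      {V : SortE B} {Z : PreCtx (A.tensor B)} {e e' : Expr (A.tensor B)}
      {W : SortE (A.tensor B)} {g : ℕ → Expr (A.tensor B)}
      (hZ : TCtx TA TB b (X ++ [(chA X, U)]) Y Z)
      (he : TTg TA TB b ⟨X, .var (chA X), U⟩ ⟨Y, v, V⟩ e)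
      (he' : TTg TA TB b ⟨X, .var (chA X), U⟩ ⟨Y, v', V⟩ e')
      (hW : TSo TA TB b X (chA X) U Y (chB Y) V W)
      (hg : ∀ i (hi : i < X.length),
          TTg TA TB b ⟨X.take i, .var (X[i]'hi).1, (X[i]'hi).2⟩ ⟨Y, v, V⟩ (g i)) :
      TJudg TA TB chA chB b (.sort X U) (.termEq Y v v' V)
        (.termEq Z e e' (W.substL (pairsL X (chB Y) g)))
  /- term equality ⊙ sort -/
  | teqs {b : Bool} {X : PreCtx A} {u u' : Expr A} {U : SortE A} {Y : PreCtx B}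
      {V : SortE B} {Z : PreCtx (A.tensor B)} {e e' : Expr (A.tensor B)}
      {W : SortE (A.tensor B)} {g : ℕ → Expr (A.tensor B)}
      (hZ : TCtx TA TB b X (Y ++ [(chB Y, V)]) Z)
      (he : TTg TA TB b ⟨X, u, U⟩ ⟨Y, .var (chB Y), V⟩ e)
      (he' : TTg TA TB b ⟨X, u', U⟩ ⟨Y, .var (chB Y), V⟩ e')
      (hW : TSo TA TB b X (chA X) U Y (chB Y) V W)
      (hg : ∀ j (hj : j < Y.length),
          TTg TA TB b ⟨X, u, U⟩ ⟨Y.take j, .var (Y[j]'hj).1, (Y[j]'hj).2⟩ (g j)) :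
      TJudg TA TB chA chB b (.termEq X u u' U) (.sort Y V)
        (.termEq Z e e' (W.substL (pairsR (chA X) Y g)))
  /- sort equality ⊙ term -/
  | seqt {b : Bool} {X : PreCtx A} {U U' : SortE A} {Y : PreCtx B} {v : Expr B}
      {V : SortE B} {Z : PreCtx (A.tensor B)} {e e' : Expr (A.tensor B)}
      {W : SortE (A.tensor B)} {g : ℕ → Expr (A.tensor B)}
      (hZ : TCtx TA TB b (X ++ [(chA X, U)]) Y Z)
      (he : TTg TA TB b ⟨X, .var (chA X), U⟩ ⟨Y, v, V⟩ e)
      (he' : TTg TA TB b ⟨X, .var (chA X), U'⟩ ⟨Y, v, V⟩ e')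
      (hW : TSo TA TB b X (chA X) U Y (chB Y) V W)
      (hg : ∀ i (hi : i < X.length),
          TTg TA TB b ⟨X.take i, .var (X[i]'hi).1, (X[i]'hi).2⟩ ⟨Y, v, V⟩ (g i)) :
      TJudg TA TB chA chB b (.sortEq X U U') (.term Y v V)
        (.termEq Z e e' (W.substL (pairsL X (chB Y) g)))
  /- term ⊙ sort equality -/
  | tseq {b : Bool} {X : PreCtx A} {u : Expr A} {U : SortE A} {Y : PreCtx B}
      {V V' : SortE B} {Z : PreCtx (A.tensor B)} {e e' : Expr (A.tensor B)}
      {W : SortE (A.tensor B)} {g : ℕ → Expr (A.tensor B)}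
      (hZ : TCtx TA TB b X (Y ++ [(chB Y, V)]) Z)
      (he : TTg TA TB b ⟨X, u, U⟩ ⟨Y, .var (chB Y), V⟩ e)
      (he' : TTg TA TB b ⟨X, u, U⟩ ⟨Y, .var (chB Y), V'⟩ e')
      (hW : TSo TA TB b X (chA X) U Y (chB Y) V W)
      (hg : ∀ j (hj : j < Y.length),
          TTg TA TB b ⟨X, u, U⟩ ⟨Y.take j, .var (Y[j]'hj).1, (Y[j]'hj).2⟩ (g j)) :
      TJudg TA TB chA chB b (.term X u U) (.sortEq Y V V')
        (.termEq Z e e' (W.substL (pairsR (chA X) Y g)))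

/-- A choice, for every precontext, of a variable not contained in it. -/
def FreshCh {A : Alphabet} (ch : PreCtx A → A.Var) : Prop :=
  ∀ X : PreCtx A, ∀ p ∈ X, p.1 ≠ ch X

/-- The set of axioms of the pretheory `𝔸 ⊗ 𝔹`: the judgments `J ⊙ J'` for `J` an
axiom of `𝔸` and `J'` an axiom of `𝔹`. -/
def tensorAx (TA : Set (Judg A)) (TB : Set (Judg B))
    (chA : PreCtx A → A.Var) (chB : PreCtx B → B.Var) : Set (Judg (A.tensor B)) :=
  {K | ∃ J J', J ∈ TA ∧ J' ∈ TB ∧ TJudg TA TB chA chB false J J' K}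

/-- The pair `(𝔸, 𝔹)` is `h`-derivable: `J ⊙ J'` is derivable in the pretheory
`𝔸 ⊗ 𝔹` whenever `J`, `J'` are derivable judgments of `𝔸`, `𝔹` (of admissible
kinds) with `ht J * ht J' ≤ h`. -/
def hDerivable (TA : Set (Judg A)) (TB : Set (Judg B))
    (chA : PreCtx A → A.Var) (chB : PreCtx B → B.Var) (h : ℕ) : Prop :=
  ∀ (J : Judg A) (J' : Judg B) (K : Judg (A.tensor B)),
    Derivable TA J → Derivable TB J' → ht TA J * ht TB J' ≤ h →
    TJudg TA TB chA chB false J J' K → Derivable (tensorAx TA TB chA chB) K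

/-- The tensor `out = f ⊗ g` of two tuples of derivable terms, each entry being
the tensor of terms taken at their canonical sorts, ordered lexicographically. -/
def TMor (TA : Set (Judg A)) (TB : Set (Judg B)) (b : Bool)
    (X : PreCtx A) (f : List (Expr A)) (Y : PreCtx B) (g : List (Expr B))
    (out : List (Expr (A.tensor B))) : Prop :=
  out.length = f.length * g.length ∧
  ∀ i j (hi : i < f.length) (hj : j < g.length) (h : i * g.length + j < out.length),
    ∃ U V, CanonSort TA X (f[i]'hi) U ∧ CanonSort TB Y (g[j]'hj) V ∧
      TTg TA TB b ⟨X, f[i]'hi, U⟩ ⟨Y, g[j]'hj, V⟩ (out[i * g.length + j]'h)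

/-- The tensor `out = f ⊗ Y` of a tuple of derivable terms of `𝔸` with a context
of `𝔹`: entries `fᵢ^{𝒮(fᵢ)} ⊗ yⱼ^{Yⱼ}`. -/
def TMorCtx (TA : Set (Judg A)) (TB : Set (Judg B)) (b : Bool)
    (X : PreCtx A) (f : List (Expr A)) (Y : PreCtx B)
    (out : List (Expr (A.tensor B))) : Prop :=
  out.length = f.length * Y.length ∧
  ∀ i j (hi : i < f.length) (hj : j < Y.length) (h : i * Y.length + j < out.length),
    ∃ U, CanonSort TA X (f[i]'hi) U ∧
      TTg TA TB b ⟨X, f[i]'hi, U⟩ ⟨Y.take j, .var (Y[j]'hj).1, (Y[j]'hj).2⟩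
        (out[i * Y.length + j]'h)

/-- The tensor `out = X ⊗ g` of a context of `𝔸` with a tuple of derivable terms
of `𝔹`: entries `xᵢ^{Xᵢ} ⊗ gⱼ^{𝒮(gⱼ)}`. -/
def TCtxMor (TA : Set (Judg A)) (TB : Set (Judg B)) (b : Bool)
    (X : PreCtx A) (Y : PreCtx B) (g : List (Expr B))
    (out : List (Expr (A.tensor B))) : Prop :=
  out.length = X.length * g.length ∧
  ∀ i j (hi : i < X.length) (hj : j < g.length) (h : i * g.length + j < out.length),
    ∃ V, CanonSort TB Y (g[j]'hj) V ∧
      TTg TA TB b ⟨X.take i, .var (X[i]'hi).1, (X[i]'hi).2⟩ ⟨Y, g[j]'hj, V⟩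
        (out[i * g.length + j]'h)

/-- The tensor `out = (x₁,…,x_m,u^U) ⊗ Y` of the section determined by a term
`X ⊢ u : U` with a context of `𝔹`. -/
def TSecL (TA : Set (Judg A)) (TB : Set (Judg B)) (b : Bool)
    (X : PreCtx A) (u : Expr A) (U : SortE A) (Y : PreCtx B)
    (out : List (Expr (A.tensor B))) : Prop :=
  out.length = (X.length + 1) * Y.length ∧
  (∀ i j (hi : i < X.length) (hj : j < Y.length) (h : i * Y.length + j < out.length),
      TTg TA TB b ⟨X.take i, .var (X[i]'hi).1, (X[i]'hi).2⟩
        ⟨Y.take j, .var (Y[j]'hj).1, (Y[j]'hj).2⟩ (out[i * Y.length + j]'h)) ∧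
  (∀ j (hj : j < Y.length) (h : X.length * Y.length + j < out.length),
      TTg TA TB b ⟨X, u, U⟩ ⟨Y.take j, .var (Y[j]'hj).1, (Y[j]'hj).2⟩
        (out[X.length * Y.length + j]'h))

/-- The tensor `out = X ⊗ (y₁,…,yₙ,v^V)` of a context of `𝔸` with the section
determined by a term `Y ⊢ v : V` of `𝔹`. -/
def TSecR (TA : Set (Judg A)) (TB : Set (Judg B)) (b : Bool)
    (X : PreCtx A) (Y : PreCtx B) (v : Expr B) (V : SortE B)
    (out : List (Expr (A.tensor B))) : Prop :=
  out.length = X.length * (Y.length + 1) ∧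
  (∀ i j (hi : i < X.length) (hj : j < Y.length)
      (h : i * (Y.length + 1) + j < out.length),
      TTg TA TB b ⟨X.take i, .var (X[i]'hi).1, (X[i]'hi).2⟩
        ⟨Y.take j, .var (Y[j]'hj).1, (Y[j]'hj).2⟩ (out[i * (Y.length + 1) + j]'h)) ∧
  (∀ i (hi : i < X.length) (h : i * (Y.length + 1) + Y.length < out.length),
      TTg TA TB b ⟨X.take i, .var (X[i]'hi).1, (X[i]'hi).2⟩ ⟨Y, v, V⟩
        (out[i * (Y.length + 1) + Y.length]'h))

/-! ## Substitution -/

@[simp] theorem Expr.subst_var (σ : A.Var → Expr A) (x : A.Var) :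
    (Expr.var x).subst σ = σ x := by
  simp [Expr.subst]

@[simp] theorem Expr.subst_app (σ : A.Var → Expr A) (t : A.TermSym) (es : List (Expr A)) :
    (Expr.app t es).subst σ = .app t (es.map (Expr.subst σ)) := by
  rw [Expr.subst]
  congr 1
  exact List.attach_map_val (l := es) (f := Expr.subst σ)

theorem Expr.ind {P : Expr A → Prop} (hv : ∀ x, P (.var x))
    (ha : ∀ t es, (∀ e ∈ es, P e) → P (.app t es)) (e : Expr A) : P e := by
  suffices H : ∀ n, ∀ e : Expr A, sizeOf e < n → P e from H _ e (Nat.lt_succ_self _)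
  intro n
  induction n with
  | zero => intro e h; omega
  | succ n ih =>
    intro e h
    cases e with
    | var x => exact hv x
    | app t es =>
      refine ha t es fun e he => ih e ?_
      have := List.sizeOf_lt_of_mem he
      simp only [Expr.app.sizeOf_spec] at h
      omega

theorem occurs_var_iff {x y : A.Var} : Occurs x (Expr.var y) ↔ x = y :=
  ⟨fun h => by cases h; rfl, fun h => h ▸ Occurs.var⟩

theorem occurs_app_iff {x : A.Var} {t : A.TermSym} {es : List (Expr A)} :
    Occurs x (Expr.app t es) ↔ ∃ e ∈ es, Occurs x e :=
  ⟨fun h => by cases h with | app h1 h2 => exact ⟨_, h1, h2⟩, fun ⟨_, h1, h2⟩ => .app h1 h2⟩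

theorem Expr.subst_congr {σ τ : A.Var → Expr A} {e : Expr A}
    (h : ∀ x, Occurs x e → σ x = τ x) : e.subst σ = e.subst τ := by
  induction e using Expr.ind with
  | hv x => simpa using h x .var
  | ha t es ih =>
    simp only [Expr.subst_app, Expr.app.injEq, true_and]
    exact List.map_congr_left fun e he => ih e he fun x hx => h x (.app he hx)

theorem Expr.subst_subst (σ τ : A.Var → Expr A) (e : Expr A) :
    (e.subst σ).subst τ = e.subst fun x => (σ x).subst τ := by
  induction e using Expr.ind with
  | hv x => simp
  | ha t es ih =>
    simp only [Expr.subst_app, List.map_map, Expr.app.injEq, true_and]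
    exact List.map_congr_left fun e he => ih e he

theorem Expr.subst_id (e : Expr A) : e.subst Expr.var = e := by
  induction e using Expr.ind with
  | hv x => simp
  | ha t es ih =>
    simp only [Expr.subst_app, Expr.app.injEq, true_and]
    exact (List.map_congr_left ih).trans (List.map_id _)

theorem SortE.subst_congr {σ τ : A.Var → Expr A} {U : SortE A}
    (h : ∀ x, SOccurs x U → σ x = τ x) : U.subst σ = U.subst τ := by
  simp only [SortE.subst, SortE.mk.injEq, true_and]
  exact List.map_congr_left fun e he => Expr.subst_congr fun x hx => h x ⟨e, he, hx⟩

theorem SortE.subst_subst (σ τ : A.Var → Expr A) (U : SortE A) :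
    (U.subst σ).subst τ = U.subst fun x => (σ x).subst τ := by
  simp only [SortE.subst, List.map_map, SortE.mk.injEq, true_and]
  exact List.map_congr_left fun e _ => Expr.subst_subst σ τ e

theorem SortE.subst_id (U : SortE A) : U.subst Expr.var = U := by
  obtain ⟨S, es⟩ := U
  simp only [SortE.subst, SortE.mk.injEq, true_and]
  exact (List.map_congr_left fun e _ => Expr.subst_id e).trans (List.map_id _)

/-- The variables of a precontext. -/
abbrev keys (X : PreCtx A) : List A.Var := X.map Prod.fst

/-- All variables of the term expression belong to the precontext. -/
def Scoped (X : PreCtx A) (e : Expr A) : Prop := ∀ v, Occurs v e → v ∈ keys X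

/-- All variables of the sort expression belong to the precontext. -/
def SScoped (X : PreCtx A) (U : SortE A) : Prop := ∀ v, SOccurs v U → v ∈ keys X

theorem keys_take (X : PreCtx A) (i : ℕ) : keys (X.take i) = (keys X).take i := by
  simp [keys, List.map_take]

theorem mkSub_take (X : PreCtx A) (f : List (Expr A)) (i : ℕ) :
    mkSub (X.take i) (f.take i) = (mkSub X f).take i := by
  simp [mkSub, List.zip, List.take_zipWith, List.map_take]

theorem lookupV_of_notMem {ps : List (A.Var × Expr A)} {v : A.Var}
    (h : v ∉ ps.map Prod.fst) : lookupV ps v = .var v := by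
  induction ps with
  | nil => rfl
  | cons p ps ih =>
    simp only [List.map_cons, List.mem_cons, not_or] at h
    rw [lookupV, if_neg (Ne.symm h.1), ih h.2]

theorem lookupV_append_of_mem {ps qs : List (A.Var × Expr A)} {v : A.Var}
    (h : v ∈ ps.map Prod.fst) : lookupV (ps ++ qs) v = lookupV ps v := by
  induction ps with
  | nil => simp at h
  | cons p ps ih =>
    simp only [List.cons_append, lookupV]
    split
    · rfl
    · next hne =>
      simp only [List.map_cons, List.mem_cons] at h
      exact ih (h.resolve_left (Ne.symm hne))

theorem lookupV_append_of_notMem {ps qs : List (A.Var × Expr A)} {v : A.Var}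
    (h : v ∉ ps.map Prod.fst) : lookupV (ps ++ qs) v = lookupV qs v := by
  induction ps with
  | nil => rfl
  | cons p ps ih =>
    simp only [List.map_cons, List.mem_cons, not_or] at h
    rw [List.cons_append, lookupV, if_neg (Ne.symm h.1), ih h.2]

theorem lookupV_map {ps : List (A.Var × Expr A)} {v : A.Var} {σ : A.Var → Expr A}
    (h : v ∈ ps.map Prod.fst) :
    lookupV (ps.map fun p => (p.1, p.2.subst σ)) v = (lookupV ps v).subst σ := by
  induction ps with
  | nil => simp at h
  | cons p ps ih =>
    simp only [List.map_cons, lookupV]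
    split
    · rfl
    · next hne =>
      simp only [List.map_cons, List.mem_cons] at h
      exact ih (h.resolve_left (Ne.symm hne))

/-- A list of substitution pairs whose values are given by a function on keys. -/
theorem lookupV_eq_of_forall {ps : List (A.Var × Expr A)} {v : A.Var} {e : Expr A}
    (hv : v ∈ ps.map Prod.fst) (h : ∀ p ∈ ps, p.1 = v → p.2 = e) : lookupV ps v = e := by
  induction ps with
  | nil => simp at hv
  | cons p ps ih =>
    simp only [lookupV]
    split
    · next hp => exact h p (by simp) hp
    · next hne =>
      simp only [List.map_cons, List.mem_cons] at hv
      exact ih (hv.resolve_left (Ne.symm hne)) fun q hq => h q (by simp [hq])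

theorem keys_mkSub {X : PreCtx A} {f : List (Expr A)} (h : f.length = X.length) :
    (mkSub X f).map Prod.fst = keys X := by
  rw [mkSub, List.map_fst_zip]
  simp [h]

theorem lookupV_mkSub_getElem {X : PreCtx A} {f : List (Expr A)} (hX : (keys X).Nodup)
    (hlen : f.length = X.length) {i : ℕ} (hi : i < X.length) (hif : i < f.length) :
    lookupV (mkSub X f) (X[i]'hi).1 = f[i]'hif := by
  refine lookupV_eq_of_forall ?_ ?_
  · rw [keys_mkSub hlen]
    exact List.mem_map_of_mem (List.getElem_mem hi)
  · intro p hp hpe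
    obtain ⟨j, hj, rfl⟩ := List.getElem_of_mem hp
    simp only [mkSub, List.getElem_zip, List.getElem_map] at hpe ⊢
    simp only [mkSub, List.length_zip, List.length_map] at hj
    have := (List.Nodup.getElem_inj_iff hX (hi := by simp; omega) (hj := by simpa using hi)
      (i := j) (j := i)).1 (by simpa using hpe)
    subst this; rfl

theorem lookupV_take {ps : List (A.Var × Expr A)} {i : ℕ} {v : A.Var}
    (h : v ∈ (ps.take i).map Prod.fst) : lookupV (ps.take i) v = lookupV ps v := by
  conv_rhs => rw [← List.take_append_drop i ps]
  rw [lookupV_append_of_mem h]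

theorem mkSub_map (X : PreCtx A) (f : List (Expr A)) (σ : A.Var → Expr A) :
    mkSub X (f.map (Expr.subst σ)) = (mkSub X f).map fun p => (p.1, p.2.subst σ) := by
  rw [mkSub, mkSub, List.zip_map_right]
  rfl

theorem lookupV_mkSub_map {X : PreCtx A} {σ : A.Var → Expr A} {v : A.Var} (hv : v ∈ keys X) :
    lookupV (mkSub X (X.map fun p => σ p.1)) v = σ v := by
  refine lookupV_eq_of_forall (by rw [keys_mkSub (by simp)]; exact hv) ?_
  intro p hp hpe
  obtain ⟨j, hj, rfl⟩ := List.getElem_of_mem hp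
  simp only [mkSub, List.getElem_zip, List.getElem_map] at hpe ⊢
  rw [hpe]

theorem subst_substL {X : PreCtx A} {f : List (Expr A)} (hlen : f.length = X.length)
    {U : SortE A} (hU : SScoped X U) (σ : A.Var → Expr A) :
    (U.substL (mkSub X f)).subst σ = U.substL (mkSub X (f.map (Expr.subst σ))) := by
  rw [SortE.substL, SortE.substL, SortE.subst_subst]
  refine SortE.subst_congr fun x hx => ?_
  rw [mkSub_map, lookupV_map]
  rw [keys_mkSub hlen]
  exact hU x hx

theorem Expr.subst_substL {X : PreCtx A} {f : List (Expr A)} (hlen : f.length = X.length)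
    {u : Expr A} (hu : Scoped X u) (σ : A.Var → Expr A) :
    (u.substL (mkSub X f)).subst σ = u.substL (mkSub X (f.map (Expr.subst σ))) := by
  rw [Expr.substL, Expr.substL, Expr.subst_subst]
  refine Expr.subst_congr fun x hx => ?_
  rw [mkSub_map, lookupV_map]
  rw [keys_mkSub hlen]
  exact hu x hx

theorem IsPreCtx.scoped {X : PreCtx A} (h : IsPreCtx X) {i : ℕ} (hi : i < X.length) :
    SScoped (X.take i) (X[i]'hi).2 := fun v hv => h i hi v hv

theorem subPre_subst {X : PreCtx A} (hX : IsPreCtx X) {f : List (Expr A)}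
    (hlen : f.length = X.length) {i : ℕ} (hi : i < X.length) (σ : A.Var → Expr A) :
    (subPre X f i hi).subst σ = subPre X (f.map (Expr.subst σ)) i hi := by
  rw [subPre, subPre, subst_substL (by simp [hlen]) (hX.scoped hi), List.map_take]

theorem subPre_eq_substL {X : PreCtx A} (hX : IsPreCtx X) {f : List (Expr A)}
    (hlen : f.length = X.length) {i : ℕ} (hi : i < X.length) :
    subPre X f i hi = (X[i]'hi).2.subst (lookupV (mkSub X f)) := by
  rw [subPre, SortE.substL]
  refine SortE.subst_congr fun x hx => ?_
  rw [mkSub_take, lookupV_take]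
  rw [← mkSub_take, keys_mkSub (by simp [hlen])]
  exact hX.scoped hi x hx

theorem subPre_map {X : PreCtx A} (hX : IsPreCtx X) (σ : A.Var → Expr A)
    {i : ℕ} (hi : i < X.length) :
    subPre X (X.map fun p => σ p.1) i hi = (X[i]'hi).2.subst σ := by
  rw [subPre_eq_substL hX (by simp)]
  refine SortE.subst_congr fun x hx => lookupV_mkSub_map ?_
  have := hX.scoped hi x hx
  rw [keys_take] at this
  exact List.mem_of_mem_take this

theorem substL_map {X : PreCtx A} {U : SortE A} (hU : SScoped X U) (σ : A.Var → Expr A) :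
    U.substL (mkSub X (X.map fun p => σ p.1)) = U.subst σ :=
  SortE.subst_congr fun x hx => lookupV_mkSub_map (hU x hx)

theorem Expr.substL_map {X : PreCtx A} {u : Expr A} (hu : Scoped X u) (σ : A.Var → Expr A) :
    u.substL (mkSub X (X.map fun p => σ p.1)) = u.subst σ :=
  Expr.subst_congr fun x hx => lookupV_mkSub_map (hu x hx)

theorem ctxVars_subst (X : PreCtx A) (σ : A.Var → Expr A) :
    (ctxVars X).map (Expr.subst σ) = X.map fun p => σ p.1 := by
  simp [ctxVars, Function.comp_def]

/-! ## Derivability -/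

variable {Ax : Set (Judg A)}

theorem DerAt.mono {m n : ℕ} (h : m ≤ n) {J : Judg A} (hJ : DerAt Ax m J) : DerAt Ax n J := by
  induction n, h using Nat.le_induction with
  | base => exact hJ
  | succ n _ ih => exact Or.inl ih

theorem DerAt.derivable {n : ℕ} {J : Judg A} (h : DerAt Ax n J) : Derivable Ax J := ⟨n, h⟩

theorem Derivable.eventually {J : Judg A} (h : Derivable Ax J) :
    ∀ᶠ n in Filter.atTop, DerAt Ax n J := by
  obtain ⟨m, hm⟩ := h
  filter_upwards [Filter.eventually_ge_atTop m] with n hn using hm.mono hn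

theorem eventually_forall_lt {N : ℕ} {P : ∀ i, i < N → ℕ → Prop}
    (h : ∀ i hi, ∀ᶠ n in Filter.atTop, P i hi n) :
    ∀ᶠ n in Filter.atTop, ∀ i hi, P i hi n := by
  have : ∀ᶠ n in Filter.atTop, ∀ i : Fin N, P i.1 i.2 n :=
    Filter.eventually_all.2 fun i => h i.1 i.2
  exact this.mono fun n hn i hi => hn ⟨i, hi⟩

theorem Step.derivable {J : Judg A} (h : Step Ax (Derivable Ax) J) : Derivable Ax J := by
  suffices H : ∀ᶠ n in Filter.atTop, Step Ax (DerAt Ax n) J by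
    obtain ⟨n, hn⟩ := H.exists
    exact ⟨n + 1, Or.inr hn⟩
  cases h with
  | ctx_nil => exact .of_forall fun _ => .ctx_nil
  | ctx_cons hs hf hp =>
    filter_upwards [hs.eventually] with n hs using .ctx_cons hs hf hp
  | s1 h1 => filter_upwards [h1.eventually] with n h1 using .s1 h1
  | s2 h1 => filter_upwards [h1.eventually] with n h1 using .s2 h1
  | s3 h1 h2 => filter_upwards [h1.eventually, h2.eventually] with n h1 h2 using .s3 h1 h2
  | t1 h1 => filter_upwards [h1.eventually] with n h1 using .t1 h1
  | t2 h1 => filter_upwards [h1.eventually] with n h1 using .t2 h1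
  | t3 h1 h2 => filter_upwards [h1.eventually, h2.eventually] with n h1 h2 using .t3 h1 h2
  | seqt h1 h2 => filter_upwards [h1.eventually, h2.eventually] with n h1 h2 using .seqt h1 h2
  | seqteq h1 h2 h3 h4 =>
    filter_upwards [h1.eventually, h2.eventually, h3.eventually, h4.eventually]
      with n h1 h2 h3 h4 using .seqteq h1 h2 h3 h4
  | var hi h1 => filter_upwards [h1.eventually] with n h1 using .var hi h1
  | sA ha h1 hv =>
    filter_upwards [h1.eventually, eventually_forall_lt fun i hi => (hv i hi).eventually]
      with n h1 hv using .sA ha h1 hv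
  | tA ha h1 hv =>
    filter_upwards [h1.eventually, eventually_forall_lt fun i hi => (hv i hi).eventually]
      with n h1 hv using .tA ha h1 hv
  | seqA ha h1 h2 =>
    filter_upwards [h1.eventually, h2.eventually] with n h1 h2 using .seqA ha h1 h2
  | teqA ha h1 h2 =>
    filter_upwards [h1.eventually, h2.eventually] with n h1 h2 using .teqA ha h1 h2
  | sSub ha hY hl hJ hc hv =>
    filter_upwards [hJ.eventually, hc.eventually, eventually_forall_lt fun i hi =>
      Filter.eventually_all.2 fun hf => (hv i hi hf).eventually]
      with n hJ hc hv using .sSub ha hY hl hJ hc hv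
  | tSub ha hY hl hJ hc hv =>
    filter_upwards [hJ.eventually, hc.eventually, eventually_forall_lt fun i hi =>
      Filter.eventually_all.2 fun hf => (hv i hi hf).eventually]
      with n hJ hc hv using .tSub ha hY hl hJ hc hv
  | seqSub1 ha hY hl hJ h1 h2 hv =>
    filter_upwards [hJ.eventually, h1.eventually, h2.eventually, eventually_forall_lt fun i hi =>
      Filter.eventually_all.2 fun hf => (hv i hi hf).eventually]
      with n hJ h1 h2 hv using .seqSub1 ha hY hl hJ h1 h2 hv
  | seqSub2 ha hY hl hl' hJ h1 h2 hv =>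
    filter_upwards [hJ.eventually, h1.eventually, h2.eventually, eventually_forall_lt fun i hi =>
      Filter.eventually_all.2 fun hf => Filter.eventually_all.2 fun hg => (hv i hi hf hg).eventually]
      with n hJ h1 h2 hv using .seqSub2 ha hY hl hl' hJ h1 h2 hv
  | teqSub1 ha hY hl hJ h1 h2 hv =>
    filter_upwards [hJ.eventually, h1.eventually, h2.eventually, eventually_forall_lt fun i hi =>
      Filter.eventually_all.2 fun hf => (hv i hi hf).eventually]
      with n hJ h1 h2 hv using .teqSub1 ha hY hl hJ h1 h2 hv
  | teqSub2 ha hY hl hl' hJ h1 h2 hv =>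
    filter_upwards [hJ.eventually, h1.eventually, h2.eventually, eventually_forall_lt fun i hi =>
      Filter.eventually_all.2 fun hf => Filter.eventually_all.2 fun hg => (hv i hi hf hg).eventually]
      with n hJ h1 h2 hv using .teqSub2 ha hY hl hl' hJ h1 h2 hv

/-! ## Presuppositions, with heights -/

theorem DerAt.ctx_of_sort {n : ℕ} {X : PreCtx A} {U : SortE A}
    (h : DerAt Ax (n + 1) (.sort X U)) : DerAt Ax n (.ctx X) := by
  induction n with
  | zero =>
    rcases h with h | h
    · exact h.elim
    · cases h with
      | sA _ h _ => exact h
      | sSub _ _ _ _ h _ => exact h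
  | succ n ih =>
    rcases h with h | h
    · exact (ih h).mono (Nat.le_succ n)
    · cases h with
      | sA _ h _ => exact h
      | sSub _ _ _ _ h _ => exact h

theorem DerAt.ctx_of_sort' {n : ℕ} {X : PreCtx A} {U : SortE A}
    (h : DerAt Ax n (.sort X U)) : DerAt Ax n (.ctx X) := by
  cases n with
  | zero => exact h.elim
  | succ n => exact h.ctx_of_sort.mono (Nat.le_succ n)

theorem DerAt.sort_of_sortEq {n : ℕ} {X : PreCtx A} {U V : SortE A}
    (h : DerAt Ax (n + 1) (.sortEq X U V)) :
    DerAt Ax n (.sort X U) ∧ DerAt Ax n (.sort X V) := by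
  induction n generalizing U V with
  | zero =>
    rcases h with h | h
    · exact h.elim
    · cases h with
      | s1 h => exact ⟨h, h⟩
      | s2 h => exact h.elim
      | s3 h => exact h.elim
      | seqA _ h => exact h.elim
      | seqSub1 _ _ _ h => exact h.elim
      | seqSub2 _ _ _ _ h => exact h.elim
  | succ n ih =>
    rcases h with h | h
    · exact (ih h).imp (DerAt.mono (Nat.le_succ n)) (DerAt.mono (Nat.le_succ n))
    · cases h with
      | s1 h => exact ⟨h, h⟩
      | s2 h => exact ((ih h).imp (DerAt.mono (Nat.le_succ n)) (DerAt.mono (Nat.le_succ n))).symm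
      | s3 h1 h2 => exact ⟨(ih h1).1.mono (Nat.le_succ n), (ih h2).2.mono (Nat.le_succ n)⟩
      | seqA _ h1 h2 => exact ⟨h1, h2⟩
      | seqSub1 _ _ _ _ h1 h2 => exact ⟨h1, h2⟩
      | seqSub2 _ _ _ _ _ h1 h2 => exact ⟨h1, h2⟩

theorem DerAt.sort_of_term {n : ℕ} {X : PreCtx A} {u : Expr A} {U : SortE A}
    (h : DerAt Ax (n + 1) (.term X u U)) : DerAt Ax n (.sort X U) := by
  induction n with
  | zero =>
    rcases h with h | h
    · exact h.elim
    · cases h with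
      | seqt h => exact h.elim
      | var hi h => exact h
      | tA _ h => exact h
      | tSub _ _ _ _ h => exact h
  | succ n ih =>
    rcases h with h | h
    · exact (ih h).mono (Nat.le_succ n)
    · cases h with
      | seqt h => exact h.sort_of_sortEq.2.mono (Nat.le_succ n)
      | var hi h => exact h
      | tA _ h => exact h
      | tSub _ _ _ _ h => exact h

theorem DerAt.sort_of_term' {n : ℕ} {X : PreCtx A} {u : Expr A} {U : SortE A}
    (h : DerAt Ax n (.term X u U)) : DerAt Ax n (.sort X U) := by
  cases n with
  | zero => exact h.elim
  | succ n => exact h.sort_of_term.mono (Nat.le_succ n)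

theorem DerAt.term_of_termEq {n : ℕ} {X : PreCtx A} {u v : Expr A} {U : SortE A}
    (h : DerAt Ax (n + 1) (.termEq X u v U)) :
    DerAt Ax n (.term X u U) ∧ DerAt Ax n (.term X v U) := by
  induction n generalizing u v with
  | zero =>
    rcases h with h | h
    · exact h.elim
    · cases h with
      | t1 h => exact ⟨h, h⟩
      | t2 h => exact h.elim
      | t3 h => exact h.elim
      | seqteq h => exact h.elim
      | teqA _ h => exact h.elim
      | teqSub1 _ _ _ h => exact h.elim
      | teqSub2 _ _ _ _ h => exact h.elim
  | succ n ih =>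
    rcases h with h | h
    · exact (ih h).imp (DerAt.mono (Nat.le_succ n)) (DerAt.mono (Nat.le_succ n))
    · cases h with
      | t1 h => exact ⟨h, h⟩
      | t2 h => exact ((ih h).imp (DerAt.mono (Nat.le_succ n)) (DerAt.mono (Nat.le_succ n))).symm
      | t3 h1 h2 => exact ⟨(ih h1).1.mono (Nat.le_succ n), (ih h2).2.mono (Nat.le_succ n)⟩
      | seqteq _ _ h1 h2 => exact ⟨h1, h2⟩
      | teqA _ h1 h2 => exact ⟨h1, h2⟩
      | teqSub1 _ _ _ _ h1 h2 => exact ⟨h1, h2⟩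
      | teqSub2 _ _ _ _ _ h1 h2 => exact ⟨h1, h2⟩

/-- The data contained in the derivability of a context. -/
theorem DerAt.ctx_data {n : ℕ} {X : PreCtx A} (h : DerAt Ax (n + 1) (.ctx X)) :
    (∀ i (hi : i < X.length), DerAt Ax n (.sort (X.take i) (X[i]'hi).2)) ∧
      (keys X).Nodup ∧ IsPreCtx X := by
  induction n generalizing X with
  | zero =>
    rcases h with h | h
    · exact h.elim
    · generalize hJ : Judg.ctx X = J at h
      cases h <;> cases hJ
      · simp [IsPreCtx]
      · next h _ _ => exact h.elim
  | succ n ih =>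
    rcases h with h | h
    · obtain ⟨h1, h2⟩ := ih h
      exact ⟨fun i hi => (h1 i hi).mono (Nat.le_succ n), h2⟩
    · generalize hJ : Judg.ctx X = J at h
      cases h <;> cases hJ
      · simp [IsPreCtx]
      · next X U x hs hf hp =>
        have hX := hs.ctx_of_sort.mono (Nat.le_succ n)
        obtain ⟨h1, h2, h3⟩ := ih hX
        refine ⟨fun i hi => ?_, ?_, hp⟩
        · rcases Nat.lt_or_ge i X.length with h | h
          · rw [List.take_append_of_le_length h.le, List.getElem_append_left h]
            exact (h1 i h).mono (Nat.le_succ n)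
          · have hi' : i = X.length := by
              simp at hi; omega
            subst hi'
            simpa using hs
        · rw [keys, List.map_append, List.nodup_append]
          refine ⟨h2, by simp, ?_⟩
          intro a ha b hb
          obtain ⟨p, hpX, rfl⟩ := List.mem_map.1 ha
          simp only [List.map_cons, List.map_nil, List.mem_singleton] at hb
          subst hb
          exact hf p hpX

theorem Derivable.ctx_of_sort {X : PreCtx A} {U : SortE A}
    (h : Derivable Ax (.sort X U)) : Derivable Ax (.ctx X) :=
  h.elim fun _ h => h.ctx_of_sort'.derivable

theorem Derivable.sort_of_term {X : PreCtx A} {u : Expr A} {U : SortE A}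
    (h : Derivable Ax (.term X u U)) : Derivable Ax (.sort X U) :=
  h.elim fun _ h => h.sort_of_term'.derivable

theorem Derivable.ctx_of_term {X : PreCtx A} {u : Expr A} {U : SortE A}
    (h : Derivable Ax (.term X u U)) : Derivable Ax (.ctx X) :=
  h.sort_of_term.ctx_of_sort

theorem Derivable.sort_of_sortEq {X : PreCtx A} {U V : SortE A}
    (h : Derivable Ax (.sortEq X U V)) :
    Derivable Ax (.sort X U) ∧ Derivable Ax (.sort X V) := by
  obtain ⟨n, h⟩ := h
  have := DerAt.sort_of_sortEq (h.mono (Nat.le_succ n))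
  exact ⟨⟨_, this.1⟩, ⟨_, this.2⟩⟩

theorem Derivable.term_of_termEq {X : PreCtx A} {u v : Expr A} {U : SortE A}
    (h : Derivable Ax (.termEq X u v U)) :
    Derivable Ax (.term X u U) ∧ Derivable Ax (.term X v U) := by
  obtain ⟨n, h⟩ := h
  have := DerAt.term_of_termEq (h.mono (Nat.le_succ n))
  exact ⟨⟨_, this.1⟩, ⟨_, this.2⟩⟩

theorem Derivable.ctx_data {X : PreCtx A} (h : Derivable Ax (.ctx X)) :
    (∀ i (hi : i < X.length), Derivable Ax (.sort (X.take i) (X[i]'hi).2)) ∧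
      (keys X).Nodup ∧ IsPreCtx X := by
  obtain ⟨n, h⟩ := h
  obtain ⟨h1, h2⟩ := DerAt.ctx_data (h.mono (Nat.le_succ n))
  exact ⟨fun i hi => ⟨_, h1 i hi⟩, h2⟩

theorem Derivable.isPreCtx {X : PreCtx A} (h : Derivable Ax (.ctx X)) : IsPreCtx X :=
  h.ctx_data.2.2

theorem Derivable.nodup {X : PreCtx A} (h : Derivable Ax (.ctx X)) : (keys X).Nodup :=
  h.ctx_data.2.1

theorem Derivable.conv {X : PreCtx A} {u : Expr A} {U V : SortE A}
    (h : Derivable Ax (.sortEq X U V)) (hu : Derivable Ax (.term X u U)) :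
    Derivable Ax (.term X u V) :=
  (Step.seqt h hu).derivable

theorem Derivable.convEq {X : PreCtx A} {u v : Expr A} {U V : SortE A}
    (h : Derivable Ax (.sortEq X U V)) (hu : Derivable Ax (.termEq X u v U)) :
    Derivable Ax (.termEq X u v V) :=
  (Step.seqteq h hu (h.conv hu.term_of_termEq.1) (h.conv hu.term_of_termEq.2)).derivable

theorem Derivable.seq_refl {X : PreCtx A} {U : SortE A} (h : Derivable Ax (.sort X U)) :
    Derivable Ax (.sortEq X U U) := (Step.s1 h).derivable

theorem Derivable.seq_symm {X : PreCtx A} {U V : SortE A} (h : Derivable Ax (.sortEq X U V)) :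
    Derivable Ax (.sortEq X V U) := (Step.s2 h).derivable

theorem Derivable.seq_trans {X : PreCtx A} {U V W : SortE A}
    (h : Derivable Ax (.sortEq X U V)) (h' : Derivable Ax (.sortEq X V W)) :
    Derivable Ax (.sortEq X U W) := (Step.s3 h h').derivable

theorem Derivable.teq_refl {X : PreCtx A} {u : Expr A} {U : SortE A}
    (h : Derivable Ax (.term X u U)) : Derivable Ax (.termEq X u u U) := (Step.t1 h).derivable

theorem Derivable.teq_symm {X : PreCtx A} {u v : Expr A} {U : SortE A}
    (h : Derivable Ax (.termEq X u v U)) : Derivable Ax (.termEq X v u U) :=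
  (Step.t2 h).derivable

theorem Derivable.teq_trans {X : PreCtx A} {u v w : Expr A} {U : SortE A}
    (h : Derivable Ax (.termEq X u v U)) (h' : Derivable Ax (.termEq X v w U)) :
    Derivable Ax (.termEq X u w U) := (Step.t3 h h').derivable

section

variable {Ax : Set (Judg A)}

/-- The shape conditions on a set of axioms used by the syntactic metatheory. -/
structure Shaped (Ax : Set (Judg A)) : Prop where
  sort_shape : ∀ {X : PreCtx A} {U : SortE A}, Judg.sort X U ∈ Ax → U.args = ctxVars X
  term_shape : ∀ {X : PreCtx A} {u : Expr A} {U : SortE A}, Judg.term X u U ∈ Ax →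
    ∃ t : A.TermSym, u = Expr.app t (ctxVars X)
  sort_unique : ∀ {S : A.SortSym} {X X' : PreCtx A},
    introSort X S ∈ Ax → introSort X' S ∈ Ax → X = X'
  term_unique : ∀ {t : A.TermSym} {X X' : PreCtx A} {U U' : SortE A},
    introTerm X t U ∈ Ax → introTerm X' t U' ∈ Ax → X = X' ∧ U = U'

theorem IsGAT.shaped (h : IsGAT Ax) : Shaped Ax where
  sort_shape := h.1.sort_shape _ _
  term_shape := h.1.term_shape _ _ _
  sort_unique := fun h1 h2 => (h.1.sort_intro _).unique h1 h2
  term_unique := fun h1 h2 => by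
    have := (h.1.term_intro _).unique (y₁ := (_, _)) (y₂ := (_, _)) h1 h2
    exact Prod.mk.inj this

theorem Shaped.sort_mem_spec (h : Shaped Ax) {X : PreCtx A} {U : SortE A}
    (hU : Judg.sort X U ∈ Ax) : introSort X U.head ∈ Ax ∧ U = ⟨U.head, ctxVars X⟩ := by
  obtain ⟨S, es⟩ := U
  have := h.sort_shape hU
  simp only at this
  subst this
  exact ⟨hU, rfl⟩

theorem Shaped.term_mem_spec (h : Shaped Ax) {X : PreCtx A} {u : Expr A} {U : SortE A}
    (hU : Judg.term X u U ∈ Ax) :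
    ∃ t : A.TermSym, introTerm X t U ∈ Ax ∧ u = .app t (ctxVars X) := by
  obtain ⟨t, rfl⟩ := h.term_shape hU
  exact ⟨t, hU, rfl⟩

/-! ## Scoping of derivable judgments -/

theorem scoped_ctxVars {X : PreCtx A} {e : Expr A} (he : e ∈ ctxVars X) : Scoped X e := by
  obtain ⟨p, hp, rfl⟩ := List.mem_map.1 he
  intro v hv
  rw [occurs_var_iff] at hv
  exact hv ▸ List.mem_map_of_mem hp

theorem DerAt.scoped (hs : Shaped Ax) (n : ℕ) :
    (∀ X U, DerAt Ax n (.sort X U) → SScoped X U) ∧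
      (∀ X u U, DerAt Ax n (.term X u U) → Scoped X u) := by
  induction n with
  | zero => exact ⟨fun _ _ h => h.elim, fun _ _ _ h => h.elim⟩
  | succ n ih =>
    have hargs : ∀ {X : PreCtx A} {Y : PreCtx A} {f : List (Expr A)}, f.length = X.length →
        (∀ i (hi : i < X.length) (hif : i < f.length),
          DerAt Ax n (.term Y (f[i]'hif) (subPre X f i hi))) → ∀ e ∈ f, Scoped Y e := by
      intro X Y f hlen H e he
      obtain ⟨i, hi, rfl⟩ := List.getElem_of_mem he
      exact ih.2 _ _ _ (H i (hlen ▸ hi) hi)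
    constructor
    · intro X U h
      rcases h with h | h
      · exact ih.1 _ _ h
      · cases h with
        | sA hax h hv =>
          rintro v ⟨e, he, hev⟩
          rw [hs.sort_shape hax] at he
          exact scoped_ctxVars he v hev
        | sSub _ _ hlen _ _ H => rintro v ⟨e, he, hev⟩; exact hargs hlen H e he v hev
    · intro X u U h
      rcases h with h | h
      · exact ih.2 _ _ _ h
      · cases h with
        | seqt _ h => exact ih.2 _ _ _ h
        | var hi _ => exact scoped_ctxVars (List.mem_map_of_mem (List.getElem_mem hi))
        | tA hax h hv =>
          obtain ⟨t, rfl⟩ := hs.term_shape hax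
          intro v hv
          obtain ⟨e, he, hev⟩ := occurs_app_iff.1 hv
          exact scoped_ctxVars he v hev
        | tSub _ _ hlen _ _ H =>
          intro v hv
          obtain ⟨e, he, hev⟩ := occurs_app_iff.1 hv
          exact hargs hlen H e he v hev

theorem Derivable.sscoped (hs : Shaped Ax) {X : PreCtx A} {U : SortE A}
    (h : Derivable Ax (.sort X U)) : SScoped X U :=
  h.elim fun n h => (DerAt.scoped hs n).1 _ _ h

theorem Derivable.scoped (hs : Shaped Ax) {X : PreCtx A} {u : Expr A} {U : SortE A}
    (h : Derivable Ax (.term X u U)) : Scoped X u :=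
  h.elim fun n h => (DerAt.scoped hs n).2 _ _ _ h

/-! ## The substitution theorem -/

/-- A substitution which sends the variables of `X` to terms over `Y` of the right sorts. -/
def MorF (Ax : Set (Judg A)) (Y X : PreCtx A) (σ : A.Var → Expr A) : Prop :=
  ∀ p ∈ X, Derivable Ax (.term Y (σ p.1) (p.2.subst σ))

/-- Two substitutions which send the variables of `X` to equal terms over `Y`. -/
def MorEqF (Ax : Set (Judg A)) (Y X : PreCtx A) (σ τ : A.Var → Expr A) : Prop :=
  MorF Ax Y X σ ∧ MorF Ax Y X τ ∧
    ∀ p ∈ X, Derivable Ax (.termEq Y (σ p.1) (τ p.1) (p.2.subst σ))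

theorem MorF.refl {Y X : PreCtx A} {σ : A.Var → Expr A} (h : MorF Ax Y X σ) :
    MorEqF Ax Y X σ σ :=
  ⟨h, h, fun p hp => (h p hp).teq_refl⟩

/-- The result of substituting two equal substitutions in a judgment. -/
def Judg.SubstEq (Ax : Set (Judg A)) (Y : PreCtx A) (σ τ : A.Var → Expr A) : Judg A → Prop
  | .ctx _ => True
  | .sort _ U => Derivable Ax (.sortEq Y (U.subst σ) (U.subst τ))
  | .term _ u U => Derivable Ax (.termEq Y (u.subst σ) (u.subst τ) (U.subst σ))
  | .sortEq _ U V => Derivable Ax (.sortEq Y (U.subst σ) (V.subst τ))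
  | .termEq _ u v U => Derivable Ax (.termEq Y (u.subst σ) (v.subst τ) (U.subst σ))

theorem Derivable.sort_instance {X Y : PreCtx A} {S : A.SortSym} (hax : introSort X S ∈ Ax)
    (hJ : Derivable Ax (introSort X S)) (hY : Derivable Ax (.ctx Y)) {f : List (Expr A)}
    (hlen : f.length = X.length)
    (hf : ∀ i (hi : i < X.length) (hif : i < f.length),
      Derivable Ax (.term Y (f[i]'hif) (subPre X f i hi))) :
    Derivable Ax (.sort Y ⟨S, f⟩) :=
  (Step.sSub hax hY.isPreCtx hlen hJ hY hf).derivable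

theorem DerAt.substEq (hs : Shaped Ax) {n : ℕ} {J : Judg A} (h : DerAt Ax n J)
    {Y : PreCtx A} (hY : Derivable Ax (.ctx Y)) {σ τ : A.Var → Expr A}
    (hm : MorEqF Ax Y J.ctxOf σ τ) : J.SubstEq Ax Y σ τ := by
  induction n using Nat.strong_induction_on generalizing J σ τ with
  | _ n ih =>
    cases n with
    | zero => exact h.elim
    | succ n =>
    rcases h with h | h
    · exact ih n (Nat.lt_succ_self n) h hm
    have IH : ∀ {J : Judg A} {σ τ : A.Var → Expr A}, DerAt Ax n J → MorEqF Ax Y J.ctxOf σ τ →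
      J.SubstEq Ax Y σ τ := fun h hm => ih n (Nat.lt_succ_self n) h hm
    have hD : Derivable Ax J := ⟨n + 1, Or.inr h⟩
    have hargs : ∀ {X X0 : PreCtx A} {f g : List (Expr A)} (hX : IsPreCtx X)
        (hlf : f.length = X.length) (hlg : g.length = X.length)
        (hm : MorEqF Ax Y X0 σ τ)
        (H : ∀ i (hi : i < X.length) (hif : i < f.length) (hig : i < g.length),
          DerAt Ax n (.termEq X0 (f[i]'hif) (g[i]'hig) (subPre X f i hi)) ∨
          (f = g ∧ DerAt Ax n (.term X0 (f[i]'hif) (subPre X f i hi)))),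
        ∀ i (hi : i < X.length) (hif : i < (f.map (Expr.subst σ)).length)
          (hig : i < (g.map (Expr.subst τ)).length),
          Derivable Ax (.termEq Y ((f.map (Expr.subst σ))[i]'hif)
            ((g.map (Expr.subst τ))[i]'hig) (subPre X (f.map (Expr.subst σ)) i hi)) := by
      intro X X0 f g hX hlf hlg hm H i hi hif hig
      rw [← subPre_subst hX hlf]
      simp only [List.getElem_map]
      rcases H i hi (hlf ▸ hi) (hlg ▸ hi) with H' | ⟨rfl, H'⟩
      · exact IH H' hm
      · have := IH H' hm; exact this
    have hvars : ∀ {X : PreCtx A} {σ τ : A.Var → Expr A} (hX : IsPreCtx X)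
        (hm : MorEqF Ax Y X σ τ),
        ∀ i (hi : i < X.length) (hif : i < (X.map fun p => σ p.1).length)
          (hig : i < (X.map fun p => τ p.1).length),
          Derivable Ax (.termEq Y ((X.map fun p => σ p.1)[i]'hif)
            ((X.map fun p => τ p.1)[i]'hig) (subPre X (X.map fun p => σ p.1) i hi)) := by
      intro X σ τ hX hm i hi hif hig
      rw [subPre_map hX]
      simp only [List.getElem_map]
      exact hm.2.2 _ (List.getElem_mem hi)
    have hYp := hY.isPreCtx
    cases h with
    | ctx_nil => trivial
    | ctx_cons => trivial
    | s1 h => have := IH h hm; exact this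
    | s2 h =>
      have h1 := IH h hm.1.refl
      have h2 := IH h hm.2.1.refl
      have h3 := IH h hm
      exact (h1.seq_symm.seq_trans h3).seq_trans h2.seq_symm
    | s3 h1 h2 => exact (IH h1 hm.1.refl).seq_trans (IH h2 hm)
    | t1 h => have := IH h hm; exact this
    | t2 h =>
      have h1 := IH h hm.1.refl
      have h2 := IH h hm.2.1.refl
      have h3 := IH h hm
      cases n with
      | zero => exact h.elim
      | succ n =>
        have h4 := IH ((h.term_of_termEq.1.sort_of_term').mono (Nat.le_succ n)) hm
        exact (h1.teq_symm.teq_trans h3).teq_trans (h4.seq_symm.convEq h2.teq_symm)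
    | t3 h1 h2 => exact (IH h1 hm.1.refl).teq_trans (IH h2 hm)
    | seqt h1 h2 => exact (IH h1 hm.1.refl).convEq (IH h2 hm)
    | seqteq h1 h2 _ _ => exact (IH h1 hm.1.refl).convEq (IH h2 hm)
    | var hi h =>
      simp only [Judg.SubstEq, Expr.subst_var]
      exact hm.2.2 _ (List.getElem_mem hi)
    | @sA X U hax h hv =>
      obtain ⟨hax', hU⟩ := hs.sort_mem_spec hax
      rw [hU] at hD ⊢
      have hX := h.derivable.isPreCtx
      simp only [Judg.SubstEq, SortE.subst, ctxVars_subst]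
      refine (Step.seqSub2 hax' hYp (by simp) (by simp) hD ?_ ?_ (hvars hX hm)).derivable
      · exact hD.sort_instance hax' hY (by simp)
          fun i hi hif => (hvars hX hm.1.refl i hi hif hif).term_of_termEq.1
      · exact hD.sort_instance hax' hY (by simp)
          fun i hi hif => (hvars hX hm.2.1.refl i hi hif hif).term_of_termEq.1
    | @tA X u U hax h hv =>
      obtain ⟨t, hax', rfl⟩ := hs.term_mem_spec hax
      have hX := h.ctx_of_sort'.derivable.isPreCtx
      have hU := h.derivable.sscoped hs
      have hUeq := IH h hm
      simp only [Judg.SubstEq, Expr.subst_app, ctxVars_subst]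
      have key : ∀ {ρ : A.Var → Expr A}, MorF Ax Y X ρ → Derivable Ax (.sort Y (U.subst ρ)) →
          Derivable Ax (.term Y (.app t (X.map fun p => ρ p.1)) (U.subst ρ)) := by
        intro ρ hρ hUρ
        rw [← substL_map hU ρ] at hUρ ⊢
        exact (Step.tSub hax' hYp (by simp) hD hUρ
          fun i hi hif => (hvars hX hρ.refl i hi hif hif).term_of_termEq.1).derivable
      have h1 := key hm.1 hUeq.sort_of_sortEq.1
      have h2 := hUeq.seq_symm.conv (key hm.2.1 hUeq.sort_of_sortEq.2)
      rw [← substL_map hU σ] at h1 h2 ⊢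
      exact (Step.teqSub2 hax' hYp (by simp) (by simp) hD h1 h2 (hvars hX hm)).derivable
    | @seqA X U U' hax h1 h2 =>
      have hX := h1.ctx_of_sort'.derivable.isPreCtx
      have e1 := IH h1 hm.1.refl
      have e2 := IH h2 hm
      refine Derivable.seq_trans ?_ e2
      have d1 := e1.sort_of_sortEq.1
      have d2 := e2.sort_of_sortEq.1
      rw [← substL_map (h1.derivable.sscoped hs) σ] at d1 ⊢
      rw [← substL_map (h2.derivable.sscoped hs) σ] at d2 ⊢
      exact (Step.seqSub1 hax hYp (by simp) hD d1 d2
        fun i hi hif => (hvars hX hm.1.refl i hi hif hif).term_of_termEq.1).derivable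
    | @teqA X u u' U hax h1 h2 =>
      have hX := h1.sort_of_term'.ctx_of_sort'.derivable.isPreCtx
      have e1 := IH h1 hm.1.refl
      have e2 := IH h2 hm
      refine Derivable.teq_trans ?_ e2
      have d1 := e1.term_of_termEq.1
      have d2 := e2.term_of_termEq.1
      rw [← substL_map (h1.sort_of_term'.derivable.sscoped hs) σ] at d1 d2 ⊢
      rw [← Expr.substL_map (h1.derivable.scoped hs) σ] at d1 ⊢
      rw [← Expr.substL_map (h2.derivable.scoped hs) σ] at d2 ⊢
      exact (Step.teqSub1 hax hYp (by simp) hD d1 d2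
        fun i hi hif => (hvars hX hm.1.refl i hi hif hif).term_of_termEq.1).derivable
    | @sSub X S hax X0 hX0 f hlen hJ hc H =>
      have hX := hJ.ctx_of_sort'.derivable.isPreCtx
      have a1 := hargs hX hlen hlen hm fun i hi hif _ => .inr ⟨rfl, H i hi hif⟩
      have key : ∀ {ρ}, MorF Ax Y X0 ρ →
          Derivable Ax (.sort Y ⟨S, f.map (Expr.subst ρ)⟩) := by
        intro ρ hρ
        refine hJ.derivable.sort_instance hax hY (by simpa) fun i hi hif => ?_
        rw [← subPre_subst hX hlen]
        simp only [List.getElem_map]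
        exact (IH (H i hi (hlen ▸ hi)) hρ.refl).term_of_termEq.1
      exact (Step.seqSub2 hax hYp (by simpa) (by simpa) hJ.derivable (key hm.1) (key hm.2.1)
        a1).derivable
    | @tSub X t U hax X0 hX0 f hlen hJ hU H =>
      have hX := hJ.sort_of_term'.ctx_of_sort'.derivable.isPreCtx
      have hUs := hJ.sort_of_term'.derivable.sscoped hs
      have a1 := hargs hX hlen hlen hm fun i hi hif _ => .inr ⟨rfl, H i hi hif⟩
      have hUeq := IH hU hm
      have key : ∀ {ρ}, MorF Ax Y X0 ρ →
          Derivable Ax (.term Y (.app t (f.map (Expr.subst ρ)))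
            ((U.substL (mkSub X f)).subst ρ)) := by
        intro ρ hρ
        have h0 := (IH hU hρ.refl).sort_of_sortEq.1
        rw [subst_substL hlen hUs] at h0 ⊢
        refine (Step.tSub hax hYp (by simpa) hJ.derivable h0 fun i hi hif => ?_).derivable
        rw [← subPre_subst hX hlen]
        simp only [List.getElem_map]
        exact (IH (H i hi (hlen ▸ hi)) hρ.refl).term_of_termEq.1
      have h1 := key hm.1
      have h2 := hUeq.seq_symm.conv (key hm.2.1)
      simp only [Judg.SubstEq, Expr.subst_app]
      rw [subst_substL hlen hUs] at h1 h2 ⊢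
      exact (Step.teqSub2 hax hYp (by simpa) (by simpa) hJ.derivable h1 h2 a1).derivable
    | @seqSub1 X U U' hax X0 hX0 f hlen hJ h1 h2 H =>
      have hUs := hJ.derivable.sort_of_sortEq
      have hX := hUs.1.ctx_of_sort.isPreCtx
      have e1 := (IH h1 hm.1.refl).sort_of_sortEq.1
      have e2 := IH h2 hm
      have e3 := e2.sort_of_sortEq.1
      refine Derivable.seq_trans ?_ e2
      rw [subst_substL hlen (hUs.1.sscoped hs)] at e1 ⊢
      rw [subst_substL hlen (hUs.2.sscoped hs)] at e3 ⊢
      refine (Step.seqSub1 hax hYp (by simpa) hJ.derivable e1 e3 fun i hi hif => ?_).derivable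
      rw [← subPre_subst hX hlen]
      simp only [List.getElem_map]
      exact (IH (H i hi (hlen ▸ hi)) hm.1.refl).term_of_termEq.1
    | @seqSub2 X S hax X0 hX0 f g hlf hlg hJ h1 h2 H =>
      have hX := hJ.ctx_of_sort'.derivable.isPreCtx
      exact (Step.seqSub2 hax hYp (by simpa) (by simpa) hJ.derivable
        (IH h1 hm.1.refl).sort_of_sortEq.1 (IH h2 hm.2.1.refl).sort_of_sortEq.1
        (hargs hX hlf hlg hm fun i hi hif hig => .inl (H i hi hif hig))).derivable
    | @teqSub1 X u u' U hax X0 hX0 f hlen hJ h1 h2 H =>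
      have hus := hJ.derivable.term_of_termEq
      have hX := hus.1.ctx_of_term.isPreCtx
      have hUs := hus.1.sort_of_term.sscoped hs
      have e1 := (IH h1 hm.1.refl).term_of_termEq.1
      have e2 := IH h2 hm
      have e3 := e2.term_of_termEq.1
      refine Derivable.teq_trans ?_ e2
      rw [subst_substL hlen hUs] at e1 e3 ⊢
      rw [Expr.subst_substL hlen (hus.1.scoped hs)] at e1 ⊢
      rw [Expr.subst_substL hlen (hus.2.scoped hs)] at e3 ⊢
      refine (Step.teqSub1 hax hYp (by simpa) hJ.derivable e1 e3 fun i hi hif => ?_).derivable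
      rw [← subPre_subst hX hlen]
      simp only [List.getElem_map]
      exact (IH (H i hi (hlen ▸ hi)) hm.1.refl).term_of_termEq.1
    | @teqSub2 X t U hax X0 hX0 f g hlf hlg hJ h1 h2 H =>
      have hX := hJ.sort_of_term'.ctx_of_sort'.derivable.isPreCtx
      have hUs := hJ.sort_of_term'.derivable.sscoped hs
      have e1 := (IH h1 hm.1.refl).term_of_termEq.1
      have e2 := (IH h2 hm).term_of_termEq.2
      simp only [Judg.SubstEq, Expr.subst_app] at e1 e2 ⊢
      rw [subst_substL hlf hUs] at e1 e2 ⊢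
      exact (Step.teqSub2 hax hYp (by simpa) (by simpa) hJ.derivable e1 e2
        (hargs hX hlf hlg hm fun i hi hif hig => .inl (H i hi hif hig))).derivable

theorem Derivable.substEq (hs : Shaped Ax) {J : Judg A} (h : Derivable Ax J)
    {Y : PreCtx A} (hY : Derivable Ax (.ctx Y)) {σ τ : A.Var → Expr A}
    (hm : MorEqF Ax Y J.ctxOf σ τ) : J.SubstEq Ax Y σ τ :=
  h.elim fun _ h => h.substEq hs hY hm

theorem Derivable.sort_subst (hs : Shaped Ax) {X Y : PreCtx A} {U : SortE A}
    (h : Derivable Ax (.sort X U)) (hY : Derivable Ax (.ctx Y)) {σ : A.Var → Expr A}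
    (hm : MorF Ax Y X σ) : Derivable Ax (.sort Y (U.subst σ)) :=
  (Derivable.substEq hs h hY (MorF.refl hm)).sort_of_sortEq.1

theorem Derivable.term_subst (hs : Shaped Ax) {X Y : PreCtx A} {u : Expr A} {U : SortE A}
    (h : Derivable Ax (.term X u U)) (hY : Derivable Ax (.ctx Y)) {σ : A.Var → Expr A}
    (hm : MorF Ax Y X σ) : Derivable Ax (.term Y (u.subst σ) (U.subst σ)) :=
  (Derivable.substEq hs h hY (MorF.refl hm)).term_of_termEq.1

theorem Derivable.sortEq_subst (hs : Shaped Ax) {X Y : PreCtx A} {U V : SortE A}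
    (h : Derivable Ax (.sortEq X U V)) (hY : Derivable Ax (.ctx Y)) {σ : A.Var → Expr A}
    (hm : MorF Ax Y X σ) : Derivable Ax (.sortEq Y (U.subst σ) (V.subst σ)) :=
  Derivable.substEq hs h hY (MorF.refl hm)

theorem Derivable.termEq_subst (hs : Shaped Ax) {X Y : PreCtx A} {u v : Expr A} {U : SortE A}
    (h : Derivable Ax (.termEq X u v U)) (hY : Derivable Ax (.ctx Y)) {σ : A.Var → Expr A}
    (hm : MorF Ax Y X σ) : Derivable Ax (.termEq Y (u.subst σ) (v.subst σ) (U.subst σ)) :=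
  Derivable.substEq hs h hY (MorF.refl hm)

end

section

variable {Ax : Set (Judg A)}

/-! ## Variables, contexts and uniqueness of sorts -/

theorem MorF.of_subset {X X' Y : PreCtx A} {σ : A.Var → Expr A} (h : MorF Ax Y X σ)
    (hX : ∀ p ∈ X', p ∈ X) : MorF Ax Y X' σ := fun p hp => h p (hX p hp)

theorem mem_take_iff_lt {α : Type*} {l : List α} {k : ℕ} {p : α} :
    p ∈ l.take k ↔ ∃ i, ∃ hi : i < l.length, i < k ∧ l[i] = p := by
  constructor
  · intro h
    obtain ⟨i, hi, rfl⟩ := List.getElem_of_mem h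
    simp only [List.length_take, lt_min_iff] at hi
    exact ⟨i, hi.2, hi.1, by simp⟩
  · rintro ⟨i, hi, hik, rfl⟩
    exact List.mem_take_iff_getElem.2 ⟨i, by omega, rfl⟩

theorem Derivable.var_typed (hs : Shaped Ax) {X : PreCtx A} (h : Derivable Ax (.ctx X)) :
    ∀ p ∈ X, Derivable Ax (.term X (.var p.1) p.2) := by
  have key : ∀ k, ∀ p ∈ X.take k, Derivable Ax (.term X (.var p.1) p.2) := by
    intro k
    induction k with
    | zero => simp
    | succ k ih =>
      intro p hp
      obtain ⟨i, hi, hik, rfl⟩ := mem_take_iff_lt.1 hp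
      rcases Nat.lt_succ_iff_lt_or_eq.1 hik with hik | rfl
      · exact ih _ (mem_take_iff_lt.2 ⟨i, hi, hik, rfl⟩)
      · have h1 := (h.ctx_data.1 i hi).sort_subst hs h (σ := Expr.var)
          fun p hp => by rw [SortE.subst_id]; exact ih p hp
        rw [SortE.subst_id] at h1
        exact (Step.var hi h1).derivable
  intro p hp
  exact key X.length p (by simpa using hp)

theorem Derivable.morF_var (hs : Shaped Ax) {X : PreCtx A} (h : Derivable Ax (.ctx X)) :
    MorF Ax X X Expr.var := fun p hp => by
  rw [SortE.subst_id]; exact h.var_typed hs p hp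

theorem keys_nodup_take {X : PreCtx A} (h : (keys X).Nodup) (k : ℕ) :
    (keys (X.take k)).Nodup := by
  rw [keys_take]; exact h.sublist (List.take_sublist _ _)

/-- A list of distinct variables with sorts derivable over the preceding ones is a context. -/
theorem derivable_ctx_of_forall (hs : Shaped Ax) {X : PreCtx A} (hn : (keys X).Nodup)
    (h : ∀ k (hk : k < X.length), Derivable Ax (.ctx (X.take k)) →
      Derivable Ax (.sort (X.take k) (X[k]'hk).2)) : Derivable Ax (.ctx X) := by
  have key : ∀ k, k ≤ X.length → Derivable Ax (.ctx (X.take k)) := by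
    intro k
    induction k with
    | zero => intro _; simpa using (Step.ctx_nil (Ax := Ax)).derivable
    | succ k ih =>
      intro hk
      have hc := ih (by omega)
      have h1 := h k hk hc
      have h2 := h1.sscoped hs
      rw [List.take_succ_eq_append_getElem hk]
      have hn' := keys_nodup_take hn (k + 1)
      rw [List.take_succ_eq_append_getElem hk] at hn'
      refine (Step.ctx_cons (x := (X[k]'hk).1) h1 ?_ ?_).derivable
      · intro p hp hpe
        rw [keys, List.map_append, List.nodup_append] at hn'
        exact hn'.2.2 p.1 (List.mem_map_of_mem hp) _ (by simp) hpe
      · intro i hi v hv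
        simp only [List.length_append, List.length_take, List.length_singleton] at hi
        rcases Nat.lt_or_ge i (X.take k).length with hik | hik
        · simp only [List.getElem_append_left hik] at hv
          rw [List.take_append_of_le_length hik.le]
          exact hc.isPreCtx i hik v hv
        · have hl : (X.take k).length = k := by rw [List.length_take]; omega
          have : i = (X.take k).length := by omega
          subst this
          simp only [List.getElem_concat_length] at hv
          rw [List.take_left]
          exact h2 v hv
  simpa using key X.length le_rfl

theorem eq_map_lookupV {X : PreCtx A} (hX : (keys X).Nodup) {f : List (Expr A)}
    (hlen : f.length = X.length) : f = X.map fun p => lookupV (mkSub X f) p.1 := by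
  refine List.ext_getElem (by simpa) fun i hi hi' => ?_
  rw [List.getElem_map, lookupV_mkSub_getElem hX hlen (by omega) hi]

theorem morF_lookupV {X Y : PreCtx A} (hX : Derivable Ax (.ctx X)) {f : List (Expr A)}
    (hlen : f.length = X.length)
    (h : ∀ i (hi : i < X.length) (hif : i < f.length),
      Derivable Ax (.term Y (f[i]'hif) (subPre X f i hi))) :
    MorF Ax Y X (lookupV (mkSub X f)) := by
  intro p hp
  obtain ⟨i, hi, rfl⟩ := List.getElem_of_mem hp
  rw [lookupV_mkSub_getElem hX.nodup hlen hi (hlen ▸ hi), ← subPre_eq_substL hX.isPreCtx hlen]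
  exact h i hi _

theorem Derivable.sort_inv (hs : Shaped Ax) {Z : PreCtx A} {U : SortE A}
    (h : Derivable Ax (.sort Z U)) :
    ∃ (X : PreCtx A) (σ : A.Var → Expr A), introSort X U.head ∈ Ax ∧
      Derivable Ax (introSort X U.head) ∧ U.args = X.map (fun p => σ p.1) ∧ MorF Ax Z X σ := by
  obtain ⟨n, h⟩ := h
  induction n with
  | zero => exact h.elim
  | succ n ih =>
    rcases h with h | h
    · exact ih h
    · have hD : Derivable Ax (.sort Z U) := ⟨n + 1, Or.inr h⟩
      cases h with
      | sA hax h hv =>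
        obtain ⟨h1, h2⟩ := hs.sort_mem_spec hax
        refine ⟨Z, Expr.var, h1, ?_, hs.sort_shape hax, h.derivable.morF_var hs⟩
        rwa [h2] at hD
      | sSub hax hY hlen hJ hYc H =>
        have hX := hJ.derivable.ctx_of_sort
        exact ⟨_, _, hax, hJ.derivable, eq_map_lookupV hX.nodup hlen,
          morF_lookupV hX hlen fun i hi hif => (H i hi hif).derivable⟩

theorem Derivable.app_inv (hs : Shaped Ax) {Z : PreCtx A} {t : A.TermSym} {es : List (Expr A)}
    {W : SortE A} (h : Derivable Ax (.term Z (.app t es) W)) :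
    ∃ (X : PreCtx A) (V : SortE A) (σ : A.Var → Expr A), introTerm X t V ∈ Ax ∧
      Derivable Ax (introTerm X t V) ∧ es = X.map (fun p => σ p.1) ∧ MorF Ax Z X σ ∧
      Derivable Ax (.sortEq Z (V.subst σ) W) := by
  obtain ⟨n, h⟩ := h
  induction n generalizing W with
  | zero => exact h.elim
  | succ n ih =>
    rcases h with h | h
    · exact ih h
    · have hD : Derivable Ax (.term Z (.app t es) W) := ⟨n + 1, Or.inr h⟩
      generalize hu : Expr.app t es = u at h
      cases h with
      | seqt h1 h2 =>
        subst hu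
        obtain ⟨X, V, σ, e1, e2, e3, e4, e5⟩ := ih h2
        exact ⟨X, V, σ, e1, e2, e3, e4, e5.seq_trans h1.derivable⟩
      | var hi h => cases hu
      | tA hax h hv =>
        obtain ⟨t', h1, h2⟩ := hs.term_mem_spec hax
        subst hu
        cases h2
        refine ⟨Z, W, Expr.var, h1, hD, rfl, hD.ctx_of_term.morF_var hs, ?_⟩
        rw [SortE.subst_id]
        exact h.derivable.seq_refl
      | tSub hax hY hlen hJ hU H =>
        cases hu
        have hX := hJ.derivable.ctx_of_term
        exact ⟨_, _, _, hax, hJ.derivable, eq_map_lookupV hX.nodup hlen,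
          morF_lookupV hX hlen fun i hi hif => (H i hi hif).derivable, hU.derivable.seq_refl⟩

theorem Derivable.var_inv {Z : PreCtx A} {x : A.Var} {W : SortE A}
    (h : Derivable Ax (.term Z (.var x) W)) (hs : Shaped Ax) :
    ∃ p ∈ Z, p.1 = x ∧ Derivable Ax (.sortEq Z p.2 W) := by
  obtain ⟨n, h⟩ := h
  induction n generalizing W with
  | zero => exact h.elim
  | succ n ih =>
    rcases h with h | h
    · exact ih h
    · generalize hu : Expr.var x = u at h
      cases h with
      | seqt h1 h2 =>
        subst hu
        obtain ⟨p, hp, e1, e2⟩ := ih h2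
        exact ⟨p, hp, e1, e2.seq_trans h1.derivable⟩
      | var hi h =>
        cases hu
        exact ⟨_, List.getElem_mem hi, rfl, h.derivable.seq_refl⟩
      | tA hax h hv =>
        obtain ⟨t', h1, h2⟩ := hs.term_mem_spec hax
        rw [h2] at hu
        cases hu
      | tSub => cases hu

theorem eq_of_mem_keys {X : PreCtx A} (hX : (keys X).Nodup) {p q : A.Var × SortE A}
    (hp : p ∈ X) (hq : q ∈ X) (h : p.1 = q.1) : p = q :=
  List.inj_on_of_nodup_map hX hp hq h

theorem SScoped.subst_congr {X : PreCtx A} {U : SortE A} (hU : SScoped X U)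
    {σ τ : A.Var → Expr A} (h : ∀ p ∈ X, σ p.1 = τ p.1) : U.subst σ = U.subst τ :=
  SortE.subst_congr fun x hx => by
    obtain ⟨q, hq, rfl⟩ := List.mem_map.1 (hU x hx)
    exact h q hq

theorem map_fst_inj {X : PreCtx A} {σ τ : A.Var → Expr A}
    (h : (X.map fun p => σ p.1) = X.map fun p => τ p.1) : ∀ p ∈ X, σ p.1 = τ p.1 :=
  List.map_inj_left.1 h

/-- A term has at most one sort up to derivable equality. -/
theorem Derivable.sort_unique (hs : Shaped Ax) {Z : PreCtx A} {e : Expr A} {W W' : SortE A}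
    (h : Derivable Ax (.term Z e W)) (h' : Derivable Ax (.term Z e W')) :
    Derivable Ax (.sortEq Z W W') := by
  cases e with
  | var x =>
    obtain ⟨p, hp, e1, e2⟩ := h.var_inv hs
    obtain ⟨q, hq, e3, e4⟩ := h'.var_inv hs
    obtain rfl := eq_of_mem_keys h.ctx_of_term.nodup hp hq (e1.trans e3.symm)
    exact e2.seq_symm.seq_trans e4
  | app t es =>
    obtain ⟨X, V, σ, e1, e2, e3, e4, e5⟩ := h.app_inv hs
    obtain ⟨X', V', σ', e1', e2', e3', e4', e5'⟩ := h'.app_inv hs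
    obtain ⟨rfl, rfl⟩ := hs.term_unique e1 e1'
    rw [e3] at e3'
    rw [e2.sort_of_term.sscoped hs |>.subst_congr (map_fst_inj e3')] at e5
    exact e5.seq_symm.seq_trans e5'

/-! ## Untyped equality of terms -/

/-- Derivable equality of terms at some sort. -/
def TEq (Ax : Set (Judg A)) (Z : PreCtx A) (e e' : Expr A) : Prop :=
  ∃ W, Derivable Ax (.termEq Z e e' W)

theorem TEq.symm {Z : PreCtx A} {e e' : Expr A} (h : TEq Ax Z e e') : TEq Ax Z e' e :=
  h.imp fun _ h => h.teq_symm

theorem TEq.at_sort (hs : Shaped Ax) {Z : PreCtx A} {e e' : Expr A} {W : SortE A}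
    (h : TEq Ax Z e e') (he : Derivable Ax (.term Z e W)) : Derivable Ax (.termEq Z e e' W) := by
  obtain ⟨W', h⟩ := h
  exact (h.term_of_termEq.1.sort_unique hs he).convEq h

theorem TEq.trans (hs : Shaped Ax) {Z : PreCtx A} {e e' e'' : Expr A}
    (h : TEq Ax Z e e') (h' : TEq Ax Z e' e'') : TEq Ax Z e e'' := by
  obtain ⟨W, h⟩ := h
  exact ⟨W, h.teq_trans (h'.at_sort hs h.term_of_termEq.2)⟩

theorem TEq.term (hs : Shaped Ax) {Z : PreCtx A} {e e' : Expr A} {W : SortE A}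
    (h : TEq Ax Z e e') (he : Derivable Ax (.term Z e W)) : Derivable Ax (.term Z e' W) :=
  (h.at_sort hs he).term_of_termEq.2

theorem MorF.morEqF (hs : Shaped Ax) {X Y : PreCtx A} (hX : Derivable Ax (.ctx X))
    (hY : Derivable Ax (.ctx Y)) {σ τ : A.Var → Expr A} (hσ : MorF Ax Y X σ)
    (h : ∀ p ∈ X, TEq Ax Y (σ p.1) (τ p.1)) : MorEqF Ax Y X σ τ := by
  refine ⟨hσ, ?_, fun p hp => (h p hp).at_sort hs (hσ p hp)⟩
  have key : ∀ k, MorF Ax Y (X.take k) τ := by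
    intro k
    induction k with
    | zero => intro p hp; simp at hp
    | succ k ih =>
      intro p hp
      obtain ⟨i, hi, hik, rfl⟩ := mem_take_iff_lt.1 hp
      rcases Nat.lt_succ_iff_lt_or_eq.1 hik with hik | rfl
      · exact ih _ (mem_take_iff_lt.2 ⟨i, hi, hik, rfl⟩)
      · have h1 := (hX.ctx_data.1 i hi).substEq hs hY (σ := σ) (τ := τ)
          ⟨hσ.of_subset fun p => List.mem_of_mem_take, ih,
            fun p hp => (h p (List.mem_of_mem_take hp)).at_sort hs
              (hσ p (List.mem_of_mem_take hp))⟩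
        exact Derivable.conv h1 ((h _ (List.getElem_mem hi)).term hs (hσ _ (List.getElem_mem hi)))
  intro p hp
  exact key X.length p (by simpa using hp)

theorem TEq.app_congr (hs : Shaped Ax) {Z : PreCtx A} {t : A.TermSym} {es es' : List (Expr A)}
    {W : SortE A} (h : Derivable Ax (.term Z (.app t es) W))
    (hes : List.Forall₂ (TEq Ax Z) es es') : TEq Ax Z (.app t es) (.app t es') := by
  obtain ⟨X, V, σ, e1, e2, rfl, e4, e5⟩ := h.app_inv hs
  have hX := e2.ctx_of_term
  have hlen : es'.length = X.length := by simpa using hes.length_eq.symm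
  rw [eq_map_lookupV hX.nodup hlen] at hes ⊢
  rw [List.forall₂_map_left_iff, List.forall₂_map_right_iff, List.forall₂_same] at hes
  have hm := e4.morEqF hs hX h.ctx_of_term (τ := lookupV (mkSub X es')) hes
  have := e2.substEq hs h.ctx_of_term (J := introTerm X t V) hm
  simp only [introTerm, Judg.SubstEq, Expr.subst_app, ctxVars_subst] at this
  exact ⟨_, this⟩

theorem Derivable.sort_congr (hs : Shaped Ax) {Z : PreCtx A} {S : A.SortSym}
    {es es' : List (Expr A)} (h : Derivable Ax (.sort Z ⟨S, es⟩))
    (hes : List.Forall₂ (TEq Ax Z) es es') : Derivable Ax (.sortEq Z ⟨S, es⟩ ⟨S, es'⟩) := by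
  obtain ⟨X, σ, e1, e2, e3, e4⟩ := h.sort_inv hs
  simp only at e1 e2 e3
  subst e3
  have hX := e2.ctx_of_sort
  have hlen : es'.length = X.length := by simpa using hes.length_eq.symm
  rw [eq_map_lookupV hX.nodup hlen] at hes ⊢
  rw [List.forall₂_map_left_iff, List.forall₂_map_right_iff, List.forall₂_same] at hes
  have hm := e4.morEqF hs hX h.ctx_of_sort (τ := lookupV (mkSub X es')) hes
  have := e2.substEq hs h.ctx_of_sort (J := introSort X S) hm
  simpa only [introSort, Judg.SubstEq, SortE.subst, ctxVars_subst] using this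

theorem Derivable.app_args (hs : Shaped Ax) {Z : PreCtx A} {t : A.TermSym} {es : List (Expr A)}
    {W : SortE A} (h : Derivable Ax (.term Z (.app t es) W)) : ∀ e ∈ es, TEq Ax Z e e := by
  obtain ⟨X, V, σ, e1, e2, rfl, e4, e5⟩ := h.app_inv hs
  intro e he
  obtain ⟨p, hp, rfl⟩ := List.mem_map.1 he
  exact ⟨_, (e4 p hp).teq_refl⟩

theorem Derivable.sort_args (hs : Shaped Ax) {Z : PreCtx A} {U : SortE A}
    (h : Derivable Ax (.sort Z U)) : ∀ e ∈ U.args, TEq Ax Z e e := by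
  obtain ⟨X, σ, e1, e2, e3, e4⟩ := h.sort_inv hs
  intro e he
  rw [e3] at he
  obtain ⟨p, hp, rfl⟩ := List.mem_map.1 he
  exact ⟨_, (e4 p hp).teq_refl⟩

end

section

variable {Ax : Set (Judg A)}

/-! ## A stratified presentation of the non-context judgments -/

/-- Derivability with heights, in terms of functional substitutions and without context
judgments. -/
inductive HD (Ax : Set (Judg A)) : ℕ → Judg A → Prop where
  | lift {n : ℕ} {J : Judg A} (h : HD Ax n J) : HD Ax (n + 1) J
  | s1 {n : ℕ} {X : PreCtx A} {U : SortE A} (h : HD Ax n (.sort X U)) :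
      HD Ax (n + 1) (.sortEq X U U)
  | s2 {n : ℕ} {X : PreCtx A} {U V : SortE A} (h : HD Ax n (.sortEq X U V)) :
      HD Ax (n + 1) (.sortEq X V U)
  | s3 {n : ℕ} {X : PreCtx A} {U V W : SortE A} (h : HD Ax n (.sortEq X U V))
      (h' : HD Ax n (.sortEq X V W)) : HD Ax (n + 1) (.sortEq X U W)
  | t1 {n : ℕ} {X : PreCtx A} {u : Expr A} {U : SortE A} (h : HD Ax n (.term X u U)) :
      HD Ax (n + 1) (.termEq X u u U)
  | t2 {n : ℕ} {X : PreCtx A} {u v : Expr A} {U : SortE A} (h : HD Ax n (.termEq X u v U)) :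
      HD Ax (n + 1) (.termEq X v u U)
  | t3 {n : ℕ} {X : PreCtx A} {u v w : Expr A} {U : SortE A} (h : HD Ax n (.termEq X u v U))
      (h' : HD Ax n (.termEq X v w U)) : HD Ax (n + 1) (.termEq X u w U)
  | conv {n : ℕ} {X : PreCtx A} {u : Expr A} {U U' : SortE A} (h : HD Ax n (.sortEq X U U'))
      (h' : HD Ax n (.term X u U)) : HD Ax (n + 1) (.term X u U')
  | convEq {n : ℕ} {X : PreCtx A} {u u' : Expr A} {U U' : SortE A}
      (h : HD Ax n (.sortEq X U U')) (h1 : HD Ax n (.termEq X u u' U))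
      (h2 : HD Ax n (.term X u U')) (h3 : HD Ax n (.term X u' U')) :
      HD Ax (n + 1) (.termEq X u u' U')
  | var {n : ℕ} {X : PreCtx A} {p : A.Var × SortE A} (hp : p ∈ X)
      (h : HD Ax n (.sort X p.2)) : HD Ax (n + 1) (.term X (.var p.1) p.2)
  | sort {n : ℕ} {X Xs : PreCtx A} {S : A.SortSym} {φ : A.Var → Expr A}
      (hax : introSort Xs S ∈ Ax)
      (hX : ∀ i (hi : i < Xs.length), HD Ax n (.sort (Xs.take i) (Xs[i]'hi).2))
      (hv : ∀ p ∈ Xs, HD Ax n (.term Xs (.var p.1) p.2))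
      (hφ : ∀ p ∈ Xs, HD Ax n (.term X (φ p.1) (p.2.subst φ))) :
      HD Ax (n + 1) (.sort X ⟨S, Xs.map fun p => φ p.1⟩)
  | app {n : ℕ} {X Xs : PreCtx A} {t : A.TermSym} {U : SortE A} {φ : A.Var → Expr A}
      (hax : introTerm Xs t U ∈ Ax)
      (hX : ∀ i (hi : i < Xs.length), HD Ax n (.sort (Xs.take i) (Xs[i]'hi).2))
      (hv : ∀ p ∈ Xs, HD Ax n (.term Xs (.var p.1) p.2))
      (hU : HD Ax n (.sort Xs U))
      (hφ : ∀ p ∈ Xs, HD Ax n (.term X (φ p.1) (p.2.subst φ)))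
      (hUφ : HD Ax n (.sort X (U.subst φ))) :
      HD Ax (n + 1) (.term X (.app t (Xs.map fun p => φ p.1)) (U.subst φ))
  | sortAx {n : ℕ} {X Xs : PreCtx A} {U U' : SortE A} {φ : A.Var → Expr A}
      (hax : Judg.sortEq Xs U U' ∈ Ax)
      (hX : ∀ i (hi : i < Xs.length), HD Ax n (.sort (Xs.take i) (Xs[i]'hi).2))
      (hU : HD Ax n (.sort Xs U)) (hU' : HD Ax n (.sort Xs U'))
      (hv : ∀ p ∈ Xs, HD Ax n (.term Xs (.var p.1) p.2))
      (hφ : ∀ p ∈ Xs, HD Ax n (.term X (φ p.1) (p.2.subst φ)))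
      (hUφ : HD Ax n (.sort X (U.subst φ))) (hUφ' : HD Ax n (.sort X (U'.subst φ))) :
      HD Ax (n + 1) (.sortEq X (U.subst φ) (U'.subst φ))
  | termAx {n : ℕ} {X Xs : PreCtx A} {u u' : Expr A} {U : SortE A} {φ : A.Var → Expr A}
      (hax : Judg.termEq Xs u u' U ∈ Ax)
      (hX : ∀ i (hi : i < Xs.length), HD Ax n (.sort (Xs.take i) (Xs[i]'hi).2))
      (hu : HD Ax n (.term Xs u U)) (hu' : HD Ax n (.term Xs u' U))
      (hv : ∀ p ∈ Xs, HD Ax n (.term Xs (.var p.1) p.2))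
      (hφ : ∀ p ∈ Xs, HD Ax n (.term X (φ p.1) (p.2.subst φ)))
      (huφ : HD Ax n (.term X (u.subst φ) (U.subst φ)))
      (huφ' : HD Ax n (.term X (u'.subst φ) (U.subst φ))) :
      HD Ax (n + 1) (.termEq X (u.subst φ) (u'.subst φ) (U.subst φ))
  | sortCong {n : ℕ} {X Xs : PreCtx A} {S : A.SortSym} {φ ψ : A.Var → Expr A}
      (hax : introSort Xs S ∈ Ax)
      (h1 : HD Ax n (.sort X ⟨S, Xs.map fun p => φ p.1⟩))
      (h2 : HD Ax n (.sort X ⟨S, Xs.map fun p => ψ p.1⟩))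
      (hφ : ∀ p ∈ Xs, HD Ax n (.termEq X (φ p.1) (ψ p.1) (p.2.subst φ))) :
      HD Ax (n + 1) (.sortEq X ⟨S, Xs.map fun p => φ p.1⟩ ⟨S, Xs.map fun p => ψ p.1⟩)
  | termCong {n : ℕ} {X Xs : PreCtx A} {t : A.TermSym} {U : SortE A} {φ ψ : A.Var → Expr A}
      (hax : introTerm Xs t U ∈ Ax)
      (h1 : HD Ax n (.term X (.app t (Xs.map fun p => φ p.1)) (U.subst φ)))
      (h2 : HD Ax n (.term X (.app t (Xs.map fun p => ψ p.1)) (U.subst φ)))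
      (hφ : ∀ p ∈ Xs, HD Ax n (.termEq X (φ p.1) (ψ p.1) (p.2.subst φ))) :
      HD Ax (n + 1) (.termEq X (.app t (Xs.map fun p => φ p.1))
        (.app t (Xs.map fun p => ψ p.1)) (U.subst φ))

theorem HD.mono {m n : ℕ} (h : m ≤ n) {J : Judg A} (hJ : HD Ax m J) : HD Ax n J := by
  induction n, h using Nat.le_induction with
  | base => exact hJ
  | succ n _ ih => exact ih.lift

theorem HD.presup {n : ℕ} {J : Judg A} (h : HD Ax n J) :
    match J with
    | .ctx _ => False
    | .sort X U => SScoped X U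
    | .term X u U => HD Ax n (.sort X U) ∧ Scoped X u
    | .sortEq X U V => HD Ax n (.sort X U) ∧ HD Ax n (.sort X V)
    | .termEq X u v U => HD Ax n (.term X u U) ∧ HD Ax n (.term X v U) := by
  induction h with
  | lift h ih =>
    rename_i J
    cases J with
    | ctx => exact ih
    | sort => exact ih
    | term => exact ⟨ih.1.lift, ih.2⟩
    | sortEq => exact ⟨ih.1.lift, ih.2.lift⟩
    | termEq => exact ⟨ih.1.lift, ih.2.lift⟩
  | s1 h => exact ⟨h.lift, h.lift⟩
  | s2 h ih => exact ⟨ih.2.lift, ih.1.lift⟩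
  | s3 _ _ ih ih' => exact ⟨ih.1.lift, ih'.2.lift⟩
  | t1 h => exact ⟨h.lift, h.lift⟩
  | t2 h ih => exact ⟨ih.2.lift, ih.1.lift⟩
  | t3 _ _ ih ih' => exact ⟨ih.1.lift, ih'.2.lift⟩
  | conv _ _ ih ih' => exact ⟨ih.2.lift, ih'.2⟩
  | convEq _ _ h2 h3 => exact ⟨h2.lift, h3.lift⟩
  | var hp h =>
    exact ⟨h.lift, fun v hv => by rw [occurs_var_iff.1 hv]; exact List.mem_map_of_mem hp⟩
  | sort hax hX hv hφ _ _ ih =>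
    rintro v ⟨e, he, hv⟩
    obtain ⟨p, hp, rfl⟩ := List.mem_map.1 he
    exact (ih p hp).2 v hv
  | app hax hX hv hU hφ hUφ _ _ _ ih =>
    refine ⟨hUφ.lift, fun v hv => ?_⟩
    obtain ⟨e, he, hv⟩ := occurs_app_iff.1 hv
    obtain ⟨p, hp, rfl⟩ := List.mem_map.1 he
    exact (ih p hp).2 v hv
  | sortAx _ _ _ _ _ _ h h' => exact ⟨h.lift, h'.lift⟩
  | termAx _ _ _ _ _ _ h h' => exact ⟨h.lift, h'.lift⟩
  | sortCong _ h h' => exact ⟨h.lift, h'.lift⟩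
  | termCong _ h h' => exact ⟨h.lift, h'.lift⟩

section

variable {n : ℕ} {X : PreCtx A} {u v : Expr A} {U V : SortE A}

theorem HD.sscoped (h : HD Ax n (.sort X U)) : SScoped X U := h.presup

theorem HD.scoped (h : HD Ax n (.term X u U)) : Scoped X u := h.presup.2

theorem HD.sort_of_term (h : HD Ax n (.term X u U)) : HD Ax n (.sort X U) := h.presup.1

theorem HD.sort_of_sortEq (h : HD Ax n (.sortEq X U V)) :
    HD Ax n (.sort X U) ∧ HD Ax n (.sort X V) := h.presup

theorem HD.term_of_termEq (h : HD Ax n (.termEq X u v U)) :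
    HD Ax n (.term X u U) ∧ HD Ax n (.term X v U) := h.presup

theorem HD.sort_inv {n : ℕ} {X : PreCtx A} {U : SortE A} (h : HD Ax n (.sort X U)) :
    ∃ m Xs, ∃ φ : A.Var → Expr A, n = m + 1 ∧ introSort Xs U.head ∈ Ax ∧
      (∀ i (hi : i < Xs.length), HD Ax m (.sort (Xs.take i) (Xs[i]'hi).2)) ∧
      (∀ p ∈ Xs, HD Ax m (.term Xs (.var p.1) p.2)) ∧
      (∀ p ∈ Xs, HD Ax m (.term X (φ p.1) (p.2.subst φ))) ∧
      U = ⟨U.head, Xs.map fun p => φ p.1⟩ := by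
  generalize hJ : Judg.sort X U = J at h
  induction h with
  | lift h ih =>
    obtain ⟨m, Xs, φ, rfl, h1, h2, h3, h4, h5⟩ := ih hJ
    exact ⟨_, Xs, φ, rfl, h1, fun i hi => (h2 i hi).lift, fun p hp => (h3 p hp).lift,
      fun p hp => (h4 p hp).lift, h5⟩
  | sort hax hX hv hφ => cases hJ; exact ⟨_, _, _, rfl, hax, hX, hv, hφ, rfl⟩
  | _ => cases hJ

theorem HD.app_inv {n : ℕ} {X : PreCtx A} {t : A.TermSym} {es : List (Expr A)} {W : SortE A}
    (h : HD Ax n (.term X (.app t es) W)) :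
    ∃ m Xs U, ∃ φ : A.Var → Expr A, n = m + 1 ∧ introTerm Xs t U ∈ Ax ∧
      (∀ i (hi : i < Xs.length), HD Ax m (.sort (Xs.take i) (Xs[i]'hi).2)) ∧
      (∀ p ∈ Xs, HD Ax m (.term Xs (.var p.1) p.2)) ∧ HD Ax m (.sort Xs U) ∧
      (∀ p ∈ Xs, HD Ax m (.term X (φ p.1) (p.2.subst φ))) ∧
      es = Xs.map fun p => φ p.1 := by
  generalize hJ : Judg.term X (.app t es) W = J at h
  induction h generalizing W with
  | lift h ih =>
    obtain ⟨m, Xs, U, φ, rfl, h1, h2, h3, h4, h5, h6⟩ := ih hJ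
    exact ⟨_, Xs, U, φ, rfl, h1, fun i hi => (h2 i hi).lift, fun p hp => (h3 p hp).lift,
      h4.lift, fun p hp => (h5 p hp).lift, h6⟩
  | conv h h' _ ih =>
    cases hJ
    obtain ⟨m, Xs, U, φ, rfl, h1, h2, h3, h4, h5, h6⟩ := ih rfl
    exact ⟨_, Xs, U, φ, rfl, h1, fun i hi => (h2 i hi).lift, fun p hp => (h3 p hp).lift,
      h4.lift, fun p hp => (h5 p hp).lift, h6⟩
  | app hax hX hv hU hφ hUφ => cases hJ; exact ⟨_, _, _, _, rfl, hax, hX, hv, hU, hφ, rfl⟩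
  | _ => cases hJ

end

/-- A context all of whose sorts have height `n`. -/
structure HCtx (Ax : Set (Judg A)) (n : ℕ) (X : PreCtx A) : Prop where
  nodup : (keys X).Nodup
  isPreCtx : IsPreCtx X
  sort : ∀ i (hi : i < X.length), HD Ax n (.sort (X.take i) (X[i]'hi).2)

theorem IsPreCtx.take {X : PreCtx A} (h : IsPreCtx X) (k : ℕ) : IsPreCtx (X.take k) := by
  intro i hi v hv
  simp only [List.length_take, lt_min_iff] at hi
  rw [List.getElem_take] at hv
  have := h i hi.2 v hv
  rwa [List.take_take, min_eq_left hi.1.le]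

theorem HCtx.take {n : ℕ} {X : PreCtx A} (h : HCtx Ax n X) (k : ℕ) : HCtx Ax n (X.take k) where
  nodup := keys_nodup_take h.nodup k
  isPreCtx := h.isPreCtx.take k
  sort i hi := by
    simp only [List.length_take, lt_min_iff] at hi
    have := h.sort i hi.2
    rwa [List.getElem_take, List.take_take, min_eq_left hi.1.le]

/-- Every sort of a precontext only uses its variables. -/
theorem IsPreCtx.sscoped {X : PreCtx A} (h : IsPreCtx X) : ∀ p ∈ X, SScoped X p.2 := by
  intro p hp v hv
  obtain ⟨i, hi, rfl⟩ := List.getElem_of_mem hp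
  obtain ⟨q, hq, rfl⟩ := List.mem_map.1 (h i hi v hv)
  exact List.mem_map_of_mem (List.mem_of_mem_take hq)

/-! ### Existence of heights -/

theorem eventually_HD {J : Judg A} (h : ∃ n, HD Ax n J) : ∀ᶠ n in Filter.atTop, HD Ax n J := by
  obtain ⟨m, hm⟩ := h
  filter_upwards [Filter.eventually_ge_atTop m] with n hn using hm.mono hn

theorem eventually_forall_mem {α : Type*} {l : List α} {P : α → ℕ → Prop}
    (h : ∀ a ∈ l, ∀ᶠ n in Filter.atTop, P a n) :
    ∀ᶠ n in Filter.atTop, ∀ a ∈ l, P a n := by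
  have : ∀ᶠ n in Filter.atTop, ∀ i : Fin l.length, P (l.get i) n :=
    Filter.eventually_all.2 fun i => h _ (List.get_mem l i)
  filter_upwards [this] with n hn a ha
  obtain ⟨i, rfl⟩ := List.get_of_mem ha
  exact hn i

theorem HD.weaken {n : ℕ} {J : Judg A} (h : HD Ax n J) {Y : PreCtx A}
    (hY : ∀ p ∈ J.ctxOf, p ∈ Y) :
    match J with
    | .ctx _ => False
    | .sort _ U => HD Ax n (.sort Y U)
    | .term _ u U => HD Ax n (.term Y u U)
    | .sortEq _ U V => HD Ax n (.sortEq Y U V)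
    | .termEq _ u v U => HD Ax n (.termEq Y u v U) := by
  induction h with
  | lift h ih =>
    rename_i J
    cases J with
    | ctx => exact ih hY
    | _ => exact (ih hY).lift
  | s1 _ ih => exact .s1 (ih hY)
  | s2 _ ih => exact .s2 (ih hY)
  | s3 _ _ ih ih' => exact .s3 (ih hY) (ih' hY)
  | t1 _ ih => exact .t1 (ih hY)
  | t2 _ ih => exact .t2 (ih hY)
  | t3 _ _ ih ih' => exact .t3 (ih hY) (ih' hY)
  | conv _ _ ih ih' => exact .conv (ih hY) (ih' hY)
  | convEq _ _ _ _ i1 i2 i3 i4 => exact .convEq (i1 hY) (i2 hY) (i3 hY) (i4 hY)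
  | var hp _ ih => exact .var (hY _ hp) (ih hY)
  | sort hax hX hv _ _ _ ih => exact .sort hax hX hv fun p hp => ih p hp hY
  | app hax hX hv hU _ _ _ _ _ ih ih' => exact .app hax hX hv hU (fun p hp => ih p hp hY) (ih' hY)
  | sortAx hax hX hU hU' hv _ _ _ _ _ _ _ ih i1 i2 =>
    exact .sortAx hax hX hU hU' hv (fun p hp => ih p hp hY) (i1 hY) (i2 hY)
  | termAx hax hX hU hU' hv _ _ _ _ _ _ _ ih i1 i2 =>
    exact .termAx hax hX hU hU' hv (fun p hp => ih p hp hY) (i1 hY) (i2 hY)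
  | sortCong hax _ _ _ i1 i2 ih => exact .sortCong hax (i1 hY) (i2 hY) fun p hp => ih p hp hY
  | termCong hax _ _ _ i1 i2 ih => exact .termCong hax (i1 hY) (i2 hY) fun p hp => ih p hp hY

theorem HD.var_of_forall {n : ℕ} {X : PreCtx A}
    (h : ∀ i (hi : i < X.length), HD Ax n (.sort (X.take i) (X[i]'hi).2)) :
    ∀ p ∈ X, HD Ax (n + 1) (.term X (.var p.1) p.2) := by
  intro p hp
  obtain ⟨i, hi, rfl⟩ := List.getElem_of_mem hp
  exact .var hp ((h i hi).weaken fun q hq => List.mem_of_mem_take hq)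

theorem DerAt.sort_of_sortEq' {n : ℕ} {X : PreCtx A} {U V : SortE A}
    (h : DerAt Ax n (.sortEq X U V)) : DerAt Ax n (.sort X U) ∧ DerAt Ax n (.sort X V) := by
  cases n with
  | zero => exact h.elim
  | succ n => exact h.sort_of_sortEq.imp (.mono (Nat.le_succ n)) (.mono (Nat.le_succ n))

theorem DerAt.term_of_termEq' {n : ℕ} {X : PreCtx A} {u v : Expr A} {U : SortE A}
    (h : DerAt Ax n (.termEq X u v U)) : DerAt Ax n (.term X u U) ∧ DerAt Ax n (.term X v U) := by
  cases n with
  | zero => exact h.elim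
  | succ n => exact h.term_of_termEq.imp (.mono (Nat.le_succ n)) (.mono (Nat.le_succ n))

theorem HD.exists_of_derAt (hA : IsGAT Ax) : ∀ k, ∀ J, DerAt Ax k J →
    match J with
    | .ctx X => ∀ i (hi : i < X.length), ∃ n, HD Ax n (.sort (X.take i) (X[i]'hi).2)
    | J => ∃ n, HD Ax n J := by
  have hs := hA.shaped
  intro k
  induction k using Nat.strong_induction_on with
  | _ k ih =>
  intro J hJ
  have args : ∀ {k' : ℕ} {X Y : PreCtx A} {f : List (Expr A)}, k' < k → DerAt Ax k' (.ctx X) →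
      f.length = X.length →
      (∀ i (hi : i < X.length) (hif : i < f.length), DerAt Ax k' (.term Y (f[i]'hif) (subPre X f i hi))) →
      ∀ᶠ n in Filter.atTop, ∀ p ∈ X, HD Ax n
        (.term Y (lookupV (mkSub X f) p.1) (p.2.subst (lookupV (mkSub X f)))) := by
    intro k' X Y f hk hX hlen h
    refine eventually_forall_mem fun p hp => ?_
    obtain ⟨i, hi, rfl⟩ := List.getElem_of_mem hp
    have hd := hX.derivable
    have := ih k' hk _ (h i hi (hlen ▸ hi))
    rw [subPre_eq_substL hd.isPreCtx hlen, ← lookupV_mkSub_getElem hd.nodup hlen hi] at this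
    exact eventually_HD this
  have argsEq : ∀ {k' : ℕ} {X Y : PreCtx A} {f g : List (Expr A)}, k' < k →
      DerAt Ax k' (.ctx X) → f.length = X.length → g.length = X.length →
      (∀ i (hi : i < X.length) (hif : i < f.length) (hig : i < g.length),
        DerAt Ax k' (.termEq Y (f[i]'hif) (g[i]'hig) (subPre X f i hi))) →
      ∀ᶠ n in Filter.atTop, ∀ p ∈ X, HD Ax n
        (.termEq Y (lookupV (mkSub X f) p.1) (lookupV (mkSub X g) p.1)
          (p.2.subst (lookupV (mkSub X f)))) := by
    intro k' X Y f g hk hX hlen hlen' h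
    refine eventually_forall_mem fun p hp => ?_
    obtain ⟨i, hi, rfl⟩ := List.getElem_of_mem hp
    have hd := hX.derivable
    have := ih k' hk _ (h i hi (hlen ▸ hi) (hlen' ▸ hi))
    rw [subPre_eq_substL hd.isPreCtx hlen, ← lookupV_mkSub_getElem hd.nodup hlen hi,
      ← lookupV_mkSub_getElem hd.nodup hlen' hi] at this
    exact eventually_HD this
  have ctx : ∀ {k' : ℕ} {X : PreCtx A}, k' < k → DerAt Ax k' (.ctx X) →
      ∀ᶠ n in Filter.atTop, ∀ i (hi : i < X.length), HD Ax n (.sort (X.take i) (X[i]'hi).2) :=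
    fun hk hX => eventually_forall_lt fun i hi => eventually_HD (ih _ hk _ hX i hi)
  have vars : ∀ {k' : ℕ} {X : PreCtx A}, k' < k →
      (∀ i (hi : i < X.length), DerAt Ax k' (.term X (.var (X[i]'hi).1) (X[i]'hi).2)) →
      ∀ᶠ n in Filter.atTop, ∀ p ∈ X, HD Ax n (.term X (.var p.1) p.2) := by
    intro k' X hk h
    refine eventually_forall_mem fun p hp => ?_
    obtain ⟨i, hi, rfl⟩ := List.getElem_of_mem hp
    exact eventually_HD (ih k' hk _ (h i hi))
  cases k with
  | zero => exact hJ.elim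
  | succ k =>
  have hk := Nat.lt_succ_self k
  rcases hJ with hJ | hJ
  · exact ih k hk J hJ
  cases hJ with
  | ctx_nil => intro i hi; simp at hi
  | @ctx_cons X U x hs' hf hp =>
    intro i hi
    simp only [List.length_append, List.length_singleton] at hi
    rcases Nat.lt_succ_iff_lt_or_eq.1 hi with hi' | rfl
    · rw [List.take_append_of_le_length hi'.le]
      simp only [List.getElem_append_left hi']
      exact ih k hk _ hs'.ctx_of_sort' i hi'
    · simpa using ih k hk _ hs'
  | s1 h => obtain ⟨n, h⟩ := ih k hk _ h; exact ⟨_, .s1 h⟩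
  | s2 h => obtain ⟨n, h⟩ := ih k hk _ h; exact ⟨_, .s2 h⟩
  | s3 h h' =>
    obtain ⟨n, h, h'⟩ := ((eventually_HD (ih k hk _ h)).and (eventually_HD (ih k hk _ h'))).exists
    exact ⟨_, .s3 h h'⟩
  | t1 h => obtain ⟨n, h⟩ := ih k hk _ h; exact ⟨_, .t1 h⟩
  | t2 h => obtain ⟨n, h⟩ := ih k hk _ h; exact ⟨_, .t2 h⟩
  | t3 h h' =>
    obtain ⟨n, h, h'⟩ := ((eventually_HD (ih k hk _ h)).and (eventually_HD (ih k hk _ h'))).exists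
    exact ⟨_, .t3 h h'⟩
  | seqt h h' =>
    obtain ⟨n, h, h'⟩ := ((eventually_HD (ih k hk _ h)).and (eventually_HD (ih k hk _ h'))).exists
    exact ⟨_, .conv h h'⟩
  | seqteq h1 h2 h3 h4 =>
    obtain ⟨n, h1, h2, h3, h4⟩ := ((eventually_HD (ih k hk _ h1)).and
      ((eventually_HD (ih k hk _ h2)).and ((eventually_HD (ih k hk _ h3)).and
        (eventually_HD (ih k hk _ h4))))).exists
    exact ⟨_, .convEq h1 h2 h3 h4⟩
  | var hi h => obtain ⟨n, h⟩ := ih k hk _ h; exact ⟨_, .var (List.getElem_mem hi) h⟩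
  | @sA X U hax h hv =>
    obtain ⟨h1, h2⟩ := hs.sort_mem_spec hax
    obtain ⟨n, h3, h4⟩ := ((ctx hk h).and (vars hk hv)).exists
    have := HD.sort (φ := Expr.var) h1 h3 h4 (X := X) fun p hp => by
      rw [SortE.subst_id]; exact h4 p hp
    rw [h2]
    exact ⟨_, this⟩
  | @tA X u U hax h hv =>
    obtain ⟨t, h1, rfl⟩ := hs.term_mem_spec hax
    obtain ⟨n, h2, h3, h4⟩ := ((eventually_HD (ih k hk _ h)).and
      ((ctx hk h.ctx_of_sort').and (vars hk hv))).exists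
    have := HD.app (φ := Expr.var) h1 h3 h4 h2 (X := X) (fun p hp => by
      rw [SortE.subst_id]; exact h4 p hp) (by rwa [SortE.subst_id])
    rw [SortE.subst_id] at this
    exact ⟨_, this⟩
  | seqA hax h1 h2 =>
    obtain ⟨n, h1', h2', h3⟩ := ((eventually_HD (ih k hk _ h1)).and
      ((eventually_HD (ih k hk _ h2)).and (ctx hk h1.ctx_of_sort'))).exists
    have := HD.sortAx (φ := Expr.var) hax (fun i hi => (h3 i hi).lift) h1'.lift h2'.lift
      (HD.var_of_forall h3)
      (fun p hp => by rw [SortE.subst_id]; exact HD.var_of_forall h3 p hp)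
      (by rw [SortE.subst_id]; exact h1'.lift) (by rw [SortE.subst_id]; exact h2'.lift)
    rw [SortE.subst_id, SortE.subst_id] at this
    exact ⟨_, this⟩
  | teqA hax h1 h2 =>
    obtain ⟨n, h1', h2', h3⟩ := ((eventually_HD (ih k hk _ h1)).and
      ((eventually_HD (ih k hk _ h2)).and (ctx hk h1.sort_of_term'.ctx_of_sort'))).exists
    have := HD.termAx (φ := Expr.var) hax (fun i hi => (h3 i hi).lift) h1'.lift h2'.lift
      (HD.var_of_forall h3)
      (fun p hp => by rw [SortE.subst_id]; exact HD.var_of_forall h3 p hp)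
      (by rw [SortE.subst_id, Expr.subst_id]; exact h1'.lift)
      (by rw [SortE.subst_id, Expr.subst_id]; exact h2'.lift)
    rw [SortE.subst_id, Expr.subst_id, Expr.subst_id] at this
    exact ⟨_, this⟩
  | @sSub X S hax Y hY f hlen hJ hYc hargs =>
    obtain ⟨n, h⟩ := ih k hk _ hJ
    obtain ⟨m, Xs, φ, rfl, e1, e2, e3, e4, e5⟩ := h.sort_inv
    obtain rfl := hs.sort_unique hax e1
    obtain ⟨n, h1, h2, h3⟩ := ((args hk hJ.ctx_of_sort' hlen hargs).and
      ((eventually_forall_lt fun i hi => eventually_HD ⟨_, e2 i hi⟩).and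
        (eventually_forall_mem fun p hp => eventually_HD ⟨_, e3 p hp⟩))).exists
    have := HD.sort hax h2 h3 h1
    rw [← eq_map_lookupV hJ.derivable.ctx_of_sort.nodup hlen] at this
    exact ⟨_, this⟩
  | @tSub X t U hax Y hY f hlen hJ hU hargs =>
    obtain ⟨n, h⟩ := ih k hk _ hJ
    obtain ⟨m, Xs, V, φ, rfl, e1, e2, e3, e4, e5, e6⟩ := h.app_inv
    obtain ⟨rfl, rfl⟩ := hs.term_unique hax e1
    have hX := hJ.sort_of_term'.ctx_of_sort'
    obtain ⟨n, h1, h2, h3, h4, h5⟩ := ((args hk hX hlen hargs).and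
      ((eventually_forall_lt fun i hi => eventually_HD ⟨_, e2 i hi⟩).and
        ((eventually_forall_mem fun p hp => eventually_HD ⟨_, e3 p hp⟩).and
          ((eventually_HD ⟨_, e4⟩).and (eventually_HD (ih k hk _ hU)))))).exists
    have := HD.app hax h2 h3 h4 h1 h5
    rw [← eq_map_lookupV hX.derivable.nodup hlen] at this
    exact ⟨_, this⟩
  | @seqSub1 X U U' hax Y hY f hlen hJ h1 h2 hargs =>
    have hX := hJ.sort_of_sortEq'.1.ctx_of_sort'
    obtain ⟨n, h1, h2, h3, h4, h5⟩ := ((eventually_HD (ih k hk _ h1)).and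
      ((eventually_HD (ih k hk _ h2)).and ((args hk hX hlen hargs).and ((ctx hk hX).and
        (eventually_HD (ih k hk _ hJ)))))).exists
    exact ⟨_, .sortAx hax (fun i hi => (h4 i hi).lift) h5.sort_of_sortEq.1.lift
      h5.sort_of_sortEq.2.lift (HD.var_of_forall h4) (fun p hp => (h3 p hp).lift) h1.lift h2.lift⟩
  | @seqSub2 X S hax Y hY f g hlf hlg hJ h1 h2 hargs =>
    have hX := hJ.ctx_of_sort'
    obtain ⟨n, h1, h2, h3⟩ := ((eventually_HD (ih k hk _ h1)).and
      ((eventually_HD (ih k hk _ h2)).and (argsEq hk hX hlf hlg hargs))).exists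
    have ef := eq_map_lookupV hX.derivable.nodup hlf
    have eg := eq_map_lookupV hX.derivable.nodup hlg
    rw [ef] at h1
    rw [eg] at h2
    have := HD.sortCong hax h1 h2 h3
    rw [← ef, ← eg] at this
    exact ⟨_, this⟩
  | @teqSub1 X u u' U hax Y hY f hlen hJ h1 h2 hargs =>
    have hX := hJ.term_of_termEq'.1.sort_of_term'.ctx_of_sort'
    obtain ⟨n, h1, h2, h3, h4, h5⟩ := ((eventually_HD (ih k hk _ h1)).and
      ((eventually_HD (ih k hk _ h2)).and ((args hk hX hlen hargs).and ((ctx hk hX).and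
        (eventually_HD (ih k hk _ hJ)))))).exists
    exact ⟨_, .termAx hax (fun i hi => (h4 i hi).lift) h5.term_of_termEq.1.lift
      h5.term_of_termEq.2.lift (HD.var_of_forall h4) (fun p hp => (h3 p hp).lift) h1.lift h2.lift⟩
  | @teqSub2 X t U hax Y hY f g hlf hlg hJ h1 h2 hargs =>
    have hX := hJ.sort_of_term'.ctx_of_sort'
    obtain ⟨n, h1, h2, h3⟩ := ((eventually_HD (ih k hk _ h1)).and
      ((eventually_HD (ih k hk _ h2)).and (argsEq hk hX hlf hlg hargs))).exists
    have key : ∀ φ ψ : A.Var → Expr A, (f = X.map fun p => φ p.1) → (g = X.map fun p => ψ p.1) →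
        HD Ax n (.term Y (.app t f) (U.subst φ)) → HD Ax n (.term Y (.app t g) (U.subst φ)) →
        (∀ p ∈ X, HD Ax n (.termEq Y (φ p.1) (ψ p.1) (p.2.subst φ))) →
        HD Ax (n + 1) (.termEq Y (.app t f) (.app t g) (U.subst φ)) := by
      intro φ ψ ef eg
      rw [ef, eg]
      exact HD.termCong hax
    exact ⟨_, key _ _ (eq_map_lookupV hX.derivable.nodup hlf)
      (eq_map_lookupV hX.derivable.nodup hlg) h1 h2 h3⟩

theorem IsGAT.exists_HD_sort (hA : IsGAT Ax) {X : PreCtx A} {U : SortE A}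
    (h : Derivable Ax (.sort X U)) : ∃ n, HD Ax n (.sort X U) :=
  h.elim fun k h => HD.exists_of_derAt hA k _ h

theorem IsGAT.exists_HD_term (hA : IsGAT Ax) {X : PreCtx A} {u : Expr A} {U : SortE A}
    (h : Derivable Ax (.term X u U)) : ∃ n, HD Ax n (.term X u U) :=
  h.elim fun k h => HD.exists_of_derAt hA k _ h

theorem IsGAT.eventually_HCtx (hA : IsGAT Ax) {X : PreCtx A} (h : Derivable Ax (.ctx X)) :
    ∀ᶠ n in Filter.atTop, HCtx Ax n X := by
  obtain ⟨k, hk⟩ := h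
  filter_upwards [eventually_forall_lt fun i hi =>
    eventually_HD (HD.exists_of_derAt hA k _ hk i hi)] with n hn
  exact ⟨hk.derivable.nodup, hk.derivable.isPreCtx, hn⟩

end

/-! ## Bilinear models

The tensor operations are studied through an abstract model with an evident symmetry
exchanging the two factors.  A model interprets a pair of a sort (or term) of `A` and a sort
(or term) of `B` relative to an environment, which assigns sorts to the variables of both
sides and an expression to every pair of variables. -/

/-- Environments for the interpretation of pairs. -/
structure Nv (A B : Alphabet) (E : Type) where
  /-- the sorts of the variables on the left -/
  sA : A.Var → SortE A
  /-- the sorts of the variables on the right -/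
  sB : B.Var → SortE B
  /-- the values of the pairs of variables -/
  ρ : A.Var → B.Var → E

/-- Exchanging the two sides of an environment. -/
def Nv.flip {E : Type} (ε : Nv A B E) : Nv B A E := ⟨ε.sB, ε.sA, fun y x => ε.ρ x y⟩

/-- The operations of a bilinear model. -/
structure Mdl (A B : Alphabet) (Ex So W : Type) where
  /-- the sort attached to two sort symbols -/
  mkSS : A.SortSym → B.SortSym → List (Expr A) → List (Expr B) →
    (Expr A → Expr B → Ex) → (Expr B → Ex) → (Expr A → Ex) → So
  /-- the term attached to a sort symbol and a term symbol -/
  mkSt : A.SortSym → B.TermSym → List (Expr A) → List (Expr B) →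
    (Expr A → Expr B → Ex) → (Expr B → Ex) → Ex
  /-- the term attached to a term symbol and a sort symbol -/
  mkTs : A.TermSym → B.SortSym → List (Expr A) → List (Expr B) →
    (Expr A → Expr B → Ex) → (Expr A → Ex) → Ex
  /-- typing over a world -/
  ty : W → Ex → So → Prop
  /-- equality of terms over a world -/
  eq : W → Ex → Ex → Prop
  /-- equality of sorts over a world -/
  seq : W → So → So → Prop
  /-- the pairing of two terms -/
  I : Nv A B Ex → Expr A → Expr B → Ex
  /-- the pairing of a generic element of a sort with a term -/
  R : Nv A B Ex → SortE A → (B.Var → Ex) → Expr B → Ex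
  /-- the pairing of a term with a generic element of a sort -/
  C : Nv A B Ex → SortE B → (A.Var → Ex) → Expr A → Ex

/-- A sort assignment agrees with a precontext. -/
def Compat (s : A.Var → SortE A) (X : PreCtx A) : Prop := ∀ p ∈ X, s p.1 = p.2

theorem Compat.take {s : A.Var → SortE A} {X : PreCtx A} (h : Compat s X) (k : ℕ) :
    Compat s (X.take k) := fun p hp => h p (List.mem_of_mem_take hp)

namespace Mdl

variable {Ex So W : Type}

/-- Exchanging the two sides of a model. -/
def flip (M : Mdl A B Ex So W) : Mdl B A Ex So W where
  mkSS T S ts ss i r c := M.mkSS S T ss ts (fun s t => i t s) c r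
  mkSt T s ts ss i r := M.mkTs s T ss ts (fun s t => i t s) r
  mkTs t S ts ss i r := M.mkSt S t ss ts (fun s t => i t s) r
  ty := M.ty
  eq := M.eq
  seq := M.seq
  I ε v u := M.I ε.flip u v
  R ε V b u := M.C ε.flip V b u
  C ε U a v := M.R ε.flip U a v

variable (M : Mdl A B Ex So W)

/-- The pairing of a term with the variables on the right. -/
def au (ε : Nv A B Ex) (u : Expr A) (y : B.Var) : Ex := M.C ε (ε.sB y) (fun x => ε.ρ x y) u

/-- The pairing of the variables on the left with a term. -/
def bv (ε : Nv A B Ex) (v : Expr B) (x : A.Var) : Ex := M.R ε (ε.sA x) (ε.ρ x) v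

/-- The sort attached to two sorts and generic elements of them. -/
def T2 (ε : Nv A B Ex) (U : SortE A) (V : SortE B) (a : B.Var → Ex) (b : A.Var → Ex) : So :=
  M.mkSS U.head V.head U.args V.args (M.I ε) (M.R ε U a) (M.C ε V b)

/-- The generic elements of a sort on the left. -/
def Row (w : W) (ε : Nv A B Ex) (U : SortE A) (Y : PreCtx B) (a : B.Var → Ex) : Prop :=
  ∀ q ∈ Y, M.ty w (a q.1) (M.T2 ε U q.2 a fun x => ε.ρ x q.1)

/-- The generic elements of a sort on the right. -/
def Col (w : W) (ε : Nv A B Ex) (V : SortE B) (X : PreCtx A) (b : A.Var → Ex) : Prop :=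
  ∀ p ∈ X, M.ty w (b p.1) (M.T2 ε p.2 V (ε.ρ p.1) b)

/-- Environments over a pair of precontexts. -/
structure Env (w : W) (ε : Nv A B Ex) (X : PreCtx A) (Y : PreCtx B) : Prop where
  cA : Compat ε.sA X
  cB : Compat ε.sB Y
  ty : ∀ p ∈ X, ∀ q ∈ Y,
    M.ty w (ε.ρ p.1 q.1) (M.T2 ε p.2 q.2 (ε.ρ p.1) fun x => ε.ρ x q.1)

/-- The tensor of two sorts over two precontexts is a sort. -/
def SSok (X : PreCtx A) (U : SortE A) (Y : PreCtx B) (V : SortE B) : Prop :=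
  ∀ w ε, M.Env w ε X Y → ∀ a b, M.Row w ε U Y a → M.Col w ε V X b →
    M.seq w (M.T2 ε U V a b) (M.T2 ε U V a b)

/-- The tensor of two precontexts is a context. -/
def Entries (X : PreCtx A) (Y : PreCtx B) : Prop :=
  ∀ i (hi : i < X.length) j (hj : j < Y.length),
    M.SSok (X.take i) (X[i]'hi).2 (Y.take j) (Y[j]'hj).2

/-- The tensor of a precontext and an extended precontext is a context, apart from the tensor
of the last sort with the first precontext. -/
def RowOk (X : PreCtx A) (U : SortE A) (Y : PreCtx B) : Prop :=
  ∀ j (hj : j < Y.length), M.SSok X U (Y.take j) (Y[j]'hj).2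

/-- The mirror image of `RowOk`. -/
def ColOk (X : PreCtx A) (Y : PreCtx B) (V : SortE B) : Prop :=
  ∀ i (hi : i < X.length), M.SSok (X.take i) (X[i]'hi).2 Y V

/-- Compatibility of the terms on the left with the generic elements. -/
structure GoodR (TA : Set (Judg A)) (N : ℕ) (w : W) (ε : Nv A B Ex) (X : PreCtx A)
    (Y : PreCtx B) : Prop where
  row : ∀ {u U}, HD TA N (.term X u U) → M.Row w ε U Y (M.au ε u)
  iff : ∀ {U U'}, HD TA N (.sortEq X U U') → ∀ a, M.Row w ε U Y a ↔ M.Row w ε U' Y a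

/-- Compatibility of the terms on both sides with the generic elements. -/
structure Good (TA : Set (Judg A)) (TB : Set (Judg B)) (N K : ℕ) (w : W) (ε : Nv A B Ex)
    (X : PreCtx A) (Y : PreCtx B) : Prop where
  left : M.GoodR TA N w ε X Y
  right : M.flip.GoodR TB K w ε.flip Y X

/-- One half of the assertion that the tensor is bilinear. -/
structure Half (TA : Set (Judg A)) (TB : Set (Judg B)) (N K : ℕ) (w : W) (ε : Nv A B Ex)
    (X : PreCtx A) (Y : PreCtx B) : Prop where
  st : ∀ {U v V a}, HD TA N (.sort X U) → HD TB K (.term Y v V) → M.Row w ε U Y a →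
    M.ty w (M.R ε U a v) (M.T2 ε U V a (M.bv ε v))
  ssq : ∀ {U V V' a b}, HD TA N (.sort X U) → HD TB K (.sortEq Y V V') → M.Row w ε U Y a →
    M.Col w ε V X b → M.seq w (M.T2 ε U V a b) (M.T2 ε U V' a b)
  stq : ∀ {U v v' V a}, HD TA N (.sort X U) → HD TB K (.termEq Y v v' V) → M.Row w ε U Y a →
    M.eq w (M.R ε U a v) (M.R ε U a v')
  qt : ∀ {U U' v V a}, HD TA N (.sortEq X U U') → HD TB K (.term Y v V) → M.Row w ε U Y a →
    M.eq w (M.R ε U a v) (M.R ε U' a v)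

/-- Both halves. -/
structure Full (TA : Set (Judg A)) (TB : Set (Judg B)) (N K : ℕ) (w : W) (ε : Nv A B Ex)
    (X : PreCtx A) (Y : PreCtx B) : Prop where
  left : M.Half TA TB N K w ε X Y
  right : M.flip.Half TB TA K N w ε.flip Y X
  ss : ∀ {U V a b}, HD TA N (.sort X U) → HD TB K (.sort Y V) → M.Row w ε U Y a →
    M.Col w ε V X b → M.seq w (M.T2 ε U V a b) (M.T2 ε U V a b)
  tt : ∀ {u U v V}, HD TA N (.term X u U) → HD TB K (.term Y v V) →
    M.eq w (M.I ε u v) (M.R ε U (M.au ε u) v)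
  tt' : ∀ {u U v V}, HD TA N (.term X u U) → HD TB K (.term Y v V) →
    M.eq w (M.I ε u v) (M.C ε V (M.bv ε v) u)
  ty : ∀ {u U v V}, HD TA N (.term X u U) → HD TB K (.term Y v V) →
    M.ty w (M.I ε u v) (M.T2 ε U V (M.au ε u) (M.bv ε v))

/-- Bilinearity at given heights. -/
def H (TA : Set (Judg A)) (TB : Set (Judg B)) (N K : ℕ) : Prop :=
  ∀ {w ε X Y}, M.Env w ε X Y → M.Good TA TB N K w ε X Y → M.Full TA TB N K w ε X Y

/-- The laws of a bilinear model which do not depend on the order of the two sides. -/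
structure Laws (TA : Set (Judg A)) (TB : Set (Judg B)) : Prop where
  eq_symm : ∀ {w e e'}, M.eq w e e' → M.eq w e' e
  eq_trans : ∀ {w e e' e''}, M.eq w e e' → M.eq w e' e'' → M.eq w e e''
  seq_symm : ∀ {w s s'}, M.seq w s s' → M.seq w s' s
  seq_trans : ∀ {w s s' s''}, M.seq w s s' → M.seq w s' s'' → M.seq w s s''
  ty_refl : ∀ {w e s}, M.ty w e s → M.eq w e e
  ty_sok : ∀ {w e s}, M.ty w e s → M.seq w s s
  ty_conv : ∀ {w e s s'}, M.ty w e s → M.seq w s s' → M.ty w e s'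
  eq_ty : ∀ {w e e' s}, M.eq w e e' → M.ty w e s → M.ty w e' s
  R_var : ∀ ε U a y, M.R ε U a (.var y) = a y
  R_app : ∀ ε U a t ts, M.R ε U a (.app t ts) = M.mkSt U.head t U.args ts (M.I ε) (M.R ε U a)
  mkSt_cong : ∀ {α β : Type} {w} (S : A.SortSym) (t : B.TermSym) (ks : List α) (ls : List β)
    (f f' : α → Expr A) (g g' : β → Expr B) (i i' : Expr A → Expr B → Ex) (r r' : Expr B → Ex),
    M.eq w (M.mkSt S t (ks.map f) (ls.map g) i r) (M.mkSt S t (ks.map f) (ls.map g) i r) →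
    (∀ k ∈ ks, ∀ l ∈ ls, M.eq w (i (f k) (g l)) (i' (f' k) (g' l))) →
    (∀ l ∈ ls, M.eq w (r (g l)) (r' (g' l))) →
    M.eq w (M.mkSt S t (ks.map f) (ls.map g) i r) (M.mkSt S t (ks.map f') (ls.map g') i' r')
  mkSS_cong : ∀ {α β : Type} {w} (S : A.SortSym) (T : B.SortSym) (ks : List α) (ls : List β)
    (f f' : α → Expr A) (g g' : β → Expr B) (i i' : Expr A → Expr B → Ex) (r r' : Expr B → Ex)
    (c c' : Expr A → Ex),
    M.seq w (M.mkSS S T (ks.map f) (ls.map g) i r c) (M.mkSS S T (ks.map f) (ls.map g) i r c) →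
    (∀ k ∈ ks, ∀ l ∈ ls, M.eq w (i (f k) (g l)) (i' (f' k) (g' l))) →
    (∀ l ∈ ls, M.eq w (r (g l)) (r' (g' l))) → (∀ k ∈ ks, M.eq w (c (f k)) (c' (f' k))) →
    M.seq w (M.mkSS S T (ks.map f) (ls.map g) i r c)
      (M.mkSS S T (ks.map f') (ls.map g') i' r' c')
  mkSt_args : ∀ {w S t ss ts i r}, M.eq w (M.mkSt S t ss ts i r) (M.mkSt S t ss ts i r) →
    (∀ s ∈ ss, ∀ t ∈ ts, M.eq w (i s t) (i s t)) ∧ ∀ t ∈ ts, M.eq w (r t) (r t)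
  mkSS_args : ∀ {w S T ss ts i r c}, M.seq w (M.mkSS S T ss ts i r c) (M.mkSS S T ss ts i r c) →
    (∀ s ∈ ss, ∀ t ∈ ts, M.eq w (i s t) (i s t)) ∧ (∀ t ∈ ts, M.eq w (r t) (r t)) ∧
      ∀ s ∈ ss, M.eq w (c s) (c s)
  sort_sort : ∀ {X S Y T}, introSort X S ∈ TA → introSort Y T ∈ TB → M.Entries X Y →
    M.RowOk X ⟨S, ctxVars X⟩ Y → M.ColOk X Y ⟨T, ctxVars Y⟩ →
    M.SSok X ⟨S, ctxVars X⟩ Y ⟨T, ctxVars Y⟩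
  sort_term : ∀ {X S Y t V}, introSort X S ∈ TA → introTerm Y t V ∈ TB → M.Entries X Y →
    M.RowOk X ⟨S, ctxVars X⟩ Y →
    (∀ w ε, M.Env w ε X Y → ∀ a, M.Row w ε ⟨S, ctxVars X⟩ Y a →
      M.seq w (M.T2 ε ⟨S, ctxVars X⟩ V a (M.bv ε (.app t (ctxVars Y))))
        (M.T2 ε ⟨S, ctxVars X⟩ V a (M.bv ε (.app t (ctxVars Y))))) →
    ∀ {w ε}, M.Env w ε X Y → ∀ {a}, M.Row w ε ⟨S, ctxVars X⟩ Y a →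
      M.ty w (M.R ε ⟨S, ctxVars X⟩ a (.app t (ctxVars Y)))
        (M.T2 ε ⟨S, ctxVars X⟩ V a (M.bv ε (.app t (ctxVars Y))))
  term_term : ∀ {X s U Y t V}, introTerm X s U ∈ TA → introTerm Y t V ∈ TB → M.Entries X Y →
    (∀ w ε, M.Env w ε X Y →
      M.ty w (M.R ε U (M.au ε (.app s (ctxVars X))) (.app t (ctxVars Y)))
          (M.T2 ε U V (M.au ε (.app s (ctxVars X))) (M.bv ε (.app t (ctxVars Y)))) ∧
        M.ty w (M.C ε V (M.bv ε (.app t (ctxVars Y))) (.app s (ctxVars X)))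
          (M.T2 ε U V (M.au ε (.app s (ctxVars X))) (M.bv ε (.app t (ctxVars Y))))) →
    ∀ {w ε}, M.Env w ε X Y →
      M.eq w (M.R ε U (M.au ε (.app s (ctxVars X))) (.app t (ctxVars Y)))
        (M.C ε V (M.bv ε (.app t (ctxVars Y))) (.app s (ctxVars X)))
  sort_sortEq : ∀ {X S Y V V'}, introSort X S ∈ TA → Judg.sortEq Y V V' ∈ TB → M.Entries X Y →
    M.RowOk X ⟨S, ctxVars X⟩ Y → M.ColOk X Y V →
    (∀ w ε, M.Env w ε X Y → ∀ a b, M.Row w ε ⟨S, ctxVars X⟩ Y a → M.Col w ε V X b →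
      M.seq w (M.T2 ε ⟨S, ctxVars X⟩ V a b) (M.T2 ε ⟨S, ctxVars X⟩ V a b) ∧
        M.seq w (M.T2 ε ⟨S, ctxVars X⟩ V' a b) (M.T2 ε ⟨S, ctxVars X⟩ V' a b)) →
    ∀ {w ε}, M.Env w ε X Y → ∀ {a b}, M.Row w ε ⟨S, ctxVars X⟩ Y a → M.Col w ε V X b →
      M.seq w (M.T2 ε ⟨S, ctxVars X⟩ V a b) (M.T2 ε ⟨S, ctxVars X⟩ V' a b)
  sort_termEq : ∀ {X S Y v v' V}, introSort X S ∈ TA → Judg.termEq Y v v' V ∈ TB →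
    M.Entries X Y → M.RowOk X ⟨S, ctxVars X⟩ Y →
    (∀ w ε, M.Env w ε X Y → ∀ a, M.Row w ε ⟨S, ctxVars X⟩ Y a →
      M.ty w (M.R ε ⟨S, ctxVars X⟩ a v) (M.T2 ε ⟨S, ctxVars X⟩ V a (M.bv ε v)) ∧
        M.ty w (M.R ε ⟨S, ctxVars X⟩ a v') (M.T2 ε ⟨S, ctxVars X⟩ V a (M.bv ε v))) →
    ∀ {w ε}, M.Env w ε X Y → ∀ {a}, M.Row w ε ⟨S, ctxVars X⟩ Y a →
      M.eq w (M.R ε ⟨S, ctxVars X⟩ a v) (M.R ε ⟨S, ctxVars X⟩ a v')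
  sortEq_term : ∀ {X U U' Y t V}, Judg.sortEq X U U' ∈ TA → introTerm Y t V ∈ TB →
    M.Entries X Y → M.RowOk X U Y →
    (∀ w ε, M.Env w ε X Y → ∀ a, M.Row w ε U Y a →
      M.ty w (M.R ε U a (.app t (ctxVars Y))) (M.T2 ε U V a (M.bv ε (.app t (ctxVars Y)))) ∧
        M.ty w (M.R ε U' a (.app t (ctxVars Y)))
          (M.T2 ε U V a (M.bv ε (.app t (ctxVars Y))))) →
    ∀ {w ε}, M.Env w ε X Y → ∀ {a}, M.Row w ε U Y a →
      M.eq w (M.R ε U a (.app t (ctxVars Y))) (M.R ε U' a (.app t (ctxVars Y)))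

variable {M} {TA : Set (Judg A)} {TB : Set (Judg B)}

section flip

variable {w : W} {ε : Nv A B Ex} {X : PreCtx A} {Y : PreCtx B} {N K : ℕ}

theorem Env.flip (h : M.Env w ε X Y) : M.flip.Env w ε.flip Y X :=
  ⟨h.cB, h.cA, fun q hq p hp => h.ty p hp q hq⟩

theorem Good.flip (h : M.Good TA TB N K w ε X Y) : M.flip.Good TB TA K N w ε.flip Y X :=
  ⟨h.right, h.left⟩

theorem Full.flip (h : M.Full TA TB N K w ε X Y) : M.flip.Full TB TA K N w ε.flip Y X where
  left := h.right
  right := h.left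
  ss hV hU hb ha := h.ss hU hV ha hb
  tt hv hu := h.tt' hu hv
  tt' hv hu := h.tt hu hv
  ty hv hu := h.ty hu hv

theorem H.flip (h : M.H TA TB N K) : M.flip.H TB TA K N := fun he hg =>
  (h (Env.flip he) (Good.flip hg)).flip

theorem SSok.flip {U : SortE A} {V : SortE B} (h : M.SSok X U Y V) : M.flip.SSok Y V X U :=
  fun w ε he a b ha hb => h w ε.flip he.flip b a hb ha

theorem Entries.flip (h : M.Entries X Y) : M.flip.Entries Y X :=
  fun j hj i hi => SSok.flip (h i hi j hj)

theorem Env.take (h : M.Env w ε X Y) (i j : ℕ) : M.Env w ε (X.take i) (Y.take j) :=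
  ⟨h.cA.take i, h.cB.take j, fun p hp q hq =>
    h.ty p (List.mem_of_mem_take hp) q (List.mem_of_mem_take hq)⟩

theorem Good.mono {N' K' : ℕ} (hN : N' ≤ N) (hK : K' ≤ K) (h : M.Good TA TB N K w ε X Y) :
    M.Good TA TB N' K' w ε X Y :=
  ⟨⟨fun hu => h.left.row (hu.mono hN), fun hU => h.left.iff (hU.mono hN)⟩,
    ⟨fun hu => h.right.row (hu.mono hK), fun hU => h.right.iff (hU.mono hK)⟩⟩

theorem Row.take {U : SortE A} {a : B.Var → Ex} (h : M.Row w ε U Y a) (j : ℕ) :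
    M.Row w ε U (Y.take j) a := fun q hq => h q (List.mem_of_mem_take hq)

theorem goodR_of_forall (L : M.Laws TA TB) {b : ℕ} (hY : HCtx TB b Y) (he : M.Env w ε X Y)
    (h : ∀ l < Y.length, M.Good TA TB N b w ε X (Y.take l)) (hN : M.H TA TB N b) :
    M.GoodR TA N w ε X Y where
  row {u U} hu q hq := by
    obtain ⟨l, hl, rfl⟩ := List.getElem_of_mem hq
    have he' : M.Env w ε X (Y.take l) := by simpa using he.take X.length l
    have := (hN he' (h l hl)).right.st (a := fun x => ε.ρ x (Y[l]'hl).1) (hY.sort l hl) hu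
      fun p hp => he.ty p hp _ hq
    unfold au
    rw [he.cB _ hq]
    exact this
  iff {U U'} hU a := by
    have key : ∀ l (hl : l < Y.length), M.Row w ε U (Y.take l) a →
        M.seq w (M.T2 ε U (Y[l]'hl).2 a fun x => ε.ρ x (Y[l]'hl).1)
          (M.T2 ε U' (Y[l]'hl).2 a fun x => ε.ρ x (Y[l]'hl).1) := fun l hl ha => by
      have he' : M.Env w ε X (Y.take l) := by simpa using he.take X.length l
      exact (hN he' (h l hl)).right.ssq (hY.sort l hl) hU
        (fun p hp => he.ty p hp _ (List.getElem_mem hl)) ha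
    constructor
    · intro ha q hq
      obtain ⟨l, hl, rfl⟩ := List.getElem_of_mem hq
      exact L.ty_conv (ha _ hq) (key l hl (ha.take l))
    · intro ha q hq
      obtain ⟨l, hl, rfl⟩ := List.getElem_of_mem hq
      exact L.ty_conv (ha _ hq)
        (L.seq_symm (key l hl (((h l hl).left.iff hU a).2 (ha.take l))))

theorem Env.good (L : M.Laws TA TB) (L' : M.flip.Laws TB TA) {a b : ℕ} (hX : HCtx TA a X)
    (hY : HCtx TB b Y) (he : M.Env w ε X Y) (hab : M.H TA TB a b) (hN : M.H TA TB N b)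
    (hK : M.H TA TB a K) : M.Good TA TB N K w ε X Y := by
  generalize hs : X.length + Y.length = s
  induction s using Nat.strong_induction_on generalizing X Y N K with
  | _ s ih =>
  constructor
  · refine goodR_of_forall L hY he (fun l hl => ?_) hN
    have he' : M.Env w ε X (Y.take l) := by simpa using he.take X.length l
    refine ih _ ?_ hX (hY.take l) he' hN hab rfl
    simp only [List.length_take, ← hs]
    omega
  · refine goodR_of_forall L' hX he.flip (fun l hl => ?_) (H.flip hK)
    have he' : M.Env w ε (X.take l) Y := by simpa using he.take l Y.length
    refine (ih _ ?_ (hX.take l) hY he' hab hK rfl).flip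
    simp only [List.length_take, ← hs]
    omega

end flip

/-! ### Congruence in the generic elements -/

theorem R_congr (L : M.Laws TA TB) {w : W} {ε : Nv A B Ex} {U : SortE A} {a a' : B.Var → Ex}
    {Y : PreCtx B} (ha : ∀ q ∈ Y, M.eq w (a q.1) (a' q.1)) {v : Expr B} (hv : Scoped Y v)
    (h : M.eq w (M.R ε U a v) (M.R ε U a v)) : M.eq w (M.R ε U a v) (M.R ε U a' v) := by
  induction v using Expr.ind with
  | hv y =>
    obtain ⟨q, hq, rfl⟩ := List.mem_map.1 (hv y (.var))
    simpa only [L.R_var] using ha q hq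
  | ha t ts ih =>
    simp only [L.R_app] at h ⊢
    obtain ⟨h1, h2⟩ := L.mkSt_args h
    have := L.mkSt_cong (w := w) U.head t U.args ts id id id id (M.I ε) (M.I ε) (M.R ε U a)
      (M.R ε U a')
    simp only [List.map_id, id] at this
    exact this h h1 fun t ht => ih t ht (fun y hy => hv y (occurs_app_iff.2 ⟨t, ht, hy⟩)) (h2 t ht)

theorem T2_congr (L : M.Laws TA TB) (L' : M.flip.Laws TB TA) {w : W} {ε : Nv A B Ex}
    {U : SortE A} {V : SortE B} {X : PreCtx A} {Y : PreCtx B} {a a' : B.Var → Ex}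
    {b b' : A.Var → Ex} (ha : ∀ q ∈ Y, M.eq w (a q.1) (a' q.1))
    (hb : ∀ p ∈ X, M.eq w (b p.1) (b' p.1)) (hU : SScoped X U) (hV : SScoped Y V)
    (h : M.seq w (M.T2 ε U V a b) (M.T2 ε U V a b)) :
    M.seq w (M.T2 ε U V a b) (M.T2 ε U V a' b') := by
  obtain ⟨h1, h2, h3⟩ := L.mkSS_args h
  have := L.mkSS_cong (w := w) U.head V.head U.args V.args id id id id (M.I ε) (M.I ε) (M.R ε U a)
    (M.R ε U a') (M.C ε V b) (M.C ε V b')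
  simp only [List.map_id, id] at this
  exact this h h1 (fun t ht => R_congr L ha (fun y hy => hV y ⟨t, ht, hy⟩) (h2 t ht))
    (fun s hs => R_congr (M := M.flip) (ε := ε.flip) L' hb (fun y hy => hU y ⟨s, hs, hy⟩)
      (h3 s hs))

end Mdl

/-! ## Substitution in bilinear models -/

/-- A term of height `n` over `X'` whose instance over `X` has height `N`. -/
def TSt (TA : Set (Judg A)) (X X' : PreCtx A) (φ : A.Var → Expr A) (n N : ℕ) (u : Expr A) : Prop :=
  ∃ U, HD TA n (.term X' u U) ∧ HD TA N (.term X (u.subst φ) (U.subst φ))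

/-- A sort of height `n` over `X'` whose instance over `X` has height `N`. -/
def TSs (TA : Set (Judg A)) (X X' : PreCtx A) (φ : A.Var → Expr A) (n N : ℕ) (U : SortE A) :
    Prop := HD TA n (.sort X' U) ∧ HD TA N (.sort X (U.subst φ))

section

variable {TA : Set (Judg A)} {X X' : PreCtx A} {φ : A.Var → Expr A} {n n' N N' : ℕ}

theorem TSt.mono (hn : n ≤ n') (hN : N ≤ N') {u : Expr A} (h : TSt TA X X' φ n N u) :
    TSt TA X X' φ n' N' u :=
  h.imp fun _ h => ⟨h.1.mono hn, h.2.mono hN⟩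

theorem TSs.mono (hn : n ≤ n') (hN : N ≤ N') {U : SortE A} (h : TSs TA X X' φ n N U) :
    TSs TA X X' φ n' N' U := ⟨h.1.mono hn, h.2.mono hN⟩

theorem TSt.scoped {u : Expr A} (h : TSt TA X X' φ n N u) : Scoped X' u :=
  h.elim fun _ h => h.1.scoped

theorem sscoped_of_forall_HD
    (h : ∀ i (hi : i < X.length), HD TA n (.sort (X.take i) (X[i]'hi).2)) :
    ∀ p ∈ X, SScoped X p.2 := by
  intro p hp
  obtain ⟨i, hi, rfl⟩ := List.getElem_of_mem hp
  exact ((h i hi).weaken (Y := X) fun q hq => List.mem_of_mem_take hq).sscoped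

theorem TSt.of_args {Xa : PreCtx A} {θ θ' : A.Var → Expr A}
    (hXa : ∀ i (hi : i < Xa.length), HD TA n (.sort (Xa.take i) (Xa[i]'hi).2))
    (h : ∀ p ∈ Xa, HD TA n (.term X' (θ p.1) (p.2.subst θ)))
    (h' : ∀ p ∈ Xa, HD TA N (.term X (θ' p.1) (p.2.subst θ')))
    (he : (Xa.map fun p => (θ p.1).subst φ) = Xa.map fun p => θ' p.1) :
    ∀ e ∈ Xa.map fun p => θ p.1, TSt TA X X' φ n N e := by
  intro e he'
  obtain ⟨p, hp, rfl⟩ := List.mem_map.1 he'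
  have he := map_fst_inj (σ := fun x => (θ x).subst φ) he
  refine ⟨_, h p hp, ?_⟩
  have := h' p hp
  rw [← he p hp] at this
  rwa [SortE.subst_subst, (sscoped_of_forall_HD hXa p hp).subst_congr he]

theorem TSt.args (hs : Shaped TA) {t : A.TermSym} {es : List (Expr A)}
    (h : TSt TA X X' φ (n + 1) (N + 1) (.app t es)) : ∀ e ∈ es, TSt TA X X' φ n N e := by
  obtain ⟨U, h1, h2⟩ := h
  obtain ⟨m, Xa, V, θ, e1, e2, e3, e4, e5, e6, rfl⟩ := h1.app_inv
  rw [Expr.subst_app] at h2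
  obtain ⟨m', Xa', V', θ', e1', e2', e3', e4', e5', e6', e7'⟩ := h2.app_inv
  obtain ⟨rfl, rfl⟩ := hs.term_unique e2 e2'
  cases e1
  cases e1'
  exact TSt.of_args e3 e6 e6' (by simpa using e7')

theorem TSs.args (hs : Shaped TA) {U : SortE A}
    (h : TSs TA X X' φ (n + 1) (N + 1) U) : ∀ e ∈ U.args, TSt TA X X' φ n N e := by
  obtain ⟨h1, h2⟩ := h
  obtain ⟨m, Xa, θ, e1, e2, e3, e4, e5, e6⟩ := h1.sort_inv
  obtain ⟨m', Xa', θ', e1', e2', e3', e4', e5', e6'⟩ := h2.sort_inv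
  obtain rfl := hs.sort_unique e2 e2'
  cases e1
  cases e1'
  have e7 := congrArg SortE.args e6
  have e8 := congrArg SortE.args e6'
  simp only at e7 e8
  rw [e7]
  refine TSt.of_args e3 e5 e5' ?_
  rw [← e8]
  change _ = U.args.map _
  rw [e7]
  simp

end

namespace Mdl

variable {Ex So W : Type} {M : Mdl A B Ex So W} {TA : Set (Judg A)} {TB : Set (Judg B)}

/-- Compatibility of the pairing with substitution, at given heights. -/
def SubI (M : Mdl A B Ex So W) (TA : Set (Judg A)) (TB : Set (Judg B)) (w : W)
    (ε ε₁ : Nv A B Ex) (X X' : PreCtx A) (Y Y' : PreCtx B) (φ : A.Var → Expr A)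
    (ψ : B.Var → Expr B) (n N k K : ℕ) : Prop :=
  ∀ u v, TSt TA X X' φ n N u → TSt TB Y Y' ψ k K v →
    M.eq w (M.I ε (u.subst φ) (v.subst ψ)) (M.I ε₁ u v)

section

variable {w : W} {ε ε₁ : Nv A B Ex} {X X' : PreCtx A} {Y Y' : PreCtx B} {φ : A.Var → Expr A}
  {ψ : B.Var → Expr B} {n N k K : ℕ}

theorem SubI.flip (h : M.SubI TA TB w ε ε₁ X X' Y Y' φ ψ n N k K) :
    M.flip.SubI TB TA w ε.flip ε₁.flip Y Y' X X' ψ φ k K n N := fun v u hv hu => h u v hu hv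

theorem SubI.R_subst (L : M.Laws TA TB) (hsA : Shaped TA) (hsB : Shaped TB)
    (hI : M.SubI TA TB w ε ε₁ X X' Y Y' φ ψ n N k K) {U : SortE A}
    (hU : TSs TA X X' φ (n + 1) (N + 1) U) {a : B.Var → Ex} {v : Expr B}
    (hv : TSt TB Y Y' ψ (k + 1) (K + 1) v)
    (h : M.eq w (M.R ε (U.subst φ) a (v.subst ψ)) (M.R ε (U.subst φ) a (v.subst ψ))) :
    M.eq w (M.R ε (U.subst φ) a (v.subst ψ))
      (M.R ε₁ U (fun y => M.R ε (U.subst φ) a (ψ y)) v) := by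
  induction v using Expr.ind with
  | hv y => simpa only [L.R_var, Expr.subst_var] using h
  | ha t ts ih =>
    rw [Expr.subst_app, L.R_app] at h
    rw [Expr.subst_app, L.R_app, L.R_app]
    obtain ⟨h1, h2⟩ := L.mkSt_args h
    have := L.mkSt_cong (w := w) U.head t U.args ts (Expr.subst φ) id (Expr.subst ψ) id (M.I ε)
      (M.I ε₁) (M.R ε (U.subst φ) a) (M.R ε₁ U fun y => M.R ε (U.subst φ) a (ψ y))
    simp only [List.map_id, id] at this
    exact this h (fun s hs t ht => hI _ _ (hU.args hsA s hs) (hv.args hsB t ht))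
      fun t ht => ih t ht ((hv.args hsB t ht).mono (Nat.le_succ k) (Nat.le_succ K))
        (h2 _ (List.mem_map_of_mem ht))

theorem SubI.T2_subst (L : M.Laws TA TB) (L' : M.flip.Laws TB TA) (hsA : Shaped TA)
    (hsB : Shaped TB) (hI : M.SubI TA TB w ε ε₁ X X' Y Y' φ ψ n N k K) {U : SortE A}
    (hU : TSs TA X X' φ (n + 1) (N + 1) U) {V : SortE B} (hV : TSs TB Y Y' ψ (k + 1) (K + 1) V)
    {a : B.Var → Ex} {b : A.Var → Ex}
    (h : M.seq w (M.T2 ε (U.subst φ) (V.subst ψ) a b) (M.T2 ε (U.subst φ) (V.subst ψ) a b)) :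
    M.seq w (M.T2 ε (U.subst φ) (V.subst ψ) a b)
      (M.T2 ε₁ U V (fun y => M.R ε (U.subst φ) a (ψ y))
        fun x => M.C ε (V.subst ψ) b (φ x)) := by
  obtain ⟨h1, h2, h3⟩ := L.mkSS_args h
  have := L.mkSS_cong (w := w) U.head V.head U.args V.args (Expr.subst φ) id (Expr.subst ψ) id
    (M.I ε) (M.I ε₁) (M.R ε (U.subst φ) a) (M.R ε₁ U fun y => M.R ε (U.subst φ) a (ψ y))
    (M.C ε (V.subst ψ) b) (M.C ε₁ V fun x => M.C ε (V.subst ψ) b (φ x))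
  simp only [List.map_id, id] at this
  exact this h (fun s hs t ht => hI _ _ (hU.args hsA s hs) (hV.args hsB t ht))
    (fun t ht => hI.R_subst L hsA hsB hU
      ((hV.args hsB t ht).mono (Nat.le_succ k) (Nat.le_succ K)) (h2 _ (List.mem_map_of_mem ht)))
    fun s hs => hI.flip.R_subst L' hsB hsA hV
      ((hU.args hsA s hs).mono (Nat.le_succ n) (Nat.le_succ N)) (h3 _ (List.mem_map_of_mem hs))

end

/-- A pair of substitutions together with the environment which they induce. -/
structure SubCtx (M : Mdl A B Ex So W) (TA : Set (Judg A)) (TB : Set (Judg B)) (N K : ℕ) (w : W)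
    (ε ε₁ : Nv A B Ex) (X X' : PreCtx A) (Y Y' : PreCtx B) (φ : A.Var → Expr A)
    (ψ : B.Var → Expr B) : Prop where
  hX : HCtx TA N X'
  hY : HCtx TB K Y'
  hφ : ∀ p ∈ X', HD TA N (.term X (φ p.1) (p.2.subst φ))
  hψ : ∀ q ∈ Y', HD TB K (.term Y (ψ q.1) (q.2.subst ψ))
  full : M.Full TA TB N K w ε X Y
  cA : Compat ε₁.sA X'
  cB : Compat ε₁.sB Y'
  hρ : ∀ p ∈ X', ∀ q ∈ Y', ε₁.ρ p.1 q.1 = M.I ε (φ p.1) (ψ q.1)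

section

variable {w : W} {ε ε₁ : Nv A B Ex} {X X' : PreCtx A} {Y Y' : PreCtx B} {φ : A.Var → Expr A}
  {ψ : B.Var → Expr B} {n N N' k K K' : ℕ}

theorem SubCtx.flip (S : M.SubCtx TA TB N K w ε ε₁ X X' Y Y' φ ψ) :
    M.flip.SubCtx TB TA K N w ε.flip ε₁.flip Y Y' X X' ψ φ where
  hX := S.hY
  hY := S.hX
  hφ := S.hψ
  hψ := S.hφ
  full := S.full.flip
  cA := S.cB
  cB := S.cA
  hρ q hq p hp := S.hρ p hp q hq

theorem SubCtx.take (S : M.SubCtx TA TB N K w ε ε₁ X X' Y Y' φ ψ) (i j : ℕ) :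
    M.SubCtx TA TB N K w ε ε₁ X (X'.take i) Y (Y'.take j) φ ψ where
  hX := S.hX.take i
  hY := S.hY.take j
  hφ p hp := S.hφ p (List.mem_of_mem_take hp)
  hψ q hq := S.hψ q (List.mem_of_mem_take hq)
  full := S.full
  cA := S.cA.take i
  cB := S.cB.take j
  hρ p hp q hq := S.hρ p (List.mem_of_mem_take hp) q (List.mem_of_mem_take hq)

theorem HCtx.tss {X X' : PreCtx A} {φ : A.Var → Expr A} {N : ℕ} (hX : HCtx TA N X')
    (hφ : ∀ p ∈ X', HD TA N (.term X (φ p.1) (p.2.subst φ))) :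
    ∀ p ∈ X', TSs TA X X' φ N N p.2 := by
  intro p hp
  obtain ⟨i, hi, rfl⟩ := List.getElem_of_mem hp
  exact ⟨(hX.sort i hi).weaken fun q hq => List.mem_of_mem_take hq, (hφ _ hp).sort_of_term⟩

theorem SubCtx.au_subst (L : M.Laws TA TB) (L' : M.flip.Laws TB TA) (hsA : Shaped TA)
    (hsB : Shaped TB) (S : M.SubCtx TA TB N K w ε ε₁ X X' Y Y' φ ψ)
    (hI : M.SubI TA TB w ε ε₁ X X' Y Y' φ ψ n N K K) (hN : N' ≤ N + 1)
    (F : M.Full TA TB N' K w ε X Y) {u : Expr A} {U : SortE A}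
    (hu : HD TA (n + 1) (.term X' u U)) (hu' : HD TA N' (.term X (u.subst φ) (U.subst φ))) :
    ∀ q ∈ Y', M.eq w (M.R ε (U.subst φ) (M.au ε (u.subst φ)) (ψ q.1)) (M.au ε₁ u q.1) := by
  intro q hq
  have h1 := L.eq_symm (F.tt hu' (S.hψ q hq))
  have h2 := F.tt' hu' (S.hψ q hq)
  have h3 := hI.flip.R_subst L' hsB hsA
    ((HCtx.tss S.hY S.hψ q hq).mono (Nat.le_succ K) (Nat.le_succ K))
    ⟨U, hu, hu'.mono hN⟩ (L.eq_trans (L.eq_symm h2) h2)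
  refine L.eq_trans h1 (L.eq_trans h2 (L.eq_trans h3 ?_))
  have h4 := R_congr (M := M.flip) L' (w := w) (ε := ε₁.flip) (U := q.2) (Y := X') (v := u)
    (a := fun x => M.C ε (q.2.subst ψ) (M.bv ε (ψ q.1)) (φ x)) (a' := fun x => ε₁.ρ x q.1)
    (fun p hp => by
      rw [S.hρ p hp q hq]
      exact L.eq_symm (S.full.tt' (S.hφ p hp) (S.hψ q hq))) hu.scoped
    (L.eq_trans (L.eq_symm h3) h3)
  unfold au
  rw [S.cB q hq]
  exact h4

theorem SubCtx.subI_of_env (L : M.Laws TA TB) (L' : M.flip.Laws TB TA) (hsA : Shaped TA)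
    (hsB : Shaped TB) (S : M.SubCtx TA TB N K w ε ε₁ X X' Y Y' φ ψ)
    (F : M.Full TA TB N K w ε₁ X' Y') : ∀ n ≤ N, M.SubI TA TB w ε ε₁ X X' Y Y' φ ψ n N K K := by
  intro n
  induction n with
  | zero =>
    rintro _ u v ⟨U, hu, _⟩ _
    cases hu
  | succ n ih =>
    rintro hn u v ⟨U, hu, hu'⟩ ⟨V, hv, hv'⟩
    have hI := ih (Nat.le_of_succ_le hn)
    have h1 := S.full.tt hu' hv'
    have h2 := hI.R_subst L hsA hsB ⟨hu.sort_of_term, hu'.sort_of_term.lift⟩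
      (⟨V, hv.lift, hv'.lift⟩ : TSt TB Y Y' ψ (K + 1) (K + 1) v) (L.eq_trans (L.eq_symm h1) h1)
    have h3 := R_congr L (S.au_subst L L' hsA hsB hI (Nat.le_succ N) S.full hu hu') hv.scoped
      (L.eq_trans (L.eq_symm h2) h2)
    exact L.eq_trans h1 (L.eq_trans h2 (L.eq_trans h3 (L.eq_symm (F.tt (hu.mono hn) hv))))

theorem SubCtx.env (L : M.Laws TA TB) (L' : M.flip.Laws TB TA) (hsA : Shaped TA)
    (hsB : Shaped TB) (hH : M.H TA TB N K) (S : M.SubCtx TA TB N K w ε ε₁ X X' Y Y' φ ψ) :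
    M.Env w ε₁ X' Y' := by
  generalize hs : X'.length + Y'.length = s
  induction s using Nat.strong_induction_on generalizing X' Y' with
  | _ s ih =>
  refine ⟨S.cA, S.cB, fun p hp q hq => ?_⟩
  obtain ⟨i, hi, rfl⟩ := List.getElem_of_mem hp
  obtain ⟨j, hj, rfl⟩ := List.getElem_of_mem hq
  have S' := S.take i j
  have he := ih _ (by simp only [List.length_take, ← hs]; omega) S' rfl
  have hI := S'.subI_of_env L L' hsA hsB
    (hH he (he.good L L' S'.hX S'.hY hH hH hH)) N le_rfl
  have h1 := S.full.ty (S.hφ _ hp) (S.hψ _ hq)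
  have h2 := hI.T2_subst L L' hsA hsB
    ⟨(S.hX.sort i hi).lift, (S.hφ _ hp).sort_of_term.lift⟩
    ⟨(S.hY.sort j hj).lift, (S.hψ _ hq).sort_of_term.lift⟩ (L.ty_sok h1)
  have h3 := T2_congr L L' (X := X'.take i) (Y := Y'.take j) (a' := ε₁.ρ (X'[i]'hi).1)
    (b' := fun x => ε₁.ρ x (Y'[j]'hj).1)
    (fun q hq' => by
      rw [S.hρ _ hp q (List.mem_of_mem_take hq')]
      exact L.eq_symm (S.full.tt (S.hφ _ hp) (S.hψ q (List.mem_of_mem_take hq'))))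
    (fun p hp' => by
      rw [S.hρ p (List.mem_of_mem_take hp') _ hq]
      exact L.eq_symm (S.full.tt' (S.hφ p (List.mem_of_mem_take hp')) (S.hψ _ hq)))
    (S.hX.sort i hi).sscoped (S.hY.sort j hj).sscoped (L.seq_trans (L.seq_symm h2) h2)
  rw [S.hρ _ hp _ hq]
  exact L.ty_conv h1 (L.seq_trans h2 h3)

theorem SubCtx.subI (L : M.Laws TA TB) (L' : M.flip.Laws TB TA) (hsA : Shaped TA)
    (hsB : Shaped TB) (hH : M.H TA TB N K) (S : M.SubCtx TA TB N K w ε ε₁ X X' Y Y' φ ψ) :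
    M.SubI TA TB w ε ε₁ X X' Y Y' φ ψ N N K K :=
  S.subI_of_env L L' hsA hsB
    (hH (S.env L L' hsA hsB hH) ((S.env L L' hsA hsB hH).good L L' S.hX S.hY hH hH hH)) N le_rfl

theorem SubCtx.row (L : M.Laws TA TB) (L' : M.flip.Laws TB TA) (hsA : Shaped TA)
    (hsB : Shaped TB) (hH : M.H TA TB N K) (S : M.SubCtx TA TB N K w ε ε₁ X X' Y Y' φ ψ)
    (hN : N' ≤ N + 1) (F : M.Half TA TB N' K w ε X Y) {U : SortE A}
    (hU : TSs TA X X' φ (N + 1) N' U) {a : B.Var → Ex} (ha : M.Row w ε (U.subst φ) Y a) :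
    M.Row w ε₁ U Y' fun y => M.R ε (U.subst φ) a (ψ y) := by
  intro q hq
  have h1 := F.st hU.2 (S.hψ q hq) ha
  have h2 := (S.subI L L' hsA hsB hH).T2_subst L L' hsA hsB (hU.mono le_rfl hN)
    ((HCtx.tss S.hY S.hψ q hq).mono (Nat.le_succ K) (Nat.le_succ K)) (L.ty_sok h1)
  have h3 := T2_congr L L' (X := X') (Y := Y')
    (a' := fun y => M.R ε (U.subst φ) a (ψ y)) (b' := fun x => ε₁.ρ x q.1)
    (fun q' hq' => L.ty_refl (F.st hU.2 (S.hψ q' hq') ha))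
    (fun p hp => by
      rw [S.hρ p hp q hq]
      exact L.eq_symm (S.full.tt' (S.hφ p hp) (S.hψ q hq)))
    hU.1.sscoped (S.hY.isPreCtx.sscoped q hq) (L.seq_trans (L.seq_symm h2) h2)
  exact L.ty_conv h1 (L.seq_trans h2 h3)

end

end Mdl

/-! ## The inductive step -/

/-- The properties of a set of axioms which are used in the analysis of the tensor. -/
structure Thy (Ax : Set (Judg A)) : Prop where
  shaped : Shaped Ax
  nodup : ∀ {J}, J ∈ Ax → (keys J.ctxOf).Nodup
  isPreCtx : ∀ {J}, J ∈ Ax → IsPreCtx J.ctxOf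

theorem exists_compat (s₀ : A.Var → SortE A) {X : PreCtx A} (h : (keys X).Nodup) :
    ∃ s, Compat s X := by
  classical
  refine ⟨fun x => ((X.find? fun p => decide (p.1 = x)).map Prod.snd).getD (s₀ x), fun p hp => ?_⟩
  cases hf : X.find? fun q => decide (q.1 = p.1) with
  | none => simpa using List.find?_eq_none.1 hf p hp
  | some q =>
    have h1 : q.1 = p.1 := by simpa using List.find?_some hf
    have h2 := List.mem_of_find?_eq_some hf
    simp [hf, eq_of_mem_keys h h2 hp h1]

section

variable {TA : Set (Judg A)} {X Xs : PreCtx A} {n : ℕ}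

theorem SortE.subst_ctxVars (S : A.SortSym) (Xs : PreCtx A) (φ : A.Var → Expr A) :
    (⟨S, ctxVars Xs⟩ : SortE A).subst φ = ⟨S, Xs.map fun p => φ p.1⟩ := by
  change (⟨S, (ctxVars Xs).map _⟩ : SortE A) = _
  simp [ctxVars]

theorem Expr.subst_ctxVars (t : A.TermSym) (Xs : PreCtx A) (φ : A.Var → Expr A) :
    (Expr.app t (ctxVars Xs)).subst φ = .app t (Xs.map fun p => φ p.1) := by
  simp [ctxVars]

theorem HD.generic_sort {S : A.SortSym} (hax : introSort Xs S ∈ TA)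
    (hX : ∀ i (hi : i < Xs.length), HD TA n (.sort (Xs.take i) (Xs[i]'hi).2))
    (hv : ∀ p ∈ Xs, HD TA n (.term Xs (.var p.1) p.2)) :
    HD TA (n + 1) (.sort Xs ⟨S, ctxVars Xs⟩) :=
  HD.sort (φ := Expr.var) hax hX hv fun p hp => by simpa only [SortE.subst_id] using hv p hp

theorem HD.generic_term {t : A.TermSym} {U : SortE A} (hax : introTerm Xs t U ∈ TA)
    (hX : ∀ i (hi : i < Xs.length), HD TA n (.sort (Xs.take i) (Xs[i]'hi).2))
    (hv : ∀ p ∈ Xs, HD TA n (.term Xs (.var p.1) p.2)) (hU : HD TA n (.sort Xs U)) :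
    HD TA (n + 1) (.term Xs (.app t (ctxVars Xs)) U) := by
  have := HD.app (φ := Expr.var) hax hX hv hU (fun p hp => by
    simpa only [SortE.subst_id] using hv p hp) (by simpa only [SortE.subst_id] using hU)
  rwa [SortE.subst_id] at this

theorem HD.generic_sortEq {U U' : SortE A} (hax : Judg.sortEq Xs U U' ∈ TA)
    (hX : ∀ i (hi : i < Xs.length), HD TA n (.sort (Xs.take i) (Xs[i]'hi).2))
    (hv : ∀ p ∈ Xs, HD TA n (.term Xs (.var p.1) p.2)) (hU : HD TA n (.sort Xs U))
    (hU' : HD TA n (.sort Xs U')) : HD TA (n + 1) (.sortEq Xs U U') := by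
  have := HD.sortAx (φ := Expr.var) (X := Xs) hax hX hU hU' hv
  simp only [SortE.subst_id] at this
  exact this hv hU hU'

theorem HD.generic_termEq {u u' : Expr A} {U : SortE A} (hax : Judg.termEq Xs u u' U ∈ TA)
    (hX : ∀ i (hi : i < Xs.length), HD TA n (.sort (Xs.take i) (Xs[i]'hi).2))
    (hv : ∀ p ∈ Xs, HD TA n (.term Xs (.var p.1) p.2)) (hu : HD TA n (.term Xs u U))
    (hu' : HD TA n (.term Xs u' U)) : HD TA (n + 1) (.termEq Xs u u' U) := by
  have := HD.termAx (φ := Expr.var) (X := Xs) hax hX hu hu' hv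
  simp only [SortE.subst_id, Expr.subst_id] at this
  exact this hv hu hu'

end

namespace Mdl

variable {Ex So W : Type} {M : Mdl A B Ex So W} {TA : Set (Judg A)} {TB : Set (Judg B)}

section

variable {w : W} {ε ε₁ : Nv A B Ex} {X X' : PreCtx A} {Y Y' : PreCtx B} {φ : A.Var → Expr A}
  {ψ : B.Var → Expr B} {n N k K : ℕ}

theorem SubI.R_inst (L : M.Laws TA TB) (hsA : Shaped TA) (hsB : Shaped TB)
    (hI : M.SubI TA TB w ε ε₁ X X' Y Y' φ ψ n N k K) {U : SortE A}
    (hU : TSs TA X X' φ (n + 1) (N + 1) U) {a a₁ : B.Var → Ex}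
    (ha : ∀ q ∈ Y', M.eq w (M.R ε (U.subst φ) a (ψ q.1)) (a₁ q.1)) {v : Expr B}
    (hv : TSt TB Y Y' ψ (k + 1) (K + 1) v) (h : M.eq w (M.R ε₁ U a₁ v) (M.R ε₁ U a₁ v)) :
    M.eq w (M.R ε₁ U a₁ v) (M.R ε (U.subst φ) a (v.subst ψ)) := by
  induction v using Expr.ind with
  | hv y =>
    obtain ⟨q, hq, rfl⟩ := List.mem_map.1 (hv.scoped y .var)
    simpa only [L.R_var, Expr.subst_var] using L.eq_symm (ha q hq)
  | ha t ts ih =>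
    rw [L.R_app] at h
    rw [Expr.subst_app, L.R_app, L.R_app]
    obtain ⟨h1, h2⟩ := L.mkSt_args h
    have := L.mkSt_cong (w := w) U.head t U.args ts id (Expr.subst φ) id (Expr.subst ψ) (M.I ε₁)
      (M.I ε) (M.R ε₁ U a₁) (M.R ε (U.subst φ) a)
    simp only [List.map_id, id] at this
    exact this h (fun s hs t ht => L.eq_symm (hI _ _ (hU.args hsA s hs) (hv.args hsB t ht)))
      fun t ht => ih t ht ((hv.args hsB t ht).mono (Nat.le_succ k) (Nat.le_succ K)) (h2 t ht)

theorem SubI.T2_inst (L : M.Laws TA TB) (L' : M.flip.Laws TB TA) (hsA : Shaped TA)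
    (hsB : Shaped TB) (hI : M.SubI TA TB w ε ε₁ X X' Y Y' φ ψ n N k K) {U : SortE A}
    (hU : TSs TA X X' φ (n + 1) (N + 1) U) {V : SortE B} (hV : TSs TB Y Y' ψ (k + 1) (K + 1) V)
    {a a₁ : B.Var → Ex} {b b₁ : A.Var → Ex}
    (ha : ∀ q ∈ Y', M.eq w (M.R ε (U.subst φ) a (ψ q.1)) (a₁ q.1))
    (hb : ∀ p ∈ X', M.eq w (M.C ε (V.subst ψ) b (φ p.1)) (b₁ p.1))
    (h : M.seq w (M.T2 ε₁ U V a₁ b₁) (M.T2 ε₁ U V a₁ b₁)) :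
    M.seq w (M.T2 ε₁ U V a₁ b₁) (M.T2 ε (U.subst φ) (V.subst ψ) a b) := by
  obtain ⟨h1, h2, h3⟩ := L.mkSS_args h
  have := L.mkSS_cong (w := w) U.head V.head U.args V.args id (Expr.subst φ) id (Expr.subst ψ)
    (M.I ε₁) (M.I ε) (M.R ε₁ U a₁) (M.R ε (U.subst φ) a) (M.C ε₁ V b₁) (M.C ε (V.subst ψ) b)
  simp only [List.map_id, id] at this
  exact this h (fun s hs t ht => L.eq_symm (hI _ _ (hU.args hsA s hs) (hV.args hsB t ht)))
    (fun t ht => hI.R_inst L hsA hsB hU ha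
      ((hV.args hsB t ht).mono (Nat.le_succ k) (Nat.le_succ K)) (h2 t ht))
    fun s hs => hI.flip.R_inst L' hsB hsA hV hb
      ((hU.args hsA s hs).mono (Nat.le_succ n) (Nat.le_succ N)) (h3 s hs)

end

/-- Bilinearity below given heights, for a model satisfying the laws. -/
structure Below (M : Mdl A B Ex So W) (TA : Set (Judg A)) (TB : Set (Judg B)) (n m : ℕ) :
    Prop where
  L : M.Laws TA TB
  L' : M.flip.Laws TB TA
  hA : Thy TA
  hB : Thy TB
  ih : ∀ N K, N + K < n + m + 2 → M.H TA TB N K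

section

variable {n m : ℕ} {w : W} {ε ε₁ : Nv A B Ex} {X Xs : PreCtx A} {Y Ys : PreCtx B}
  {φ : A.Var → Expr A} {ψ : B.Var → Expr B}

theorem Below.flip (P : M.Below TA TB n m) : M.flip.Below TB TA m n :=
  ⟨P.L', P.L, P.hB, P.hA, fun N K h => H.flip (P.ih K N (by omega))⟩

theorem Below.full (P : M.Below TA TB n m) (he : M.Env w ε X Y)
    (hg : M.Good TA TB (n + 1) (m + 1) w ε X Y) {N K : ℕ} (hN : N ≤ n + 1) (hK : K ≤ m + 1)
    (h : N + K < n + m + 2) : M.Full TA TB N K w ε X Y :=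
  P.ih N K h he (hg.mono hN hK)

theorem Below.good (P : M.Below TA TB n m) (hX : HCtx TA n X) (hY : HCtx TB m Y)
    (he : M.Env w ε X Y) : M.Good TA TB (n + 1) (m + 1) w ε X Y :=
  he.good P.L P.L' hX hY (P.ih _ _ (by omega)) (P.ih _ _ (by omega)) (P.ih _ _ (by omega))

theorem Below.ssok (P : M.Below TA TB n m) (hX : HCtx TA n X) (hY : HCtx TB m Y) {N K : ℕ}
    (hN : N ≤ n + 1) (hK : K ≤ m + 1) (h : N + K < n + m + 2) {U : SortE A} {V : SortE B}
    (hU : HD TA N (.sort X U)) (hV : HD TB K (.sort Y V)) : M.SSok X U Y V :=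
  fun _ _ he _ _ ha hb => (P.full he (P.good hX hY he) hN hK h).ss hU hV ha hb

theorem Below.entries (P : M.Below TA TB n m) (hX : HCtx TA n X) (hY : HCtx TB m Y) :
    M.Entries X Y := fun i hi j hj =>
  P.ssok (hX.take i) (hY.take j) (Nat.le_succ n) (Nat.le_succ m) (by omega) (hX.sort i hi)
    (hY.sort j hj)

theorem Below.rowOk (P : M.Below TA TB n m) (hX : HCtx TA n X) (hY : HCtx TB m Y) {U : SortE A}
    (hU : HD TA (n + 1) (.sort X U)) : M.RowOk X U Y := fun j hj =>
  P.ssok hX (hY.take j) le_rfl (Nat.le_succ m) (by omega) hU (hY.sort j hj)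

theorem Below.colOk (P : M.Below TA TB n m) (hX : HCtx TA n X) (hY : HCtx TB m Y) {V : SortE B}
    (hV : HD TB (m + 1) (.sort Y V)) : M.ColOk X Y V := fun i hi =>
  P.ssok (hX.take i) hY (Nat.le_succ n) le_rfl (by omega) (hX.sort i hi) hV

theorem Below.exists_subCtx (P : M.Below TA TB n m) (he : M.Env w ε X Y)
    (hg : M.Good TA TB (n + 1) (m + 1) w ε X Y) (hX : HCtx TA n Xs) (hY : HCtx TB m Ys)
    (hφ : ∀ p ∈ Xs, HD TA n (.term X (φ p.1) (p.2.subst φ)))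
    (hψ : ∀ q ∈ Ys, HD TB m (.term Y (ψ q.1) (q.2.subst ψ))) :
    ∃ ε₁, M.SubCtx TA TB n m w ε ε₁ X Xs Y Ys φ ψ := by
  obtain ⟨sA, hA⟩ := exists_compat ε.sA hX.nodup
  obtain ⟨sB, hB⟩ := exists_compat ε.sB hY.nodup
  exact ⟨⟨sA, sB, fun x y => M.I ε (φ x) (ψ y)⟩, hX, hY, hφ, hψ,
    P.full he hg (Nat.le_succ n) (Nat.le_succ m) (by omega), hA, hB, fun _ _ _ _ => rfl⟩

end

end Mdl

namespace Mdl

variable {Ex So W : Type} {M : Mdl A B Ex So W} {TA : Set (Judg A)} {TB : Set (Judg B)}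
  {n m : ℕ} {w : W} {ε : Nv A B Ex} {X Xs : PreCtx A} {Y Ys : PreCtx B}
  {φ : A.Var → Expr A} {ψ : B.Var → Expr B}

theorem SubCtx.row_eq (L : M.Laws TA TB) {ε₁ : Nv A B Ex} {N K N' : ℕ}
    (S : M.SubCtx TA TB N K w ε ε₁ X Xs Y Ys φ ψ) (F : M.Half TA TB N' K w ε X Y) {U : SortE A}
    (hU : HD TA N' (.sort X U)) {a : B.Var → Ex} (ha : M.Row w ε U Y a) :
    ∀ q ∈ Ys, M.eq w (M.R ε U a (ψ q.1)) (M.R ε U a (ψ q.1)) :=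
  fun q hq => L.ty_refl (F.st hU (S.hψ q hq) ha)

theorem Below.env_subCtx (P : M.Below TA TB n m) {ε₁ : Nv A B Ex}
    (S : M.SubCtx TA TB n m w ε ε₁ X Xs Y Ys φ ψ) : M.Env w ε₁ Xs Ys :=
  S.env P.L P.L' P.hA.shaped P.hB.shaped (P.ih _ _ (by omega))

theorem Below.subI (P : M.Below TA TB n m) {ε₁ : Nv A B Ex}
    (S : M.SubCtx TA TB n m w ε ε₁ X Xs Y Ys φ ψ) :
    M.SubI TA TB w ε ε₁ X Xs Y Ys φ ψ n n m m :=
  S.subI P.L P.L' P.hA.shaped P.hB.shaped (P.ih _ _ (by omega))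

theorem Below.row (P : M.Below TA TB n m) (he : M.Env w ε X Y)
    (hg : M.Good TA TB (n + 1) (m + 1) w ε X Y) {ε₁ : Nv A B Ex}
    (S : M.SubCtx TA TB n m w ε ε₁ X Xs Y Ys φ ψ) {U : SortE A}
    (hU : HD TA (n + 1) (.sort Xs U)) (hU' : HD TA (n + 1) (.sort X (U.subst φ)))
    {a : B.Var → Ex} (ha : M.Row w ε (U.subst φ) Y a) :
    M.Row w ε₁ U Ys fun y => M.R ε (U.subst φ) a (ψ y) :=
  S.row P.L P.L' P.hA.shaped P.hB.shaped (P.ih _ _ (by omega)) le_rfl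
    (P.full he hg le_rfl (Nat.le_succ m) (by omega)).left ⟨hU, hU'⟩ ha

theorem Below.col (P : M.Below TA TB n m) (he : M.Env w ε X Y)
    (hg : M.Good TA TB (n + 1) (m + 1) w ε X Y) {ε₁ : Nv A B Ex}
    (S : M.SubCtx TA TB n m w ε ε₁ X Xs Y Ys φ ψ) {V : SortE B}
    (hV : HD TB (m + 1) (.sort Ys V)) (hV' : HD TB (m + 1) (.sort Y (V.subst ψ)))
    {b : A.Var → Ex} (hb : M.Col w ε (V.subst ψ) X b) :
    M.Col w ε₁ V Xs fun x => M.C ε (V.subst ψ) b (φ x) :=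
  P.flip.row he.flip hg.flip S.flip hV hV' hb

theorem Below.row_refl (P : M.Below TA TB n m) (he : M.Env w ε X Y)
    (hg : M.Good TA TB (n + 1) (m + 1) w ε X Y) {ε₁ : Nv A B Ex}
    (S : M.SubCtx TA TB n m w ε ε₁ X Xs Y Ys φ ψ) {U : SortE A}
    (hU : HD TA (n + 1) (.sort X U)) {a : B.Var → Ex} (ha : M.Row w ε U Y a) :
    ∀ q ∈ Ys, M.eq w (M.R ε U a (ψ q.1)) (M.R ε U a (ψ q.1)) :=
  S.row_eq P.L (P.full he hg le_rfl (Nat.le_succ m) (by omega)).left hU ha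

theorem Below.au_subst (P : M.Below TA TB n m) (he : M.Env w ε X Y)
    (hg : M.Good TA TB (n + 1) (m + 1) w ε X Y) {ε₁ : Nv A B Ex}
    (S : M.SubCtx TA TB n m w ε ε₁ X Xs Y Ys φ ψ) {u : Expr A} {U : SortE A}
    (hu : HD TA (n + 1) (.term Xs u U))
    (hu' : HD TA (n + 1) (.term X (u.subst φ) (U.subst φ))) :
    ∀ q ∈ Ys, M.eq w (M.R ε (U.subst φ) (M.au ε (u.subst φ)) (ψ q.1)) (M.au ε₁ u q.1) :=
  S.au_subst P.L P.L' P.hA.shaped P.hB.shaped (P.subI S) le_rfl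
    (P.full he hg le_rfl (Nat.le_succ m) (by omega)) hu hu'

theorem Below.col_refl (P : M.Below TA TB n m) (he : M.Env w ε X Y)
    (hg : M.Good TA TB (n + 1) (m + 1) w ε X Y) {ε₁ : Nv A B Ex}
    (S : M.SubCtx TA TB n m w ε ε₁ X Xs Y Ys φ ψ) {V : SortE B}
    (hV : HD TB (m + 1) (.sort Y V)) {b : A.Var → Ex} (hb : M.Col w ε V X b) :
    ∀ p ∈ Xs, M.eq w (M.C ε V b (φ p.1)) (M.C ε V b (φ p.1)) :=
  P.flip.row_refl he.flip hg.flip S.flip hV hb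

theorem Below.bv_subst (P : M.Below TA TB n m) (he : M.Env w ε X Y)
    (hg : M.Good TA TB (n + 1) (m + 1) w ε X Y) {ε₁ : Nv A B Ex}
    (S : M.SubCtx TA TB n m w ε ε₁ X Xs Y Ys φ ψ) {v : Expr B} {V : SortE B}
    (hv : HD TB (m + 1) (.term Ys v V))
    (hv' : HD TB (m + 1) (.term Y (v.subst ψ) (V.subst ψ))) :
    ∀ p ∈ Xs, M.eq w (M.C ε (V.subst ψ) (M.bv ε (v.subst ψ)) (φ p.1)) (M.bv ε₁ v p.1) :=
  P.flip.au_subst he.flip hg.flip S.flip hv hv'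

theorem Below.col_bv {N K : ℕ} (hg : M.Good TA TB N K w ε X Y) {v : Expr B} {V : SortE B}
    (hv : HD TB K (.term Y v V)) : M.Col w ε V X (M.bv ε v) := hg.right.row hv

theorem Below.col_iff {N K : ℕ} (hg : M.Good TA TB N K w ε X Y) {V V' : SortE B}
    (hV : HD TB K (.sortEq Y V V')) (b : A.Var → Ex) : M.Col w ε V X b ↔ M.Col w ε V' X b :=
  hg.right.iff hV b

theorem Below.ss (P : M.Below TA TB n m) (he : M.Env w ε X Y)
    (hg : M.Good TA TB (n + 1) (m + 1) w ε X Y) {U : SortE A} {V : SortE B} {a : B.Var → Ex}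
    {b : A.Var → Ex} (hU : HD TA (n + 1) (.sort X U)) (hV : HD TB (m + 1) (.sort Y V))
    (ha : M.Row w ε U Y a) (hb : M.Col w ε V X b) :
    M.seq w (M.T2 ε U V a b) (M.T2 ε U V a b) := by
  obtain ⟨_, Xs, φ, e1, hax, hX, hv, hφ, hUe⟩ := hU.sort_inv
  cases e1
  obtain ⟨_, Ys, ψ, e1, hax', hY, hv', hψ, hVe⟩ := hV.sort_inv
  cases e1
  have hXs : HCtx TA n Xs := ⟨P.hA.nodup hax, P.hA.isPreCtx hax, hX⟩
  have hYs : HCtx TB m Ys := ⟨P.hB.nodup hax', P.hB.isPreCtx hax', hY⟩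
  have hS := HD.generic_sort hax hX hv
  have hT := HD.generic_sort hax' hY hv'
  obtain ⟨S, es⟩ := U
  obtain ⟨T, es'⟩ := V
  have hUe : (⟨S, es⟩ : SortE A) = _ := hUe.trans (SortE.subst_ctxVars S Xs φ).symm
  have hVe : (⟨T, es'⟩ : SortE B) = _ := hVe.trans (SortE.subst_ctxVars T Ys ψ).symm
  simp only at hS hT hax hax'
  rw [hUe] at hU ha ⊢
  rw [hVe] at hV hb ⊢
  obtain ⟨ε₁, Sb⟩ := P.exists_subCtx he hg hXs hYs hφ hψ
  have ha1 := P.row he hg Sb hS hU ha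
  have hb1 := P.col he hg Sb hT hV hb
  have h1 := P.L.sort_sort hax hax' (P.entries hXs hYs) (P.rowOk hXs hYs hS)
    (P.colOk hXs hYs hT) w ε₁ (P.env_subCtx Sb) _ _ ha1 hb1
  have h2 := (P.subI Sb).T2_inst P.L P.L' P.hA.shaped P.hB.shaped ⟨hS, hU⟩ ⟨hT, hV⟩
    (P.row_refl he hg Sb hU ha) (P.col_refl he hg Sb hV hb) h1
  exact P.L.seq_trans (P.L.seq_symm h2) h2

theorem Below.st (P : M.Below TA TB n m) (he : M.Env w ε X Y)
    (hg : M.Good TA TB (n + 1) (m + 1) w ε X Y) {U : SortE A} {V : SortE B} {v : Expr B}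
    {a : B.Var → Ex} (hU : HD TA (n + 1) (.sort X U)) (hv : HD TB (m + 1) (.term Y v V))
    (ha : M.Row w ε U Y a) : M.ty w (M.R ε U a v) (M.T2 ε U V a (M.bv ε v)) := by
  have F := (P.full he hg le_rfl (Nat.le_succ m) (by omega)).left
  have hv₀ := hv
  cases hv with
  | lift h => exact F.st hU h ha
  | conv h h' =>
    exact P.L.ty_conv (F.st hU h' ha)
      (F.ssq hU h ha (Below.col_bv hg h'.lift))
  | var hq h =>
    rename_i q
    have h1 : M.bv ε (.var q.1) = fun x => ε.ρ x q.1 := funext fun x => P.L.R_var ε _ _ _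
    rw [P.L.R_var, h1]
    exact ha _ hq
  | app hax' hY hvY hV hψ hVψ =>
    rename_i Ys t V ψ
    obtain ⟨_, Xs, φ, e1, hax, hX, hvX, hφ, hUe⟩ := hU.sort_inv
    cases e1
    have hXs : HCtx TA n Xs := ⟨P.hA.nodup hax, P.hA.isPreCtx hax, hX⟩
    have hYs : HCtx TB m Ys := ⟨P.hB.nodup hax', P.hB.isPreCtx hax', hY⟩
    have hS := HD.generic_sort hax hX hvX
    have hT := HD.generic_term hax' hY hvY hV
    obtain ⟨S, es⟩ := U
    have hUe : (⟨S, es⟩ : SortE A) = _ := hUe.trans (SortE.subst_ctxVars S Xs φ).symm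
    simp only at hS hax
    rw [hUe] at hU ha ⊢
    rw [← Expr.subst_ctxVars] at hv₀ ⊢
    obtain ⟨ε₁, Sb⟩ := P.exists_subCtx he hg hXs hYs hφ hψ
    have h1 := P.L.sort_term hax hax' (P.entries hXs hYs) (P.rowOk hXs hYs hS)
      (fun w' ε' he' a' ha' => (P.full he' (P.good hXs hYs he') le_rfl (Nat.le_succ m)
        (by omega)).ss hS hV ha' (Below.col_bv (P.good hXs hYs he') hT)) (P.env_subCtx Sb)
      (P.row he hg Sb hS hU ha)
    have h2 := (P.subI Sb).R_inst P.L P.hA.shaped P.hB.shaped ⟨hS, hU⟩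
      (P.row_refl he hg Sb hU ha) (v := .app t (ctxVars Ys)) ⟨V, hT, hv₀⟩ (P.L.ty_refl h1)
    have h3 := (P.subI Sb).T2_inst P.L P.L' P.hA.shaped P.hB.shaped ⟨hS, hU⟩
      ⟨hV.lift, hVψ.lift⟩ (P.row_refl he hg Sb hU ha)
      (P.bv_subst he hg Sb hT hv₀) (P.L.ty_sok h1)
    exact P.L.ty_conv (P.L.eq_ty h2 h1) h3

theorem Below.ssq (P : M.Below TA TB n m) (he : M.Env w ε X Y)
    (hg : M.Good TA TB (n + 1) (m + 1) w ε X Y) {U : SortE A} {V V' : SortE B}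
    {a : B.Var → Ex} {b : A.Var → Ex} (hU : HD TA (n + 1) (.sort X U))
    (hV : HD TB (m + 1) (.sortEq Y V V')) (ha : M.Row w ε U Y a) (hb : M.Col w ε V X b) :
    M.seq w (M.T2 ε U V a b) (M.T2 ε U V' a b) := by
  have F := P.full he hg le_rfl (Nat.le_succ m) (by omega)
  have F' := P.full he hg (Nat.le_succ n) le_rfl (by omega)
  have F₀ := P.full he hg (Nat.le_succ n) (Nat.le_succ m) (by omega)
  have hV₀ := hV
  cases hV with
  | lift h => exact F.left.ssq hU h ha hb
  | s1 h => exact F.ss hU h ha hb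
  | s2 h => exact P.L.seq_symm (F.left.ssq hU h ha ((Below.col_iff hg h.lift b).2 hb))
  | s3 h h' =>
    exact P.L.seq_trans (F.left.ssq hU h ha hb)
      (F.left.ssq hU h' ha ((Below.col_iff hg h.lift b).1 hb))
  | sortAx hax' hY hV hV' hvY hψ hVψ hVψ' =>
    rename_i Ys V V' ψ
    obtain ⟨_, Xs, φ, e1, hax, hX, hvX, hφ, hUe⟩ := hU.sort_inv
    cases e1
    have hXs : HCtx TA n Xs := ⟨P.hA.nodup hax, P.hA.isPreCtx hax, hX⟩
    have hYs : HCtx TB m Ys := ⟨P.hB.nodup hax', P.hB.isPreCtx hax', hY⟩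
    have hS := HD.generic_sort hax hX hvX
    have hE := HD.generic_sortEq hax' hY hvY hV hV'
    obtain ⟨S, es⟩ := U
    have hUe : (⟨S, es⟩ : SortE A) = _ := hUe.trans (SortE.subst_ctxVars S Xs φ).symm
    simp only at hS hax
    rw [hUe] at hU ha ⊢
    obtain ⟨ε₁, Sb⟩ := P.exists_subCtx he hg hXs hYs hφ hψ
    have hb1 := P.col he hg Sb hV.lift hVψ.lift hb
    have h1 := P.L.sort_sortEq hax hax' (P.entries hXs hYs) (P.rowOk hXs hYs hS)
      (P.colOk hXs hYs hV.lift) (fun w' ε' he' a' b' ha' hb' => by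
        have hg' := P.good hXs hYs he'
        have F' := P.full he' hg' le_rfl (Nat.le_succ m) (by omega)
        exact ⟨F'.ss hS hV ha' hb', F'.ss hS hV' ha' ((Below.col_iff hg' hE b').1 hb')⟩)
      (P.env_subCtx Sb) (P.row he hg Sb hS hU ha) hb1
    have h2 := (P.subI Sb).T2_inst P.L P.L' P.hA.shaped P.hB.shaped ⟨hS, hU⟩
      ⟨hV.lift, hVψ.lift⟩ (P.row_refl he hg Sb hU ha)
      (P.col_refl he hg Sb hVψ.lift hb)
      (P.L.seq_trans h1 (P.L.seq_symm h1))
    have hqt : ∀ p ∈ Xs, M.eq w (M.C ε (V.subst ψ) b (φ p.1)) (M.C ε (V'.subst ψ) b (φ p.1)) :=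
      fun p hp => F'.right.qt hV₀ (hφ p hp) hb
    have h3 := (P.subI Sb).T2_inst P.L P.L' P.hA.shaped P.hB.shaped ⟨hS, hU⟩
      ⟨hV'.lift, hVψ'.lift⟩ (P.row_refl he hg Sb hU ha)
      (fun p hp => P.L.eq_symm (hqt p hp))
      (P.L.seq_trans (P.L.seq_symm h1) h1)
    exact P.L.seq_trans (P.L.seq_symm h2) (P.L.seq_trans h1 h3)
  | sortCong hax' h1 h2 hψ =>
    rename_i Ys T ψ ψ'
    have := P.L.mkSS_cong (w := w) U.head T U.args Ys id id (fun q => ψ q.1) (fun q => ψ' q.1)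
      (M.I ε) (M.I ε) (M.R ε U a) (M.R ε U a) (M.C ε ⟨T, Ys.map fun q => ψ q.1⟩ b)
      (M.C ε ⟨T, Ys.map fun q => ψ' q.1⟩ b)
    simp only [List.map_id, id] at this
    obtain ⟨_, Xs, φ, e1, hax, hX, hvX, hφ, hUe⟩ := hU.sort_inv
    cases e1
    have hargs : ∀ s ∈ U.args, ∃ W, HD TA n (.term X s W) := by
      rw [hUe]
      intro s hs
      obtain ⟨p, hp, rfl⟩ := List.mem_map.1 hs
      exact ⟨_, hφ p hp⟩
    refine this (F.ss hU h1 ha hb) (fun s hs q hq => ?_)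
      (fun q hq => F.left.stq hU (hψ q hq) ha) fun s hs => ?_
    · obtain ⟨W, hW⟩ := hargs s hs
      have hq' := (hψ q hq).term_of_termEq
      exact P.L.eq_trans (F₀.tt hW hq'.1) (P.L.eq_trans
        (F₀.left.stq hW.sort_of_term (hψ q hq)
          ((hg.mono (Nat.le_succ n) (Nat.le_succ m)).left.row hW))
        (P.L.eq_symm (F₀.tt hW hq'.2)))
    · obtain ⟨W, hW⟩ := hargs s hs
      exact F'.right.qt hV₀ hW hb

theorem Below.stq (P : M.Below TA TB n m) (he : M.Env w ε X Y)
    (hg : M.Good TA TB (n + 1) (m + 1) w ε X Y) {U : SortE A} {V : SortE B} {v v' : Expr B}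
    {a : B.Var → Ex} (hU : HD TA (n + 1) (.sort X U)) (hv : HD TB (m + 1) (.termEq Y v v' V))
    (ha : M.Row w ε U Y a) : M.eq w (M.R ε U a v) (M.R ε U a v') := by
  have F := P.full he hg le_rfl (Nat.le_succ m) (by omega)
  have F₀ := P.full he hg (Nat.le_succ n) (Nat.le_succ m) (by omega)
  cases hv with
  | lift h => exact F.left.stq hU h ha
  | t1 h => exact P.L.ty_refl (F.left.st hU h ha)
  | t2 h => exact P.L.eq_symm (F.left.stq hU h ha)
  | t3 h h' => exact P.L.eq_trans (F.left.stq hU h ha) (F.left.stq hU h' ha)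
  | convEq h h1 => exact F.left.stq hU h1 ha
  | termAx hax' hY hv hv' hvY hψ hvψ hvψ' =>
    rename_i Ys v v' V ψ
    obtain ⟨_, Xs, φ, e1, hax, hX, hvX, hφ, hUe⟩ := hU.sort_inv
    cases e1
    have hXs : HCtx TA n Xs := ⟨P.hA.nodup hax, P.hA.isPreCtx hax, hX⟩
    have hYs : HCtx TB m Ys := ⟨P.hB.nodup hax', P.hB.isPreCtx hax', hY⟩
    have hS := HD.generic_sort hax hX hvX
    have hE := HD.generic_termEq hax' hY hvY hv hv'
    obtain ⟨S, es⟩ := U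
    have hUe : (⟨S, es⟩ : SortE A) = _ := hUe.trans (SortE.subst_ctxVars S Xs φ).symm
    simp only at hS hax
    rw [hUe] at hU ha ⊢
    obtain ⟨ε₁, Sb⟩ := P.exists_subCtx he hg hXs hYs hφ hψ
    have h1 := P.L.sort_termEq hax hax' (P.entries hXs hYs) (P.rowOk hXs hYs hS)
      (fun w' ε' he' a' ha' => by
        have hg' := P.good hXs hYs he'
        have F' := P.full he' hg' le_rfl (Nat.le_succ m) (by omega)
        have F'' := P.full he' hg' (Nat.le_succ n) le_rfl (by omega)
        have h2 := F'.left.st hS hv' ha'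
        refine ⟨F'.left.st hS hv ha', P.L.ty_conv h2 ?_⟩
        refine T2_congr P.L P.L' (X := Xs) (Y := Ys) (fun q hq => P.L.ty_refl (ha' q hq))
          (fun p hp => ?_) hS.sscoped hv.sort_of_term.sscoped (P.L.ty_sok h2)
        unfold bv
        rw [he'.cA p hp]
        obtain ⟨i, hi, rfl⟩ := List.getElem_of_mem hp
        exact P.L.eq_symm (F''.left.stq
          ((hXs.sort i hi).weaken (Y := Xs) fun q hq => List.mem_of_mem_take hq) hE
          (he'.ty _ hp)))
      (P.env_subCtx Sb) (P.row he hg Sb hS hU ha)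
    have h2 := (P.subI Sb).R_inst P.L P.hA.shaped P.hB.shaped ⟨hS, hU⟩
      (P.row_refl he hg Sb hU ha) ⟨V, hv.lift, hvψ.lift⟩ (P.L.eq_trans h1 (P.L.eq_symm h1))
    have h3 := (P.subI Sb).R_inst P.L P.hA.shaped P.hB.shaped ⟨hS, hU⟩
      (P.row_refl he hg Sb hU ha) ⟨V, hv'.lift, hvψ'.lift⟩ (P.L.eq_trans (P.L.eq_symm h1) h1)
    exact P.L.eq_trans (P.L.eq_symm h2) (P.L.eq_trans h1 h3)
  | termCong hax' h1 h2 hψ =>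
    rename_i Ys t V ψ ψ'
    have := P.L.mkSt_cong (w := w) U.head t U.args Ys id id (fun q => ψ q.1) (fun q => ψ' q.1)
      (M.I ε) (M.I ε) (M.R ε U a) (M.R ε U a)
    simp only [List.map_id, id] at this
    obtain ⟨_, Xs, φ, e1, hax, hX, hvX, hφ, hUe⟩ := hU.sort_inv
    cases e1
    have hargs : ∀ s ∈ U.args, ∃ W, HD TA n (.term X s W) := by
      rw [hUe]
      intro s hs
      obtain ⟨p, hp, rfl⟩ := List.mem_map.1 hs
      exact ⟨_, hφ p hp⟩
    have h3 := P.L.ty_refl (F.left.st hU h1 ha)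
    rw [P.L.R_app] at h3
    rw [P.L.R_app, P.L.R_app]
    refine this h3 (fun s hs q hq => ?_) fun q hq => F.left.stq hU (hψ q hq) ha
    obtain ⟨W, hW⟩ := hargs s hs
    have hq' := (hψ q hq).term_of_termEq
    exact P.L.eq_trans (F₀.tt hW hq'.1) (P.L.eq_trans
      (F₀.left.stq hW.sort_of_term (hψ q hq)
        ((hg.mono (Nat.le_succ n) (Nat.le_succ m)).left.row hW))
      (P.L.eq_symm (F₀.tt hW hq'.2)))

theorem Below.qt (P : M.Below TA TB n m) (he : M.Env w ε X Y)
    (hg : M.Good TA TB (n + 1) (m + 1) w ε X Y) {U U' : SortE A} {V : SortE B} {v : Expr B}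
    {a : B.Var → Ex} (hU : HD TA (n + 1) (.sortEq X U U')) (hv : HD TB (m + 1) (.term Y v V))
    (ha : M.Row w ε U Y a) : M.eq w (M.R ε U a v) (M.R ε U' a v) := by
  have F := P.full he hg le_rfl (Nat.le_succ m) (by omega)
  have F' := P.full he hg (Nat.le_succ n) le_rfl (by omega)
  have F₀ := P.full he hg (Nat.le_succ n) (Nat.le_succ m) (by omega)
  have hv₀ := hv
  cases hv with
  | lift h => exact F.left.qt hU h ha
  | conv h h' => exact F.left.qt hU h' ha
  | var hq h =>
    rw [P.L.R_var, P.L.R_var]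
    exact P.L.ty_refl (ha _ hq)
  | app hax' hY hvY hV hψ hVψ =>
    rename_i Ys t V ψ
    have hU₀ := hU
    cases hU with
    | lift h => exact F'.left.qt h hv₀ ha
    | s1 h => exact P.L.ty_refl (F'.left.st h hv₀ ha)
    | s2 h => exact P.L.eq_symm (F'.left.qt h hv₀ ((hg.left.iff h.lift a).2 ha))
    | s3 h h' =>
      exact P.L.eq_trans (F'.left.qt h hv₀ ha)
        (F'.left.qt h' hv₀ ((hg.left.iff h.lift a).1 ha))
    | sortAx hax hX hU hU' hvX hφ hUφ hUφ' =>
      rename_i Xs U U' φ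
      have hXs : HCtx TA n Xs := ⟨P.hA.nodup hax, P.hA.isPreCtx hax, hX⟩
      have hYs : HCtx TB m Ys := ⟨P.hB.nodup hax', P.hB.isPreCtx hax', hY⟩
      have hE := HD.generic_sortEq hax hX hvX hU hU'
      have hT := HD.generic_term hax' hY hvY hV
      rw [← Expr.subst_ctxVars] at hv₀ ⊢
      obtain ⟨ε₁, Sb⟩ := P.exists_subCtx he hg hXs hYs hφ hψ
      have ha' := (hg.left.iff hU₀ a).1 ha
      have h1 := P.L.sortEq_term hax hax' (P.entries hXs hYs) (P.rowOk hXs hYs hU.lift)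
        (fun w' ε' he' a' ha' => by
          have hg' := P.good hXs hYs he'
          have G := P.full he' hg' le_rfl (Nat.le_succ m) (by omega)
          have G' := P.full he' hg' (Nat.le_succ n) le_rfl (by omega)
          refine ⟨G'.left.st hU hT ha', P.L.ty_conv
            (G'.left.st hU' hT ((hg'.left.iff hE a').1 ha')) (P.L.seq_symm ?_)⟩
          exact G.right.ssq hV hE (Below.col_bv hg' hT) ha')
        (P.env_subCtx Sb) (P.row he hg Sb hU.lift hUφ.lift ha)
      have h2 := (P.subI Sb).R_subst P.L P.hA.shaped P.hB.shaped ⟨hU.lift, hUφ.lift⟩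
        (v := .app t (ctxVars Ys)) ⟨V, hT, hv₀⟩ (P.L.ty_refl (F'.left.st hUφ hv₀ ha))
      have h3 := (P.subI Sb).R_inst P.L P.hA.shaped P.hB.shaped ⟨hU'.lift, hUφ'.lift⟩
        (fun q hq => P.L.eq_symm (F.left.qt hU₀ (hψ q hq) ha))
        (v := .app t (ctxVars Ys)) ⟨V, hT, hv₀⟩ (P.L.eq_trans (P.L.eq_symm h1) h1)
      exact P.L.eq_trans h2 (P.L.eq_trans h1 h3)
    | sortCong hax h1 h2 hφ =>
      rename_i Xs S φ φ'
      have h3 := P.L.ty_refl (F'.left.st h1 hv₀ ha)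
      rw [P.L.R_app] at h3
      rw [P.L.R_app, P.L.R_app]
      refine P.L.mkSt_cong (w := w) S t Xs Ys (fun p => φ p.1) (fun p => φ' p.1)
        (fun q => ψ q.1) (fun q => ψ q.1) _ _ _ _ h3 (fun p hp q hq => ?_)
        fun q hq => F.left.qt hU₀ (hψ q hq) ha
      have hp' := (hφ p hp).term_of_termEq
      exact P.L.eq_trans (F₀.tt' hp'.1 (hψ q hq)) (P.L.eq_trans
        (F₀.right.stq (hψ q hq).sort_of_term (hφ p hp)
          ((hg.mono (Nat.le_succ n) (Nat.le_succ m)).right.row (hψ q hq)))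
        (P.L.eq_symm (F₀.tt' hp'.2 (hψ q hq))))

theorem Below.half (P : M.Below TA TB n m) (he : M.Env w ε X Y)
    (hg : M.Good TA TB (n + 1) (m + 1) w ε X Y) : M.Half TA TB (n + 1) (m + 1) w ε X Y :=
  ⟨P.st he hg, P.ssq he hg, P.stq he hg, P.qt he hg⟩

/-- The property of the pairing which is not symmetric. -/
def Pairs (M : Mdl A B Ex So W) (TA : Set (Judg A)) (TB : Set (Judg B)) : Prop :=
  ∀ {ε X Y n m u U v V}, Compat ε.sA X → Compat ε.sB Y → HD TA n (.term X u U) →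
    HD TB m (.term Y v V) →
    (∀ x, u = .var x → M.I ε u v = M.R ε (ε.sA x) (M.au ε u) v) ∧
      ∀ Xs t W φ, introTerm Xs t W ∈ TA → u = .app t (Xs.map fun p => φ p.1) →
        M.I ε u v = M.R ε (W.subst φ) (M.au ε u) v

theorem Below.tt (P : M.Below TA TB n m) (hM : M.Pairs TA TB) (he : M.Env w ε X Y)
    (hg : M.Good TA TB (n + 1) (m + 1) w ε X Y) {u : Expr A} {U : SortE A} {v : Expr B}
    {V : SortE B} (hu : HD TA (n + 1) (.term X u U)) (hv : HD TB (m + 1) (.term Y v V)) :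
    M.eq w (M.I ε u v) (M.R ε U (M.au ε u) v) := by
  have F' := P.full he hg (Nat.le_succ n) le_rfl (by omega)
  have h1 := P.L.ty_refl (P.st he hg hu.sort_of_term hv (hg.left.row hu))
  have h2 := hM he.cA he.cB hu hv
  cases hu with
  | lift h => exact F'.tt h hv
  | conv h h' =>
    exact P.L.eq_trans (F'.tt h' hv) (F'.left.qt h hv (hg.left.row h'.lift))
  | var hp h =>
    rw [h2.1 _ rfl, he.cA _ hp]
    exact h1
  | app hax =>
    rw [h2.2 _ _ _ _ hax rfl]
    exact h1

theorem Below.tt' (P : M.Below TA TB n m) (hM : M.Pairs TA TB) (he : M.Env w ε X Y)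
    (hg : M.Good TA TB (n + 1) (m + 1) w ε X Y) {u : Expr A} {U : SortE A} {v : Expr B}
    {V : SortE B} (hu : HD TA (n + 1) (.term X u U)) (hv : HD TB (m + 1) (.term Y v V)) :
    M.eq w (M.I ε u v) (M.C ε V (M.bv ε v) u) := by
  have F := P.full he hg le_rfl (Nat.le_succ m) (by omega)
  have F' := P.full he hg (Nat.le_succ n) le_rfl (by omega)
  have ht := P.tt hM he hg hu hv
  have hb := P.L.ty_refl
    (P.flip.st he.flip hg.flip hv.sort_of_term hu (Below.col_bv hg hv))
  have hu₀ := hu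
  have hv₀ := hv
  cases hv with
  | lift h => exact F.tt' hu h
  | conv h h' =>
    exact P.L.eq_trans (F.tt' hu h') (F.right.qt h hu (Below.col_bv hg h'.lift))
  | var hq h =>
    rename_i q
    have h1 : M.bv ε (.var q.1) = fun x => ε.ρ x q.1 := funext fun x => P.L.R_var ε _ _ _
    rw [P.L.R_var] at ht
    rw [h1]
    unfold au at ht
    rwa [he.cB _ hq] at ht
  | app hax' hY hvY hV hψ hVψ =>
    rename_i Ys t V ψ
    cases hu with
    | lift h => exact F'.tt' h hv₀
    | conv h h' => exact F'.tt' h' hv₀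
    | var hp h =>
      rename_i p
      have h1 : M.au ε (.var p.1) = fun y => ε.ρ p.1 y := funext fun y => P.L'.R_var ε.flip _ _ _
      have h2 : M.C ε (V.subst ψ) (M.bv ε (.app t (Ys.map fun p => ψ p.1))) (.var p.1) =
        M.bv ε (.app t (Ys.map fun p => ψ p.1)) p.1 := P.L'.R_var ε.flip _ _ _
      rw [h1] at ht
      rw [h2]
      unfold bv
      rwa [he.cA _ hp]
    | app hax hX hvX hU hφ hUφ =>
      rename_i Xs s U φ
      have hXs : HCtx TA n Xs := ⟨P.hA.nodup hax, P.hA.isPreCtx hax, hX⟩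
      have hYs : HCtx TB m Ys := ⟨P.hB.nodup hax', P.hB.isPreCtx hax', hY⟩
      have hS := HD.generic_term hax hX hvX hU
      have hT := HD.generic_term hax' hY hvY hV
      rw [← Expr.subst_ctxVars] at hv₀ hb ht ⊢
      rw [← Expr.subst_ctxVars] at hu₀ hb ht ⊢
      obtain ⟨ε₁, Sb⟩ := P.exists_subCtx he hg hXs hYs hφ hψ
      have h1 := (P.subI Sb).R_subst P.L P.hA.shaped P.hB.shaped ⟨hU.lift, hUφ.lift⟩
        (v := .app t (ctxVars Ys)) ⟨V, hT, hv₀⟩ (P.L.eq_trans (P.L.eq_symm ht) ht)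
      have h2 := R_congr P.L (P.au_subst he hg Sb hS hu₀) hT.scoped
        (P.L.eq_trans (P.L.eq_symm h1) h1)
      have h3 := (P.flip.subI Sb.flip).R_subst P.L' P.hB.shaped P.hA.shaped
        ⟨hV.lift, hVψ.lift⟩ (v := .app s (ctxVars Xs)) ⟨U, hS, hu₀⟩ hb
      have h4 := R_congr P.L' (P.bv_subst he hg Sb hT hv₀) hS.scoped
        (P.L'.eq_trans (P.L'.eq_symm h3) h3)
      have h5 := P.L.term_term hax hax' (P.entries hXs hYs) (fun w' ε' he' => by
        have hg' := P.good hXs hYs he'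
        have G := P.full he' hg' le_rfl (Nat.le_succ m) (by omega)
        have G' := P.full he' hg' (Nat.le_succ n) le_rfl (by omega)
        exact ⟨G'.left.st hU hT (hg'.left.row hS), G.right.st hV hS (hg'.right.row hT)⟩)
        (P.env_subCtx Sb)
      exact P.L.eq_trans ht (P.L.eq_trans h1 (P.L.eq_trans h2 (P.L.eq_trans h5
        (P.L.eq_symm (P.L.eq_trans h3 h4)))))

theorem H.of_laws (L : M.Laws TA TB) (L' : M.flip.Laws TB TA) (hA : Thy TA) (hB : Thy TB)
    (hM : M.Pairs TA TB) (N K : ℕ) : M.H TA TB N K := by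
  generalize hs : N + K = s
  induction s using Nat.strong_induction_on generalizing N K with
  | _ s ih =>
  intro w ε X Y he hg
  have h0 : ∀ {A : Alphabet} {T : Set (Judg A)} {J : Judg A}, ¬ HD T 0 J := fun h => by cases h
  obtain _ | n := N
  · exact ⟨⟨fun h => absurd h h0, fun h => absurd h h0, fun h => absurd h h0,
      fun h => absurd h h0⟩, ⟨fun _ h => absurd h h0, fun _ h => absurd h h0,
      fun _ h => absurd h h0, fun _ h => absurd h h0⟩, fun h => absurd h h0,
      fun h => absurd h h0, fun h => absurd h h0, fun h => absurd h h0⟩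
  obtain _ | m := K
  · exact ⟨⟨fun _ h => absurd h h0, fun _ h => absurd h h0, fun _ h => absurd h h0,
      fun _ h => absurd h h0⟩, ⟨fun h => absurd h h0, fun h => absurd h h0,
      fun h => absurd h h0, fun h => absurd h h0⟩, fun _ h => absurd h h0,
      fun _ h => absurd h h0, fun _ h => absurd h h0, fun _ h => absurd h h0⟩
  have P : M.Below TA TB n m := ⟨L, L', hA, hB, fun N K h => ih _ (by omega) N K rfl⟩
  exact ⟨P.half he hg, P.flip.half he.flip hg.flip, P.ss he hg, P.tt hM he hg, P.tt' hM he hg,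
    fun hu hv => L.eq_ty (L.eq_symm (P.tt hM he hg hu hv))
      (P.st he hg hu.sort_of_term hv (hg.left.row hu))⟩

end Mdl

/-! ## Canonical sorts and heights -/

section heights

variable {Ax : Set (Judg A)}

theorem HD.var_inv {n : ℕ} {X : PreCtx A} {x : A.Var} {W : SortE A}
    (h : HD Ax n (.term X (.var x) W)) :
    ∃ m, n = m + 1 ∧ ∃ p ∈ X, p.1 = x ∧ HD Ax m (.sort X p.2) := by
  generalize hJ : Judg.term X (.var x) W = J at h
  induction h generalizing W with
  | lift h ih =>
    obtain ⟨m, rfl, p, hp, hx, h⟩ := ih hJ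
    exact ⟨_, rfl, p, hp, hx, h.lift⟩
  | conv h h' _ ih =>
    cases hJ
    obtain ⟨m, rfl, p, hp, hx, h⟩ := ih rfl
    exact ⟨_, rfl, p, hp, hx, h.lift⟩
  | var hp h => cases hJ; exact ⟨_, rfl, _, hp, rfl, h⟩
  | _ => cases hJ

theorem HD.app_sort_inv {n : ℕ} {X : PreCtx A} {t : A.TermSym} {es : List (Expr A)}
    {W : SortE A} (h : HD Ax n (.term X (.app t es) W)) :
    ∃ m Xs U, ∃ φ : A.Var → Expr A, n = m + 1 ∧ introTerm Xs t U ∈ Ax ∧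
      (∀ p ∈ Xs, HD Ax m (.term X (φ p.1) (p.2.subst φ))) ∧ SScoped Xs U ∧
      HD Ax m (.sort X (U.subst φ)) ∧ es = Xs.map fun p => φ p.1 := by
  generalize hJ : Judg.term X (.app t es) W = J at h
  induction h generalizing W with
  | lift h ih =>
    obtain ⟨m, Xs, U, φ, rfl, h1, h2, h3, h4, h5⟩ := ih hJ
    exact ⟨_, Xs, U, φ, rfl, h1, fun p hp => (h2 p hp).lift, h3, h4.lift, h5⟩
  | conv h h' _ ih =>
    cases hJ
    obtain ⟨m, Xs, U, φ, rfl, h1, h2, h3, h4, h5⟩ := ih rfl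
    exact ⟨_, Xs, U, φ, rfl, h1, fun p hp => (h2 p hp).lift, h3, h4.lift, h5⟩
  | app hax hX hv hU hφ hUφ =>
    cases hJ
    exact ⟨_, _, _, _, rfl, hax, hφ, hU.sscoped, hUφ, rfl⟩
  | _ => cases hJ

theorem HD.app_args {n : ℕ} {X : PreCtx A} {t : A.TermSym} {es : List (Expr A)}
    {W : SortE A} (h : HD Ax n (.term X (.app t es) W)) :
    ∃ m, n = m + 1 ∧ ∀ e ∈ es, ∃ U, HD Ax m (.term X e U) := by
  obtain ⟨m, Xs, U, φ, rfl, -, h', -, -, rfl⟩ := h.app_sort_inv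
  refine ⟨m, rfl, fun e he => ?_⟩
  obtain ⟨p, hp, rfl⟩ := List.mem_map.1 he
  exact ⟨_, h' p hp⟩

theorem HD.sort_args {n : ℕ} {X : PreCtx A} {U : SortE A} (h : HD Ax n (.sort X U)) :
    ∃ m, n = m + 1 ∧ ∀ e ∈ U.args, ∃ U, HD Ax m (.term X e U) := by
  obtain ⟨m, Xs, φ, rfl, -, -, -, h', hU⟩ := h.sort_inv
  refine ⟨m, rfl, fun e he => ?_⟩
  rw [hU] at he
  obtain ⟨p, hp, rfl⟩ := List.mem_map.1 he
  exact ⟨_, h' p hp⟩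

/-- Derivable sorts, by heights. -/
def SD (Ax : Set (Judg A)) (X : PreCtx A) (U : SortE A) : Prop := ∃ n, HD Ax n (.sort X U)

/-- Derivable terms, by heights. -/
def TD (Ax : Set (Judg A)) (X : PreCtx A) (u : Expr A) : Prop := ∃ n U, HD Ax n (.term X u U)

variable {X : PreCtx A} {U : SortE A} {u : Expr A}

theorem SD.args (h : SD Ax X U) : ∀ e ∈ U.args, TD Ax X e := by
  obtain ⟨n, h⟩ := h
  obtain ⟨m, rfl, h'⟩ := h.sort_args
  exact fun e he => ⟨m, h' e he⟩

theorem TD.args {t : A.TermSym} {es : List (Expr A)} (h : TD Ax X (.app t es)) :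
    ∀ e ∈ es, TD Ax X e := by
  obtain ⟨n, U, h⟩ := h
  obtain ⟨m, rfl, h'⟩ := h.app_args
  exact fun e he => ⟨m, h' e he⟩

theorem TD.var_inv {x : A.Var} (h : TD Ax X (.var x)) : ∃ p ∈ X, p.1 = x ∧ SD Ax X p.2 := by
  obtain ⟨n, U, h⟩ := h
  obtain ⟨m, rfl, p, hp, h1, h2⟩ := h.var_inv
  exact ⟨p, hp, h1, m, h2⟩

/-- A choice of introducing axioms for the term symbols. -/
def IntroFn (Ax : Set (Judg A)) (ax : A.TermSym → PreCtx A × SortE A) : Prop :=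
  ∀ t, introTerm (ax t).1 t (ax t).2 ∈ Ax

/-- The canonical sort of a term, for an assignment of sorts to the variables. -/
noncomputable def canS (ax : A.TermSym → PreCtx A × SortE A) (s : A.Var → SortE A) :
    Expr A → SortE A
  | .var x => s x
  | .app t es => (ax t).2.substL (mkSub (ax t).1 es)

variable {ax : A.TermSym → PreCtx A × SortE A} {s : A.Var → SortE A}

theorem IntroFn.eq (ha : IntroFn Ax ax) (hs : Shaped Ax) {Xs : PreCtx A} {t : A.TermSym}
    {W : SortE A} (h : introTerm Xs t W ∈ Ax) : ax t = (Xs, W) := by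
  obtain ⟨h1, h2⟩ := hs.term_unique (ha t) h
  exact Prod.ext h1 h2

theorem canS_app (ha : IntroFn Ax ax) (hT : Thy Ax) {Xs : PreCtx A} {t : A.TermSym}
    {W : SortE A} (h : introTerm Xs t W ∈ Ax) (hW : SScoped Xs W) (φ : A.Var → Expr A) :
    canS ax s (.app t (Xs.map fun p => φ p.1)) = W.subst φ := by
  rw [canS, ha.eq hT.shaped h]
  refine SortE.subst_congr fun x hx => ?_
  obtain ⟨p, hp, rfl⟩ := List.mem_map.1 (hW x hx)
  obtain ⟨i, hi, rfl⟩ := List.getElem_of_mem hp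
  simp only
  have hn : (keys Xs).Nodup := hT.nodup h
  have := lookupV_mkSub_getElem (f := Xs.map fun p => φ p.1) hn (by simp) hi
  simpa [hi] using this

theorem HD.canS (ha : IntroFn Ax ax) (hT : Thy Ax) (hs : Compat s X) {n : ℕ}
    (h : HD Ax n (.term X u U)) : ∃ m, n = m + 1 ∧ HD Ax m (.sort X (canS ax s u)) := by
  cases u with
  | var x =>
    obtain ⟨m, rfl, p, hp, rfl, h'⟩ := h.var_inv
    refine ⟨m, rfl, ?_⟩
    rw [GATPaper.canS, hs p hp]
    exact h'
  | app t es =>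
    obtain ⟨m, Xs, U, φ, rfl, h1, -, h2, h3, rfl⟩ := h.app_sort_inv
    refine ⟨m, rfl, ?_⟩
    rw [canS_app ha hT h1 h2]
    exact h3

theorem TD.canS (ha : IntroFn Ax ax) (hT : Thy Ax) (hs : Compat s X) (h : TD Ax X u) :
    SD Ax X (canS ax s u) := by
  obtain ⟨n, U, h⟩ := h
  obtain ⟨m, -, h⟩ := h.canS ha hT hs
  exact ⟨m, h⟩

theorem canS_congr {s' : A.Var → SortE A} (hs : Compat s X) (hs' : Compat s' X)
    (hu : Scoped X u) : GATPaper.canS ax s u = GATPaper.canS ax s' u := by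
  cases u with
  | var x =>
    obtain ⟨p, hp, rfl⟩ := List.mem_map.1 (hu x .var)
    rw [GATPaper.canS, GATPaper.canS, hs p hp, hs' p hp]
  | app t es => rfl

theorem CanonSort.eq_canS (ha : IntroFn Ax ax) (hT : Shaped Ax) (hs : Compat s X)
    (h : CanonSort Ax X u U) : U = GATPaper.canS ax s u := by
  cases h with
  | var hi => exact (hs _ (List.getElem_mem hi)).symm
  | app h => rw [GATPaper.canS, ha.eq hT h]

theorem TD.canonSort (ha : IntroFn Ax ax) (hs : Compat s X) (h : TD Ax X u) :
    CanonSort Ax X u (GATPaper.canS ax s u) := by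
  cases u with
  | var x =>
    obtain ⟨p, hp, rfl, -⟩ := h.var_inv
    obtain ⟨i, hi, rfl⟩ := List.getElem_of_mem hp
    rw [GATPaper.canS, hs _ hp]
    exact .var hi
  | app t es => exact .app (ha t)

end heights

/-! ## Grids -/

section grids

variable {α β γ : Type}

theorem length_grid (ks : List α) (ls : List β) (f : α → β → γ) :
    (ks.flatMap fun k => ls.map (f k)).length = ks.length * ls.length := by
  induction ks with
  | nil => simp
  | cons k ks ih => simp only [List.flatMap_cons, List.length_append, ih, List.length_map,
      List.length_cons]; ring

theorem getElem_grid (ks : List α) (ls : List β) (f : α → β → γ) {i j : ℕ}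
    (hi : i < ks.length) (hj : j < ls.length)
    (h : i * ls.length + j < (ks.flatMap fun k => ls.map (f k)).length) :
    (ks.flatMap fun k => ls.map (f k))[i * ls.length + j]'h = f (ks[i]'hi) (ls[j]'hj) := by
  induction ks generalizing i with
  | nil => simp at hi
  | cons k ks ih =>
    simp only [List.flatMap_cons]
    cases i with
    | zero =>
      rw [List.getElem_append_left (by simpa using hj)]
      simp
    | succ i =>
      have hi' : i < ks.length := by simpa using hi
      have e : (i + 1) * ls.length + j = (ls.map (f k)).length + (i * ls.length + j) := by
        rw [List.length_map]; ring
      have h' : i * ls.length + j < (ks.flatMap fun k => ls.map (f k)).length := by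
        rw [List.flatMap_cons, List.length_append, e] at h
        omega
      simp only [e, List.getElem_append_right (Nat.le_add_right _ _), Nat.add_sub_cancel_left,
        List.getElem_cons_succ]
      exact ih hi' h'

theorem exists_grid_index {m n k : ℕ} (h : k < m * n) :
    ∃ i j, i < m ∧ j < n ∧ k = i * n + j := by
  have hn : 0 < n := Nat.pos_of_ne_zero fun h0 => by simp [h0] at h
  exact ⟨k / n, k % n, by rwa [Nat.div_lt_iff_lt_mul hn], Nat.mod_lt _ hn,
    (Nat.div_add_mod' k n).symm⟩

theorem grid_index_lt {m n i j : ℕ} (hi : i < m) (hj : j < n) : i * n + j < m * n := by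
  calc i * n + j < i * n + n := by omega
    _ = (i + 1) * n := by ring
    _ ≤ m * n := Nat.mul_le_mul_right n hi

theorem eq_grid (ks : List α) (ls : List β) (f : α → β → γ) {L : List γ}
    (hL : L.length = ks.length * ls.length)
    (h : ∀ i j (hi : i < ks.length) (hj : j < ls.length) (h : i * ls.length + j < L.length),
      L[i * ls.length + j]'h = f (ks[i]'hi) (ls[j]'hj)) :
    L = ks.flatMap fun k => ls.map (f k) := by
  refine List.ext_getElem (by rw [hL, length_grid]) fun k h1 h2 => ?_
  obtain ⟨i, j, hi, hj, rfl⟩ := exists_grid_index (hL ▸ h1)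
  rw [h i j hi hj h1, getElem_grid ks ls f hi hj]

end grids

/-! ## The pairing operations -/

section pairing

/-- A list followed by `none`. -/
def optL {α : Type} (l : List α) : List (Option α) := l.map some ++ [none]

/-- The term attached to a sort symbol and a term symbol. -/
def gSt (S : A.SortSym) (t : B.TermSym) (ss : List (Expr A)) (ts : List (Expr B))
    (i : Expr A → Expr B → Expr (A.tensor B)) (r : Expr B → Expr (A.tensor B)) :
    Expr (A.tensor B) :=
  .app (Sum.inl (S, t))
    ((optL ss).flatMap fun o => ts.map fun t => o.elim (r t) fun s => i s t)

/-- The term attached to a term symbol and a sort symbol. -/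
def gTs (s : A.TermSym) (T : B.SortSym) (ss : List (Expr A)) (ts : List (Expr B))
    (i : Expr A → Expr B → Expr (A.tensor B)) (c : Expr A → Expr (A.tensor B)) :
    Expr (A.tensor B) :=
  .app (Sum.inr (s, T)) (ss.flatMap fun s => (optL ts).map fun o => o.elim (c s) (i s))

/-- The sort attached to two sort symbols. -/
def gSS (S : A.SortSym) (T : B.SortSym) (ss : List (Expr A)) (ts : List (Expr B))
    (i : Expr A → Expr B → Expr (A.tensor B)) (r : Expr B → Expr (A.tensor B))
    (c : Expr A → Expr (A.tensor B)) : SortE (A.tensor B) :=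
  ⟨(S, T), (ss.flatMap fun s => (optL ts).map fun o => o.elim (c s) (i s)) ++ ts.map r⟩

/-- The pairing of a generic element of a sort with a term, given the pairing of terms. -/
def pairR (I : Expr A → Expr B → Expr (A.tensor B)) (U : SortE A)
    (a : B.Var → Expr (A.tensor B)) : Expr B → Expr (A.tensor B)
  | .var y => a y
  | .app t ts => .app (Sum.inl (U.head, t))
    ((optL U.args).flatMap fun o => ts.attach.map fun t => o.elim (pairR I U a t.1) fun s => I s t.1)
termination_by v => sizeOf v
decreasing_by
  have := List.sizeOf_lt_of_mem t.2
  simp only [Expr.app.sizeOf_spec]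
  omega

/-- The pairing of a term with a generic element of a sort, given the pairing of terms. -/
def pairC (I : Expr A → Expr B → Expr (A.tensor B)) (V : SortE B)
    (b : A.Var → Expr (A.tensor B)) : Expr A → Expr (A.tensor B)
  | .var x => b x
  | .app s ss => .app (Sum.inr (s, V.head))
    (ss.attach.flatMap fun s => (optL V.args).map fun o => o.elim (pairC I V b s.1) (I s.1))
termination_by u => sizeOf u
decreasing_by
  have := List.sizeOf_lt_of_mem s.2
  simp only [Expr.app.sizeOf_spec]
  omega

variable {I I' : Expr A → Expr B → Expr (A.tensor B)} {U : SortE A} {V : SortE B}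
  {a a' : B.Var → Expr (A.tensor B)} {b b' : A.Var → Expr (A.tensor B)}

@[simp] theorem pairR_var (y : B.Var) : pairR I U a (.var y) = a y := by rw [pairR]

@[simp] theorem pairC_var (x : A.Var) : pairC I V b (.var x) = b x := by rw [pairC]

theorem pairR_app (t : B.TermSym) (ts : List (Expr B)) :
    pairR I U a (.app t ts) = gSt U.head t U.args ts I (pairR I U a) := by
  rw [pairR, gSt]
  congr 2
  funext o
  rw [← List.attach_map_subtype_val (l := ts), List.map_map]
  simp [Function.comp_def]

theorem pairC_app (s : A.TermSym) (ss : List (Expr A)) :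
    pairC I V b (.app s ss) = gTs s V.head ss V.args I (pairC I V b) := by
  rw [pairC, gTs]
  congr 1
  conv_rhs => rw [← List.attach_map_subtype_val (l := ss), List.flatMap_map]

theorem gSt_subst {σ : A.Var × B.Var → Expr (A.tensor B)} {S : A.SortSym} {t : B.TermSym}
    {ss : List (Expr A)} {ts : List (Expr B)} {r r' : Expr B → Expr (A.tensor B)}
    (hi : ∀ s ∈ ss, ∀ t ∈ ts, I' s t = (I s t).subst σ)
    (hr : ∀ t ∈ ts, r' t = (r t).subst σ) :
    gSt S t ss ts I' r' = (gSt S t ss ts I r).subst σ := by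
  simp only [gSt, Expr.subst_app, List.map_flatMap, List.map_map]
  congr 1
  refine List.flatMap_congr fun o ho => List.map_congr_left fun t ht => ?_
  rcases List.mem_append.1 ho with h | h
  · obtain ⟨s, hs, rfl⟩ := List.mem_map.1 h
    exact hi s hs t ht
  · cases List.mem_singleton.1 h
    exact hr t ht

theorem gTs_subst {σ : A.Var × B.Var → Expr (A.tensor B)} {s : A.TermSym} {T : B.SortSym}
    {ss : List (Expr A)} {ts : List (Expr B)} {c c' : Expr A → Expr (A.tensor B)}
    (hi : ∀ s ∈ ss, ∀ t ∈ ts, I' s t = (I s t).subst σ)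
    (hc : ∀ s ∈ ss, c' s = (c s).subst σ) :
    gTs s T ss ts I' c' = (gTs s T ss ts I c).subst σ := by
  simp only [gTs, Expr.subst_app, List.map_flatMap, List.map_map]
  congr 1
  refine List.flatMap_congr fun s hs => List.map_congr_left fun o ho => ?_
  rcases List.mem_append.1 ho with h | h
  · obtain ⟨t, ht, rfl⟩ := List.mem_map.1 h
    exact hi s hs t ht
  · cases List.mem_singleton.1 h
    exact hc s hs

theorem gSS_subst {σ : A.Var × B.Var → Expr (A.tensor B)} {S : A.SortSym} {T : B.SortSym}
    {ss : List (Expr A)} {ts : List (Expr B)} {r r' : Expr B → Expr (A.tensor B)}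
    {c c' : Expr A → Expr (A.tensor B)}
    (hi : ∀ s ∈ ss, ∀ t ∈ ts, I' s t = (I s t).subst σ)
    (hr : ∀ t ∈ ts, r' t = (r t).subst σ) (hc : ∀ s ∈ ss, c' s = (c s).subst σ) :
    gSS S T ss ts I' r' c' = (gSS S T ss ts I r c).subst σ := by
  change gSS S T ss ts I' r' c' = ⟨_, ((gSS S T ss ts I r c).args).map (Expr.subst σ)⟩
  simp only [gSS, List.map_flatMap, List.map_map, List.map_append]
  congr 2
  · refine List.flatMap_congr fun s hs => List.map_congr_left fun o ho => ?_
    rcases List.mem_append.1 ho with h | h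
    · obtain ⟨t, ht, rfl⟩ := List.mem_map.1 h
      exact hi s hs t ht
    · cases List.mem_singleton.1 h
      exact hc s hs
  · exact List.map_congr_left hr

theorem pairR_subst {σ : A.Var × B.Var → Expr (A.tensor B)} {P : Expr B → Prop}
    (hP : ∀ t ts, P (.app t ts) → ∀ w ∈ ts, P w)
    (hI : ∀ s ∈ U.args, ∀ w, P w → I' s w = (I s w).subst σ)
    (ha : ∀ y, P (.var y) → a' y = (a y).subst σ) {v : Expr B} (hv : P v) :
    pairR I' U a' v = (pairR I U a v).subst σ := by
  induction v using Expr.ind with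
  | hv y => simpa using ha y hv
  | ha t ts ih =>
    rw [pairR_app, pairR_app]
    exact gSt_subst (fun s hs w hw => hI s hs w (hP t ts hv w hw)) fun w hw =>
      ih w hw (hP t ts hv w hw)

theorem pairC_subst {σ : A.Var × B.Var → Expr (A.tensor B)} {P : Expr A → Prop}
    (hP : ∀ t ts, P (.app t ts) → ∀ w ∈ ts, P w)
    (hI : ∀ s ∈ V.args, ∀ w, P w → I' w s = (I w s).subst σ)
    (hb : ∀ x, P (.var x) → b' x = (b x).subst σ) {u : Expr A} (hu : P u) :
    pairC I' V b' u = (pairC I V b u).subst σ := by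
  induction u using Expr.ind with
  | hv x => simpa using hb x hu
  | ha t ts ih =>
    rw [pairC_app, pairC_app]
    exact gTs_subst (fun w hw s hs => hI s hs w (hP t ts hu w hw)) fun w hw =>
      ih w hw (hP t ts hu w hw)

/-- Approximations of the pairing of two terms. -/
noncomputable def pairA (ax : A.TermSym → PreCtx A × SortE A)
    (ε : Nv A B (Expr (A.tensor B))) : ℕ → Expr A → Expr B → Expr (A.tensor B)
  | 0, _, _ => .var (Classical.arbitrary A.Var, Classical.arbitrary B.Var)
  | k + 1, u, v => pairR (pairA ax ε k) (canS ax ε.sA u)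
      (fun y => pairC (pairA ax ε k) (ε.sB y) (fun x => ε.ρ x y) u) v

open Classical in
/-- The pairing of two terms. -/
noncomputable def pairI (ax : A.TermSym → PreCtx A × SortE A)
    (ε : Nv A B (Expr (A.tensor B))) (u : Expr A) (v : Expr B) : Expr (A.tensor B) :=
  if h : ∃ e, ∀ᶠ k in Filter.atTop, pairA ax ε k u v = e then h.choose
  else pairA ax ε 0 u v

/-- The second environment is obtained from the first one by a substitution. -/
structure Agr (X : PreCtx A) (Y : PreCtx B) (ε ε' : Nv A B (Expr (A.tensor B)))
    (σ : A.Var × B.Var → Expr (A.tensor B)) : Prop where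
  cA : Compat ε.sA X
  cA' : Compat ε'.sA X
  cB : Compat ε.sB Y
  cB' : Compat ε'.sB Y
  ρ : ∀ p ∈ X, ∀ q ∈ Y, ε'.ρ p.1 q.1 = (ε.ρ p.1 q.1).subst σ

theorem Agr.refl {X : PreCtx A} {Y : PreCtx B} {ε : Nv A B (Expr (A.tensor B))}
    (hA : Compat ε.sA X) (hB : Compat ε.sB Y) : Agr X Y ε ε (Expr.var (A := A.tensor B)) :=
  ⟨hA, hA, hB, hB, fun _ _ _ _ => by rw [Expr.subst_id]⟩

variable {TA : Set (Judg A)} {TB : Set (Judg B)} {ax : A.TermSym → PreCtx A × SortE A}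
  {X : PreCtx A} {Y : PreCtx B} {ε ε' : Nv A B (Expr (A.tensor B))}
  {σ : A.Var × B.Var → Expr (A.tensor B)} {u : Expr A} {v : Expr B}

theorem pairA_subst (ha : IntroFn TA ax) (hA : Thy TA) (he : Agr X Y ε ε' σ) {n m k k' : ℕ}
    {W : SortE A} {W' : SortE B} (hu : HD TA n (.term X u W)) (hv : HD TB m (.term Y v W'))
    (hk : n + m ≤ k) (hk' : n + m ≤ k') : pairA ax ε' k' u v = (pairA ax ε k u v).subst σ := by
  generalize hN : n + m = N at hk hk'
  induction N using Nat.strong_induction_on generalizing n m k k' u v W W' with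
  | _ N ih =>
  obtain ⟨n, rfl, hcu⟩ := hu.canS ha hA he.cA
  obtain ⟨k, rfl⟩ := Nat.exists_eq_succ_of_ne_zero (by omega : k ≠ 0)
  obtain ⟨k', rfl⟩ := Nat.exists_eq_succ_of_ne_zero (by omega : k' ≠ 0)
  obtain ⟨n', rfl, hargs⟩ := hcu.sort_args
  rw [pairA, pairA, canS_congr he.cA' he.cA hu.scoped]
  refine pairR_subst (P := fun w => ∃ m' ≤ m, ∃ W, HD TB m' (.term Y w W)) ?_ ?_ ?_
    ⟨m, le_rfl, _, hv⟩
  · rintro t ts ⟨m', hm, W, h⟩ w hw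
    obtain ⟨m'', rfl, h'⟩ := h.app_args
    exact ⟨m'', by omega, h' w hw⟩
  · rintro s hs w ⟨m', hm, W, h⟩
    obtain ⟨W', h'⟩ := hargs s hs
    exact ih _ (by omega) h' h rfl (by omega) (by omega)
  · rintro y ⟨m', hm, W, h⟩
    obtain ⟨m'', rfl, q, hq, rfl, h'⟩ := h.var_inv
    obtain ⟨l, rfl, hargs'⟩ := h'.sort_args
    rw [he.cB q hq, he.cB' q hq]
    refine pairC_subst (P := fun w => ∃ n'' ≤ n' + 1 + 1, ∃ W, HD TA n'' (.term X w W)) ?_ ?_ ?_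
      ⟨_, le_rfl, _, hu⟩
    · rintro t ts ⟨m', hm, W, h⟩ w hw
      obtain ⟨m'', rfl, h'⟩ := h.app_args
      exact ⟨m'', by omega, h' w hw⟩
    · rintro s hs w ⟨n'', hn, W, h⟩
      obtain ⟨W', h'⟩ := hargs' s hs
      exact ih _ (by omega) h h' rfl (by omega) (by omega)
    · rintro x ⟨m', hm, W, h⟩
      obtain ⟨-, -, p, hp, rfl, -⟩ := h.var_inv
      exact he.ρ p hp q hq

theorem pairI_eq_pairA (ha : IntroFn TA ax) (hA : Thy TA) (hsA : Compat ε.sA X)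
    (hsB : Compat ε.sB Y) {n m k : ℕ} {W : SortE A} {W' : SortE B}
    (hu : HD TA n (.term X u W)) (hv : HD TB m (.term Y v W')) (hk : n + m ≤ k) :
    pairI ax ε u v = pairA ax ε k u v := by
  have key : ∀ l, n + m ≤ l → pairA ax ε l u v = pairA ax ε k u v := fun l hl => by
    simpa only [Expr.subst_id] using pairA_subst ha hA (Agr.refl hsA hsB) hu hv hk hl
  have h : ∃ e, ∀ᶠ k in Filter.atTop, pairA ax ε k u v = e :=
    ⟨_, (Filter.eventually_ge_atTop (n + m)).mono key⟩
  rw [pairI, dif_pos h]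
  obtain ⟨l, h1, h2⟩ := (h.choose_spec.and (Filter.eventually_ge_atTop (n + m))).exists
  rw [← h1, key l h2]

theorem pairI_subst (ha : IntroFn TA ax) (hA : Thy TA) (he : Agr X Y ε ε' σ)
    (hu : TD TA X u) (hv : TD TB Y v) : pairI ax ε' u v = (pairI ax ε u v).subst σ := by
  obtain ⟨n, W, hu⟩ := hu
  obtain ⟨m, W', hv⟩ := hv
  rw [pairI_eq_pairA ha hA he.cA he.cB hu hv le_rfl,
    pairI_eq_pairA ha hA he.cA' he.cB' hu hv le_rfl]
  exact pairA_subst ha hA he hu hv le_rfl le_rfl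

theorem pairI_eq (ha : IntroFn TA ax) (hA : Thy TA) (hsA : Compat ε.sA X)
    (hsB : Compat ε.sB Y) (hu : TD TA X u) (hv : TD TB Y v) :
    pairI ax ε u v = pairR (pairI ax ε) (canS ax ε.sA u)
      (fun y => pairC (pairI ax ε) (ε.sB y) (fun x => ε.ρ x y) u) v := by
  obtain ⟨n, W, hu⟩ := hu
  obtain ⟨m, W', hv⟩ := hv
  rw [pairI_eq_pairA ha hA hsA hsB hu hv (Nat.le_succ _), pairA]
  obtain ⟨n, rfl, hcu⟩ := hu.canS ha hA hsA
  obtain ⟨n', rfl, hargs⟩ := hcu.sort_args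
  nth_rw 1 [← Expr.subst_id (pairR (pairI ax ε) _ _ v)]
  symm
  rw [Expr.subst_id]
  nth_rw 1 [← Expr.subst_id (pairR (pairA ax ε _) _ _ v)]
  refine pairR_subst (P := fun w => ∃ m' ≤ m, ∃ W, HD TB m' (.term Y w W)) ?_ ?_ ?_
    ⟨m, le_rfl, _, hv⟩
  · rintro t ts ⟨m', hm, W, h⟩ w hw
    obtain ⟨m'', rfl, h'⟩ := h.app_args
    exact ⟨m'', by omega, h' w hw⟩
  · rintro s hs w ⟨m', hm, W, h⟩
    obtain ⟨W', h'⟩ := hargs s hs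
    rw [Expr.subst_id]
    exact pairI_eq_pairA ha hA hsA hsB h' h (by omega)
  · rintro y ⟨m', hm, W, h⟩
    obtain ⟨m'', rfl, q, hq, rfl, h'⟩ := h.var_inv
    obtain ⟨l, rfl, hargs'⟩ := h'.sort_args
    rw [hsB q hq]
    refine pairC_subst (P := fun w => ∃ n'' ≤ n' + 1 + 1, ∃ W, HD TA n'' (.term X w W)) ?_ ?_ ?_
      ⟨_, le_rfl, _, hu⟩
    · rintro t ts ⟨m', hm, W, h⟩ w hw
      obtain ⟨m'', rfl, h'⟩ := h.app_args
      exact ⟨m'', by omega, h' w hw⟩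
    · rintro s hs w ⟨n'', hn, W, h⟩
      obtain ⟨W', h'⟩ := hargs' s hs
      rw [Expr.subst_id]
      exact pairI_eq_pairA ha hA hsA hsB h h' (by omega)
    · rintro x -
      rw [Expr.subst_id]

end pairing

/-! ## The syntactic model -/

/-- The model given by the expressions of the tensor alphabet, with the contexts of a theory
as worlds. -/
noncomputable def synM (T : Set (Judg (A.tensor B))) (ax : A.TermSym → PreCtx A × SortE A) :
    Mdl A B (Expr (A.tensor B)) (SortE (A.tensor B))
      {Z : PreCtx (A.tensor B) // Derivable T (.ctx Z)} where
  mkSS := gSS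
  mkSt := gSt
  mkTs := gTs
  ty w e s := Derivable T (.term w.1 e s)
  eq w e e' := TEq T w.1 e e'
  seq w s s' := Derivable T (.sortEq w.1 s s')
  I := pairI ax
  R ε := pairR (pairI ax ε)
  C ε := pairC (pairI ax ε)

/-- Well-formed contexts, by heights. -/
def CD (Ax : Set (Judg A)) (X : PreCtx A) : Prop := ∃ n, HCtx Ax n X

section

variable {Ax : Set (Judg A)} {X : PreCtx A} {U : SortE A}

theorem CD.take (h : CD Ax X) (k : ℕ) : CD Ax (X.take k) := h.imp fun _ h => h.take k

theorem CD.sort_take (h : CD Ax X) (i : ℕ) (hi : i < X.length) :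
    SD Ax (X.take i) (X[i]'hi).2 := h.imp fun _ h => h.sort i hi

theorem SD.weaken {Y : PreCtx A} (h : SD Ax X U) (hXY : ∀ p ∈ X, p ∈ Y) : SD Ax Y U :=
  h.imp fun _ h => HD.weaken h hXY

theorem CD.sort (h : CD Ax X) {p : A.Var × SortE A} (hp : p ∈ X) : SD Ax X p.2 := by
  obtain ⟨i, hi, rfl⟩ := List.getElem_of_mem hp
  exact (h.sort_take i hi).weaken fun q hq => List.mem_of_mem_take hq

theorem CD.var (h : CD Ax X) {p : A.Var × SortE A} (hp : p ∈ X) : TD Ax X (.var p.1) := by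
  obtain ⟨n, h⟩ := h
  exact ⟨_, _, HD.var_of_forall h.sort p hp⟩

theorem CD.nodup (h : CD Ax X) : (keys X).Nodup := h.elim fun _ h => h.nodup

theorem CD.snoc (h : CD Ax X) (hU : SD Ax X U) {x : A.Var} (hx : ∀ p ∈ X, p.1 ≠ x) :
    CD Ax (X ++ [(x, U)]) := by
  obtain ⟨n, h⟩ := h
  obtain ⟨m, hU⟩ := hU
  refine ⟨max n m, ?_, ?_, ?_⟩
  · have : keys (X ++ [(x, U)]) = keys X ++ [x] := by simp [keys]
    rw [this, List.nodup_append]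
    refine ⟨h.nodup, List.nodup_singleton x, fun y hy z hz => ?_⟩
    obtain ⟨p, hp, rfl⟩ := List.mem_map.1 hy
    rw [List.mem_singleton.1 hz]
    exact hx p hp
  · intro i hi v hv
    rcases lt_or_ge i X.length with h' | h'
    · rw [List.getElem_append_left h'] at hv
      rw [List.take_append_of_le_length h'.le]
      exact h.isPreCtx i h' v hv
    · have : i = X.length := by simp at hi; omega
      subst this
      simp only [List.getElem_append_right (le_refl X.length), Nat.sub_self,
        List.getElem_cons_zero] at hv
      simpa [keys] using hU.sscoped v hv
  · intro i hi
    rcases lt_or_ge i X.length with h' | h'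
    · rw [List.getElem_append_left h', List.take_append_of_le_length h'.le]
      exact (h.sort i h').mono (le_max_left n m)
    · have : i = X.length := by simp at hi; omega
      subst this
      simp only [List.getElem_append_right (le_refl X.length), Nat.sub_self,
        List.getElem_cons_zero, List.take_left]
      exact hU.mono (le_max_right n m)

end

namespace synM

variable {T : Set (Judg (A.tensor B))} {TA : Set (Judg A)} {TB : Set (Judg B)}
  {ax : A.TermSym → PreCtx A × SortE A} {X : PreCtx A} {Y : PreCtx B}
  {ε ε' : Nv A B (Expr (A.tensor B))} {σ : A.Var × B.Var → Expr (A.tensor B)}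
  {U : SortE A} {V : SortE B} {u : Expr A} {v : Expr B}
  {a a' : B.Var → Expr (A.tensor B)} {b b' : A.Var → Expr (A.tensor B)}

@[simp] theorem R_var (y : B.Var) : (synM T ax).R ε U a (.var y) = a y := pairR_var y

@[simp] theorem C_var (x : A.Var) : (synM T ax).C ε V b (.var x) = b x := pairC_var x

theorem R_app (t : B.TermSym) (ts : List (Expr B)) :
    (synM T ax).R ε U a (.app t ts) =
      gSt U.head t U.args ts ((synM T ax).I ε) ((synM T ax).R ε U a) := pairR_app t ts

theorem C_app (s : A.TermSym) (ss : List (Expr A)) :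
    (synM T ax).C ε V b (.app s ss) =
      gTs s V.head ss V.args ((synM T ax).I ε) ((synM T ax).C ε V b) := pairC_app s ss

@[simp] theorem au_var (x : A.Var) (y : B.Var) : (synM T ax).au ε (.var x) y = ε.ρ x y :=
  pairC_var x

@[simp] theorem bv_var (x : A.Var) (y : B.Var) : (synM T ax).bv ε (.var y) x = ε.ρ x y :=
  pairR_var y

section subst

variable (ha : IntroFn TA ax) (hA : Thy TA) (he : Agr X Y ε ε' σ)

include ha hA he

theorem I_subst (hu : TD TA X u) (hv : TD TB Y v) :
    (synM T ax).I ε' u v = ((synM T ax).I ε u v).subst σ := pairI_subst ha hA he hu hv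

theorem R_subst (hU : SD TA X U) (h : ∀ q ∈ Y, a' q.1 = (a q.1).subst σ) (hv : TD TB Y v) :
    (synM T ax).R ε' U a' v = ((synM T ax).R ε U a v).subst σ := by
  refine pairR_subst (P := TD TB Y) (fun t ts h => h.args)
    (fun s hs w hw => pairI_subst ha hA he (hU.args s hs) hw) (fun y hy => ?_) hv
  obtain ⟨q, hq, rfl, -⟩ := hy.var_inv
  exact h q hq

theorem C_subst (hV : SD TB Y V) (h : ∀ p ∈ X, b' p.1 = (b p.1).subst σ) (hu : TD TA X u) :
    (synM T ax).C ε' V b' u = ((synM T ax).C ε V b u).subst σ := by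
  refine pairC_subst (P := TD TA X) (fun t ts h => h.args)
    (fun s hs w hw => pairI_subst ha hA he hw (hV.args s hs)) (fun y hy => ?_) hu
  obtain ⟨q, hq, rfl, -⟩ := hy.var_inv
  exact h q hq

theorem T2_subst (hU : SD TA X U) (hV : SD TB Y V) (h : ∀ q ∈ Y, a' q.1 = (a q.1).subst σ)
    (h' : ∀ p ∈ X, b' p.1 = (b p.1).subst σ) :
    (synM T ax).T2 ε' U V a' b' = ((synM T ax).T2 ε U V a b).subst σ :=
  gSS_subst (fun s hs t ht => pairI_subst ha hA he (hU.args s hs) (hV.args t ht))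
    (fun t ht => R_subst (T := T) ha hA he hU h (hV.args t ht))
    fun s hs => C_subst (T := T) ha hA he hV h' (hU.args s hs)

theorem au_subst (hu : TD TA X u) {q : B.Var × SortE B} (hq : q ∈ Y) (hV : SD TB Y q.2) :
    (synM T ax).au ε' u q.1 = ((synM T ax).au ε u q.1).subst σ := by
  rw [Mdl.au, Mdl.au, he.cB q hq, he.cB' q hq]
  exact C_subst ha hA he hV (fun p hp => he.ρ p hp q hq) hu

theorem bv_subst (hv : TD TB Y v) {p : A.Var × SortE A} (hp : p ∈ X) (hU : SD TA X p.2) :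
    (synM T ax).bv ε' v p.1 = ((synM T ax).bv ε v p.1).subst σ := by
  rw [Mdl.bv, Mdl.bv, he.cA p hp, he.cA' p hp]
  exact R_subst ha hA he hU (fun q hq => he.ρ p hp q hq) hv

end subst

theorem I_eq (ha : IntroFn TA ax) (hA : Thy TA) (hsA : Compat ε.sA X) (hsB : Compat ε.sB Y)
    (hu : TD TA X u) (hv : TD TB Y v) :
    (synM T ax).I ε u v = (synM T ax).R ε (canS ax ε.sA u) ((synM T ax).au ε u) v :=
  pairI_eq ha hA hsA hsB hu hv

theorem pairs (ha : IntroFn TA ax) (hA : Thy TA) : (synM T ax).Pairs TA TB := by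
  intro ε X Y n m u U v V hsA hsB hu hv
  have h := I_eq (T := T) ha hA hsA hsB ⟨n, U, hu⟩ ⟨m, V, hv⟩
  refine ⟨?_, ?_⟩
  · rintro x rfl
    exact h
  · rintro Xs t W φ hax rfl
    obtain ⟨-, Xs', W', φ', -, h1, -, h2, -⟩ := hu.app_sort_inv
    obtain ⟨rfl, rfl⟩ := hA.shaped.term_unique hax h1
    rw [canS_app ha hA hax h2] at h
    exact h

end synM

/-! ## The values of the tensor operations -/

section values

/-- The generic environment. -/
def genNv (sA : A.Var → SortE A) (sB : B.Var → SortE B) : Nv A B (Expr (A.tensor B)) :=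
  ⟨sA, sB, fun x y => .var (x, y)⟩

theorem lookupV_pairsR {x : A.Var} {Y : PreCtx B} {g : ℕ → Expr (A.tensor B)}
    {f : B.Var → Expr (A.tensor B)} (hg : ∀ j (hj : j < Y.length), g j = f (Y[j]'hj).1)
    {q : B.Var × SortE B} (hq : q ∈ Y) : lookupV (pairsR x Y g) (x, q.1) = f q.1 := by
  obtain ⟨j, hj, rfl⟩ := List.getElem_of_mem hq
  refine lookupV_eq_of_forall ?_ fun p hp h => ?_
  · simp only [pairsR, List.map_map, List.mem_map]
    exact ⟨⟨j, hj⟩, List.mem_finRange _, rfl⟩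
  · obtain ⟨k, -, rfl⟩ := List.mem_map.1 hp
    have h2 : Y[k.1].1 = Y[j].1 := (Prod.ext_iff.1 h).2
    rw [← h2]
    exact hg k.1 k.2

theorem lookupV_pairsL {X : PreCtx A} {y : B.Var} {g : ℕ → Expr (A.tensor B)}
    {f : A.Var → Expr (A.tensor B)} (hg : ∀ i (hi : i < X.length), g i = f (X[i]'hi).1)
    {p : A.Var × SortE A} (hp : p ∈ X) : lookupV (pairsL X y g) (p.1, y) = f p.1 := by
  obtain ⟨j, hj, rfl⟩ := List.getElem_of_mem hp
  refine lookupV_eq_of_forall ?_ fun p hp h => ?_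
  · simp only [pairsL, List.map_map, List.mem_map]
    exact ⟨⟨j, hj⟩, List.mem_finRange _, rfl⟩
  · obtain ⟨k, -, rfl⟩ := List.mem_map.1 hp
    have h2 : X[k.1].1 = X[j].1 := (Prod.ext_iff.1 h).1
    rw [← h2]
    exact hg k.1 k.2

theorem mem_keys_pairsR {x : A.Var} {Y : PreCtx B} {g : ℕ → Expr (A.tensor B)}
    {z : A.Var × B.Var} (h : z ∈ (pairsR x Y g).map Prod.fst) : z.1 = x := by
  obtain ⟨p, hp, rfl⟩ := List.mem_map.1 h
  obtain ⟨_, _, rfl⟩ := List.mem_map.1 hp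
  rfl

theorem mem_keys_pairsL {X : PreCtx A} {y : B.Var} {g : ℕ → Expr (A.tensor B)}
    {z : A.Var × B.Var} (h : z ∈ (pairsL X y g).map Prod.fst) : z.2 = y := by
  obtain ⟨p, hp, rfl⟩ := List.mem_map.1 h
  obtain ⟨_, _, rfl⟩ := List.mem_map.1 hp
  rfl

/-- Arguments consisting of a derivable sort and a derivable term or a variable. -/
structure TArg.Ok (Ax : Set (Judg A)) (s : A.Var → SortE A) (a : TArg A) : Prop where
  ctx : CD Ax a.ctx
  compat : Compat s a.ctx
  srt : SD Ax a.ctx a.srt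
  tm : TD Ax a.ctx a.tm ∨ ∃ x, a.tm = .var x

variable {TA : Set (Judg A)} {TB : Set (Judg B)} {ax : A.TermSym → PreCtx A × SortE A}
  {bx : B.TermSym → PreCtx B × SortE B} {sA : A.Var → SortE A} {sB : B.Var → SortE B}
  {T : Set (Judg (A.tensor B))}

theorem TArg.Ok.of_mem {X : PreCtx A} (h : CD TA X) (hs : Compat sA X) (i : ℕ)
    (hi : i < X.length) : TArg.Ok TA sA ⟨X.take i, .var (X[i]'hi).1, (X[i]'hi).2⟩ :=
  ⟨h.take i, hs.take i, h.sort_take i hi, .inr ⟨_, rfl⟩⟩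

theorem TArg.Ok.canon (ha : IntroFn TA ax) (hA : Thy TA) {a : TArg A} (h : a.Ok TA sA)
    {u : Expr A} {U : SortE A} (hu : TD TA a.ctx u) (hU : CanonSort TA a.ctx u U) :
    TArg.Ok TA sA ⟨a.ctx, u, U⟩ := by
  refine ⟨h.ctx, h.compat, ?_, .inl hu⟩
  rw [hU.eq_canS ha hA.shaped h.compat]
  exact hu.canS ha hA h.compat

theorem TArg.Ok.with_var {a : TArg A} (h : a.Ok TA sA) (x : A.Var) :
    TArg.Ok TA sA ⟨a.ctx, .var x, a.srt⟩ := ⟨h.ctx, h.compat, h.srt, .inr ⟨x, rfl⟩⟩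

theorem TArg.Ok.term {a : TArg A} (h : a.Ok TA sA) {s : A.TermSym} {ss : List (Expr A)}
    (ha : a.tm = .app s ss) : TD TA a.ctx (.app s ss) := by
  rcases h.tm with h | ⟨x, h⟩
  · rwa [← ha]
  · rw [ha] at h
    cases h

/-- The value of the tensor of two terms at two sorts. -/
noncomputable def valG (ax : A.TermSym → PreCtx A × SortE A) (ε : Nv A B (Expr (A.tensor B)))
    (a : TArg A) (b : TArg B) : Expr (A.tensor B) :=
  match b.tm with
  | .var y => (synM ∅ ax).C ε b.srt (fun x => ε.ρ x y) a.tm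
  | .app t ts => (synM ∅ ax).R ε a.srt ((synM ∅ ax).au ε a.tm) (.app t ts)

theorem valG_var_right (ε : Nv A B (Expr (A.tensor B))) (a : TArg A) (Y : PreCtx B)
    (y : B.Var) (V : SortE B) :
    valG ax ε a ⟨Y, .var y, V⟩ = (synM T ax).C ε V (fun x => ε.ρ x y) a.tm := rfl

theorem valG_var_left (ε : Nv A B (Expr (A.tensor B))) (X : PreCtx A) (x : A.Var)
    (U : SortE A) (b : TArg B) :
    valG ax ε ⟨X, .var x, U⟩ b = (synM T ax).R ε U (ε.ρ x) b.tm := by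
  obtain ⟨Y, v, V⟩ := b
  cases v with
  | var y =>
    rw [valG_var_right (T := T)]
    simp
  | app t ts =>
    change (synM T ax).R ε U ((synM T ax).au ε (.var x)) (.app t ts) = _
    congr 1
    funext y
    exact synM.au_var x y

theorem valG_app (ε : Nv A B (Expr (A.tensor B))) (a : TArg A) (Y : PreCtx B)
    (t : B.TermSym) (ts : List (Expr B)) (V : SortE B) :
    valG ax ε a ⟨Y, .app t ts, V⟩ =
      (synM T ax).R ε a.srt ((synM T ax).au ε a.tm) (.app t ts) := rfl

theorem valG_canon (ha : IntroFn TA ax) (hA : Thy TA) {ε : Nv A B (Expr (A.tensor B))}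
    {X : PreCtx A} {Y : PreCtx B} {u : Expr A} {v : Expr B} {U : SortE A} {V : SortE B}
    (hsA : Compat ε.sA X) (hsB : Compat ε.sB Y) (hu : TD TA X u) (hv : TD TB Y v)
    (hU : CanonSort TA X u U) (hV : CanonSort TB Y v V) :
    valG ax ε ⟨X, u, U⟩ ⟨Y, v, V⟩ = (synM T ax).I ε u v := by
  rw [synM.I_eq ha hA hsA hsB hu hv]
  obtain rfl := hU.eq_canS ha hA.shaped hsA
  cases v with
  | var y =>
    rw [synM.R_var, Mdl.au, valG_var_right (T := T)]
    congr 1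
    generalize hz : Expr.var y = z at hV
    cases hV with
    | var hi =>
      cases hz
      exact (hsB _ (List.getElem_mem hi)).symm
    | app _ => cases hz
  | app t ts => rfl

end values
section uniqueness

variable {TA : Set (Judg A)} {TB : Set (Judg B)} {ax : A.TermSym → PreCtx A × SortE A}
  {bx : B.TermSym → PreCtx B × SortE B} {sA : A.Var → SortE A} {sB : B.Var → SortE B}
  {T : Set (Judg (A.tensor B))}

theorem length_optL {α : Type} (l : List α) : (optL l).length = l.length + 1 := by
  simp [optL]

theorem getElem_optL_lt {α : Type} {l : List α} {i : ℕ} (hi : i < l.length)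
    (h : i < (optL l).length) : (optL l)[i]'h = some (l[i]'hi) := by
  simp only [optL]
  rw [List.getElem_append_left (by simpa using hi)]
  simp

theorem getElem_optL_length {α : Type} (l : List α) (h : l.length < (optL l).length) :
    (optL l)[l.length]'h = none := by
  simp only [optL]
  rw [List.getElem_append_right (by simp)]
  simp

theorem IsGrid.eq_gSt {S : A.SortSym} {t : B.TermSym} {ss : List (Expr A)}
    {ts : List (Expr B)} {M : ℕ → ℕ → Expr (A.tensor B)} {out : List (Expr (A.tensor B))}
    {I : Expr A → Expr B → Expr (A.tensor B)} {r : Expr B → Expr (A.tensor B)}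
    (h : IsGrid (ss.length + 1) ts.length M out)
    (hM : ∀ i (hi : i < ss.length) j (hj : j < ts.length), M i j = I (ss[i]'hi) (ts[j]'hj))
    (hr : ∀ j (hj : j < ts.length), M ss.length j = r (ts[j]'hj)) :
    Expr.app (A := A.tensor B) (Sum.inl (S, t)) out = gSt S t ss ts I r := by
  rw [gSt]
  congr 1
  refine eq_grid (optL ss) ts (fun o t => o.elim (r t) fun s => I s t)
    (by rw [h.1, length_optL]) fun i j hi hj h' => ?_
  rw [h.2 i j (by rwa [← length_optL]) hj h']
  rcases Nat.lt_succ_iff_lt_or_eq.1 (length_optL ss ▸ hi) with hi' | rfl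
  · rw [getElem_optL_lt hi' hi, hM i hi' j hj]
    rfl
  · rw [getElem_optL_length, hr j hj]
    rfl

theorem IsGrid.eq_gTs {s : A.TermSym} {T : B.SortSym} {ss : List (Expr A)}
    {ts : List (Expr B)} {M : ℕ → ℕ → Expr (A.tensor B)} {out : List (Expr (A.tensor B))}
    {I : Expr A → Expr B → Expr (A.tensor B)} {c : Expr A → Expr (A.tensor B)}
    (h : IsGrid ss.length (ts.length + 1) M out)
    (hM : ∀ i (hi : i < ss.length) j (hj : j < ts.length), M i j = I (ss[i]'hi) (ts[j]'hj))
    (hc : ∀ i (hi : i < ss.length), M i ts.length = c (ss[i]'hi)) :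
    Expr.app (A := A.tensor B) (Sum.inr (s, T)) out = gTs s T ss ts I c := by
  rw [gTs]
  congr 1
  refine eq_grid ss (optL ts) (fun s o => o.elim (c s) (I s))
    (by rw [h.1, length_optL]) fun i j hi hj h' => ?_
  have h'' := h.2 i j hi (by rwa [← length_optL])
  simp only [← length_optL ts] at h''
  rw [h'' h']
  rcases Nat.lt_succ_iff_lt_or_eq.1 (length_optL ts ▸ hj) with hj' | rfl
  · rw [getElem_optL_lt hj' hj, hM i hi j hj']
    rfl
  · rw [getElem_optL_length, hc i hi]
    rfl

theorem IsGrid.eq_gSS {S : A.SortSym} {T : B.SortSym} {ss : List (Expr A)}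
    {ts : List (Expr B)} {M : ℕ → ℕ → Expr (A.tensor B)} {out : List (Expr (A.tensor B))}
    {I : Expr A → Expr B → Expr (A.tensor B)} {r : Expr B → Expr (A.tensor B)}
    {c : Expr A → Expr (A.tensor B)} (h : IsGrid (ss.length + 1) (ts.length + 1) M out)
    (hM : ∀ i (hi : i < ss.length) j (hj : j < ts.length), M i j = I (ss[i]'hi) (ts[j]'hj))
    (hr : ∀ j (hj : j < ts.length), M ss.length j = r (ts[j]'hj))
    (hc : ∀ i (hi : i < ss.length), M i ts.length = c (ss[i]'hi)) :
    SortE.mk (A := A.tensor B) (S, T) out.dropLast = gSS S T ss ts I r c := by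
  have key : out = (optL ss).flatMap fun o => (optL ts).map fun o' =>
      o.elim (o'.elim (M ss.length ts.length) r) fun s => o'.elim (c s) (I s) := by
    refine eq_grid (optL ss) (optL ts) (fun o o' =>
      o.elim (o'.elim (M ss.length ts.length) r) fun s => o'.elim (c s) (I s))
      (by rw [h.1, length_optL, length_optL]) fun i j hi hj h' => ?_
    have h'' := h.2 i j (by rwa [← length_optL]) (by rwa [← length_optL])
    simp only [← length_optL ts] at h''
    rw [h'' h']
    rcases Nat.lt_succ_iff_lt_or_eq.1 (length_optL ss ▸ hi) with hi' | rfl <;>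
    rcases Nat.lt_succ_iff_lt_or_eq.1 (length_optL ts ▸ hj) with hj' | rfl
    · rw [getElem_optL_lt hj' hj, getElem_optL_lt hi' hi, hM i hi' j hj']
      rfl
    · rw [getElem_optL_length, getElem_optL_lt hi' hi, hc i hi']
      rfl
    · rw [getElem_optL_length, getElem_optL_lt hj' hj, hr j hj']
      rfl
    · rw [getElem_optL_length, getElem_optL_length]
      rfl
  have key' : out = ((ss.flatMap fun s => (optL ts).map fun o => o.elim (c s) (I s)) ++
      ts.map r) ++ [M ss.length ts.length] := by
    rw [key]
    simp [optL, List.flatMap_map, List.flatMap_append, Function.comp_def]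
  rw [key', List.dropLast_concat]
  rfl

theorem Agr.pairsR {X : PreCtx A} {Y : PreCtx B} (hX : Compat sA X) (hY : Compat sB Y)
    {x : A.Var} (hx : ∀ p ∈ X, p.1 ≠ x) (g : ℕ → Expr (A.tensor B)) :
    Agr X Y (genNv sA sB) (genNv sA sB) (lookupV (pairsR x Y g)) :=
  ⟨hX, hX, hY, hY, fun p hp q _ =>
    by
    rw [genNv, Expr.subst_var]
    exact (lookupV_of_notMem fun h => hx p hp (mem_keys_pairsR h)).symm⟩

theorem Agr.pairsL {X : PreCtx A} {Y : PreCtx B} (hX : Compat sA X) (hY : Compat sB Y)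
    {y : B.Var} (hy : ∀ q ∈ Y, q.1 ≠ y) (g : ℕ → Expr (A.tensor B)) :
    Agr X Y (genNv sA sB) (genNv sA sB) (lookupV (pairsL X y g)) :=
  ⟨hX, hX, hY, hY, fun p _ q hq =>
    by
    rw [genNv, Expr.subst_var]
    exact (lookupV_of_notMem fun h => hy q hq (mem_keys_pairsL h)).symm⟩

theorem TTg.eq_valG (ha : IntroFn TA ax) (hA : Thy TA) (hb : IntroFn TB bx) (hB : Thy TB)
    {b : Bool} {s : TArg A} {t : TArg B} {e : Expr (A.tensor B)} (h : TTg TA TB b s t e) :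
    b = false → s.Ok TA sA → t.Ok TB sB → e = valG ax (genNv sA sB) s t := by
  induction h with
  | @varvar b X U x Y V y =>
    intro _ _ _
    rw [valG_var_right (T := ∅), synM.C_var]
    rfl
  | varapp SS TSf hSS hTS M out hM hMx hout ihM ihMx =>
    intro hf hs ht
    rw [valG_var_left (T := ∅), synM.R_app]
    refine hout.eq_gSt (fun i hi j hj => ?_) fun j hj => ?_
    · have h1 := hs.srt.args _ (List.getElem_mem hi)
      have h2 := (ht.term rfl).args _ (List.getElem_mem hj)
      rw [ihM i hi j hj hf (hs.canon ha hA h1 (hSS i hi)) (ht.canon hb hB h2 (hTS j hj))]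
      exact valG_canon ha hA hs.compat ht.compat h1 h2 (hSS i hi) (hTS j hj)
    · have h2 := (ht.term rfl).args _ (List.getElem_mem hj)
      rw [ihMx j hj hf hs (ht.canon hb hB h2 (hTS j hj)), valG_var_left (T := ∅)]
  | appvar SS TSf hSS hTS M out hM hMy hout ihM ihMy =>
    intro hf hs ht
    rw [valG_var_right (T := ∅), synM.C_app]
    refine hout.eq_gTs (fun i hi j hj => ?_) fun i hi => ?_
    · have h1 := (hs.term rfl).args _ (List.getElem_mem hi)
      have h2 := ht.srt.args _ (List.getElem_mem hj)
      rw [ihM i hi j hj hf (hs.canon ha hA h1 (hSS i hi)) (ht.canon hb hB h2 (hTS j hj))]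
      exact valG_canon ha hA hs.compat ht.compat h1 h2 (hSS i hi) (hTS j hj)
    · have h1 := (hs.term rfl).args _ (List.getElem_mem hi)
      rw [ihMy i hi hf (hs.canon ha hA h1 (hSS i hi)) ht, valG_var_right (T := ∅)]
  | @appapp_base X s ss U Y t ts V x hx e0 h0 g hg ih0 ihg =>
    intro hf hs ht
    rw [ih0 hf (hs.with_var x) ht, valG_var_left (T := ∅), valG_app (T := ∅)]
    refine (synM.R_subst ha hA (Agr.pairsR hs.compat ht.compat hx g) hs.srt (fun q hq => ?_)
      (ht.term rfl)).symm
    rw [genNv, Expr.subst_var]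
    exact (lookupV_pairsR (g := g) (f := (synM ∅ ax).au (genNv sA sB) (.app s ss)) (fun j hj => by
      rw [ihg j hj hf hs (.of_mem ht.ctx ht.compat j hj), valG_var_right (T := ∅), Mdl.au]
      congr 1
      exact (ht.compat _ (List.getElem_mem hj)).symm) hq).symm
  | appapp_star => exact fun h => by cases h

/-- The value of the second tensor of two terms at two sorts. -/
noncomputable def valD (ax : A.TermSym → PreCtx A × SortE A) (ε : Nv A B (Expr (A.tensor B)))
    (a : TArg A) (b : TArg B) : Expr (A.tensor B) :=
  match a.tm with
  | .var x => (synM ∅ ax).R ε a.srt (ε.ρ x) b.tm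
  | .app s ss => (synM ∅ ax).C ε b.srt ((synM ∅ ax).bv ε b.tm) (.app s ss)

theorem valD_var_right (ε : Nv A B (Expr (A.tensor B))) (a : TArg A) (Y : PreCtx B)
    (y : B.Var) (V : SortE B) :
    valD ax ε a ⟨Y, .var y, V⟩ = (synM T ax).C ε V (fun x => ε.ρ x y) a.tm := by
  obtain ⟨X, u, U⟩ := a
  cases u with
  | var x =>
    change (synM T ax).R ε U (ε.ρ x) (.var y) = _
    simp
  | app s ss =>
    change (synM T ax).C ε V ((synM T ax).bv ε (.var y)) (.app s ss) = _
    congr 1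
    funext x
    exact synM.bv_var x y

theorem TTd.eq_valD (ha : IntroFn TA ax) (hA : Thy TA) (hb : IntroFn TB bx) (hB : Thy TB)
    {s : TArg A} {t : TArg B} {e : Expr (A.tensor B)} (h : TTd TA TB false s t e)
    (hs : s.Ok TA sA) (ht : t.Ok TB sB) : e = valD ax (genNv sA sB) s t := by
  cases h with
  | varL h => rw [h.eq_valG ha hA hb hB rfl hs ht, valG_var_left (T := ∅)]; rfl
  | varR h =>
    rw [h.eq_valG ha hA hb hB rfl hs ht, valG_var_right (T := ∅), valD_var_right (T := ∅)]
  | @appapp_base X s ss U Y t ts V y hy e0 h0 g hg =>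
    rw [h0.eq_valG ha hA hb hB rfl hs (ht.with_var y), valG_var_right (T := ∅)]
    refine (synM.C_subst ha hA (Agr.pairsL hs.compat ht.compat hy g) ht.srt (fun p hp => ?_)
      (hs.term rfl)).symm
    rw [genNv, Expr.subst_var]
    exact (lookupV_pairsL (g := g) (f := (synM ∅ ax).bv (genNv sA sB) (.app t ts)) (fun i hi => by
      rw [(hg i hi).eq_valG ha hA hb hB rfl (.of_mem hs.ctx hs.compat i hi) ht,
        valG_var_left (T := ∅), Mdl.bv]
      congr 1
      exact (hs.compat _ (List.getElem_mem hi)).symm) hp).symm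

theorem TSo.eq_T2 (ha : IntroFn TA ax) (hA : Thy TA) (hb : IntroFn TB bx) (hB : Thy TB)
    {X : PreCtx A} {Y : PreCtx B} {x : A.Var} {y : B.Var} {U : SortE A} {V : SortE B}
    {W : SortE (A.tensor B)} (h : TSo TA TB false X x U Y y V W) (hX : CD TA X)
    (hY : CD TB Y) (hcA : Compat sA X) (hcB : Compat sB Y) (hU : SD TA X U) (hV : SD TB Y V) :
    W = (synM T ax).T2 (genNv sA sB) U V (fun y => .var (x, y)) fun x => .var (x, y) := by
  cases h with
  | mk hx hy SS TSf hSS hTS M out hM hMx hMy hout =>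
    have hs : TArg.Ok TA sA ⟨X, .var x, _⟩ := ⟨hX, hcA, hU, .inr ⟨x, rfl⟩⟩
    have ht : TArg.Ok TB sB ⟨Y, .var y, _⟩ := ⟨hY, hcB, hV, .inr ⟨y, rfl⟩⟩
    have h1 := fun i (hi : i < _) => hU.args _ (List.getElem_mem hi)
    have h2 := fun j (hj : j < _) => hV.args _ (List.getElem_mem hj)
    refine hout.eq_gSS (fun i hi j hj => ?_) (fun j hj => ?_) fun i hi => ?_
    · rw [(hM i hi j hj).eq_valG ha hA hb hB rfl (hs.canon ha hA (h1 i hi) (hSS i hi))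
        (ht.canon hb hB (h2 j hj) (hTS j hj))]
      exact valG_canon ha hA hcA hcB (h1 i hi) (h2 j hj) (hSS i hi) (hTS j hj)
    · rw [(hMx j hj).eq_valG ha hA hb hB rfl hs (ht.canon hb hB (h2 j hj) (hTS j hj)),
        valG_var_left (T := T)]
      rfl
    · rw [(hMy i hi).eq_valG ha hA hb hB rfl (hs.canon ha hA (h1 i hi) (hSS i hi)) ht,
        valG_var_right (T := T)]
      rfl

/-- The value of the tensor of two precontexts. -/
noncomputable def tz (ax : A.TermSym → PreCtx A × SortE A) (ε : Nv A B (Expr (A.tensor B)))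
    (X : PreCtx A) (Y : PreCtx B) : PreCtx (A.tensor B) :=
  X.flatMap fun p => Y.map fun q => ((p.1, q.1), (synM ∅ ax).T2 ε p.2 q.2
    (fun y => .var (p.1, y)) fun x => .var (x, q.1))

theorem TCtx.eq_tz (ha : IntroFn TA ax) (hA : Thy TA) (hb : IntroFn TB bx) (hB : Thy TB)
    {X : PreCtx A} {Y : PreCtx B} {Z : PreCtx (A.tensor B)} (h : TCtx TA TB false X Y Z)
    (hX : CD TA X) (hY : CD TB Y) (hcA : Compat sA X) (hcB : Compat sB Y) :
    Z = tz ax (genNv sA sB) X Y := by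
  refine eq_grid X Y (fun p q => ((p.1, q.1), _)) h.1 fun i j hi hj h' => Prod.ext ?_ ?_
  · exact (h.2 i j hi hj h').1
  · exact (h.2 i j hi hj h').2.eq_T2 ha hA hb hB (hX.take i) (hY.take j) (hcA.take i)
      (hcB.take j) (hX.sort_take i hi) (hY.sort_take j hj)

end uniqueness

section existence

theorem exists_isGrid {γ : Type} (m n : ℕ) (M : ℕ → ℕ → γ) : ∃ L, IsGrid m n M L := by
  refine ⟨(List.range m).flatMap fun i => (List.range n).map (M i), ?_, fun i j hi hj h => ?_⟩
  · rw [length_grid, List.length_range, List.length_range]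
  · have h' := getElem_grid (List.range m) (List.range n) M (i := i) (j := j)
      (by rwa [List.length_range]) (by rwa [List.length_range])
      (by rw [List.length_range]; exact h)
    simp only [List.length_range, List.getElem_range] at h'
    exact h'

variable (TA : Set (Judg A)) (TB : Set (Judg B)) (X : PreCtx A) (Y : PreCtx B) (n m : ℕ)

/-- Existence of the tensor of a variable with the terms of a given height. -/
def ExL : Prop := ∀ x U v V V', HD TA n (.sort X U) → HD TB m (.term Y v V') →
  ∃ e, TTg TA TB false ⟨X, .var x, U⟩ ⟨Y, v, V⟩ e

/-- The mirror image of `ExL`. -/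
def ExR : Prop := ∀ u U U' y V, HD TA n (.term X u U') → HD TB m (.sort Y V) →
  ∃ e, TTg TA TB false ⟨X, u, U⟩ ⟨Y, .var y, V⟩ e

variable {TA TB X Y n m}
variable {ax : A.TermSym → PreCtx A × SortE A}
  {bx : B.TermSym → PreCtx B × SortE B} {sA : A.Var → SortE A} {sB : B.Var → SortE B}

theorem exists_canonSorts {n : ℕ} {ss : List (Expr A)} (hS : Nonempty (SortE A))
    (ha : IntroFn TA ax) (hcA : Compat sA X) (h : ∀ e ∈ ss, ∃ U, HD TA n (.term X e U)) :
    ∃ SS : ℕ → SortE A, ∀ i (hi : i < ss.length), CanonSort TA X (ss[i]'hi) (SS i) := by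
  have : ∀ i, ∃ U, ∀ hi : i < ss.length, CanonSort TA X (ss[i]'hi) U := fun i => by
    by_cases hi : i < ss.length
    · obtain ⟨U, hU⟩ := h _ (List.getElem_mem hi)
      exact ⟨_, fun _ => TD.canonSort ha hcA ⟨n, U, hU⟩⟩
    · exact ⟨hS.some, fun h => absurd h hi⟩
  choose SS hSS using this
  exact ⟨SS, hSS⟩

theorem CanonSort.height (ha : IntroFn TA ax) (hA : Thy TA) (hcA : Compat sA X) {u : Expr A}
    {U U' : SortE A} (h : CanonSort TA X u U) (hu : HD TA n (.term X u U')) :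
    ∃ k, n = k + 1 ∧ HD TA k (.sort X U) := by
  rw [h.eq_canS ha hA.shaped hcA]
  exact hu.canS ha hA hcA

theorem exists_fresh (X : PreCtx A) : ∃ x : A.Var, ∀ p ∈ X, p.1 ≠ x := by
  classical
  obtain ⟨x, hx⟩ := Infinite.exists_notMem_finset (keys X).toFinset
  exact ⟨x, fun p hp h => hx (by simpa [keys] using ⟨p.2, h ▸ hp⟩)⟩

theorem exists_TTg_canon (ha : IntroFn TA ax) (hA : Thy TA) (hb : IntroFn TB bx)
    (hB : Thy TB) (hcA : Compat sA X) (hcB : Compat sB Y) (hY : CD TB Y)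
    (ih : ∀ n' m', n' + m' < n + m → ExL TA TB X Y n' m' ∧ ExR TA TB X Y n' m')
    (ih' : ∀ j < Y.length, ∀ m', ExR TA TB X (Y.take j) n m') {u : Expr A} {v : Expr B}
    {U U' : SortE A} {V V' : SortE B} (hu : HD TA n (.term X u U'))
    (hv : HD TB m (.term Y v V')) (hU : CanonSort TA X u U) (hV : CanonSort TB Y v V) :
    ∃ e, TTg TA TB false ⟨X, u, U⟩ ⟨Y, v, V⟩ e := by
  obtain ⟨k, rfl, hUk⟩ := hU.height ha hA hcA hu
  obtain ⟨l, rfl, hVl⟩ := hV.height hb hB hcB hv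
  cases u with
  | var x => exact (ih k (l + 1) (by omega)).1 x U v V V' hUk hv
  | app s ss =>
    cases v with
    | var y => exact (ih (k + 1) l (by omega)).2 _ U U' y V hu hVl
    | app t ts =>
      obtain ⟨x, hx⟩ := exists_fresh X
      obtain ⟨e0, h0⟩ := (ih k (l + 1) (by omega)).1 x U _ V V' hUk hv
      have : ∀ j, ∃ e, ∀ hj : j < Y.length, TTg TA TB false ⟨X, .app s ss, U⟩
          ⟨Y.take j, .var (Y[j]'hj).1, (Y[j]'hj).2⟩ e := fun j => by
        by_cases hj : j < Y.length
        · obtain ⟨m', hm⟩ := hY.sort_take j hj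
          obtain ⟨e, he⟩ := ih' j hj m' _ U U' (Y[j]'hj).1 (Y[j]'hj).2 hu hm
          exact ⟨e, fun _ => he⟩
        · exact ⟨e0, fun h => absurd h hj⟩
      choose g hg using this
      exact ⟨_, .appapp_base hx e0 h0 g hg⟩

theorem exists_TTg_var (ha : IntroFn TA ax) (hA : Thy TA) (hb : IntroFn TB bx)
    (hB : Thy TB) (hX : CD TA X) (hY : CD TB Y) (hcA : Compat sA X) (hcB : Compat sB Y) :
    ExL TA TB X Y n m ∧ ExR TA TB X Y n m := by
  generalize hL : X.length + Y.length = L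
  induction L using Nat.strong_induction_on generalizing X Y n m with
  | _ L ihL =>
  generalize hs : n + m = s
  induction s using Nat.strong_induction_on generalizing n m with
  | _ s ih =>
  have ihR : ∀ j < Y.length, ∀ n' m', ExR TA TB X (Y.take j) n' m' := fun j hj n' m' =>
    (ihL _ (by rw [List.length_take]; omega) hX (hY.take j) hcA (hcB.take j) rfl).2
  have core : ∀ {k l} {ss : List (Expr A)} {ts : List (Expr B)} {SS : ℕ → SortE A}
      {TS : ℕ → SortE B}, k + l ≤ s → (∀ e ∈ ss, ∃ U, HD TA k (.term X e U)) →
      (∀ e ∈ ts, ∃ U, HD TB l (.term Y e U)) →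
      (∀ i (hi : i < ss.length), CanonSort TA X (ss[i]'hi) (SS i)) →
      (∀ j (hj : j < ts.length), CanonSort TB Y (ts[j]'hj) (TS j)) →
      ∀ i (hi : i < ss.length) j (hj : j < ts.length), ∃ e,
        TTg TA TB false ⟨X, ss[i]'hi, SS i⟩ ⟨Y, ts[j]'hj, TS j⟩ e := by
    intro k l ss ts SS TS hkl hss hts hSS hTS i hi j hj
    obtain ⟨U', hu⟩ := hss _ (List.getElem_mem hi)
    obtain ⟨V', hv⟩ := hts _ (List.getElem_mem hj)
    exact exists_TTg_canon ha hA hb hB hcA hcB hY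
      (fun n' m' h => ih (n' + m') (by omega) rfl) (fun j hj => ihR j hj k)
      hu hv (hSS i hi) (hTS j hj)
  constructor
  · intro x U v V V' hU hv
    cases v with
    | var y => exact ⟨_, .varvar⟩
    | app t ts =>
      obtain ⟨S, ss⟩ := U
      obtain ⟨k, rfl, hss⟩ := hU.sort_args
      obtain ⟨l, rfl, hts⟩ := hv.app_args
      obtain ⟨SS, hSS⟩ := exists_canonSorts ⟨⟨S, ss⟩⟩ ha hcA hss
      obtain ⟨TS, hTS⟩ := exists_canonSorts ⟨V⟩ hb hcB hts
      have : ∀ i j, ∃ e, (∀ (hi : i < ss.length) (hj : j < ts.length),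
          TTg TA TB false ⟨X, ss[i]'hi, SS i⟩ ⟨Y, ts[j]'hj, TS j⟩ e) ∧
          (i = ss.length → ∀ hj : j < ts.length,
            TTg TA TB false ⟨X, .var x, ⟨S, ss⟩⟩ ⟨Y, ts[j]'hj, TS j⟩ e) := fun i j => by
        by_cases hj : j < ts.length
        · by_cases hi : i < ss.length
          · obtain ⟨e, he⟩ := core (by omega) hss hts hSS hTS i hi j hj
            exact ⟨e, fun _ _ => he, fun h => absurd hi (by omega)⟩
          · obtain ⟨V', hv⟩ := hts _ (List.getElem_mem hj)
            obtain ⟨e, he⟩ := (ih (k + 1 + l) (by omega) rfl).1 x ⟨S, ss⟩ _ (TS j) V' hU hv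
            exact ⟨e, fun h => absurd h hi, fun _ _ => he⟩
        · exact ⟨.var (x, Classical.arbitrary _), fun _ h => absurd h hj,
            fun _ h => absurd h hj⟩
      choose M hM using this
      obtain ⟨out, hout⟩ := exists_isGrid (ss.length + 1) ts.length M
      exact ⟨_, .varapp SS TS hSS hTS M out (fun i hi j hj => (hM i j).1 hi hj)
        (fun j hj => (hM _ j).2 rfl hj) hout⟩
  · intro u U U' y V hu hV
    cases u with
    | var x => exact ⟨_, .varvar⟩
    | app t ss =>
      obtain ⟨T, ts⟩ := V
      obtain ⟨k, rfl, hss⟩ := hu.app_args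
      obtain ⟨l, rfl, hts⟩ := hV.sort_args
      obtain ⟨SS, hSS⟩ := exists_canonSorts ⟨U⟩ ha hcA hss
      obtain ⟨TS, hTS⟩ := exists_canonSorts ⟨⟨T, ts⟩⟩ hb hcB hts
      have : ∀ i j, ∃ e, (∀ (hi : i < ss.length) (hj : j < ts.length),
          TTg TA TB false ⟨X, ss[i]'hi, SS i⟩ ⟨Y, ts[j]'hj, TS j⟩ e) ∧
          (j = ts.length → ∀ hi : i < ss.length,
            TTg TA TB false ⟨X, ss[i]'hi, SS i⟩ ⟨Y, .var y, ⟨T, ts⟩⟩ e) := fun i j => by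
        by_cases hi : i < ss.length
        · by_cases hj : j < ts.length
          · obtain ⟨e, he⟩ := core (by omega) hss hts hSS hTS i hi j hj
            exact ⟨e, fun _ _ => he, fun h => absurd hj (by omega)⟩
          · obtain ⟨U', hu⟩ := hss _ (List.getElem_mem hi)
            obtain ⟨e, he⟩ := (ih (k + (l + 1)) (by omega) rfl).2 _ (SS i) U' y ⟨T, ts⟩ hu hV
            exact ⟨e, fun _ h => absurd h hj, fun _ _ => he⟩
        · exact ⟨.var (Classical.arbitrary _, y), fun h => absurd h hi,
            fun _ h => absurd h hi⟩
      choose M hM using this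
      obtain ⟨out, hout⟩ := exists_isGrid ss.length (ts.length + 1) M
      exact ⟨_, .appvar SS TS hSS hTS M out (fun i hi j hj => (hM i j).1 hi hj)
        (fun i hi => (hM i _).2 rfl hi) hout⟩

theorem TArg.Ok.exists_TTg (ha : IntroFn TA ax) (hA : Thy TA) (hb : IntroFn TB bx)
    (hB : Thy TB) {s : TArg A} {t : TArg B} (hs : s.Ok TA sA) (ht : t.Ok TB sB) :
    ∃ e, TTg TA TB false s t e := by
  obtain ⟨X, u, U⟩ := s
  obtain ⟨Y, v, V⟩ := t
  obtain ⟨hX, hcA, ⟨n, hU⟩, hu⟩ := hs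
  obtain ⟨hY, hcB, ⟨m, hV⟩, hv⟩ := ht
  rcases hu.symm with ⟨x, rfl : u = _⟩ | ⟨n', U', hu⟩ <;>
    rcases hv.symm with ⟨y, rfl : v = _⟩ | ⟨m', V', hv⟩
  · exact ⟨_, .varvar⟩
  · exact (exists_TTg_var ha hA hb hB hX hY hcA hcB).1 x U v V V' hU hv
  · exact (exists_TTg_var ha hA hb hB hX hY hcA hcB).2 u U U' y V hu hV
  · cases u with
    | var x => exact (exists_TTg_var ha hA hb hB hX hY hcA hcB).1 x U v V V' hU hv
    | app s ss =>
      cases v with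
      | var y => exact (exists_TTg_var ha hA hb hB hX hY hcA hcB).2 _ U U' y V hu hV
      | app t ts =>
        obtain ⟨x, hx⟩ := exists_fresh X
        obtain ⟨e0, h0⟩ := (exists_TTg_var ha hA hb hB hX hY hcA hcB).1 x U _ V V' hU hv
        have : ∀ j, ∃ e, ∀ hj : j < Y.length, TTg TA TB false ⟨X, .app s ss, U⟩
            ⟨Y.take j, .var (Y[j]'hj).1, (Y[j]'hj).2⟩ e := fun j => by
          by_cases hj : j < Y.length
          · obtain ⟨m', hm⟩ := hY.sort_take j hj
            obtain ⟨e, he⟩ := (exists_TTg_var ha hA hb hB hX (hY.take j) hcA (hcB.take j)).2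
              _ U U' (Y[j]'hj).1 (Y[j]'hj).2 hu hm
            exact ⟨e, fun _ => he⟩
          · exact ⟨e0, fun h => absurd h hj⟩
        choose g hg using this
        exact ⟨_, .appapp_base hx e0 h0 g hg⟩

section

variable (ha : IntroFn TA ax) (hA : Thy TA) (hb : IntroFn TB bx) (hB : Thy TB)

include ha hA hb hB

theorem TArg.Ok.exists_left {X : PreCtx A} {t : TArg B} (hX : CD TA X)
    (hcA : Compat sA X) (ht : t.Ok TB sB) : ∃ g : ℕ → Expr (A.tensor B),
      ∀ i (hi : i < X.length),
        TTg TA TB false ⟨X.take i, .var (X[i]'hi).1, (X[i]'hi).2⟩ t (g i) := by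
  have : ∀ i, ∃ e, ∀ hi : i < X.length,
      TTg TA TB false ⟨X.take i, .var (X[i]'hi).1, (X[i]'hi).2⟩ t e := fun i => by
    by_cases hi : i < X.length
    · obtain ⟨e, he⟩ := (TArg.Ok.of_mem hX hcA i hi).exists_TTg ha hA hb hB ht
      exact ⟨e, fun _ => he⟩
    · exact ⟨.var (Classical.arbitrary _, Classical.arbitrary _), fun h => absurd h hi⟩
  choose g hg using this
  exact ⟨g, hg⟩

theorem TArg.Ok.exists_right {s : TArg A} {Y : PreCtx B} (hs : s.Ok TA sA) (hY : CD TB Y)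
    (hcB : Compat sB Y) : ∃ g : ℕ → Expr (A.tensor B), ∀ j (hj : j < Y.length),
      TTg TA TB false s ⟨Y.take j, .var (Y[j]'hj).1, (Y[j]'hj).2⟩ (g j) := by
  have : ∀ j, ∃ e, ∀ hj : j < Y.length,
      TTg TA TB false s ⟨Y.take j, .var (Y[j]'hj).1, (Y[j]'hj).2⟩ e := fun j => by
    by_cases hj : j < Y.length
    · obtain ⟨e, he⟩ := hs.exists_TTg ha hA hb hB (TArg.Ok.of_mem hY hcB j hj)
      exact ⟨e, fun _ => he⟩
    · exact ⟨.var (Classical.arbitrary _, Classical.arbitrary _), fun h => absurd h hj⟩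
  choose g hg using this
  exact ⟨g, hg⟩

theorem TArg.Ok.exists_TTd {s : TArg A} {t : TArg B} (hs : s.Ok TA sA) (ht : t.Ok TB sB) :
    ∃ e, TTd TA TB false s t e := by
  obtain ⟨X, u, U⟩ := s
  obtain ⟨Y, v, V⟩ := t
  cases u with
  | var x => exact (hs.exists_TTg ha hA hb hB ht).imp fun _ h => .varL h
  | app s ss =>
    cases v with
    | var y => exact (hs.exists_TTg ha hA hb hB ht).imp fun _ h => .varR h
    | app t ts =>
      obtain ⟨y, hy⟩ := exists_fresh Y
      obtain ⟨e0, h0⟩ := hs.exists_TTg ha hA hb hB (ht.with_var y)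
      obtain ⟨g, hg⟩ := TArg.Ok.exists_left ha hA hb hB hs.ctx hs.compat ht
      exact ⟨_, .appapp_base hy e0 h0 g hg⟩

theorem exists_TSo {x : A.Var} {y : B.Var} {U : SortE A} {V : SortE B} (hX : CD TA X)
    (hY : CD TB Y) (hcA : Compat sA X) (hcB : Compat sB Y) (hU : SD TA X U) (hV : SD TB Y V)
    (hx : ∀ p ∈ X, p.1 ≠ x) (hy : ∀ p ∈ Y, p.1 ≠ y) :
    ∃ W, TSo TA TB false X x U Y y V W := by
  obtain ⟨S, ss⟩ := U
  obtain ⟨T, ts⟩ := V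
  have hs : TArg.Ok TA sA ⟨X, .var x, ⟨S, ss⟩⟩ := ⟨hX, hcA, hU, .inr ⟨x, rfl⟩⟩
  have ht : TArg.Ok TB sB ⟨Y, .var y, ⟨T, ts⟩⟩ := ⟨hY, hcB, hV, .inr ⟨y, rfl⟩⟩
  obtain ⟨_, hU⟩ := hU
  obtain ⟨k, rfl, hss⟩ := hU.sort_args
  obtain ⟨_, hV⟩ := hV
  obtain ⟨l, rfl, hts⟩ := hV.sort_args
  obtain ⟨SS, hSS⟩ := exists_canonSorts ⟨⟨S, ss⟩⟩ ha hcA hss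
  obtain ⟨TS, hTS⟩ := exists_canonSorts ⟨⟨T, ts⟩⟩ hb hcB hts
  have h1 := fun i (hi : i < ss.length) =>
    hs.canon ha hA ⟨k, hss _ (List.getElem_mem hi)⟩ (hSS i hi)
  have h2 := fun j (hj : j < ts.length) =>
    ht.canon hb hB ⟨l, hts _ (List.getElem_mem hj)⟩ (hTS j hj)
  have : ∀ i j, ∃ e, (∀ (hi : i < ss.length) (hj : j < ts.length),
      TTg TA TB false ⟨X, ss[i]'hi, SS i⟩ ⟨Y, ts[j]'hj, TS j⟩ e) ∧
      (i = ss.length → ∀ hj : j < ts.length,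
        TTg TA TB false ⟨X, .var x, ⟨S, ss⟩⟩ ⟨Y, ts[j]'hj, TS j⟩ e) ∧
      (j = ts.length → ∀ hi : i < ss.length,
        TTg TA TB false ⟨X, ss[i]'hi, SS i⟩ ⟨Y, .var y, ⟨T, ts⟩⟩ e) := fun i j => by
    by_cases hi : i < ss.length <;> by_cases hj : j < ts.length
    · obtain ⟨e, he⟩ := (h1 i hi).exists_TTg ha hA hb hB (h2 j hj)
      exact ⟨e, fun _ _ => he, fun h => by omega, fun h => by omega⟩
    · obtain ⟨e, he⟩ := (h1 i hi).exists_TTg ha hA hb hB ht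
      exact ⟨e, fun _ h => absurd h hj, fun _ h => absurd h hj, fun _ _ => he⟩
    · obtain ⟨e, he⟩ := hs.exists_TTg ha hA hb hB (h2 j hj)
      exact ⟨e, fun h => absurd h hi, fun _ _ => he, fun _ h => absurd h hi⟩
    · exact ⟨.var (x, y), fun h => absurd h hi, fun _ h => absurd h hj,
        fun _ h => absurd h hi⟩
  choose M hM using this
  obtain ⟨out, hout⟩ := exists_isGrid (ss.length + 1) (ts.length + 1) M
  exact ⟨_, .mk hx hy SS TS hSS hTS M out (fun i hi j hj => (hM i j).1 hi hj)
    (fun j hj => (hM _ j).2.1 rfl hj) (fun i hi => (hM i _).2.2 rfl hi) hout⟩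

theorem exists_TCtx (hX : CD TA X) (hY : CD TB Y) (hcA : Compat sA X) (hcB : Compat sB Y) :
    ∃ Z, TCtx TA TB false X Y Z := by
  have fresh : ∀ {C : Alphabet} {TC : Set (Judg C)} {X : PreCtx C}, CD TC X →
      ∀ i (hi : i < X.length), ∀ p ∈ X.take i, p.1 ≠ (X[i]'hi).1 := by
    intro C TC X hX i hi p hp h
    obtain ⟨k, hk, rfl⟩ := List.getElem_of_mem hp
    rw [List.length_take] at hk
    have := (List.nodup_iff_injective_getElem.1 hX.nodup
      (a₁ := ⟨k, by simp only [keys, List.length_map]; omega⟩)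
      (a₂ := ⟨i, by simpa only [keys, List.length_map]⟩) (by simpa [keys] using h))
    have := congrArg Fin.val this
    simp only at this
    omega
  rcases X.eq_nil_or_concat' with rfl | h
  · exact ⟨[], by simp, fun i j hi => absurd hi (by simp)⟩
  obtain ⟨p, -⟩ : ∃ p : A.Var × SortE A, True := h.elim fun _ ⟨p, _⟩ => ⟨p, trivial⟩
  rcases Y.eq_nil_or_concat' with rfl | h
  · exact ⟨[], by simp, fun i j _ hj => absurd hj (by simp)⟩
  obtain ⟨q, -⟩ : ∃ q : B.Var × SortE B, True := h.elim fun _ ⟨q, _⟩ => ⟨q, trivial⟩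
  have : ∀ i j, ∃ W : (A.tensor B).Var × SortE (A.tensor B),
      ∀ (hi : i < X.length) (hj : j < Y.length),
      W.1 = ((X[i]'hi).1, (Y[j]'hj).1) ∧
      TSo TA TB false (X.take i) (X[i]'hi).1 (X[i]'hi).2
        (Y.take j) (Y[j]'hj).1 (Y[j]'hj).2 W.2 := by
    intro i j
    by_cases h : i < X.length ∧ j < Y.length
    · obtain ⟨W, hW⟩ := exists_TSo ha hA hb hB (hX.take i) (hY.take j) (hcA.take i)
        (hcB.take j) (hX.sort_take i h.1) (hY.sort_take j h.2) (fresh hX i h.1)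
        (fresh hY j h.2)
      exact ⟨(((X[i]'h.1).1, (Y[j]'h.2).1), W), fun _ _ => ⟨rfl, hW⟩⟩
    · exact ⟨((p.1, q.1), ⟨(p.2.head, q.2.head), []⟩), fun hi hj => absurd ⟨hi, hj⟩ h⟩
  choose M hM using this
  obtain ⟨Z, hZ⟩ := exists_isGrid X.length Y.length M
  exact ⟨Z, hZ.1, fun i j hi hj h => by rw [hZ.2 i j hi hj h]; exact hM i j hi hj⟩

end

end existence

/-! ## The axioms of the tensor product -/

section axioms

variable {TA : Set (Judg A)} {TB : Set (Judg B)} {chA : PreCtx A → A.Var}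
  {chB : PreCtx B → B.Var} {ax : A.TermSym → PreCtx A × SortE A}
  {bx : B.TermSym → PreCtx B × SortE B} {sA : A.Var → SortE A} {sB : B.Var → SortE B}
  {T : Set (Judg (A.tensor B))} {X : PreCtx A} {Y : PreCtx B} {U U' : SortE A} {V V' : SortE B}
  {u u' : Expr A} {v v' : Expr B}

theorem tz_append_left (ε : Nv A B (Expr (A.tensor B))) (X X' : PreCtx A) (Y : PreCtx B) :
    tz ax ε (X ++ X') Y = tz ax ε X Y ++ tz ax ε X' Y := List.flatMap_append

theorem mem_tz {ε : Nv A B (Expr (A.tensor B))} {z : (A.tensor B).Var × SortE (A.tensor B)} :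
    z ∈ tz ax ε X Y ↔ ∃ p ∈ X, ∃ q ∈ Y, ((p.1, q.1), (synM T ax).T2 ε p.2 q.2
      (fun y => .var (p.1, y)) fun x => .var (x, q.1)) = z := by
  simp only [tz, List.mem_flatMap, List.mem_map]
  rfl

theorem mem_tz_append_right {ε : Nv A B (Expr (A.tensor B))} {Y' : PreCtx B}
    {z : (A.tensor B).Var × SortE (A.tensor B)} :
    z ∈ tz ax ε X (Y ++ Y') ↔ z ∈ tz ax ε X Y ∨ z ∈ tz ax ε X Y' := by
  simp only [mem_tz (T := ∅), List.mem_append, or_and_right, exists_or, and_or_left]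

theorem dropLast_tz (ε : Nv A B (Expr (A.tensor B))) (p : A.Var × SortE A)
    (q : B.Var × SortE B) : (tz ax ε (X ++ [p]) (Y ++ [q])).dropLast =
      tz ax ε X (Y ++ [q]) ++ tz ax ε [p] Y := by
  rw [tz_append_left]
  simp only [tz, List.flatMap_cons, List.flatMap_nil, List.append_nil, List.map_append,
    List.map_cons, List.map_nil]
  rw [← List.append_assoc, List.dropLast_concat]

section

variable (ha : IntroFn TA ax) (hA : Thy TA) (hcA : Compat sA X) (hcB : Compat sB Y)
  (hU : SD TA X U) (hV : SD TB Y V) {x : A.Var} {y : B.Var}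

include ha hA hcA hcB hU hV

theorem T2_pairsL (hy : ∀ q ∈ Y, q.1 ≠ y) {g : ℕ → Expr (A.tensor B)}
    (hg : ∀ i (hi : i < X.length), g i = (synM T ax).bv (genNv sA sB) v (X[i]'hi).1) :
    ((synM T ax).T2 (genNv sA sB) U V (fun y => .var (x, y)) fun x => .var (x, y)).substL
      (pairsL X y g) = (synM T ax).T2 (genNv sA sB) U V (fun y => .var (x, y))
        ((synM T ax).bv (genNv sA sB) v) := by
  refine (synM.T2_subst (T := T) ha hA (Agr.pairsL hcA hcB hy g) hU hV (fun q hq => ?_)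
    fun p hp => ?_).symm
  · rw [Expr.subst_var, lookupV_of_notMem fun h => hy q hq (mem_keys_pairsL h)]
  · rw [Expr.subst_var, lookupV_pairsL hg hp]

theorem T2_pairsR (hx : ∀ p ∈ X, p.1 ≠ x) {g : ℕ → Expr (A.tensor B)}
    (hg : ∀ j (hj : j < Y.length), g j = (synM T ax).au (genNv sA sB) u (Y[j]'hj).1) :
    ((synM T ax).T2 (genNv sA sB) U V (fun y => .var (x, y)) fun x => .var (x, y)).substL
      (pairsR x Y g) = (synM T ax).T2 (genNv sA sB) U V
        ((synM T ax).au (genNv sA sB) u) fun x => .var (x, y) := by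
  refine (synM.T2_subst (T := T) ha hA (Agr.pairsR hcA hcB hx g) hU hV (fun q hq => ?_)
    fun p hp => ?_).symm
  · rw [Expr.subst_var, lookupV_pairsR hg hq]
  · rw [Expr.subst_var, lookupV_of_notMem fun h => hx p hp (mem_keys_pairsR h)]

theorem T2_pairs (hx : ∀ p ∈ X, p.1 ≠ x) (hy : ∀ q ∈ Y, q.1 ≠ y)
    {g g' : ℕ → Expr (A.tensor B)}
    (hg : ∀ i (hi : i < X.length), g i = (synM T ax).bv (genNv sA sB) v (X[i]'hi).1)
    (hg' : ∀ j (hj : j < Y.length), g' j = (synM T ax).au (genNv sA sB) u (Y[j]'hj).1) :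
    ((synM T ax).T2 (genNv sA sB) U V (fun y => .var (x, y)) fun x => .var (x, y)).substL
      (pairsL X y g ++ pairsR x Y g') = (synM T ax).T2 (genNv sA sB) U V
        ((synM T ax).au (genNv sA sB) u) ((synM T ax).bv (genNv sA sB) v) := by
  have hL : ∀ {p q}, q ∈ Y → (p, q.1) ∉ (pairsL X y g).map Prod.fst :=
    fun hq h => hy _ hq (mem_keys_pairsL h)
  have hR : ∀ {p q}, p ∈ X → (p.1, q) ∉ (pairsR x Y g').map Prod.fst :=
    fun hp h => hx _ hp (mem_keys_pairsR h)
  refine (synM.T2_subst (T := T) (ε' := genNv sA sB) ha hA ⟨hcA, hcA, hcB, hcB, ?_⟩ hU hV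
    (fun q hq => ?_) fun p hp => ?_).symm
  · intro p hp q hq
    rw [genNv, Expr.subst_var, lookupV_append_of_notMem (hL hq), lookupV_of_notMem (hR hp)]
  · rw [Expr.subst_var, lookupV_append_of_notMem (hL hq), lookupV_pairsR hg' hq]
  · rw [Expr.subst_var, lookupV_append_of_mem, lookupV_pairsL hg hp]
    obtain ⟨i, hi, rfl⟩ := List.getElem_of_mem hp
    simp only [pairsL, List.map_map, List.mem_map]
    exact ⟨⟨i, hi⟩, by simp, rfl⟩

end

section

variable (ha : IntroFn TA ax) (hA : Thy TA) (hb : IntroFn TB bx) (hB : Thy TB)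
  (hX : CD TA X) (hY : CD TB Y) (hcA : Compat sA X) (hcB : Compat sB Y)

include ha hA hb hB hX hY hcA hcB

/-- The values of the tensors of the variables on the left with a term. -/
theorem TTg.eq_bv (hv : TD TB Y v) (hV : SD TB Y V) {g : ℕ → Expr (A.tensor B)}
    (h : ∀ i (hi : i < X.length),
      TTg TA TB false ⟨X.take i, .var (X[i]'hi).1, (X[i]'hi).2⟩ ⟨Y, v, V⟩ (g i))
    (i : ℕ) (hi : i < X.length) : g i = (synM T ax).bv (genNv sA sB) v (X[i]'hi).1 := by
  rw [(h i hi).eq_valG ha hA hb hB rfl (TArg.Ok.of_mem hX hcA i hi) ⟨hY, hcB, hV, .inl hv⟩,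
    valG_var_left (T := T), Mdl.bv,
    show (genNv sA sB).sA _ = _ from hcA _ (List.getElem_mem hi)]

theorem TTg.eq_au (hu : TD TA X u) (hU : SD TA X U) {g : ℕ → Expr (A.tensor B)}
    (h : ∀ j (hj : j < Y.length),
      TTg TA TB false ⟨X, u, U⟩ ⟨Y.take j, .var (Y[j]'hj).1, (Y[j]'hj).2⟩ (g j))
    (j : ℕ) (hj : j < Y.length) : g j = (synM T ax).au (genNv sA sB) u (Y[j]'hj).1 := by
  rw [(h j hj).eq_valG ha hA hb hB rfl ⟨hX, hcA, hU, .inl hu⟩ (TArg.Ok.of_mem hY hcB j hj),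
    valG_var_right (T := T), Mdl.au,
    show (genNv sA sB).sB _ = _ from hcB _ (List.getElem_mem hj)]

theorem TTg.eq_R (hU : SD TA X U) (hv : TD TB Y v) (hV : SD TB Y V) {x : A.Var}
    {e : Expr (A.tensor B)} (h : TTg TA TB false ⟨X, .var x, U⟩ ⟨Y, v, V⟩ e) :
    e = (synM T ax).R (genNv sA sB) U (fun y => .var (x, y)) v := by
  rw [h.eq_valG ha hA hb hB rfl ⟨hX, hcA, hU, .inr ⟨x, rfl⟩⟩ ⟨hY, hcB, hV, .inl hv⟩,
    valG_var_left (T := T)]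
  rfl

theorem TTg.eq_C (hu : TD TA X u) (hU : SD TA X U) (hV : SD TB Y V) {y : B.Var}
    {e : Expr (A.tensor B)} (h : TTg TA TB false ⟨X, u, U⟩ ⟨Y, .var y, V⟩ e) :
    e = (synM T ax).C (genNv sA sB) V (fun x => .var (x, y)) u := by
  rw [h.eq_valG ha hA hb hB rfl ⟨hX, hcA, hU, .inl hu⟩ ⟨hY, hcB, hV, .inr ⟨y, rfl⟩⟩,
    valG_var_right (T := T)]
  rfl

variable (hfA : FreshCh chA) (hfB : FreshCh chB)
  (hU : SD TA X U) (hV : SD TB Y V) (hcA' : Compat sA (X ++ [(chA X, U)]))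
  (hcB' : Compat sB (Y ++ [(chB Y, V)]))

include hfA hfB hU hV

include hcA' hcB' in
theorem tensorAx_sort_sort (h : .sort X U ∈ TA) (h' : .sort Y V ∈ TB) :
    Judg.sort (tz ax (genNv sA sB) (X ++ [(chA X, U)]) (Y ++ [(chB Y, V)])).dropLast
      ((synM T ax).T2 (genNv sA sB) U V (fun y => .var (chA X, y)) fun x => .var (x, chB Y)) ∈
      tensorAx TA TB chA chB := by
  obtain ⟨Z, hZ⟩ := exists_TCtx ha hA hb hB (hX.snoc hU (hfA X)) (hY.snoc hV (hfB Y)) hcA' hcB'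
  obtain ⟨W, hW⟩ := exists_TSo ha hA hb hB hX hY hcA hcB hU hV (hfA X) (hfB Y)
  rw [← hZ.eq_tz ha hA hb hB (hX.snoc hU (hfA X)) (hY.snoc hV (hfB Y)) hcA' hcB',
    ← hW.eq_T2 ha hA hb hB hX hY hcA hcB hU hV]
  exact ⟨_, _, h, h', .ss hZ hW⟩

include hcA' hcB' in
theorem tensorAx_sort_sortEq (hV' : SD TB Y V') (h : .sort X U ∈ TA)
    (h' : .sortEq Y V V' ∈ TB) :
    Judg.sortEq (tz ax (genNv sA sB) (X ++ [(chA X, U)]) (Y ++ [(chB Y, V)])).dropLast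
      ((synM T ax).T2 (genNv sA sB) U V (fun y => .var (chA X, y)) fun x => .var (x, chB Y))
      ((synM T ax).T2 (genNv sA sB) U V' (fun y => .var (chA X, y)) fun x => .var (x, chB Y)) ∈
      tensorAx TA TB chA chB := by
  obtain ⟨Z, hZ⟩ := exists_TCtx ha hA hb hB (hX.snoc hU (hfA X)) (hY.snoc hV (hfB Y)) hcA' hcB'
  obtain ⟨W, hW⟩ := exists_TSo ha hA hb hB hX hY hcA hcB hU hV (hfA X) (hfB Y)
  obtain ⟨W', hW'⟩ := exists_TSo ha hA hb hB hX hY hcA hcB hU hV' (hfA X) (hfB Y)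
  rw [← hZ.eq_tz ha hA hb hB (hX.snoc hU (hfA X)) (hY.snoc hV (hfB Y)) hcA' hcB',
    ← hW.eq_T2 ha hA hb hB hX hY hcA hcB hU hV, ← hW'.eq_T2 ha hA hb hB hX hY hcA hcB hU hV']
  exact ⟨_, _, h, h', .sseq hZ hW hW'⟩

include hcA' hcB' in
theorem tensorAx_sortEq_sort (hU' : SD TA X U') (h : .sortEq X U U' ∈ TA)
    (h' : .sort Y V ∈ TB) :
    Judg.sortEq (tz ax (genNv sA sB) (X ++ [(chA X, U)]) (Y ++ [(chB Y, V)])).dropLast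
      ((synM T ax).T2 (genNv sA sB) U V (fun y => .var (chA X, y)) fun x => .var (x, chB Y))
      ((synM T ax).T2 (genNv sA sB) U' V (fun y => .var (chA X, y)) fun x => .var (x, chB Y)) ∈
      tensorAx TA TB chA chB := by
  obtain ⟨Z, hZ⟩ := exists_TCtx ha hA hb hB (hX.snoc hU (hfA X)) (hY.snoc hV (hfB Y)) hcA' hcB'
  obtain ⟨W, hW⟩ := exists_TSo ha hA hb hB hX hY hcA hcB hU hV (hfA X) (hfB Y)
  obtain ⟨W', hW'⟩ := exists_TSo ha hA hb hB hX hY hcA hcB hU' hV (hfA X) (hfB Y)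
  rw [← hZ.eq_tz ha hA hb hB (hX.snoc hU (hfA X)) (hY.snoc hV (hfB Y)) hcA' hcB',
    ← hW.eq_T2 ha hA hb hB hX hY hcA hcB hU hV, ← hW'.eq_T2 ha hA hb hB hX hY hcA hcB hU' hV]
  exact ⟨_, _, h, h', .seqs hZ hW hW'⟩

include hcA' in
theorem tensorAx_sort_term (hv : TD TB Y v) (h : .sort X U ∈ TA) (h' : .term Y v V ∈ TB) :
    Judg.term (tz ax (genNv sA sB) (X ++ [(chA X, U)]) Y)
      ((synM T ax).R (genNv sA sB) U (fun y => .var (chA X, y)) v)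
      ((synM T ax).T2 (genNv sA sB) U V (fun y => .var (chA X, y))
        ((synM T ax).bv (genNv sA sB) v)) ∈ tensorAx TA TB chA chB := by
  obtain ⟨Z, hZ⟩ := exists_TCtx ha hA hb hB (hX.snoc hU (hfA X)) hY hcA' hcB
  obtain ⟨W, hW⟩ := exists_TSo ha hA hb hB hX hY hcA hcB hU hV (hfA X) (hfB Y)
  have hs : TArg.Ok TA sA ⟨X, .var (chA X), U⟩ := ⟨hX, hcA, hU, .inr ⟨_, rfl⟩⟩
  have ht : TArg.Ok TB sB ⟨Y, v, V⟩ := ⟨hY, hcB, hV, .inl hv⟩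
  obtain ⟨e, he⟩ := hs.exists_TTg ha hA hb hB ht
  obtain ⟨g, hg⟩ := TArg.Ok.exists_left ha hA hb hB hX hcA ht
  have := hW.eq_T2 (T := T) ha hA hb hB hX hY hcA hcB hU hV
  rw [← hZ.eq_tz ha hA hb hB (hX.snoc hU (hfA X)) hY hcA' hcB,
    ← TTg.eq_R ha hA hb hB hX hY hcA hcB hU hv hV he,
    ← T2_pairsL ha hA hcA hcB hU hV (hfB Y) (TTg.eq_bv ha hA hb hB hX hY hcA hcB hv hV hg),
    ← hW.eq_T2 ha hA hb hB hX hY hcA hcB hU hV]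
  exact ⟨_, _, h, h', .st hZ he hW hg⟩

include hcB' in
theorem tensorAx_term_sort (hu : TD TA X u) (h : .term X u U ∈ TA) (h' : .sort Y V ∈ TB) :
    Judg.term (tz ax (genNv sA sB) X (Y ++ [(chB Y, V)]))
      ((synM T ax).C (genNv sA sB) V (fun x => .var (x, chB Y)) u)
      ((synM T ax).T2 (genNv sA sB) U V ((synM T ax).au (genNv sA sB) u)
        fun x => .var (x, chB Y)) ∈ tensorAx TA TB chA chB := by
  obtain ⟨Z, hZ⟩ := exists_TCtx ha hA hb hB hX (hY.snoc hV (hfB Y)) hcA hcB'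
  obtain ⟨W, hW⟩ := exists_TSo ha hA hb hB hX hY hcA hcB hU hV (hfA X) (hfB Y)
  have hs : TArg.Ok TA sA ⟨X, u, U⟩ := ⟨hX, hcA, hU, .inl hu⟩
  have ht : TArg.Ok TB sB ⟨Y, .var (chB Y), V⟩ := ⟨hY, hcB, hV, .inr ⟨_, rfl⟩⟩
  obtain ⟨e, he⟩ := hs.exists_TTg ha hA hb hB ht
  obtain ⟨g, hg⟩ := TArg.Ok.exists_right ha hA hb hB hs hY hcB
  rw [← hZ.eq_tz ha hA hb hB hX (hY.snoc hV (hfB Y)) hcA hcB',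
    ← TTg.eq_C ha hA hb hB hX hY hcA hcB hu hU hV he,
    ← T2_pairsR ha hA hcA hcB hU hV (hfA X) (TTg.eq_au ha hA hb hB hX hY hcA hcB hu hU hg),
    ← hW.eq_T2 ha hA hb hB hX hY hcA hcB hU hV]
  exact ⟨_, _, h, h', .ts hZ he hW hg⟩

include hcA' in
theorem tensorAx_sort_termEq (hv : TD TB Y v) (hv' : TD TB Y v') (h : .sort X U ∈ TA)
    (h' : .termEq Y v v' V ∈ TB) :
    Judg.termEq (tz ax (genNv sA sB) (X ++ [(chA X, U)]) Y)
      ((synM T ax).R (genNv sA sB) U (fun y => .var (chA X, y)) v)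
      ((synM T ax).R (genNv sA sB) U (fun y => .var (chA X, y)) v')
      ((synM T ax).T2 (genNv sA sB) U V (fun y => .var (chA X, y))
        ((synM T ax).bv (genNv sA sB) v)) ∈ tensorAx TA TB chA chB := by
  obtain ⟨Z, hZ⟩ := exists_TCtx ha hA hb hB (hX.snoc hU (hfA X)) hY hcA' hcB
  obtain ⟨W, hW⟩ := exists_TSo ha hA hb hB hX hY hcA hcB hU hV (hfA X) (hfB Y)
  have hs : TArg.Ok TA sA ⟨X, .var (chA X), U⟩ := ⟨hX, hcA, hU, .inr ⟨_, rfl⟩⟩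
  have ht : TArg.Ok TB sB ⟨Y, v, V⟩ := ⟨hY, hcB, hV, .inl hv⟩
  have ht' : TArg.Ok TB sB ⟨Y, v', V⟩ := ⟨hY, hcB, hV, .inl hv'⟩
  obtain ⟨e, he⟩ := hs.exists_TTg ha hA hb hB ht
  obtain ⟨e', he'⟩ := hs.exists_TTg ha hA hb hB ht'
  obtain ⟨g, hg⟩ := TArg.Ok.exists_left ha hA hb hB hX hcA ht
  rw [← hZ.eq_tz ha hA hb hB (hX.snoc hU (hfA X)) hY hcA' hcB,
    ← TTg.eq_R ha hA hb hB hX hY hcA hcB hU hv hV he,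
    ← TTg.eq_R ha hA hb hB hX hY hcA hcB hU hv' hV he',
    ← T2_pairsL ha hA hcA hcB hU hV (hfB Y) (TTg.eq_bv ha hA hb hB hX hY hcA hcB hv hV hg),
    ← hW.eq_T2 ha hA hb hB hX hY hcA hcB hU hV]
  exact ⟨_, _, h, h', .steq hZ he he' hW hg⟩

include hcA' in
theorem tensorAx_sortEq_term (hU' : SD TA X U') (hv : TD TB Y v) (h : .sortEq X U U' ∈ TA)
    (h' : .term Y v V ∈ TB) :
    Judg.termEq (tz ax (genNv sA sB) (X ++ [(chA X, U)]) Y)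
      ((synM T ax).R (genNv sA sB) U (fun y => .var (chA X, y)) v)
      ((synM T ax).R (genNv sA sB) U' (fun y => .var (chA X, y)) v)
      ((synM T ax).T2 (genNv sA sB) U V (fun y => .var (chA X, y))
        ((synM T ax).bv (genNv sA sB) v)) ∈ tensorAx TA TB chA chB := by
  obtain ⟨Z, hZ⟩ := exists_TCtx ha hA hb hB (hX.snoc hU (hfA X)) hY hcA' hcB
  obtain ⟨W, hW⟩ := exists_TSo ha hA hb hB hX hY hcA hcB hU hV (hfA X) (hfB Y)
  have hs : TArg.Ok TA sA ⟨X, .var (chA X), U⟩ := ⟨hX, hcA, hU, .inr ⟨_, rfl⟩⟩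
  have hs' : TArg.Ok TA sA ⟨X, .var (chA X), U'⟩ := ⟨hX, hcA, hU', .inr ⟨_, rfl⟩⟩
  have ht : TArg.Ok TB sB ⟨Y, v, V⟩ := ⟨hY, hcB, hV, .inl hv⟩
  obtain ⟨e, he⟩ := hs.exists_TTg ha hA hb hB ht
  obtain ⟨e', he'⟩ := hs'.exists_TTg ha hA hb hB ht
  obtain ⟨g, hg⟩ := TArg.Ok.exists_left ha hA hb hB hX hcA ht
  rw [← hZ.eq_tz ha hA hb hB (hX.snoc hU (hfA X)) hY hcA' hcB,
    ← TTg.eq_R ha hA hb hB hX hY hcA hcB hU hv hV he,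
    ← TTg.eq_R ha hA hb hB hX hY hcA hcB hU' hv hV he',
    ← T2_pairsL ha hA hcA hcB hU hV (hfB Y) (TTg.eq_bv ha hA hb hB hX hY hcA hcB hv hV hg),
    ← hW.eq_T2 ha hA hb hB hX hY hcA hcB hU hV]
  exact ⟨_, _, h, h', .seqt hZ he he' hW hg⟩

include hcB' in
theorem tensorAx_termEq_sort (hu : TD TA X u) (hu' : TD TA X u') (h : .termEq X u u' U ∈ TA)
    (h' : .sort Y V ∈ TB) :
    Judg.termEq (tz ax (genNv sA sB) X (Y ++ [(chB Y, V)]))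
      ((synM T ax).C (genNv sA sB) V (fun x => .var (x, chB Y)) u)
      ((synM T ax).C (genNv sA sB) V (fun x => .var (x, chB Y)) u')
      ((synM T ax).T2 (genNv sA sB) U V ((synM T ax).au (genNv sA sB) u)
        fun x => .var (x, chB Y)) ∈ tensorAx TA TB chA chB := by
  obtain ⟨Z, hZ⟩ := exists_TCtx ha hA hb hB hX (hY.snoc hV (hfB Y)) hcA hcB'
  obtain ⟨W, hW⟩ := exists_TSo ha hA hb hB hX hY hcA hcB hU hV (hfA X) (hfB Y)
  have hs : TArg.Ok TA sA ⟨X, u, U⟩ := ⟨hX, hcA, hU, .inl hu⟩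
  have hs' : TArg.Ok TA sA ⟨X, u', U⟩ := ⟨hX, hcA, hU, .inl hu'⟩
  have ht : TArg.Ok TB sB ⟨Y, .var (chB Y), V⟩ := ⟨hY, hcB, hV, .inr ⟨_, rfl⟩⟩
  obtain ⟨e, he⟩ := hs.exists_TTg ha hA hb hB ht
  obtain ⟨e', he'⟩ := hs'.exists_TTg ha hA hb hB ht
  obtain ⟨g, hg⟩ := TArg.Ok.exists_right ha hA hb hB hs hY hcB
  rw [← hZ.eq_tz ha hA hb hB hX (hY.snoc hV (hfB Y)) hcA hcB',
    ← TTg.eq_C ha hA hb hB hX hY hcA hcB hu hU hV he,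
    ← TTg.eq_C ha hA hb hB hX hY hcA hcB hu' hU hV he',
    ← T2_pairsR ha hA hcA hcB hU hV (hfA X) (TTg.eq_au ha hA hb hB hX hY hcA hcB hu hU hg),
    ← hW.eq_T2 ha hA hb hB hX hY hcA hcB hU hV]
  exact ⟨_, _, h, h', .teqs hZ he he' hW hg⟩

include hcB' in
theorem tensorAx_term_sortEq (hV' : SD TB Y V') (hu : TD TA X u) (h : .term X u U ∈ TA)
    (h' : .sortEq Y V V' ∈ TB) :
    Judg.termEq (tz ax (genNv sA sB) X (Y ++ [(chB Y, V)]))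
      ((synM T ax).C (genNv sA sB) V (fun x => .var (x, chB Y)) u)
      ((synM T ax).C (genNv sA sB) V' (fun x => .var (x, chB Y)) u)
      ((synM T ax).T2 (genNv sA sB) U V ((synM T ax).au (genNv sA sB) u)
        fun x => .var (x, chB Y)) ∈ tensorAx TA TB chA chB := by
  obtain ⟨Z, hZ⟩ := exists_TCtx ha hA hb hB hX (hY.snoc hV (hfB Y)) hcA hcB'
  obtain ⟨W, hW⟩ := exists_TSo ha hA hb hB hX hY hcA hcB hU hV (hfA X) (hfB Y)
  have hs : TArg.Ok TA sA ⟨X, u, U⟩ := ⟨hX, hcA, hU, .inl hu⟩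
  have ht : TArg.Ok TB sB ⟨Y, .var (chB Y), V⟩ := ⟨hY, hcB, hV, .inr ⟨_, rfl⟩⟩
  have ht' : TArg.Ok TB sB ⟨Y, .var (chB Y), V'⟩ := ⟨hY, hcB, hV', .inr ⟨_, rfl⟩⟩
  obtain ⟨e, he⟩ := hs.exists_TTg ha hA hb hB ht
  obtain ⟨e', he'⟩ := hs.exists_TTg ha hA hb hB ht'
  obtain ⟨g, hg⟩ := TArg.Ok.exists_right ha hA hb hB hs hY hcB
  rw [← hZ.eq_tz ha hA hb hB hX (hY.snoc hV (hfB Y)) hcA hcB',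
    ← TTg.eq_C ha hA hb hB hX hY hcA hcB hu hU hV he,
    ← TTg.eq_C ha hA hb hB hX hY hcA hcB hu hU hV' he',
    ← T2_pairsR ha hA hcA hcB hU hV (hfA X) (TTg.eq_au ha hA hb hB hX hY hcA hcB hu hU hg),
    ← hW.eq_T2 ha hA hb hB hX hY hcA hcB hU hV]
  exact ⟨_, _, h, h', .tseq hZ he he' hW hg⟩

theorem tensorAx_term_term {s : A.TermSym} {ss : List (Expr A)} {t : B.TermSym}
    {ts : List (Expr B)} (hu : TD TA X (.app s ss)) (hv : TD TB Y (.app t ts))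
    (h : .term X (.app s ss) U ∈ TA) (h' : .term Y (.app t ts) V ∈ TB) :
    Judg.termEq (tz ax (genNv sA sB) X Y)
      ((synM T ax).R (genNv sA sB) U ((synM T ax).au (genNv sA sB) (.app s ss)) (.app t ts))
      ((synM T ax).C (genNv sA sB) V ((synM T ax).bv (genNv sA sB) (.app t ts)) (.app s ss))
      ((synM T ax).T2 (genNv sA sB) U V ((synM T ax).au (genNv sA sB) (.app s ss))
        ((synM T ax).bv (genNv sA sB) (.app t ts))) ∈ tensorAx TA TB chA chB := by
  obtain ⟨Z, hZ⟩ := exists_TCtx ha hA hb hB hX hY hcA hcB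
  obtain ⟨W, hW⟩ := exists_TSo ha hA hb hB hX hY hcA hcB hU hV (hfA X) (hfB Y)
  have hs : TArg.Ok TA sA ⟨X, .app s ss, U⟩ := ⟨hX, hcA, hU, .inl hu⟩
  have ht : TArg.Ok TB sB ⟨Y, .app t ts, V⟩ := ⟨hY, hcB, hV, .inl hv⟩
  obtain ⟨e, he⟩ := hs.exists_TTg ha hA hb hB ht
  obtain ⟨e', he'⟩ := TArg.Ok.exists_TTd ha hA hb hB hs ht
  obtain ⟨g, hg⟩ := TArg.Ok.exists_left ha hA hb hB hX hcA ht
  obtain ⟨g', hg'⟩ := TArg.Ok.exists_right ha hA hb hB hs hY hcB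
  rw [← hZ.eq_tz ha hA hb hB hX hY hcA hcB,
    ← T2_pairs ha hA hcA hcB hU hV (hfA X) (hfB Y)
      (TTg.eq_bv ha hA hb hB hX hY hcA hcB hv hV hg)
      (TTg.eq_au ha hA hb hB hX hY hcA hcB hu hU hg'),
    ← hW.eq_T2 ha hA hb hB hX hY hcA hcB hU hV]
  have hR : e = (synM T ax).R (genNv sA sB) U ((synM T ax).au (genNv sA sB) (.app s ss))
    (.app t ts) := he.eq_valG ha hA hb hB rfl hs ht
  have hC : e' = (synM T ax).C (genNv sA sB) V ((synM T ax).bv (genNv sA sB) (.app t ts))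
    (.app s ss) := he'.eq_valD ha hA hb hB hs ht
  rw [← hR, ← hC]
  exact ⟨_, _, h, h', .tt hZ he he' hW hg hg'⟩

end

end axioms

/-! ## The tensor product is shaped like a pretheory -/

/-- The components of the axioms are well-formed. -/
structure AxOk (Ax : Set (Judg A)) : Prop where
  ctx : ∀ {J}, J ∈ Ax → CD Ax J.ctxOf
  sort : ∀ {X U}, .sort X U ∈ Ax → SD Ax X U
  term : ∀ {X u U}, .term X u U ∈ Ax → TD Ax X u ∧ SD Ax X U
  sortEq : ∀ {X U U'}, .sortEq X U U' ∈ Ax → SD Ax X U ∧ SD Ax X U'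
  termEq : ∀ {X u u' U}, .termEq X u u' U ∈ Ax → TD Ax X u ∧ TD Ax X u' ∧ SD Ax X U

section

variable {Ax : Set (Judg A)} {X : PreCtx A} {U : SortE A} {u : Expr A}

theorem IsGAT.cd (h : IsGAT Ax) (hX : Derivable Ax (.ctx X)) : CD Ax X :=
  (h.eventually_HCtx hX).exists

theorem IsGAT.sd (h : IsGAT Ax) (hU : Derivable Ax (.sort X U)) : SD Ax X U :=
  h.exists_HD_sort hU

theorem IsGAT.td (h : IsGAT Ax) (hu : Derivable Ax (.term X u U)) : TD Ax X u :=
  (h.exists_HD_term hu).imp fun _ h => ⟨U, h⟩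

theorem IsGAT.axOk (h : IsGAT Ax) : AxOk Ax where
  ctx {J} hJ := by
    have hd := h.2 J hJ
    refine h.cd ?_
    cases J with
    | ctx X => exact hd
    | sort X U => exact hd.ctx_of_sort
    | term X u U => exact hd.ctx_of_term
    | sortEq X U U' => exact hd.sort_of_sortEq.1.ctx_of_sort
    | termEq X u u' U => exact hd.term_of_termEq.1.ctx_of_term
  sort hJ := h.sd (h.2 _ hJ)
  term hJ := ⟨h.td (h.2 _ hJ), h.sd (h.2 _ hJ).sort_of_term⟩
  sortEq hJ := (h.2 _ hJ).sort_of_sortEq.imp h.sd h.sd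
  termEq hJ :=
    have hd := (h.2 _ hJ).term_of_termEq
    ⟨h.td hd.1, h.td hd.2, h.sd hd.1.sort_of_term⟩

theorem IsGAT.thy (h : IsGAT Ax) : Thy Ax where
  shaped := h.shaped
  nodup hJ := (h.axOk.ctx hJ).nodup
  isPreCtx hJ := h.1.wf_ctx _ hJ

theorem IsGAT.exists_introFn (h : IsGAT Ax) : ∃ ax, IntroFn Ax ax := by
  choose ax hax _ using h.1.term_intro
  exact ⟨ax, hax⟩

end

/-- The data from which the tensor product is formed. -/
structure Factors (TA : Set (Judg A)) (TB : Set (Judg B)) (chA : PreCtx A → A.Var)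
    (chB : PreCtx B → B.Var) (ax : A.TermSym → PreCtx A × SortE A)
    (bx : B.TermSym → PreCtx B × SortE B) : Prop where
  ha : IntroFn TA ax
  hA : Thy TA
  wA : AxOk TA
  fA : FreshCh chA
  hb : IntroFn TB bx
  hB : Thy TB
  wB : AxOk TB
  fB : FreshCh chB

section

variable {TA : Set (Judg A)} {TB : Set (Judg B)} {chA : PreCtx A → A.Var}
  {chB : PreCtx B → B.Var} {ax : A.TermSym → PreCtx A × SortE A}
  {bx : B.TermSym → PreCtx B × SortE B} {sA : A.Var → SortE A} {sB : B.Var → SortE B}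
  {T : Set (Judg (A.tensor B))} {X : PreCtx A} {Y : PreCtx B} {U U' : SortE A} {V V' : SortE B}
  {u u' : Expr A} {v v' : Expr B} {Z : PreCtx (A.tensor B)} {e : Expr (A.tensor B)}
  {W : SortE (A.tensor B)}

theorem ctxVars_tz (ε : Nv A B (Expr (A.tensor B))) :
    ctxVars (tz ax ε X Y) =
      X.flatMap fun p => Y.map fun q => Expr.var (A := A.tensor B) (p.1, q.1) := by
  simp [ctxVars, tz, List.map_flatMap, Function.comp_def]

theorem Compat.append_left {X' : PreCtx A} (h : Compat sA (X ++ X')) : Compat sA X :=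
  fun p hp => h p (List.mem_append_left _ hp)

theorem exists_compat_snoc (h : CD TA X) (U : SortE A) {x : A.Var} (hx : ∀ p ∈ X, p.1 ≠ x) :
    ∃ s, Compat s (X ++ [(x, U)]) := by
  refine exists_compat (fun _ => U) ?_
  have : keys (X ++ [(x, U)]) = keys X ++ [x] := by simp [keys]
  rw [this, List.nodup_append]
  refine ⟨h.nodup, List.nodup_singleton x, fun y hy z hz => ?_⟩
  obtain ⟨p, hp, rfl⟩ := List.mem_map.1 hy
  rw [List.mem_singleton.1 hz]
  exact hx p hp

theorem synM.I_var_var (ha : IntroFn TA ax) (hA : Thy TA) (hX : CD TA X) (hY : CD TB Y)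
    {ε : Nv A B (Expr (A.tensor B))} (hcA : Compat ε.sA X) (hcB : Compat ε.sB Y)
    {p : A.Var × SortE A} (hp : p ∈ X) {q : B.Var × SortE B} (hq : q ∈ Y) :
    (synM T ax).I ε (.var p.1) (.var q.1) = ε.ρ p.1 q.1 := by
  rw [synM.I_eq ha hA hcA hcB (hX.var hp) (hY.var hq), synM.R_var, synM.au_var]

theorem flatMap_snoc_map (X : PreCtx A) (Y : PreCtx B) (p : A.Var × SortE A)
    (f : A.Var × SortE A → B.Var × SortE B → Expr (A.tensor B)) :
    ((X ++ [p]).flatMap fun p => Y.map (f p)) =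
      (X.flatMap fun p => Y.map (f p)) ++ Y.map (f p) := by
  simp

namespace Factors

variable (D : Factors TA TB chA chB ax bx)

include D

theorem R_generic (hX : CD TA X) (hY : CD TB Y) {ε : Nv A B (Expr (A.tensor B))}
    (hcA : Compat ε.sA X) (hcB : Compat ε.sB Y) (S : A.SortSym) (t : B.TermSym)
    (a : B.Var → Expr (A.tensor B)) :
    (synM T ax).R ε ⟨S, ctxVars X⟩ a (.app t (ctxVars Y)) =
      .app (.inl (S, t)) ((X.flatMap fun p => Y.map fun q => ε.ρ p.1 q.1) ++
        Y.map fun q => a q.1) := by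
  rw [synM.R_app]
  simp only [gSt, optL, ctxVars, List.flatMap_append, List.map_map, List.flatMap_map,
    Function.comp_def, Option.elim, List.flatMap_cons, List.flatMap_nil, List.append_nil,
    synM.R_var]
  congr 2
  exact List.flatMap_congr fun p hp => List.map_congr_left fun q hq =>
    synM.I_var_var D.ha D.hA hX hY hcA hcB hp hq

theorem C_generic (hX : CD TA X) (hY : CD TB Y) {ε : Nv A B (Expr (A.tensor B))}
    (hcA : Compat ε.sA X) (hcB : Compat ε.sB Y) (s : A.TermSym) (S : B.SortSym)
    (b : A.Var → Expr (A.tensor B)) :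
    (synM T ax).C ε ⟨S, ctxVars Y⟩ b (.app s (ctxVars X)) =
      .app (.inr (s, S)) (X.flatMap fun p => (Y.map fun q => ε.ρ p.1 q.1) ++ [b p.1]) := by
  rw [synM.C_app]
  simp only [gTs, optL, ctxVars, List.map_append, List.map_map, List.flatMap_map,
    Function.comp_def, Option.elim, List.map_cons, List.map_nil, synM.C_var]
  congr 1
  exact List.flatMap_congr fun p hp => congrArg (· ++ [b p.1]) (List.map_congr_left fun q hq =>
    synM.I_var_var D.ha D.hA hX hY hcA hcB hp hq)

theorem T2_generic (hX : CD TA X) (hY : CD TB Y) {ε : Nv A B (Expr (A.tensor B))}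
    (hcA : Compat ε.sA X) (hcB : Compat ε.sB Y) (S : A.SortSym) (S' : B.SortSym)
    (a : B.Var → Expr (A.tensor B)) (b : A.Var → Expr (A.tensor B)) :
    (synM T ax).T2 ε ⟨S, ctxVars X⟩ ⟨S', ctxVars Y⟩ a b =
      ⟨(S, S'), (X.flatMap fun p => (Y.map fun q => ε.ρ p.1 q.1) ++ [b p.1]) ++
        Y.map fun q => a q.1⟩ := by
  change gSS _ _ _ _ _ _ _ = _
  simp only [gSS, optL, ctxVars, List.map_append, List.map_map, List.flatMap_map,
    Function.comp_def, Option.elim, List.map_cons, List.map_nil, synM.C_var, synM.R_var]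
  congr 2
  exact List.flatMap_congr fun p hp => congrArg (· ++ [b p.1]) (List.map_congr_left fun q hq =>
    synM.I_var_var D.ha D.hA hX hY hcA hcB hp hq)

theorem sort_mem (h : .sort Z W ∈ tensorAx TA TB chA chB) :
    ∃ X U Y V, .sort X U ∈ TA ∧ .sort Y V ∈ TB ∧
      ∀ sA sB, Compat sA (X ++ [(chA X, U)]) → Compat sB (Y ++ [(chB Y, V)]) →
        Z = (tz ax (genNv sA sB) (X ++ [(chA X, U)]) (Y ++ [(chB Y, V)])).dropLast ∧
        W = (synM T ax).T2 (genNv sA sB) U V (fun y => .var (chA X, y))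
          fun x => .var (x, chB Y) := by
  obtain ⟨J, J', hJ, hJ', h⟩ := h
  cases h with
  | @ss X U Y V Z W hZ hW =>
    refine ⟨X, U, Y, V, hJ, hJ', fun sA sB hcA hcB => ⟨?_, ?_⟩⟩
    · rw [hZ.eq_tz D.ha D.hA D.hb D.hB ((D.wA.ctx hJ).snoc (D.wA.sort hJ) (D.fA X))
        ((D.wB.ctx hJ').snoc (D.wB.sort hJ') (D.fB Y)) hcA hcB]
    · exact hW.eq_T2 D.ha D.hA D.hb D.hB (D.wA.ctx hJ) (D.wB.ctx hJ') hcA.append_left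
        hcB.append_left (D.wA.sort hJ) (D.wB.sort hJ')

theorem term_mem (h : .term Z e W ∈ tensorAx TA TB chA chB) :
    (∃ X U Y v V, .sort X U ∈ TA ∧ .term Y v V ∈ TB ∧
      ∀ sA sB, Compat sA (X ++ [(chA X, U)]) → Compat sB Y →
        Z = tz ax (genNv sA sB) (X ++ [(chA X, U)]) Y ∧
        e = (synM T ax).R (genNv sA sB) U (fun y => .var (chA X, y)) v ∧
        W = (synM T ax).T2 (genNv sA sB) U V (fun y => .var (chA X, y))
          ((synM T ax).bv (genNv sA sB) v)) ∨
    ∃ X u U Y V, .term X u U ∈ TA ∧ .sort Y V ∈ TB ∧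
      ∀ sA sB, Compat sA X → Compat sB (Y ++ [(chB Y, V)]) →
        Z = tz ax (genNv sA sB) X (Y ++ [(chB Y, V)]) ∧
        e = (synM T ax).C (genNv sA sB) V (fun x => .var (x, chB Y)) u ∧
        W = (synM T ax).T2 (genNv sA sB) U V ((synM T ax).au (genNv sA sB) u)
          fun x => .var (x, chB Y) := by
  obtain ⟨J, J', hJ, hJ', h⟩ := h
  cases h with
  | @st X U Y v V Z e W g hZ he hW hg =>
    refine .inl ⟨X, U, Y, v, V, hJ, hJ', fun sA sB hcA hcB => ?_⟩
    have hX := D.wA.ctx hJ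
    have hY := D.wB.ctx hJ'
    have hU := D.wA.sort hJ
    have hv := D.wB.term hJ'
    refine ⟨hZ.eq_tz D.ha D.hA D.hb D.hB (hX.snoc hU (D.fA X)) hY hcA hcB,
      TTg.eq_R D.ha D.hA D.hb D.hB hX hY hcA.append_left hcB hU hv.1 hv.2 he, ?_⟩
    rw [hW.eq_T2 D.ha D.hA D.hb D.hB hX hY hcA.append_left hcB hU hv.2,
      T2_pairsL D.ha D.hA hcA.append_left hcB hU hv.2 (D.fB Y)
        (TTg.eq_bv D.ha D.hA D.hb D.hB hX hY hcA.append_left hcB hv.1 hv.2 hg)]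
  | @ts X u U Y V Z e W g hZ he hW hg =>
    refine .inr ⟨X, u, U, Y, V, hJ, hJ', fun sA sB hcA hcB => ?_⟩
    have hX := D.wA.ctx hJ
    have hY := D.wB.ctx hJ'
    have hu := D.wA.term hJ
    have hV := D.wB.sort hJ'
    refine ⟨hZ.eq_tz D.ha D.hA D.hb D.hB hX (hY.snoc hV (D.fB Y)) hcA hcB,
      TTg.eq_C D.ha D.hA D.hb D.hB hX hY hcA hcB.append_left hu.1 hu.2 hV he, ?_⟩
    rw [hW.eq_T2 D.ha D.hA D.hb D.hB hX hY hcA hcB.append_left hu.2 hV,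
      T2_pairsR D.ha D.hA hcA hcB.append_left hu.2 hV (D.fA X)
        (TTg.eq_au D.ha D.hA D.hb D.hB hX hY hcA hcB.append_left hu.1 hu.2 hg)]

theorem shaped : Shaped (tensorAx TA TB chA chB) where
  sort_shape {Z W} h := by
    obtain ⟨X, U, Y, V, hU, hV, h⟩ := D.sort_mem (T := ∅) h
    obtain ⟨sA, hcA⟩ := exists_compat_snoc (D.wA.ctx hU) U (D.fA X)
    obtain ⟨sB, hcB⟩ := exists_compat_snoc (D.wB.ctx hV) V (D.fB Y)
    obtain ⟨rfl, rfl⟩ := h sA sB hcA hcB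
    rw [(D.hA.shaped.sort_mem_spec hU).2, (D.hB.shaped.sort_mem_spec hV).2]
    rw [D.T2_generic (T := ∅) (X := X) (Y := Y) (D.wA.ctx hU) (D.wB.ctx hV) (ε := genNv sA sB) hcA.append_left
      hcB.append_left, dropLast_tz]
    simp only [ctxVars, List.map_append]
    change _ = ctxVars (tz ax _ _ _) ++ ctxVars (tz ax _ _ _)
    rw [ctxVars_tz, ctxVars_tz]
    simp [genNv]
  term_shape {Z e W} h := by
    rcases D.term_mem (T := ∅) h with ⟨X, U, Y, v, V, hU, hv, h⟩ | ⟨X, u, U, Y, V, hu, hV, h⟩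
    · obtain ⟨sA, hcA⟩ := exists_compat_snoc (D.wA.ctx hU) U (D.fA X)
      obtain ⟨sB, hcB⟩ := exists_compat (fun _ => V) (D.wB.ctx hv).nodup
      obtain ⟨rfl, rfl, rfl⟩ := h sA sB hcA hcB
      obtain ⟨t, -, rfl⟩ := D.hB.shaped.term_mem_spec hv
      rw [(D.hA.shaped.sort_mem_spec hU).2, D.R_generic (T := ∅) (X := X) (Y := Y) (D.wA.ctx hU) (D.wB.ctx hv)
        (ε := genNv sA sB) hcA.append_left hcB, ctxVars_tz, flatMap_snoc_map]
      exact ⟨_, rfl⟩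
    · obtain ⟨sA, hcA⟩ := exists_compat (fun _ => U) (D.wA.ctx hu).nodup
      obtain ⟨sB, hcB⟩ := exists_compat_snoc (D.wB.ctx hV) V (D.fB Y)
      obtain ⟨rfl, rfl, rfl⟩ := h sA sB hcA hcB
      obtain ⟨t, -, rfl⟩ := D.hA.shaped.term_mem_spec hu
      rw [(D.hB.shaped.sort_mem_spec hV).2, D.C_generic (T := ∅) (X := X) (Y := Y) (D.wA.ctx hu) (D.wB.ctx hV)
        (ε := genNv sA sB) hcA hcB.append_left, ctxVars_tz]
      simp only [List.map_append]
      exact ⟨_, rfl⟩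
  sort_unique {S Z Z'} h h' := by
    obtain ⟨X, U, Y, V, hU, hV, h⟩ := D.sort_mem (T := ∅) h
    obtain ⟨X', U', Y', V', hU', hV', h'⟩ := D.sort_mem (T := ∅) h'
    obtain ⟨sA, hcA⟩ := exists_compat_snoc (D.wA.ctx hU) U (D.fA X)
    obtain ⟨sB, hcB⟩ := exists_compat_snoc (D.wB.ctx hV) V (D.fB Y)
    obtain ⟨sA', hcA'⟩ := exists_compat_snoc (D.wA.ctx hU') U' (D.fA X')
    obtain ⟨sB', hcB'⟩ := exists_compat_snoc (D.wB.ctx hV') V' (D.fB Y')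
    have h1 := congrArg SortE.head (h sA sB hcA hcB).2
    have h2 := congrArg SortE.head (h' sA' sB' hcA' hcB').2
    obtain ⟨hU, eU⟩ := D.hA.shaped.sort_mem_spec hU
    obtain ⟨hU', eU'⟩ := D.hA.shaped.sort_mem_spec hU'
    obtain ⟨hV, eV⟩ := D.hB.shaped.sort_mem_spec hV
    obtain ⟨hV', eV'⟩ := D.hB.shaped.sort_mem_spec hV'
    have h3 : (U.head, V.head) = (U'.head, V'.head) := h1.symm.trans h2
    obtain ⟨h4, h5⟩ := Prod.mk.inj h3
    rw [← h4] at hU' eU'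
    rw [← h5] at hV' eV'
    obtain rfl := D.hA.shaped.sort_unique hU hU'
    obtain rfl := D.hB.shaped.sort_unique hV hV'
    obtain rfl := eU.trans eU'.symm
    obtain rfl := eV.trans eV'.symm
    exact (h sA sB hcA hcB).1.trans (h' sA sB hcA hcB).1.symm
  term_unique {t Z Z' W W'} h h' := by
    rcases D.term_mem (T := ∅) h with ⟨X, U, Y, v, V, hU, hv, h⟩ | ⟨X, u, U, Y, V, hu, hV, h⟩ <;>
      rcases D.term_mem (T := ∅) h' with ⟨X', U', Y', v', V', hU', hv', h'⟩ |
        ⟨X', u', U', Y', V', hu', hV', h'⟩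
    · obtain ⟨sA, hcA⟩ := exists_compat_snoc (D.wA.ctx hU) U (D.fA X)
      obtain ⟨sB, hcB⟩ := exists_compat (fun _ => V) (D.wB.ctx hv).nodup
      obtain ⟨sA', hcA'⟩ := exists_compat_snoc (D.wA.ctx hU') U' (D.fA X')
      obtain ⟨sB', hcB'⟩ := exists_compat (fun _ => V') (D.wB.ctx hv').nodup
      obtain ⟨t, hv, rfl⟩ := D.hB.shaped.term_mem_spec hv
      obtain ⟨t', hv', rfl⟩ := D.hB.shaped.term_mem_spec hv'
      have h1 := (h sA sB hcA hcB).2.1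
      have h2 := (h' sA' sB' hcA' hcB').2.1
      rw [synM.R_app] at h1 h2
      obtain ⟨hU, eU⟩ := D.hA.shaped.sort_mem_spec hU
      obtain ⟨hU', eU'⟩ := D.hA.shaped.sort_mem_spec hU'
      simp only [gSt, Expr.app.injEq] at h1 h2
      obtain ⟨h4, h5⟩ := Prod.mk.inj (Sum.inl.inj (h1.1.symm.trans h2.1))
      rw [← h4] at hU' eU'
      subst h5
      obtain rfl := D.hA.shaped.sort_unique hU hU'
      obtain rfl := eU.trans eU'.symm
      obtain ⟨rfl, rfl⟩ := D.hB.shaped.term_unique hv hv'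
      have h1 := h sA sB hcA hcB
      have h2 := h' sA sB hcA hcB
      exact ⟨h1.1.trans h2.1.symm, h1.2.2.trans h2.2.2.symm⟩
    · obtain ⟨sA, hcA⟩ := exists_compat_snoc (D.wA.ctx hU) U (D.fA X)
      obtain ⟨sB, hcB⟩ := exists_compat (fun _ => V) (D.wB.ctx hv).nodup
      obtain ⟨sA', hcA'⟩ := exists_compat (fun _ => U') (D.wA.ctx hu').nodup
      obtain ⟨sB', hcB'⟩ := exists_compat_snoc (D.wB.ctx hV') V' (D.fB Y')
      obtain ⟨t, hv, rfl⟩ := D.hB.shaped.term_mem_spec hv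
      obtain ⟨t', hu', rfl⟩ := D.hA.shaped.term_mem_spec hu'
      have h1 := (h sA sB hcA hcB).2.1
      have h2 := (h' sA' sB' hcA' hcB').2.1
      rw [synM.R_app] at h1
      rw [synM.C_app] at h2
      simp only [gSt, gTs, Expr.app.injEq] at h1 h2
      exact absurd (h1.1.symm.trans h2.1) (by simp)
    · obtain ⟨sA, hcA⟩ := exists_compat_snoc (D.wA.ctx hU') U' (D.fA X')
      obtain ⟨sB, hcB⟩ := exists_compat (fun _ => V') (D.wB.ctx hv').nodup
      obtain ⟨sA', hcA'⟩ := exists_compat (fun _ => U) (D.wA.ctx hu).nodup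
      obtain ⟨sB', hcB'⟩ := exists_compat_snoc (D.wB.ctx hV) V (D.fB Y)
      obtain ⟨t, hv', rfl⟩ := D.hB.shaped.term_mem_spec hv'
      obtain ⟨t', hu, rfl⟩ := D.hA.shaped.term_mem_spec hu
      have h1 := (h' sA sB hcA hcB).2.1
      have h2 := (h sA' sB' hcA' hcB').2.1
      rw [synM.R_app] at h1
      rw [synM.C_app] at h2
      simp only [gSt, gTs, Expr.app.injEq] at h1 h2
      exact absurd (h1.1.symm.trans h2.1) (by simp)
    · obtain ⟨sA, hcA⟩ := exists_compat (fun _ => U) (D.wA.ctx hu).nodup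
      obtain ⟨sB, hcB⟩ := exists_compat_snoc (D.wB.ctx hV) V (D.fB Y)
      obtain ⟨sA', hcA'⟩ := exists_compat (fun _ => U') (D.wA.ctx hu').nodup
      obtain ⟨sB', hcB'⟩ := exists_compat_snoc (D.wB.ctx hV') V' (D.fB Y')
      obtain ⟨t, hu, rfl⟩ := D.hA.shaped.term_mem_spec hu
      obtain ⟨t', hu', rfl⟩ := D.hA.shaped.term_mem_spec hu'
      have h1 := (h sA sB hcA hcB).2.1
      have h2 := (h' sA' sB' hcA' hcB').2.1
      rw [synM.C_app] at h1 h2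
      obtain ⟨hV, eV⟩ := D.hB.shaped.sort_mem_spec hV
      obtain ⟨hV', eV'⟩ := D.hB.shaped.sort_mem_spec hV'
      simp only [gTs, Expr.app.injEq] at h1 h2
      obtain ⟨h5, h4⟩ := Prod.mk.inj (Sum.inr.inj (h1.1.symm.trans h2.1))
      rw [← h4] at hV' eV'
      subst h5
      obtain rfl := D.hB.shaped.sort_unique hV hV'
      obtain rfl := eV.trans eV'.symm
      obtain ⟨rfl, rfl⟩ := D.hA.shaped.term_unique hu hu'
      have h1 := h sA sB hcA hcB
      have h2 := h' sA sB hcA hcB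
      exact ⟨h1.1.trans h2.1.symm, h1.2.2.trans h2.2.2.symm⟩

end Factors

end

/-! ## Generic worlds of the syntactic model -/

namespace Mdl

variable {Ex So W : Type} {M : Mdl A B Ex So W} {X : PreCtx A} {Y : PreCtx B} {U : SortE A}
  {V : SortE B}

theorem Entries.snoc_left (h : M.Entries X Y) (hR : M.RowOk X U Y) (x : A.Var) :
    M.Entries (X ++ [(x, U)]) Y := by
  intro i hi j hj
  rcases lt_or_ge i X.length with h' | h'
  · rw [List.getElem_append_left h', List.take_append_of_le_length h'.le]
    exact h i h' j hj
  · have : i = X.length := by simp at hi; omega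
    subst this
    simp only [List.getElem_append_right (le_refl X.length), Nat.sub_self,
      List.getElem_cons_zero, List.take_left]
    exact hR j hj

theorem Entries.snoc_right (h : M.Entries X Y) (hC : M.ColOk X Y V) (y : B.Var) :
    M.Entries X (Y ++ [(y, V)]) :=
  (Entries.snoc_left (M := M.flip) h.flip (fun i hi => (hC i hi).flip) y).flip

end Mdl

section

variable {TA : Set (Judg A)} {TB : Set (Judg B)} {ax : A.TermSym → PreCtx A × SortE A}
  {sA : A.Var → SortE A} {sB : B.Var → SortE B}
  {T : Set (Judg (A.tensor B))} {X : PreCtx A} {Y : PreCtx B} {U U' : SortE A} {V V' : SortE B}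
  {u : Expr A} {v : Expr B}
  {w : {Z : PreCtx (A.tensor B) // Derivable T (.ctx Z)}}

theorem keys_tz_nodup (hX : (keys X).Nodup) (hY : (keys Y).Nodup) (ε : Nv A B (Expr (A.tensor B))) :
    (keys (tz ax ε X Y)).Nodup := by
  have : keys (tz ax ε X Y) = (keys X).product (keys Y) := by
    simp [keys, tz, List.map_flatMap, List.product, List.flatMap_map, Function.comp_def]
  rw [this]
  exact hX.product hY

theorem length_tz (ε : Nv A B (Expr (A.tensor B))) :
    (tz ax ε X Y).length = X.length * Y.length := length_grid _ _ _

theorem env_gen (hs : Shaped T) (hcA : Compat sA X) (hcB : Compat sB Y)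
    (h : ∀ z ∈ tz ax (genNv sA sB) X Y, z ∈ w.1) : (synM T ax).Env w (genNv sA sB) X Y :=
  ⟨hcA, hcB, fun p hp q hq =>
    w.2.var_typed hs _ (h _ ((mem_tz (T := T)).2 ⟨p, hp, q, hq, rfl⟩))⟩

theorem row_gen (hs : Shaped T) {x : A.Var} (h : ∀ z ∈ tz ax (genNv sA sB) [(x, U)] Y, z ∈ w.1) :
    (synM T ax).Row w (genNv sA sB) U Y fun y => .var (x, y) := fun q hq =>
  w.2.var_typed hs _ (h _ ((mem_tz (T := T)).2 ⟨_, List.mem_singleton_self _, q, hq, rfl⟩))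

theorem col_gen (hs : Shaped T) {y : B.Var} (h : ∀ z ∈ tz ax (genNv sA sB) X [(y, V)], z ∈ w.1) :
    (synM T ax).Col w (genNv sA sB) V X fun x => .var (x, y) := fun p hp =>
  w.2.var_typed hs _ (h _ ((mem_tz (T := T)).2 ⟨p, hp, _, List.mem_singleton_self _, rfl⟩))

/-- An initial segment of the tensor of two contexts is a context, if its sorts are. -/
theorem ctx_tz_take (hs : Shaped T) (hX : CD TA X) (hY : CD TB Y) (hcA : Compat sA X)
    (hcB : Compat sB Y) (K : ℕ)
    (h : ∀ i (hi : i < X.length) j (hj : j < Y.length), i * Y.length + j < K →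
      (synM T ax).SSok (X.take i) (X[i]'hi).2 (Y.take j) (Y[j]'hj).2) :
    Derivable T (.ctx ((tz ax (genNv sA sB) X Y).take K)) := by
  refine derivable_ctx_of_forall hs
    (keys_nodup_take (keys_tz_nodup hX.nodup hY.nodup _) K) fun k hk hctx => ?_
  rw [List.length_take, lt_min_iff, length_tz] at hk
  obtain ⟨i, j, hi, hj, rfl⟩ := exists_grid_index hk.2
  rw [List.take_take, min_eq_left hk.1.le] at hctx ⊢
  rw [List.getElem_take]
  have hget : ∀ i' j' (hi' : i' < X.length) (hj' : j' < Y.length)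
      (h' : i' * Y.length + j' < (tz ax (genNv sA sB) X Y).length),
      (tz ax (genNv sA sB) X Y)[i' * Y.length + j'] = (((X[i']).1, (Y[j']).1),
        (synM T ax).T2 (genNv sA sB) (X[i']).2 (Y[j']).2
          (fun y => .var ((X[i']).1, y)) fun x => .var (x, (Y[j']).1)) :=
    fun i' j' hi' hj' h' => getElem_grid _ _ _ hi' hj' h'
  have hmem : ∀ i' j' (hi' : i' < X.length) (hj' : j' < Y.length),
      i' * Y.length + j' < i * Y.length + j →
      (((X[i']).1, (Y[j']).1), (synM T ax).T2 (genNv sA sB) (X[i']).2 (Y[j']).2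
          (fun y => .var ((X[i']).1, y)) fun x => .var (x, (Y[j']).1)) ∈
        (tz ax (genNv sA sB) X Y).take (i * Y.length + j) := fun i' j' hi' hj' h' =>
    mem_take_iff_lt.2 ⟨_, (by rw [length_tz]; exact grid_index_lt hi' hj'), h', hget _ _ hi' hj' _⟩
  have hrow : ∀ i', i' < i → ∀ j', j' < Y.length → i' * Y.length + j' < i * Y.length + j := by
    intro i' hi' j' hj'
    have := grid_index_lt hi' hj'
    omega
  rw [hget i j hi hj]
  refine (Derivable.sort_of_sortEq (h i hi j hj hk.1 ⟨_, hctx⟩ (genNv sA sB)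
    (env_gen hs (hcA.take i) (hcB.take j) fun z hz => ?_) _ _
    (row_gen hs fun z hz => ?_) (col_gen hs fun z hz => ?_))).1
  · obtain ⟨p, hp, q, hq, rfl⟩ := (mem_tz (T := T)).1 hz
    obtain ⟨i', hi', hii', rfl⟩ := mem_take_iff_lt.1 hp
    obtain ⟨j', hj', hjj', rfl⟩ := mem_take_iff_lt.1 hq
    exact hmem i' j' hi' hj' (hrow i' hii' j' hj')
  · obtain ⟨p, hp, q, hq, rfl⟩ := (mem_tz (T := T)).1 hz
    obtain rfl := List.mem_singleton.1 hp
    obtain ⟨j', hj', hjj', rfl⟩ := mem_take_iff_lt.1 hq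
    exact hmem i j' hi hj' (by omega)
  · obtain ⟨p, hp, q, hq, rfl⟩ := (mem_tz (T := T)).1 hz
    obtain rfl := List.mem_singleton.1 hq
    obtain ⟨i', hi', hii', rfl⟩ := mem_take_iff_lt.1 hp
    exact hmem i' j hi' hj (hrow i' hii' j hj)

theorem ctx_tz (hs : Shaped T) (hX : CD TA X) (hY : CD TB Y) (hcA : Compat sA X)
    (hcB : Compat sB Y) (h : (synM T ax).Entries X Y) :
    Derivable T (.ctx (tz ax (genNv sA sB) X Y)) := by
  have := ctx_tz_take (ax := ax) hs hX hY hcA hcB (X.length * Y.length)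
    fun i hi j hj _ => h i hi j hj
  rwa [List.take_of_length_le (length_tz _).le] at this

theorem ctx_tz_dropLast (hs : Shaped T) {x : A.Var} {y : B.Var} (hX : CD TA (X ++ [(x, U)]))
    (hY : CD TB (Y ++ [(y, V)])) (hcA : Compat sA (X ++ [(x, U)]))
    (hcB : Compat sB (Y ++ [(y, V)])) (h : (synM T ax).Entries X Y)
    (hR : (synM T ax).RowOk X U Y) (hC : (synM T ax).ColOk X Y V) :
    Derivable T (.ctx (tz ax (genNv sA sB) (X ++ [(x, U)]) (Y ++ [(y, V)])).dropLast) := by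
  rw [List.dropLast_eq_take]
  refine ctx_tz_take hs hX hY hcA hcB _ fun i hi j hj hij => ?_
  rw [length_tz] at hij
  simp only [List.length_append, List.length_singleton] at hij hi hj
  rcases lt_or_ge i X.length with hi' | hi'
  · rw [List.getElem_append_left hi', List.take_append_of_le_length hi'.le]
    exact h.snoc_right hC y i hi' j (by simpa using hj)
  · rcases lt_or_ge j Y.length with hj' | hj'
    · simp only [List.getElem_append_left hj', List.take_append_of_le_length hj'.le]
      exact h.snoc_left hR x i (by simpa using hi) j hj'
    · obtain rfl : i = X.length := by omega
      obtain rfl : j = Y.length := by omega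
      exfalso
      have : (X.length + 1) * (Y.length + 1) = X.length * (Y.length + 1) + Y.length + 1 := by ring
      omega

end

/-! ## Congruence of the tensor constructors -/

section

variable {α β : Type}

theorem forall₂_flatMap {γ δ : Type} {R : γ → δ → Prop} {ks : List α} {f : α → List γ}
    {f' : α → List δ} (h : ∀ k ∈ ks, List.Forall₂ R (f k) (f' k)) :
    List.Forall₂ R (ks.flatMap f) (ks.flatMap f') := by
  induction ks with
  | nil => simp
  | cons k ks ih =>
    simp only [List.flatMap_cons]
    exact List.rel_append (h k List.mem_cons_self)
      (ih fun k hk => h k (List.mem_cons_of_mem _ hk))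

theorem forall₂_map_map {γ δ : Type} {R : γ → δ → Prop} {ks : List α} {f : α → γ}
    {f' : α → δ} (h : ∀ k ∈ ks, R (f k) (f' k)) :
    List.Forall₂ R (ks.map f) (ks.map f') := by
  induction ks with
  | nil => simp
  | cons k ks ih =>
    exact .cons (h k List.mem_cons_self) (ih fun k hk => h k (List.mem_cons_of_mem _ hk))

variable (ks : List α) (ls : List β) (f : α → Expr A) (g : β → Expr B)
  (i : Expr A → Expr B → Expr (A.tensor B)) (r : Expr B → Expr (A.tensor B))
  (c : Expr A → Expr (A.tensor B))

theorem gSt_map (S : A.SortSym) (t : B.TermSym) :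
    gSt S t (ks.map f) (ls.map g) i r = .app (.inl (S, t))
      ((ks.flatMap fun k => ls.map fun l => i (f k) (g l)) ++ ls.map fun l => r (g l)) := by
  simp [gSt, optL, List.flatMap_map, Function.comp_def]

theorem gTs_map (s : A.TermSym) (T : B.SortSym) :
    gTs s T (ks.map f) (ls.map g) i c = .app (.inr (s, T))
      (ks.flatMap fun k => (ls.map fun l => i (f k) (g l)) ++ [c (f k)]) := by
  simp [gTs, optL, List.flatMap_map, Function.comp_def]

theorem gSS_map (S : A.SortSym) (T : B.SortSym) :
    gSS S T (ks.map f) (ls.map g) i r c = ⟨(S, T),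
      (ks.flatMap fun k => (ls.map fun l => i (f k) (g l)) ++ [c (f k)]) ++
        ls.map fun l => r (g l)⟩ := by
  simp [gSS, optL, List.flatMap_map, Function.comp_def]

end

section

variable {T : Set (Judg (A.tensor B))} (hs : Shaped T) {Z : PreCtx (A.tensor B)}

include hs

theorem TEq.app_congr' {t : (A.tensor B).TermSym} {es es' : List (Expr (A.tensor B))}
    (h : TEq T Z (.app t es) (.app t es)) (hes : List.Forall₂ (TEq T Z) es es') :
    TEq T Z (.app t es) (.app t es') := by
  obtain ⟨W, h⟩ := h
  exact TEq.app_congr hs h.term_of_termEq.1 hes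

theorem TEq.app_args {t : (A.tensor B).TermSym} {es : List (Expr (A.tensor B))}
    (h : TEq T Z (.app t es) (.app t es)) : ∀ e ∈ es, TEq T Z e e := by
  obtain ⟨W, h⟩ := h
  exact h.term_of_termEq.1.app_args hs

theorem gSt_congr {α β : Type} (S : A.SortSym) (t : B.TermSym) (ks : List α) (ls : List β)
    (f f' : α → Expr A) (g g' : β → Expr B) (i i' : Expr A → Expr B → Expr (A.tensor B))
    (r r' : Expr B → Expr (A.tensor B))
    (h : TEq T Z (gSt S t (ks.map f) (ls.map g) i r) (gSt S t (ks.map f) (ls.map g) i r))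
    (hi : ∀ k ∈ ks, ∀ l ∈ ls, TEq T Z (i (f k) (g l)) (i' (f' k) (g' l)))
    (hr : ∀ l ∈ ls, TEq T Z (r (g l)) (r' (g' l))) :
    TEq T Z (gSt S t (ks.map f) (ls.map g) i r) (gSt S t (ks.map f') (ls.map g') i' r') := by
  rw [gSt_map] at h ⊢
  rw [gSt_map]
  exact h.app_congr' hs (List.rel_append
    (forall₂_flatMap fun k hk => forall₂_map_map (hi k hk)) (forall₂_map_map hr))

theorem gTs_congr {α β : Type} (s : A.TermSym) (S : B.SortSym) (ks : List α) (ls : List β)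
    (f f' : α → Expr A) (g g' : β → Expr B) (i i' : Expr A → Expr B → Expr (A.tensor B))
    (c c' : Expr A → Expr (A.tensor B))
    (h : TEq T Z (gTs s S (ks.map f) (ls.map g) i c) (gTs s S (ks.map f) (ls.map g) i c))
    (hi : ∀ k ∈ ks, ∀ l ∈ ls, TEq T Z (i (f k) (g l)) (i' (f' k) (g' l)))
    (hc : ∀ k ∈ ks, TEq T Z (c (f k)) (c' (f' k))) :
    TEq T Z (gTs s S (ks.map f) (ls.map g) i c) (gTs s S (ks.map f') (ls.map g') i' c') := by
  rw [gTs_map] at h ⊢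
  rw [gTs_map]
  exact h.app_congr' hs (forall₂_flatMap fun k hk => List.rel_append
    (forall₂_map_map (hi k hk)) (.cons (hc k hk) .nil))

theorem gSS_congr {α β : Type} (S : A.SortSym) (S' : B.SortSym) (ks : List α) (ls : List β)
    (f f' : α → Expr A) (g g' : β → Expr B) (i i' : Expr A → Expr B → Expr (A.tensor B))
    (r r' : Expr B → Expr (A.tensor B)) (c c' : Expr A → Expr (A.tensor B))
    (h : Derivable T (.sortEq Z (gSS S S' (ks.map f) (ls.map g) i r c)
      (gSS S S' (ks.map f) (ls.map g) i r c)))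
    (hi : ∀ k ∈ ks, ∀ l ∈ ls, TEq T Z (i (f k) (g l)) (i' (f' k) (g' l)))
    (hr : ∀ l ∈ ls, TEq T Z (r (g l)) (r' (g' l)))
    (hc : ∀ k ∈ ks, TEq T Z (c (f k)) (c' (f' k))) :
    Derivable T (.sortEq Z (gSS S S' (ks.map f) (ls.map g) i r c)
      (gSS S S' (ks.map f') (ls.map g') i' r' c')) := by
  rw [gSS_map] at h ⊢
  rw [gSS_map]
  exact h.sort_of_sortEq.1.sort_congr hs (List.rel_append
    (forall₂_flatMap fun k hk => List.rel_append (forall₂_map_map (hi k hk))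
      (.cons (hc k hk) .nil)) (forall₂_map_map hr))

variable {ss : List (Expr A)} {ts : List (Expr B)}
  {i : Expr A → Expr B → Expr (A.tensor B)} {r : Expr B → Expr (A.tensor B)}
  {c : Expr A → Expr (A.tensor B)}

theorem gSt_args {S : A.SortSym} {t : B.TermSym}
    (h : TEq T Z (gSt S t ss ts i r) (gSt S t ss ts i r)) :
    (∀ s ∈ ss, ∀ t ∈ ts, TEq T Z (i s t) (i s t)) ∧ ∀ t ∈ ts, TEq T Z (r t) (r t) := by
  have h := gSt_map ss ts id id i r S t ▸ (by simpa using h :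
    TEq T Z (gSt S t (ss.map id) (ts.map id) i r) (gSt S t (ss.map id) (ts.map id) i r))
  have h := h.app_args hs
  exact ⟨fun s hs' t ht => h _ (List.mem_append_left _
    (List.mem_flatMap.2 ⟨s, hs', List.mem_map.2 ⟨t, ht, rfl⟩⟩)),
    fun t ht => h _ (List.mem_append_right _ (List.mem_map.2 ⟨t, ht, rfl⟩))⟩

theorem gTs_args {s : A.TermSym} {S : B.SortSym}
    (h : TEq T Z (gTs s S ss ts i c) (gTs s S ss ts i c)) :
    (∀ s ∈ ss, ∀ t ∈ ts, TEq T Z (i s t) (i s t)) ∧ ∀ s ∈ ss, TEq T Z (c s) (c s) := by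
  have h := gTs_map ss ts id id i c s S ▸ (by simpa using h :
    TEq T Z (gTs s S (ss.map id) (ts.map id) i c) (gTs s S (ss.map id) (ts.map id) i c))
  have h := h.app_args hs
  exact ⟨fun s hs' t ht => h _ (List.mem_flatMap.2 ⟨s, hs', List.mem_append_left _
    (List.mem_map.2 ⟨t, ht, rfl⟩)⟩),
    fun s hs' => h _ (List.mem_flatMap.2 ⟨s, hs', List.mem_append_right _
      (List.mem_singleton.2 rfl)⟩)⟩

theorem gSS_args {S : A.SortSym} {S' : B.SortSym}
    (h : Derivable T (.sortEq Z (gSS S S' ss ts i r c) (gSS S S' ss ts i r c))) :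
    (∀ s ∈ ss, ∀ t ∈ ts, TEq T Z (i s t) (i s t)) ∧ (∀ t ∈ ts, TEq T Z (r t) (r t)) ∧
      ∀ s ∈ ss, TEq T Z (c s) (c s) := by
  have h := gSS_map ss ts id id i r c S S' ▸ (by simpa using h :
    Derivable T (.sortEq Z (gSS S S' (ss.map id) (ts.map id) i r c)
      (gSS S S' (ss.map id) (ts.map id) i r c)))
  have h := h.sort_of_sortEq.1.sort_args hs
  exact ⟨fun s hs' t ht => h _ (List.mem_append_left _ (List.mem_flatMap.2 ⟨s, hs',
    List.mem_append_left _ (List.mem_map.2 ⟨t, ht, rfl⟩)⟩)),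
    fun t ht => h _ (List.mem_append_right _ (List.mem_map.2 ⟨t, ht, rfl⟩)),
    fun s hs' => h _ (List.mem_append_left _ (List.mem_flatMap.2 ⟨s, hs',
      List.mem_append_right _ (List.mem_singleton.2 rfl)⟩))⟩

end

/-! ## Substitution for the generic elements -/

open Classical in
/-- The substitution which sends the generic elements to given ones. -/
noncomputable def gsub (x : A.Var) (y : B.Var) (ε : Nv A B (Expr (A.tensor B)))
    (a : B.Var → Expr (A.tensor B)) (b : A.Var → Expr (A.tensor B)) :
    A.Var × B.Var → Expr (A.tensor B) :=
  fun z => if z.1 = x then a z.2 else if z.2 = y then b z.1 else ε.ρ z.1 z.2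

/-- Sorts over two contexts, with fresh variables for them. -/
structure Fresh (TA : Set (Judg A)) (TB : Set (Judg B)) (x : A.Var) (y : B.Var)
    (sA : A.Var → SortE A) (sB : B.Var → SortE B) (X : PreCtx A) (U : SortE A) (Y : PreCtx B)
    (V : SortE B) : Prop where
  hX : CD TA X
  hY : CD TB Y
  hU : SD TA X U
  hV : SD TB Y V
  fx : ∀ p ∈ X, p.1 ≠ x
  fy : ∀ q ∈ Y, q.1 ≠ y
  cA : Compat sA (X ++ [(x, U)])
  cB : Compat sB (Y ++ [(y, V)])

section

variable {TA : Set (Judg A)} {TB : Set (Judg B)} {x : A.Var} {y : B.Var}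
  {ax : A.TermSym → PreCtx A × SortE A}
  {sA : A.Var → SortE A} {sB : B.Var → SortE B}
  {T : Set (Judg (A.tensor B))} {X : PreCtx A} {Y : PreCtx B} {U : SortE A} {V : SortE B}
  {w : {Z : PreCtx (A.tensor B) // Derivable T (.ctx Z)}} {ε : Nv A B (Expr (A.tensor B))}
  {a : B.Var → Expr (A.tensor B)} {b : A.Var → Expr (A.tensor B)}

namespace Fresh

variable (F : Fresh TA TB x y sA sB X U Y V)

include F

theorem gsub_env {p : A.Var × SortE A} (hp : p ∈ X) {q : B.Var × SortE B} (hq : q ∈ Y) :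
    gsub x y ε a b (p.1, q.1) = ε.ρ p.1 q.1 := by
  simp [gsub, F.fx p hp, F.fy q hq]

omit F in
theorem gsub_row (q : B.Var) : gsub x y ε a b (x, q) = a q := by simp [gsub]

theorem gsub_col {p : A.Var × SortE A} (hp : p ∈ X) : gsub x y ε a b (p.1, y) = b p.1 := by
  simp [gsub, F.fx p hp]

theorem subst_env {p : A.Var × SortE A} (hp : p ∈ X) {q : B.Var × SortE B} (hq : q ∈ Y) :
    ε.ρ p.1 q.1 = (Expr.var (A := A.tensor B) (p.1, q.1)).subst (gsub x y ε a b) := by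
  rw [Expr.subst_var, F.gsub_env hp hq]

omit F in
theorem subst_row (q : B.Var) :
    a q = (Expr.var (A := A.tensor B) (x, q)).subst (gsub x y ε a b) := by
  rw [Expr.subst_var, gsub_row]

theorem subst_col {p : A.Var × SortE A} (hp : p ∈ X) :
    b p.1 = (Expr.var (A := A.tensor B) (p.1, y)).subst (gsub x y ε a b) := by
  rw [Expr.subst_var, F.gsub_col hp]

theorem agr (he : (synM T ax).Env w ε X Y) (a : B.Var → Expr (A.tensor B))
    (b : A.Var → Expr (A.tensor B)) : Agr X Y (genNv sA sB) ε (gsub x y ε a b) where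
  cA := F.cA.append_left
  cA' := he.cA
  cB := F.cB.append_left
  cB' := he.cB
  ρ _ hp _ hq := F.subst_env hp hq

variable (ha : IntroFn TA ax) (hA : Thy TA) (he : (synM T ax).Env w ε X Y)

include ha hA he

theorem morF_env : MorF T w.1 (tz ax (genNv sA sB) X Y) (gsub x y ε a b) := by
  intro z hz
  obtain ⟨p, hp, q, hq, rfl⟩ := (mem_tz (T := T)).1 hz
  rw [← synM.T2_subst (a' := ε.ρ p.1) (b' := fun x => ε.ρ x q.1) ha hA (F.agr he a b) (F.hX.sort hp) (F.hY.sort hq)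
    (fun q' hq' => F.subst_env hp hq') fun p' hp' => F.subst_env hp' hq]
  change Derivable T (.term w.1 (gsub x y ε a b (p.1, q.1)) _)
  rw [F.gsub_env hp hq]
  exact he.ty p hp q hq

theorem morF_row' (hr : (synM T ax).Row w ε U Y a) :
    MorF T w.1 (tz ax (genNv sA sB) [(x, U)] Y) (gsub x y ε a b) := by
  intro z hz
  obtain ⟨p, hp, q, hq, rfl⟩ := (mem_tz (T := T)).1 hz
  obtain rfl := List.mem_singleton.1 hp
  rw [← synM.T2_subst (b' := fun x => ε.ρ x q.1) ha hA (F.agr he a b) F.hU (F.hY.sort hq)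
    (fun q' hq' => subst_row q'.1) fun p' hp' => F.subst_env hp' hq]
  change Derivable T (.term w.1 (gsub x y ε a b (x, q.1)) _)
  rw [gsub_row]
  exact hr q hq

theorem morF_col' (hc : (synM T ax).Col w ε V X b) :
    MorF T w.1 (tz ax (genNv sA sB) X [(y, V)]) (gsub x y ε a b) := by
  intro z hz
  obtain ⟨p, hp, q, hq, rfl⟩ := (mem_tz (T := T)).1 hz
  obtain rfl := List.mem_singleton.1 hq
  rw [← synM.T2_subst ha hA (F.agr he a b) (F.hX.sort hp) F.hV
    (fun q' hq' => F.subst_env hp hq') fun p' hp' => F.subst_col hp']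
  change Derivable T (.term w.1 (gsub x y ε a b (p.1, y)) _)
  rw [F.gsub_col hp]
  exact hc p hp

theorem morF_row (hr : (synM T ax).Row w ε U Y a) :
    MorF T w.1 (tz ax (genNv sA sB) (X ++ [(x, U)]) Y) (gsub x y ε a b) := by
  intro z hz
  rw [tz_append_left] at hz
  rcases List.mem_append.1 hz with hz | hz
  · exact F.morF_env ha hA he z hz
  · exact F.morF_row' ha hA he hr z hz

theorem morF_col (hc : (synM T ax).Col w ε V X b) :
    MorF T w.1 (tz ax (genNv sA sB) X (Y ++ [(y, V)])) (gsub x y ε a b) := by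
  intro z hz
  rcases mem_tz_append_right.1 hz with hz | hz
  · exact F.morF_env ha hA he z hz
  · exact F.morF_col' ha hA he hc z hz

theorem morF_both (hr : (synM T ax).Row w ε U Y a) (hc : (synM T ax).Col w ε V X b) :
    MorF T w.1 (tz ax (genNv sA sB) (X ++ [(x, U)]) (Y ++ [(y, V)])).dropLast
      (gsub x y ε a b) := by
  intro z hz
  rw [dropLast_tz] at hz
  rcases List.mem_append.1 hz with hz | hz
  · exact F.morF_col ha hA he hc z hz
  · exact F.morF_row' ha hA he hr z hz

end Fresh

namespace Fresh

variable (F : Fresh TA TB x y sA sB X U Y V)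

include F

variable (ha : IntroFn TA ax) (hA : Thy TA) (he : (synM T ax).Env w ε X Y)
  (a : B.Var → Expr (A.tensor B)) (b : A.Var → Expr (A.tensor B))

include ha hA he

theorem R_eq {U' : SortE A} {v : Expr B} (hU : SD TA X U') (hv : TD TB Y v) :
    (synM T ax).R ε U' a v =
      ((synM T ax).R (genNv sA sB) U' (fun y => .var (x, y)) v).subst (gsub x y ε a b) :=
  synM.R_subst ha hA (F.agr he a b) hU (fun q _ => subst_row q.1) hv

theorem C_eq {V' : SortE B} {u : Expr A} (hV : SD TB Y V') (hu : TD TA X u) :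
    (synM T ax).C ε V' b u =
      ((synM T ax).C (genNv sA sB) V' (fun x => .var (x, y)) u).subst (gsub x y ε a b) :=
  synM.C_subst ha hA (F.agr he a b) hV (fun _ hp => F.subst_col hp) hu

theorem T2_eq {U' : SortE A} {V' : SortE B} (hU : SD TA X U') (hV : SD TB Y V') :
    (synM T ax).T2 ε U' V' a b =
      ((synM T ax).T2 (genNv sA sB) U' V' (fun y => .var (x, y)) fun x => .var (x, y)).subst
        (gsub x y ε a b) :=
  synM.T2_subst ha hA (F.agr he a b) hU hV (fun q _ => subst_row q.1)
    fun _ hp => F.subst_col hp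

theorem T2_bv_eq {U' : SortE A} {V' : SortE B} {v : Expr B} (hU : SD TA X U')
    (hV : SD TB Y V') (hv : TD TB Y v) :
    (synM T ax).T2 ε U' V' a ((synM T ax).bv ε v) =
      ((synM T ax).T2 (genNv sA sB) U' V' (fun y => .var (x, y))
        ((synM T ax).bv (genNv sA sB) v)).subst (gsub x y ε a b) :=
  synM.T2_subst ha hA (F.agr he a b) hU hV (fun q _ => subst_row q.1)
    fun _ hp => synM.bv_subst ha hA (F.agr he a b) hv hp (F.hX.sort hp)

theorem T2_au_eq {U' : SortE A} {V' : SortE B} {u : Expr A} (hU : SD TA X U')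
    (hV : SD TB Y V') (hu : TD TA X u) :
    (synM T ax).T2 ε U' V' ((synM T ax).au ε u) b =
      ((synM T ax).T2 (genNv sA sB) U' V' ((synM T ax).au (genNv sA sB) u)
        fun x => .var (x, y)).subst (gsub x y ε a b) :=
  synM.T2_subst ha hA (F.agr he a b) hU hV
    (fun _ hq => synM.au_subst ha hA (F.agr he a b) hu hq (F.hY.sort hq))
    fun _ hp => F.subst_col hp

end Fresh

section worlds

variable (F : Fresh TA TB x y sA sB X U Y V) (hs : Shaped T) (hE : (synM T ax).Entries X Y)

include F hs hE

theorem Fresh.ctx : Derivable T (.ctx (tz ax (genNv sA sB) X Y)) :=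
  ctx_tz hs F.hX F.hY F.cA.append_left F.cB.append_left hE

theorem Fresh.ctx_row (hR : (synM T ax).RowOk X U Y) :
    Derivable T (.ctx (tz ax (genNv sA sB) (X ++ [(x, U)]) Y)) :=
  ctx_tz hs (F.hX.snoc F.hU F.fx) F.hY F.cA F.cB.append_left (hE.snoc_left hR x)

theorem Fresh.ctx_col (hC : (synM T ax).ColOk X Y V) :
    Derivable T (.ctx (tz ax (genNv sA sB) X (Y ++ [(y, V)]))) :=
  ctx_tz hs F.hX (F.hY.snoc F.hV F.fy) F.cA.append_left F.cB (hE.snoc_right hC y)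

theorem Fresh.ctx_both (hR : (synM T ax).RowOk X U Y) (hC : (synM T ax).ColOk X Y V) :
    Derivable T (.ctx (tz ax (genNv sA sB) (X ++ [(x, U)]) (Y ++ [(y, V)])).dropLast) :=
  ctx_tz_dropLast hs (F.hX.snoc F.hU F.fx) (F.hY.snoc F.hV F.fy) F.cA F.cB hE hR hC

end worlds

section universal

variable (F : Fresh TA TB x y sA sB X U Y V) (hs : Shaped T)

include F hs

theorem Fresh.env_row (h : Derivable T (.ctx (tz ax (genNv sA sB) (X ++ [(x, U)]) Y))) :
    (synM T ax).Env ⟨_, h⟩ (genNv sA sB) X Y ∧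
      (synM T ax).Row ⟨_, h⟩ (genNv sA sB) U Y fun y => .var (x, y) := by
  simp only [tz_append_left] at h ⊢
  exact ⟨env_gen hs F.cA.append_left F.cB.append_left fun z hz => List.mem_append_left _ hz,
    row_gen hs fun z hz => List.mem_append_right _ hz⟩

theorem Fresh.env_col (h : Derivable T (.ctx (tz ax (genNv sA sB) X (Y ++ [(y, V)])))) :
    (synM T ax).Env ⟨_, h⟩ (genNv sA sB) X Y ∧
      (synM T ax).Col ⟨_, h⟩ (genNv sA sB) V X fun x => .var (x, y) :=
  ⟨env_gen hs F.cA.append_left F.cB.append_left fun _ hz => mem_tz_append_right.2 (.inl hz),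
    col_gen hs fun _ hz => mem_tz_append_right.2 (.inr hz)⟩

theorem Fresh.env_both
    (h : Derivable T (.ctx (tz ax (genNv sA sB) (X ++ [(x, U)]) (Y ++ [(y, V)])).dropLast)) :
    (synM T ax).Env ⟨_, h⟩ (genNv sA sB) X Y ∧
      (synM T ax).Row ⟨_, h⟩ (genNv sA sB) U Y (fun y => .var (x, y)) ∧
      (synM T ax).Col ⟨_, h⟩ (genNv sA sB) V X fun x => .var (x, y) := by
  have key {z} (hz : z ∈ tz ax (genNv sA sB) X (Y ++ [(y, V)]) ++ tz ax (genNv sA sB) [(x, U)] Y) :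
      z ∈ (tz ax (genNv sA sB) (X ++ [(x, U)]) (Y ++ [(y, V)])).dropLast := by
    rwa [dropLast_tz]
  exact ⟨env_gen hs F.cA.append_left F.cB.append_left fun z hz =>
      key (List.mem_append_left _ (mem_tz_append_right.2 (.inl hz))),
    row_gen hs fun z hz => key (List.mem_append_right _ hz),
    col_gen hs fun z hz => key (List.mem_append_left _ (mem_tz_append_right.2 (.inr hz)))⟩

end universal

end

/-! ## The syntactic model is a bilinear model -/

namespace Factors

variable {TA : Set (Judg A)} {TB : Set (Judg B)} {chA : PreCtx A → A.Var}
  {chB : PreCtx B → B.Var} {ax : A.TermSym → PreCtx A × SortE A}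
  {bx : B.TermSym → PreCtx B × SortE B} {T : Set (Judg (A.tensor B))}
  {X : PreCtx A} {Y : PreCtx B} {U U' : SortE A} {V V' : SortE B}
  {u u' : Expr A} {v v' : Expr B} {w : {Z : PreCtx (A.tensor B) // Derivable T (.ctx Z)}}
  {ε : Nv A B (Expr (A.tensor B))} {a : B.Var → Expr (A.tensor B)}
  {b : A.Var → Expr (A.tensor B)}

section

variable (D : Factors TA TB chA chB ax bx)

include D

theorem exists_fresh (hX : CD TA X) (hY : CD TB Y) (hU : SD TA X U) (hV : SD TB Y V) :
    ∃ sA sB, Fresh TA TB (chA X) (chB Y) sA sB X U Y V := by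
  obtain ⟨sA, hcA⟩ := exists_compat_snoc hX U (D.fA X)
  obtain ⟨sB, hcB⟩ := exists_compat_snoc hY V (D.fB Y)
  exact ⟨sA, sB, hX, hY, hU, hV, D.fA X, D.fB Y, hcA, hcB⟩

variable (hT : tensorAx TA TB chA chB ⊆ T) (hs : Shaped T) (hE : (synM T ax).Entries X Y)

include hT hs hE

theorem sort_sort (hJ : .sort X U ∈ TA) (hJ' : .sort Y V ∈ TB) (hR : (synM T ax).RowOk X U Y)
    (hC : (synM T ax).ColOk X Y V) : (synM T ax).SSok X U Y V := by
  intro w ε he a b hr hc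
  obtain ⟨sA, sB, F⟩ := D.exists_fresh (X := X) (Y := Y) (D.wA.ctx hJ) (D.wB.ctx hJ')
    (D.wA.sort hJ) (D.wB.sort hJ')
  have hctx := F.ctx_both hs hE hR hC
  have h := (Step.sA (hT (tensorAx_sort_sort (T := T) D.ha D.hA D.hb D.hB F.hX F.hY
    F.cA.append_left F.cB.append_left D.fA D.fB F.hU F.hV F.cA F.cB hJ hJ')) hctx
    fun i hi => hctx.var_typed hs _ (List.getElem_mem hi)).derivable
  rw [F.T2_eq D.ha D.hA he a b F.hU F.hV]
  exact (h.sort_subst hs w.2 (F.morF_both D.ha D.hA he hr hc)).seq_refl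

theorem sort_sortEq (hJ : .sort X U ∈ TA) (hJ' : .sortEq Y V V' ∈ TB)
    (hR : (synM T ax).RowOk X U Y) (hC : (synM T ax).ColOk X Y V)
    (h : ∀ w ε, (synM T ax).Env w ε X Y → ∀ a b, (synM T ax).Row w ε U Y a →
      (synM T ax).Col w ε V X b →
      (synM T ax).seq w ((synM T ax).T2 ε U V a b) ((synM T ax).T2 ε U V a b) ∧
        (synM T ax).seq w ((synM T ax).T2 ε U V' a b) ((synM T ax).T2 ε U V' a b))
    (he : (synM T ax).Env w ε X Y) (hr : (synM T ax).Row w ε U Y a)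
    (hc : (synM T ax).Col w ε V X b) :
    (synM T ax).seq w ((synM T ax).T2 ε U V a b) ((synM T ax).T2 ε U V' a b) := by
  have hV := D.wB.sortEq hJ'
  obtain ⟨sA, sB, F⟩ := D.exists_fresh (X := X) (Y := Y) (D.wA.ctx hJ) (D.wB.ctx hJ')
    (D.wA.sort hJ) hV.1
  have hctx := F.ctx_both hs hE hR hC
  obtain ⟨ge, gr, gc⟩ := F.env_both hs hctx
  obtain ⟨h1, h2⟩ := h _ _ ge _ _ gr gc
  have h := (Step.seqA (hT (tensorAx_sort_sortEq (T := T) D.ha D.hA D.hb D.hB F.hX F.hY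
    F.cA.append_left F.cB.append_left D.fA D.fB F.hU F.hV F.cA F.cB hV.2 hJ hJ'))
    h1.sort_of_sortEq.1 h2.sort_of_sortEq.1).derivable
  rw [F.T2_eq D.ha D.hA he a b F.hU F.hV, F.T2_eq D.ha D.hA he a b F.hU hV.2]
  exact h.sortEq_subst hs w.2 (F.morF_both D.ha D.hA he hr hc)

theorem sortEq_sort (hJ : .sortEq X U U' ∈ TA) (hJ' : .sort Y V ∈ TB)
    (hR : (synM T ax).RowOk X U Y) (hC : (synM T ax).ColOk X Y V)
    (h : ∀ w ε, (synM T ax).Env w ε X Y → ∀ a b, (synM T ax).Row w ε U Y a →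
      (synM T ax).Col w ε V X b →
      (synM T ax).seq w ((synM T ax).T2 ε U V a b) ((synM T ax).T2 ε U V a b) ∧
        (synM T ax).seq w ((synM T ax).T2 ε U' V a b) ((synM T ax).T2 ε U' V a b))
    (he : (synM T ax).Env w ε X Y) (hr : (synM T ax).Row w ε U Y a)
    (hc : (synM T ax).Col w ε V X b) :
    (synM T ax).seq w ((synM T ax).T2 ε U V a b) ((synM T ax).T2 ε U' V a b) := by
  have hU := D.wA.sortEq hJ
  obtain ⟨sA, sB, F⟩ := D.exists_fresh (X := X) (Y := Y) (D.wA.ctx hJ) (D.wB.ctx hJ')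
    hU.1 (D.wB.sort hJ')
  have hctx := F.ctx_both hs hE hR hC
  obtain ⟨ge, gr, gc⟩ := F.env_both hs hctx
  obtain ⟨h1, h2⟩ := h _ _ ge _ _ gr gc
  have h := (Step.seqA (hT (tensorAx_sortEq_sort (T := T) D.ha D.hA D.hb D.hB F.hX F.hY
    F.cA.append_left F.cB.append_left D.fA D.fB F.hU F.hV F.cA F.cB hU.2 hJ hJ'))
    h1.sort_of_sortEq.1 h2.sort_of_sortEq.1).derivable
  rw [F.T2_eq D.ha D.hA he a b F.hU F.hV, F.T2_eq D.ha D.hA he a b hU.2 F.hV]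
  exact h.sortEq_subst hs w.2 (F.morF_both D.ha D.hA he hr hc)

theorem sort_term (hJ : .sort X U ∈ TA) (hJ' : .term Y v V ∈ TB) (hR : (synM T ax).RowOk X U Y)
    (h : ∀ w ε, (synM T ax).Env w ε X Y → ∀ a, (synM T ax).Row w ε U Y a →
      (synM T ax).seq w ((synM T ax).T2 ε U V a ((synM T ax).bv ε v))
        ((synM T ax).T2 ε U V a ((synM T ax).bv ε v)))
    (he : (synM T ax).Env w ε X Y) (hr : (synM T ax).Row w ε U Y a) :
    (synM T ax).ty w ((synM T ax).R ε U a v) ((synM T ax).T2 ε U V a ((synM T ax).bv ε v)) := by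
  have hv := D.wB.term hJ'
  obtain ⟨sA, sB, F⟩ := D.exists_fresh (X := X) (Y := Y) (D.wA.ctx hJ) (D.wB.ctx hJ')
    (D.wA.sort hJ) hv.2
  have hctx := F.ctx_row hs hE hR
  obtain ⟨ge, gr⟩ := F.env_row hs hctx
  have h := (Step.tA (hT (tensorAx_sort_term (T := T) D.ha D.hA D.hb D.hB F.hX F.hY
    F.cA.append_left F.cB.append_left D.fA D.fB F.hU F.hV F.cA hv.1 hJ hJ'))
    (h _ _ ge _ gr).sort_of_sortEq.1
    fun i hi => hctx.var_typed hs _ (List.getElem_mem hi)).derivable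
  have b : A.Var → Expr (A.tensor B) := fun x => ε.ρ x (chB Y)
  rw [F.T2_bv_eq D.ha D.hA he a b F.hU F.hV hv.1, F.R_eq D.ha D.hA he a b F.hU hv.1]
  exact h.term_subst hs w.2 (F.morF_row D.ha D.hA he hr)

theorem term_sort (hJ : .term X u U ∈ TA) (hJ' : .sort Y V ∈ TB) (hC : (synM T ax).ColOk X Y V)
    (h : ∀ w ε, (synM T ax).Env w ε X Y → ∀ b, (synM T ax).Col w ε V X b →
      (synM T ax).seq w ((synM T ax).T2 ε U V ((synM T ax).au ε u) b)
        ((synM T ax).T2 ε U V ((synM T ax).au ε u) b))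
    (he : (synM T ax).Env w ε X Y) (hc : (synM T ax).Col w ε V X b) :
    (synM T ax).ty w ((synM T ax).C ε V b u) ((synM T ax).T2 ε U V ((synM T ax).au ε u) b) := by
  have hu := D.wA.term hJ
  obtain ⟨sA, sB, F⟩ := D.exists_fresh (X := X) (Y := Y) (D.wA.ctx hJ) (D.wB.ctx hJ')
    hu.2 (D.wB.sort hJ')
  have hctx := F.ctx_col hs hE hC
  obtain ⟨ge, gc⟩ := F.env_col hs hctx
  have h := (Step.tA (hT (tensorAx_term_sort (T := T) D.ha D.hA D.hb D.hB F.hX F.hY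
    F.cA.append_left F.cB.append_left D.fA D.fB F.hU F.hV F.cB hu.1 hJ hJ'))
    (h _ _ ge _ gc).sort_of_sortEq.1
    fun i hi => hctx.var_typed hs _ (List.getElem_mem hi)).derivable
  have a : B.Var → Expr (A.tensor B) := fun y => ε.ρ (chA X) y
  rw [F.T2_au_eq D.ha D.hA he a b F.hU F.hV hu.1, F.C_eq D.ha D.hA he a b F.hV hu.1]
  exact h.term_subst hs w.2 (F.morF_col D.ha D.hA he hc)

theorem sort_termEq (hJ : .sort X U ∈ TA) (hJ' : .termEq Y v v' V ∈ TB)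
    (hR : (synM T ax).RowOk X U Y)
    (h : ∀ w ε, (synM T ax).Env w ε X Y → ∀ a, (synM T ax).Row w ε U Y a →
      (synM T ax).ty w ((synM T ax).R ε U a v) ((synM T ax).T2 ε U V a ((synM T ax).bv ε v)) ∧
      (synM T ax).ty w ((synM T ax).R ε U a v') ((synM T ax).T2 ε U V a ((synM T ax).bv ε v)))
    (he : (synM T ax).Env w ε X Y) (hr : (synM T ax).Row w ε U Y a) :
    (synM T ax).eq w ((synM T ax).R ε U a v) ((synM T ax).R ε U a v') := by
  have hv := D.wB.termEq hJ'
  obtain ⟨sA, sB, F⟩ := D.exists_fresh (X := X) (Y := Y) (D.wA.ctx hJ) (D.wB.ctx hJ')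
    (D.wA.sort hJ) hv.2.2
  have hctx := F.ctx_row hs hE hR
  obtain ⟨ge, gr⟩ := F.env_row hs hctx
  obtain ⟨h1, h2⟩ := h _ _ ge _ gr
  have h := (Step.teqA (hT (tensorAx_sort_termEq (T := T) D.ha D.hA D.hb D.hB F.hX F.hY
    F.cA.append_left F.cB.append_left D.fA D.fB F.hU F.hV F.cA hv.1 hv.2.1 hJ hJ'))
    h1 h2).derivable
  have b : A.Var → Expr (A.tensor B) := fun x => ε.ρ x (chB Y)
  rw [F.R_eq D.ha D.hA he a b F.hU hv.1, F.R_eq D.ha D.hA he a b F.hU hv.2.1]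
  exact ⟨_, h.termEq_subst hs w.2 (F.morF_row D.ha D.hA he hr)⟩

theorem termEq_sort (hJ : .termEq X u u' U ∈ TA) (hJ' : .sort Y V ∈ TB)
    (hC : (synM T ax).ColOk X Y V)
    (h : ∀ w ε, (synM T ax).Env w ε X Y → ∀ b, (synM T ax).Col w ε V X b →
      (synM T ax).ty w ((synM T ax).C ε V b u) ((synM T ax).T2 ε U V ((synM T ax).au ε u) b) ∧
      (synM T ax).ty w ((synM T ax).C ε V b u') ((synM T ax).T2 ε U V ((synM T ax).au ε u) b))
    (he : (synM T ax).Env w ε X Y) (hc : (synM T ax).Col w ε V X b) :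
    (synM T ax).eq w ((synM T ax).C ε V b u) ((synM T ax).C ε V b u') := by
  have hu := D.wA.termEq hJ
  obtain ⟨sA, sB, F⟩ := D.exists_fresh (X := X) (Y := Y) (D.wA.ctx hJ) (D.wB.ctx hJ')
    hu.2.2 (D.wB.sort hJ')
  have hctx := F.ctx_col hs hE hC
  obtain ⟨ge, gc⟩ := F.env_col hs hctx
  obtain ⟨h1, h2⟩ := h _ _ ge _ gc
  have h := (Step.teqA (hT (tensorAx_termEq_sort (T := T) D.ha D.hA D.hb D.hB F.hX F.hY
    F.cA.append_left F.cB.append_left D.fA D.fB F.hU F.hV F.cB hu.1 hu.2.1 hJ hJ'))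
    h1 h2).derivable
  have a : B.Var → Expr (A.tensor B) := fun y => ε.ρ (chA X) y
  rw [F.C_eq D.ha D.hA he a b F.hV hu.1, F.C_eq D.ha D.hA he a b F.hV hu.2.1]
  exact ⟨_, h.termEq_subst hs w.2 (F.morF_col D.ha D.hA he hc)⟩

theorem sortEq_term (hJ : .sortEq X U U' ∈ TA) (hJ' : .term Y v V ∈ TB)
    (hR : (synM T ax).RowOk X U Y)
    (h : ∀ w ε, (synM T ax).Env w ε X Y → ∀ a, (synM T ax).Row w ε U Y a →
      (synM T ax).ty w ((synM T ax).R ε U a v) ((synM T ax).T2 ε U V a ((synM T ax).bv ε v)) ∧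
      (synM T ax).ty w ((synM T ax).R ε U' a v) ((synM T ax).T2 ε U V a ((synM T ax).bv ε v)))
    (he : (synM T ax).Env w ε X Y) (hr : (synM T ax).Row w ε U Y a) :
    (synM T ax).eq w ((synM T ax).R ε U a v) ((synM T ax).R ε U' a v) := by
  have hU := D.wA.sortEq hJ
  have hv := D.wB.term hJ'
  obtain ⟨sA, sB, F⟩ := D.exists_fresh (X := X) (Y := Y) (D.wA.ctx hJ) (D.wB.ctx hJ')
    hU.1 hv.2
  have hctx := F.ctx_row hs hE hR
  obtain ⟨ge, gr⟩ := F.env_row hs hctx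
  obtain ⟨h1, h2⟩ := h _ _ ge _ gr
  have h := (Step.teqA (hT (tensorAx_sortEq_term (T := T) D.ha D.hA D.hb D.hB F.hX F.hY
    F.cA.append_left F.cB.append_left D.fA D.fB F.hU F.hV F.cA hU.2 hv.1 hJ hJ'))
    h1 h2).derivable
  have b : A.Var → Expr (A.tensor B) := fun x => ε.ρ x (chB Y)
  rw [F.R_eq D.ha D.hA he a b F.hU hv.1, F.R_eq D.ha D.hA he a b hU.2 hv.1]
  exact ⟨_, h.termEq_subst hs w.2 (F.morF_row D.ha D.hA he hr)⟩

theorem term_sortEq (hJ : .term X u U ∈ TA) (hJ' : .sortEq Y V V' ∈ TB)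
    (hC : (synM T ax).ColOk X Y V)
    (h : ∀ w ε, (synM T ax).Env w ε X Y → ∀ b, (synM T ax).Col w ε V X b →
      (synM T ax).ty w ((synM T ax).C ε V b u) ((synM T ax).T2 ε U V ((synM T ax).au ε u) b) ∧
      (synM T ax).ty w ((synM T ax).C ε V' b u) ((synM T ax).T2 ε U V ((synM T ax).au ε u) b))
    (he : (synM T ax).Env w ε X Y) (hc : (synM T ax).Col w ε V X b) :
    (synM T ax).eq w ((synM T ax).C ε V b u) ((synM T ax).C ε V' b u) := by
  have hu := D.wA.term hJ
  have hV := D.wB.sortEq hJ'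
  obtain ⟨sA, sB, F⟩ := D.exists_fresh (X := X) (Y := Y) (D.wA.ctx hJ) (D.wB.ctx hJ')
    hu.2 hV.1
  have hctx := F.ctx_col hs hE hC
  obtain ⟨ge, gc⟩ := F.env_col hs hctx
  obtain ⟨h1, h2⟩ := h _ _ ge _ gc
  have h := (Step.teqA (hT (tensorAx_term_sortEq (T := T) D.ha D.hA D.hb D.hB F.hX F.hY
    F.cA.append_left F.cB.append_left D.fA D.fB F.hU F.hV F.cB hV.2 hu.1 hJ hJ'))
    h1 h2).derivable
  have a : B.Var → Expr (A.tensor B) := fun y => ε.ρ (chA X) y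
  rw [F.C_eq D.ha D.hA he a b F.hV hu.1, F.C_eq D.ha D.hA he a b hV.2 hu.1]
  exact ⟨_, h.termEq_subst hs w.2 (F.morF_col D.ha D.hA he hc)⟩

theorem term_term {s : A.TermSym} {ss : List (Expr A)} {t : B.TermSym} {ts : List (Expr B)}
    (hJ : .term X (.app s ss) U ∈ TA) (hJ' : .term Y (.app t ts) V ∈ TB)
    (h : ∀ w ε, (synM T ax).Env w ε X Y →
      (synM T ax).ty w ((synM T ax).R ε U ((synM T ax).au ε (.app s ss)) (.app t ts))
        ((synM T ax).T2 ε U V ((synM T ax).au ε (.app s ss)) ((synM T ax).bv ε (.app t ts))) ∧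
      (synM T ax).ty w ((synM T ax).C ε V ((synM T ax).bv ε (.app t ts)) (.app s ss))
        ((synM T ax).T2 ε U V ((synM T ax).au ε (.app s ss)) ((synM T ax).bv ε (.app t ts))))
    (he : (synM T ax).Env w ε X Y) :
    (synM T ax).eq w ((synM T ax).R ε U ((synM T ax).au ε (.app s ss)) (.app t ts))
      ((synM T ax).C ε V ((synM T ax).bv ε (.app t ts)) (.app s ss)) := by
  have hu := D.wA.term hJ
  have hv := D.wB.term hJ'
  obtain ⟨sA, sB, F⟩ := D.exists_fresh (X := X) (Y := Y) (D.wA.ctx hJ) (D.wB.ctx hJ')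
    hu.2 hv.2
  have hctx := F.ctx hs hE
  obtain ⟨h1, h2⟩ := h ⟨_, hctx⟩ _
    (env_gen hs F.cA.append_left F.cB.append_left fun _ hz => hz)
  have h := (Step.teqA (hT (tensorAx_term_term (T := T) D.ha D.hA D.hb D.hB F.hX F.hY
    F.cA.append_left F.cB.append_left D.fA D.fB F.hU F.hV hu.1 hv.1 hJ hJ')) h1 h2).derivable
  have a : B.Var → Expr (A.tensor B) := fun y => ε.ρ (chA X) y
  have b : A.Var → Expr (A.tensor B) := fun x => ε.ρ x (chB Y)
  have hagr := F.agr he a b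
  rw [synM.R_subst D.ha D.hA hagr F.hU
      (fun _ hq => synM.au_subst D.ha D.hA hagr hu.1 hq (F.hY.sort hq)) hv.1,
    synM.C_subst D.ha D.hA hagr F.hV
      (fun _ hp => synM.bv_subst D.ha D.hA hagr hv.1 hp (F.hX.sort hp)) hu.1]
  exact ⟨_, h.termEq_subst hs w.2 (F.morF_env D.ha D.hA he)⟩

end

end Factors

namespace Factors

variable {TA : Set (Judg A)} {TB : Set (Judg B)} {chA : PreCtx A → A.Var}
  {chB : PreCtx B → B.Var} {ax : A.TermSym → PreCtx A × SortE A}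
  {bx : B.TermSym → PreCtx B × SortE B} {T : Set (Judg (A.tensor B))}
  (D : Factors TA TB chA chB ax bx) (hT : tensorAx TA TB chA chB ⊆ T) (hs : Shaped T)

include D hT hs

theorem laws : (synM T ax).Laws TA TB where
  eq_symm h := h.symm
  eq_trans h h' := h.trans hs h'
  seq_symm h := h.seq_symm
  seq_trans h h' := h.seq_trans h'
  ty_refl h := ⟨_, h.teq_refl⟩
  ty_sok h := h.sort_of_term.seq_refl
  ty_conv h h' := h'.conv h
  eq_ty h h' := h.term hs h'
  R_var _ _ _ y := synM.R_var y
  R_app _ _ _ t ts := synM.R_app t ts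
  mkSt_cong S t ks ls f f' g g' i i' r r' := gSt_congr hs S t ks ls f f' g g' i i' r r'
  mkSS_cong S S' ks ls f f' g g' i i' r r' c c' :=
    gSS_congr hs S S' ks ls f f' g g' i i' r r' c c'
  mkSt_args h := gSt_args hs h
  mkSS_args h := gSS_args hs h
  sort_sort h h' hE hR hC := D.sort_sort hT hs hE h h' hR hC
  sort_term h h' hE hR hw _ _ he _ hr := D.sort_term hT hs hE h h' hR hw he hr
  term_term h h' hE hw _ _ he := D.term_term hT hs hE h h' hw he
  sort_sortEq h h' hE hR hC hw _ _ he _ _ hr hc :=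
    D.sort_sortEq hT hs hE h h' hR hC hw he hr hc
  sort_termEq h h' hE hR hw _ _ he _ hr := D.sort_termEq hT hs hE h h' hR hw he hr
  sortEq_term h h' hE hR hw _ _ he _ hr := D.sortEq_term hT hs hE h h' hR hw he hr

theorem laws_flip : (synM T ax).flip.Laws TB TA where
  eq_symm h := h.symm
  eq_trans h h' := h.trans hs h'
  seq_symm h := h.seq_symm
  seq_trans h h' := h.seq_trans h'
  ty_refl h := ⟨_, h.teq_refl⟩
  ty_sok h := h.sort_of_term.seq_refl
  ty_conv h h' := h'.conv h
  eq_ty h h' := h.term hs h'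
  R_var _ _ _ x := synM.C_var (T := T) x
  R_app _ _ _ s ss := synM.C_app (T := T) s ss
  mkSt_cong S t ks ls f f' g g' i i' r r' h hi hr :=
    gTs_congr hs t S ls ks g g' f f' (fun u v => i v u) (fun u v => i' v u) r r' h
      (fun l hl k hk => hi k hk l hl) hr
  mkSS_cong S S' ks ls f f' g g' i i' r r' c c' h hi hr hc :=
    gSS_congr hs S' S ls ks g g' f f' (fun u v => i v u) (fun u v => i' v u) c c' r r' h
      (fun l hl k hk => hi k hk l hl) hc hr
  mkSt_args h :=
    have h := gTs_args hs h
    ⟨fun s hs t ht => h.1 t ht s hs, h.2⟩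
  mkSS_args h :=
    have h := gSS_args hs h
    ⟨fun s hs t ht => h.1 t ht s hs, h.2.2, h.2.1⟩
  sort_sort h h' hE hR hC :=
    (D.sort_sort hT hs hE.flip h' h (fun i hi => (hC i hi).flip) fun j hj => (hR j hj).flip).flip
  sort_term h h' hE hR hw _ _ he _ hr :=
    D.term_sort hT hs hE.flip h' h (fun i hi => (hR i hi).flip)
      (fun w ε he b hc => hw w ε.flip he.flip b hc) he.flip hr
  term_term h h' hE hw _ _ he :=
    (D.term_term hT hs hE.flip h' h (fun w ε he => (hw w ε.flip he.flip).symm) he.flip).symm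
  sort_sortEq h h' hE hR hC hw _ _ he _ _ hr hc :=
    D.sortEq_sort hT hs hE.flip h' h (fun j hj => (hC j hj).flip) (fun i hi => (hR i hi).flip)
      (fun w ε he a b hr hc => hw w ε.flip he.flip b a hc hr) he.flip hc hr
  sort_termEq h h' hE hR hw _ _ he _ hr :=
    D.termEq_sort hT hs hE.flip h' h (fun i hi => (hR i hi).flip)
      (fun w ε he b hc => hw w ε.flip he.flip b hc) he.flip hr
  sortEq_term h h' hE hR hw _ _ he _ hr :=
    D.term_sortEq hT hs hE.flip h' h (fun i hi => (hR i hi).flip)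
      (fun w ε he b hc => hw w ε.flip he.flip b hc) he.flip hr

theorem bilinear (N K : ℕ) : (synM T ax).H TA TB N K :=
  Mdl.H.of_laws (D.laws hT hs) (D.laws_flip hT hs) D.hA D.hB (synM.pairs D.ha D.hA) N K

end Factors

/-! ## Functoriality of the tensor product -/

section

variable {Ax : Set (Judg A)} {X Y Z : PreCtx A} {f : List (Expr A)} {σ τ : A.Var → Expr A}

theorem MorF.isMor (hY : Derivable Ax (.ctx Y)) (hX : Derivable Ax (.ctx X))
    (h : MorF Ax Y X σ) : IsMor Ax Y X (X.map fun p => σ p.1) := by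
  refine ⟨hY, hX, by simp, fun i hi hif => ?_⟩
  rw [subPre_map hX.isPreCtx, List.getElem_map]
  exact h _ (List.getElem_mem hi)

theorem MorEqF.morEq (hY : Derivable Ax (.ctx Y)) (hX : Derivable Ax (.ctx X))
    (h : MorEqF Ax Y X σ τ) :
    MorEq Ax Y X (X.map fun p => σ p.1) (X.map fun p => τ p.1) := by
  refine ⟨h.1.isMor hY hX, h.2.1.isMor hY hX, fun i hi hif hig => ?_⟩
  rw [subPre_map hX.isPreCtx, List.getElem_map, List.getElem_map]
  exact h.2.2 _ (List.getElem_mem hi)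

theorem MorF.comp (hs : Shaped Ax) (hZ : Derivable Ax (.ctx Z)) (hσ : MorF Ax Y X σ)
    (hτ : MorF Ax Z Y τ) : MorF Ax Z X fun x => (σ x).subst τ := by
  intro p hp
  have := (hσ p hp).term_subst hs hZ hτ
  rwa [SortE.subst_subst] at this

theorem IsMor.morF (h : IsMor Ax Y X f) : MorF Ax Y X (lookupV (mkSub X f)) :=
  morF_lookupV h.2.1 h.2.2.1 h.2.2.2

theorem IsMor.eq_map (h : IsMor Ax Y X f) : f = X.map fun p => lookupV (mkSub X f) p.1 :=
  eq_map_lookupV h.2.1.nodup h.2.2.1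

theorem compMor_map (hs : Shaped Ax) (hσ : MorF Ax Y X σ) :
    compMor Y (Y.map fun p => τ p.1) (X.map fun p => σ p.1) =
      X.map fun p => (σ p.1).subst τ := by
  rw [compMor, List.map_map]
  exact List.map_congr_left fun p hp => Expr.substL_map ((hσ p hp).scoped hs) τ

theorem IsGAT.eventually_morF (hA : IsGAT Ax) (h : MorF Ax Y X σ) :
    ∀ᶠ n in Filter.atTop, ∀ p ∈ X, HD Ax n (.term Y (σ p.1) (p.2.subst σ)) :=
  eventually_forall_mem fun p hp => eventually_HD (hA.exists_HD_term (h p hp))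

end

section

variable {TA : Set (Judg A)} {TB : Set (Judg B)} {chA : PreCtx A → A.Var}
  {chB : PreCtx B → B.Var} {ax : A.TermSym → PreCtx A × SortE A}
  {bx : B.TermSym → PreCtx B × SortE B} {T : Set (Judg (A.tensor B))}
  {sA sA' : A.Var → SortE A} {sB sB' : B.Var → SortE B} {X X' X'' : PreCtx A}
  {Y Y' Y'' : PreCtx B} {φ φ' : A.Var → Expr A} {ψ ψ' : B.Var → Expr B}
  {w : {Z : PreCtx (A.tensor B) // Derivable T (.ctx Z)}} {ε : Nv A B (Expr (A.tensor B))}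

theorem TMor.eq_map (ha : IntroFn TA ax) (hA : Thy TA) (hb : IntroFn TB bx) (hB : Thy TB)
    {e : List (Expr (A.tensor B))}
    (h : TMor TA TB false X (X'.map fun p => φ p.1) Y (Y'.map fun q => ψ q.1) e)
    (hX : CD TA X) (hY : CD TB Y) (hcA : Compat sA X) (hcB : Compat sB Y)
    (hφ : ∀ p ∈ X', TD TA X (φ p.1)) (hψ : ∀ q ∈ Y', TD TB Y (ψ q.1)) :
    e = (tz ax ε X' Y').map fun z =>
      (synM T ax).I (genNv sA sB) (φ z.1.1) (ψ z.1.2) := by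
  have key : e = (X'.map fun p => φ p.1).flatMap fun u => (Y'.map fun q => ψ q.1).map fun v =>
      (synM T ax).I (genNv sA sB) u v := by
    refine eq_grid _ _ _ h.1 fun i j hi hj h' => ?_
    obtain ⟨U, V, hU, hV, ht⟩ := h.2 i j hi hj h'
    have hu : TD TA X ((X'.map fun p => φ p.1)[i]) := by
      obtain ⟨p, hp, h⟩ := List.mem_map.1 (List.getElem_mem hi)
      exact h ▸ hφ p hp
    have hv : TD TB Y ((Y'.map fun q => ψ q.1)[j]) := by
      obtain ⟨q, hq, h⟩ := List.mem_map.1 (List.getElem_mem hj)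
      exact h ▸ hψ q hq
    have hU' : SD TA X U := hU.eq_canS ha hA.shaped hcA ▸ hu.canS ha hA hcA
    have hV' : SD TB Y V := hV.eq_canS hb hB.shaped hcB ▸ hv.canS hb hB hcB
    rw [ht.eq_valG ha hA hb hB rfl ⟨hX, hcA, hU', .inl hu⟩ ⟨hY, hcB, hV', .inl hv⟩]
    exact valG_canon ha hA hcA hcB hu hv hU hV
  rw [key]
  simp [tz, List.map_flatMap, List.flatMap_map, Function.comp_def]

theorem Mdl.Env.agr (he : (synM T ax).Env w ε X Y) (hcA : Compat sA X) (hcB : Compat sB Y) :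
    Agr X Y (genNv sA sB) ε fun z => ε.ρ z.1 z.2 :=
  ⟨hcA, he.cA, hcB, he.cB, fun _ _ _ _ => by rw [genNv, Expr.subst_var]⟩

theorem Mdl.Env.morF (ha : IntroFn TA ax) (hA : Thy TA) (he : (synM T ax).Env w ε X Y)
    (hX : CD TA X) (hY : CD TB Y) (hcA : Compat sA X) (hcB : Compat sB Y) :
    MorF T w.1 (tz ax (genNv sA sB) X Y) fun z => ε.ρ z.1 z.2 := by
  intro z hz
  obtain ⟨p, hp, q, hq, rfl⟩ := (mem_tz (T := T)).1 hz
  rw [← synM.T2_subst (a' := ε.ρ p.1) (b' := fun x => ε.ρ x q.1) ha hA (he.agr hcA hcB)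
    (hX.sort hp) (hY.sort hq) (fun _ _ => by rw [Expr.subst_var]) fun _ _ => by rw [Expr.subst_var]]
  exact he.ty p hp q hq

namespace Factors

variable (D : Factors TA TB chA chB ax bx) (hT : tensorAx TA TB chA chB ⊆ T) (hs : Shaped T)

include D hT hs

theorem full (hX : CD TA X) (hY : CD TB Y) (he : (synM T ax).Env w ε X Y) (N K : ℕ) :
    (synM T ax).Full TA TB N K w ε X Y := by
  obtain ⟨a, hX⟩ := hX
  obtain ⟨b, hY⟩ := hY
  have H (N K : ℕ) : (synM T ax).H TA TB N K := D.bilinear hT hs N K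
  exact H N K he (he.good (D.laws hT hs) (D.laws_flip hT hs) hX hY (H a b) (H N b) (H a K))

theorem ctx (hX : CD TA X) (hY : CD TB Y) (hcA : Compat sA X) (hcB : Compat sB Y) :
    Derivable T (.ctx (tz ax (genNv sA sB) X Y)) := by
  refine ctx_tz hs hX hY hcA hcB fun i hi j hj w ε he a b hr hc => ?_
  obtain ⟨n, hU⟩ := hX.sort_take i hi
  obtain ⟨m, hV⟩ := hY.sort_take j hj
  exact (D.full hT hs (hX.take i) (hY.take j) he n m).ss hU hV hr hc

/-- The environment induced by a pair of substitutions. -/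
theorem eventually_subCtx (gA : IsGAT TA) (gB : IsGAT TB) (hX : CD TA X) (hY : CD TB Y)
    (he : (synM T ax).Env w ε X Y) (hX' : Derivable TA (.ctx X')) (hY' : Derivable TB (.ctx Y'))
    (hφ : MorF TA X X' φ) (hψ : MorF TB Y Y' ψ) (hcA : Compat sA' X') (hcB : Compat sB' Y') :
    ∀ᶠ n in Filter.atTop, (synM T ax).SubCtx TA TB n n w ε
      ⟨sA', sB', fun x y => (synM T ax).I ε (φ x) (ψ y)⟩ X X' Y Y' φ ψ := by
  filter_upwards [gA.eventually_HCtx hX', gB.eventually_HCtx hY', gA.eventually_morF hφ,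
    gB.eventually_morF hψ] with n h1 h2 h3 h4
  exact ⟨h1, h2, h3, h4, D.full hT hs hX hY he n n, hcA, hcB, fun _ _ _ _ => rfl⟩

theorem env_sub (gA : IsGAT TA) (gB : IsGAT TB) (hX : CD TA X) (hY : CD TB Y)
    (he : (synM T ax).Env w ε X Y) (hX' : Derivable TA (.ctx X')) (hY' : Derivable TB (.ctx Y'))
    (hφ : MorF TA X X' φ) (hψ : MorF TB Y Y' ψ) (hcA : Compat sA' X') (hcB : Compat sB' Y') :
    (synM T ax).Env w ⟨sA', sB', fun x y => (synM T ax).I ε (φ x) (ψ y)⟩ X' Y' := by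
  obtain ⟨n, S⟩ := (D.eventually_subCtx hT hs gA gB hX hY he hX' hY' hφ hψ hcA hcB).exists
  exact S.env (D.laws hT hs) (D.laws_flip hT hs) D.hA.shaped D.hB.shaped (D.bilinear hT hs n n)

/-- The tensor of two terms commutes with substitution. -/
theorem I_sub (gA : IsGAT TA) (gB : IsGAT TB) (hX : CD TA X) (hY : CD TB Y)
    (he : (synM T ax).Env w ε X Y) (hX' : Derivable TA (.ctx X')) (hY' : Derivable TB (.ctx Y'))
    (hφ : MorF TA X X' φ) (hψ : MorF TB Y Y' ψ) (hcA : Compat sA' X') (hcB : Compat sB' Y')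
    (hw : Derivable TA (.ctx X)) (hw' : Derivable TB (.ctx Y))
    {u : Expr A} {U : SortE A} (hu : Derivable TA (.term X' u U))
    {v : Expr B} {V : SortE B} (hv : Derivable TB (.term Y' v V)) :
    TEq T w.1 ((synM T ax).I ε (u.subst φ) (v.subst ψ))
      ((synM T ax).I ⟨sA', sB', fun x y => (synM T ax).I ε (φ x) (ψ y)⟩ u v) := by
  obtain ⟨n, S, h1, h2, h3, h4⟩ :=
    ((D.eventually_subCtx hT hs gA gB hX hY he hX' hY' hφ hψ hcA hcB).and <|
      (eventually_HD (gA.exists_HD_term hu)).and <|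
      (eventually_HD (gA.exists_HD_term (hu.term_subst D.hA.shaped hw hφ))).and <|
      (eventually_HD (gB.exists_HD_term hv)).and <|
      eventually_HD (gB.exists_HD_term (hv.term_subst D.hB.shaped hw' hψ))).exists
  exact S.subI (D.laws hT hs) (D.laws_flip hT hs) D.hA.shaped D.hB.shaped (D.bilinear hT hs n n)
    u v ⟨U, h1, h2⟩ ⟨V, h3, h4⟩

/-- The tensor of two context morphisms, as a substitution. -/
theorem morF_tensor (gA : IsGAT TA) (gB : IsGAT TB) (hX : Derivable TA (.ctx X))
    (hY : Derivable TB (.ctx Y)) (hX' : Derivable TA (.ctx X')) (hY' : Derivable TB (.ctx Y'))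
    (hφ : MorF TA X X' φ) (hψ : MorF TB Y Y' ψ) (hcA : Compat sA X) (hcB : Compat sB Y)
    (hcA' : Compat sA' X') (hcB' : Compat sB' Y') :
    MorF T (tz ax (genNv sA sB) X Y) (tz ax (genNv sA' sB') X' Y') fun z =>
      (synM T ax).I (genNv sA sB) (φ z.1) (ψ z.2) :=
  (D.env_sub (w := ⟨_, D.ctx hT hs (gA.cd hX) (gB.cd hY) hcA hcB⟩) hT hs gA gB (gA.cd hX)
    (gB.cd hY) (env_gen hs hcA hcB fun _ hz => hz) hX' hY' hφ hψ hcA' hcB').morF D.ha D.hA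
      (gA.cd hX') (gB.cd hY') hcA' hcB'

theorem morEq_tensor (gA : IsGAT TA) (gB : IsGAT TB) (hX : Derivable TA (.ctx X))
    (hY : Derivable TB (.ctx Y)) (hX' : Derivable TA (.ctx X')) (hY' : Derivable TB (.ctx Y'))
    (hX'' : Derivable TA (.ctx X'')) (hY'' : Derivable TB (.ctx Y''))
    (hφ : MorF TA X X' φ) (hψ : MorF TB Y Y' ψ)
    (hφ' : MorF TA X' X'' φ') (hψ' : MorF TB Y' Y'' ψ')
    {sA'' : A.Var → SortE A} {sB'' : B.Var → SortE B} (hcA : Compat sA X) (hcB : Compat sB Y)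
    (hcA' : Compat sA' X') (hcB' : Compat sB' Y')
    (hcA'' : Compat sA'' X'') (hcB'' : Compat sB'' Y'') :
    MorEqF T (tz ax (genNv sA sB) X Y) (tz ax (genNv sA'' sB'') X'' Y'')
      (fun z => ((synM T ax).I (genNv sA' sB') (φ' z.1) (ψ' z.2)).subst fun z =>
        (synM T ax).I (genNv sA sB) (φ z.1) (ψ z.2))
      fun z => (synM T ax).I (genNv sA sB) ((φ' z.1).subst φ) ((ψ' z.2).subst ψ) := by
  have hZ := D.ctx hT hs (gA.cd hX) (gB.cd hY) hcA hcB
  have hZ'' := D.ctx hT hs (gA.cd hX'') (gB.cd hY'') hcA'' hcB''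
  have he : (synM T ax).Env ⟨_, hZ⟩ (genNv sA sB) X Y := env_gen hs hcA hcB fun _ hz => hz
  have he' := D.env_sub hT hs gA gB (gA.cd hX) (gB.cd hY) he hX' hY' hφ hψ hcA' hcB'
  refine ((D.morF_tensor hT hs gA gB hX' hY' hX'' hY'' hφ' hψ' hcA' hcB' hcA'' hcB'').comp hs hZ
    (D.morF_tensor hT hs gA gB hX hY hX' hY' hφ hψ hcA hcB hcA' hcB')).morEqF hs hZ'' hZ
    fun z hz => ?_
  obtain ⟨p, hp, q, hq, rfl⟩ := (mem_tz (T := T)).1 hz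
  have h := D.I_sub hT hs gA gB (gA.cd hX) (gB.cd hY) he hX' hY' hφ hψ hcA' hcB' hX hY
    (hφ' p hp) (hψ' q hq)
  rw [synM.I_subst D.ha D.hA (he'.agr hcA' hcB') (gA.td (hφ' p hp)) (gB.td (hψ' q hq))] at h
  exact h.symm

end Factors

end

theorem PreCtx.eq_nil_of_isEmpty [h : IsEmpty (SortE A)] : ∀ X : PreCtx A, X = []
  | [] => rfl
  | p :: _ => (h.false p.2).elim

theorem morEq_nil {Ax : Set (Judg A)} (hs : Shaped Ax) : MorEq Ax [] [] [] [] := by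
  have h : Derivable Ax (.ctx []) := derivable_ctx_of_forall hs (by simp [keys]) (by simp)
  have h' : MorF Ax [] [] Expr.var := by simp [MorF]
  exact h'.refl.morEq h h

/-- For context morphisms `f : X → X'`, `f' : X' → X''` in `𝔸`
and `g : Y → Y'`, `g' : Y' → Y''` in `𝔹`, the morphism equality
`(f'⊗g') ∘ (f⊗g) ≡ (f'∘f) ⊗ (g'∘g) : X⊗Y → X''⊗Y''` is derivable in `𝔸⊗𝔹`. -/
theorem tensor_interchange
    (A B : Alphabet) (TA : Set (Judg A)) (TB : Set (Judg B))
    (hA : IsGAT TA) (hB : IsGAT TB)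
    (chA : PreCtx A → A.Var) (hchA : FreshCh chA)
    (chB : PreCtx B → B.Var) (hchB : FreshCh chB)
    (X X' X'' : PreCtx A) (f f' : List (Expr A))
    (Y Y' Y'' : PreCtx B) (g g' : List (Expr B))
    (hf : IsMor TA X X' f) (hf' : IsMor TA X' X'' f')
    (hg : IsMor TB Y Y' g) (hg' : IsMor TB Y' Y'' g')
    (ZXY Z' Z'' : PreCtx (A.tensor B))
    (hZXY : TCtx TA TB false X Y ZXY) (hZ' : TCtx TA TB false X' Y' Z')
    (hZ'' : TCtx TA TB false X'' Y'' Z'')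
    (e e' ec : List (Expr (A.tensor B)))
    (he : TMor TA TB false X f Y g e) (he' : TMor TA TB false X' f' Y' g' e')
    (hec : TMor TA TB false X (compMor X' f f') Y (compMor Y' g g') ec) :
    MorEq (tensorAx TA TB chA chB) ZXY Z'' (compMor Z' e e') ec := by
  obtain ⟨ax, ha⟩ := hA.exists_introFn
  obtain ⟨bx, hb⟩ := hB.exists_introFn
  have D : Factors TA TB chA chB ax bx :=
    ⟨ha, hA.thy, hA.axOk, hchA, hb, hB.thy, hB.axOk, hchB⟩
  have hs := D.shaped
  by_cases hE : Nonempty (SortE A) ∧ Nonempty (SortE B)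
  · obtain ⟨⟨U₀⟩, ⟨V₀⟩⟩ := hE
    obtain ⟨sA, hcA⟩ := exists_compat (fun _ => U₀) hf.1.nodup
    obtain ⟨sA', hcA'⟩ := exists_compat (fun _ => U₀) hf'.1.nodup
    obtain ⟨sA'', hcA''⟩ := exists_compat (fun _ => U₀) hf'.2.1.nodup
    obtain ⟨sB, hcB⟩ := exists_compat (fun _ => V₀) hg.1.nodup
    obtain ⟨sB', hcB'⟩ := exists_compat (fun _ => V₀) hg'.1.nodup
    obtain ⟨sB'', hcB''⟩ := exists_compat (fun _ => V₀) hg'.2.1.nodup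
    have hX := hA.cd hf.1
    have hX' := hA.cd hf'.1
    have hX'' := hA.cd hf'.2.1
    have hY := hB.cd hg.1
    have hY' := hB.cd hg'.1
    have hY'' := hB.cd hg'.2.1
    have hφ := hf.morF
    have hφ' := hf'.morF
    have hψ := hg.morF
    have hψ' := hg'.morF
    rw [hf.eq_map] at he hec
    rw [hf'.eq_map] at he' hec
    rw [hg.eq_map] at he hec
    rw [hg'.eq_map] at he' hec
    rw [compMor_map D.hA.shaped hφ', compMor_map D.hB.shaped hψ'] at hec
    generalize lookupV (mkSub X' f) = φ at *
    generalize lookupV (mkSub X'' f') = φ' at *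
    generalize lookupV (mkSub Y' g) = ψ at *
    generalize lookupV (mkSub Y'' g') = ψ' at *
    obtain rfl := hZXY.eq_tz ha D.hA hb D.hB hX hY hcA hcB
    obtain rfl := hZ'.eq_tz ha D.hA hb D.hB hX' hY' hcA' hcB'
    obtain rfl := hZ''.eq_tz ha D.hA hb D.hB hX'' hY'' hcA'' hcB''
    rw [he.eq_map (T := tensorAx TA TB chA chB) (ε := genNv sA' sB') ha D.hA hb D.hB hX hY
        hcA hcB (fun p hp => hA.td (hφ p hp)) fun q hq => hB.td (hψ q hq),
      he'.eq_map (T := tensorAx TA TB chA chB) (ε := genNv sA'' sB'') ha D.hA hb D.hB hX' hY'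
        hcA' hcB' (fun p hp => hA.td (hφ' p hp)) fun q hq => hB.td (hψ' q hq),
      TMor.eq_map (T := tensorAx TA TB chA chB) (ε := genNv sA'' sB'')
        (φ := fun x => (φ' x).subst φ) (ψ := fun y => (ψ' y).subst ψ) ha D.hA hb D.hB hec hX hY
        hcA hcB (fun p hp => hA.td (hφ'.comp D.hA.shaped hf.1 hφ p hp))
        fun q hq => hB.td (hψ'.comp D.hB.shaped hg.1 hψ q hq),
      compMor_map (σ := fun z => (synM (tensorAx TA TB chA chB) ax).I (genNv sA' sB')
          (φ' z.1) (ψ' z.2))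
        (τ := fun z => (synM (tensorAx TA TB chA chB) ax).I (genNv sA sB) (φ z.1) (ψ z.2)) hs
        (D.morF_tensor subset_rfl hs hA hB hf'.1 hg'.1 hf'.2.1 hg'.2.1 hφ' hψ' hcA' hcB' hcA''
          hcB'')]
    exact (D.morEq_tensor subset_rfl hs hA hB hf.1 hg.1 hf'.1 hg'.1 hf'.2.1 hg'.2.1 hφ hψ hφ' hψ'
      hcA hcB hcA' hcB' hcA'' hcB'').morEq (D.ctx subset_rfl hs hX hY hcA hcB)
      (D.ctx subset_rfl hs hX'' hY'' hcA'' hcB'')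
  · have hnil : ZXY = [] ∧ Z'' = [] ∧ e' = [] ∧ ec = [] := by
      simp only [← List.length_eq_zero_iff, hZXY.1, hZ''.1, he'.1, hec.1, compMor, List.length_map,
        hf'.2.2.1, hg'.2.2.1, mul_eq_zero]
      simp only [not_and_or, not_nonempty_iff] at hE
      rcases hE with hE | hE
      · simp [PreCtx.eq_nil_of_isEmpty X, PreCtx.eq_nil_of_isEmpty X'']
      · simp [PreCtx.eq_nil_of_isEmpty Y, PreCtx.eq_nil_of_isEmpty Y'']
    obtain ⟨rfl, rfl, rfl, rfl⟩ := hnil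
    exact morEq_nil hs

end GATPaper
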